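/- Let Ω ⊂⊂ ℂⁿ (n ≥ 2) be a bounded pseudoconvex domain with C^k (k ≥ 3)-smooth boundary. For a defining function ρ of Ω, let α_ρ be the D'Angelo 1-form of ρ and ω_ρ = π_{1,0} α_ρ its (1,0)-component. Then S(Ω) = inf over defining functions ρ of { η₂ > 1 : ( (η₂/(η₂−1)) (ω_ρ ∧ ω̄_ρ) + ∂̄ω_ρ )(L, L̄) ≤ 0 for all p ∈ Σ and all L ∈ Null_p }, where Σ is the set of weakly pseudoconvex boundary points and Null_p is the null space of the Levi form at p. -/

import Mathlib

open Complex
open scoped ComplexOrder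

noncomputable section

/-- Points of ℂⁿ. -/
abbrev Pt (n : ℕ) := Fin n → ℂ

/-- Wirtinger derivative ∂f/∂z_j at z (junk value if f is not differentiable). -/
def dZ (n : ℕ) (f : Pt n → ℂ) (j : Fin n) (z : Pt n) : ℂ :=
  (1 / 2 : ℂ) * (fderiv ℝ f z (Pi.single j 1) - Complex.I * fderiv ℝ f z (Pi.single j Complex.I))

/-- Wirtinger derivative ∂f/∂z̄_j at z. -/
def dZb (n : ℕ) (f : Pt n → ℂ) (j : Fin n) (z : Pt n) : ℂ :=
  (1 / 2 : ℂ) * (fderiv ℝ f z (Pi.single j 1) + Complex.I * fderiv ℝ f z (Pi.single j Complex.I))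

/-- Complexification of a real-valued function. -/
def cR (n : ℕ) (ρ : Pt n → ℝ) : Pt n → ℂ := fun z => (ρ z : ℂ)

/-- Levi form of ρ at z: Levi_ρ(X,Y) = Σ_{j,k} ∂²ρ/∂z_j∂z̄_k X_j conj(Y_k), where X, Y are
(1,0)-vectors given by their coefficient tuples. -/
def levi (n : ℕ) (ρ : Pt n → ℝ) (z : Pt n) (X Y : Fin n → ℂ) : ℂ :=
  ∑ j, ∑ k, dZ n (fun w => dZb n (cR n ρ) k w) j z * X j * (starRingEnd ℂ) (Y k)

/-- Holomorphic tangent space T^{1,0}_p(∂Ω) (for boundary points p), described via a defining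
function: (1,0)-vectors X with Σ_j X_j ∂ρ/∂z_j(p) = 0. -/
def T10 (n : ℕ) (ρ : Pt n → ℝ) (p : Pt n) : Set (Fin n → ℂ) :=
  {X | ∑ j, X j * dZ n (cR n ρ) j p = 0}

/-- Null space of the Levi form inside T^{1,0}_p(∂Ω). -/
def nullSp (n : ℕ) (ρ : Pt n → ℝ) (p : Pt n) : Set (Fin n → ℂ) :=
  {X | X ∈ T10 n ρ p ∧ ∀ Y ∈ T10 n ρ p, levi n ρ p X Y = 0}

/-- ρ is a C^s defining function of Ω on the neighborhood V of the closure of Ω. -/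
def IsDefining (n : ℕ) (s : ℕ∞) (Ω : Set (Pt n)) (ρ : Pt n → ℝ) (V : Set (Pt n)) : Prop :=
  IsOpen V ∧ closure Ω ⊆ V ∧ ContDiffOn ℝ s ρ V ∧
    Ω = {z | z ∈ V ∧ ρ z < 0} ∧ ∀ z ∈ frontier Ω, fderiv ℝ ρ z ≠ 0

/-- Strict plurisubharmonicity on a set, via positivity of the Levi form. -/
def StrictPSHOn (n : ℕ) (f : Pt n → ℝ) (s : Set (Pt n)) : Prop :=
  ∀ z ∈ s, ∀ X : Fin n → ℂ, X ≠ 0 → 0 < (levi n f z X X).re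

/-- Diederich–Fornaess exponent of a defining function ρ (0 if the defining set is empty). -/
def DFexp (n : ℕ) (ρ : Pt n → ℝ) (Ω : Set (Pt n)) : ℝ :=
  sSup {η : ℝ | 0 < η ∧ η < 1 ∧ StrictPSHOn n (fun z => -((-ρ z) ^ η)) Ω}

/-- Diederich–Fornaess index of Ω: supremum over all (C¹) defining functions. -/
def DFindex (n : ℕ) (Ω : Set (Pt n)) : ℝ :=
  sSup {e : ℝ | ∃ ρ V, IsDefining n 1 Ω ρ V ∧ e = DFexp n ρ Ω}

/-- Steinness exponent of a defining function ρ (⊤ = ∞ if the defining set is empty). -/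
def Sexp (n : ℕ) (ρ : Pt n → ℝ) (Ω : Set (Pt n)) : EReal :=
  sInf {e : EReal | ∃ η : ℝ, 1 < η ∧
    (∃ U : Set (Pt n), IsOpen U ∧ frontier Ω ⊆ U ∧
      StrictPSHOn n (fun z => ρ z ^ η) ((closure Ω)ᶜ ∩ U)) ∧ e = (η : EReal)}

/-- Steinness index of Ω: infimum over all (C¹) defining functions. -/
def Sindex (n : ℕ) (Ω : Set (Pt n)) : EReal :=
  sInf {e : EReal | ∃ ρ V, IsDefining n 1 Ω ρ V ∧ e = Sexp n ρ Ω}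

/-- A complex vector field Σ_j a_j ∂/∂z_j + Σ_j b_j ∂/∂z̄_j on ℂⁿ, recorded by its
coefficient functions. -/
structure VF (n : ℕ) where
  a : Pt n → Fin n → ℂ
  b : Pt n → Fin n → ℂ

/-- Action of a complex vector field on a function. -/
def VF.app {n : ℕ} (V : VF n) (f : Pt n → ℂ) (z : Pt n) : ℂ :=
  ∑ j, V.a z j * dZ n f j z + ∑ j, V.b z j * dZb n f j z

/-- The value of a vector field at a point, as a pair ((1,0)-part, (0,1)-part). -/
def VF.atPt {n : ℕ} (V : VF n) (p : Pt n) : (Fin n → ℂ) × (Fin n → ℂ) := (V.a p, V.b p)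

/-- A complex 1-form Σ_j w_j dz_j + Σ_j t_j dz̄_j on ℂⁿ. -/
structure Form1 (n : ℕ) where
  w : Pt n → Fin n → ℂ
  t : Pt n → Fin n → ℂ

/-- Value of a 1-form at a point on a complex tangent vector (pair of (1,0) and (0,1) parts). -/
def Form1.eval {n : ℕ} (η : Form1 n) (z : Pt n) (X : (Fin n → ℂ) × (Fin n → ℂ)) : ℂ :=
  ∑ j, η.w z j * X.1 j + ∑ j, η.t z j * X.2 j

/-- Pairing of a 1-form with a vector field. -/
def Form1.app {n : ℕ} (η : Form1 n) (V : VF n) (z : Pt n) : ℂ :=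
  η.eval z (V.atPt z)

/-- Lie bracket of complex vector fields. -/
def VF.bracket {n : ℕ} (V W : VF n) : VF n :=
  ⟨fun z j => V.app (fun w => W.a w j) z - W.app (fun w => V.a w j) z,
   fun z j => V.app (fun w => W.b w j) z - W.app (fun w => V.b w j) z⟩

/-- Levi-Civita covariant derivative ∇_V W of the Euclidean metric (componentwise derivative). -/
def covD {n : ℕ} (V W : VF n) : VF n :=
  ⟨fun z j => V.app (fun w => W.a w j) z, fun z j => V.app (fun w => W.b w j) z⟩

/-- Lie derivative of a 1-form along a vector field, in coordinates. -/
def lieD {n : ℕ} (T : VF n) (η : Form1 n) : Form1 n :=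
  ⟨fun z j => T.app (fun w => η.w w j) z + ∑ m, η.w z m * dZ n (fun w => T.a w m) j z
      + ∑ m, η.t z m * dZ n (fun w => T.b w m) j z,
   fun z j => T.app (fun w => η.t w j) z + ∑ m, η.w z m * dZb n (fun w => T.a w m) j z
      + ∑ m, η.t z m * dZb n (fun w => T.b w m) j z⟩

/-- Negation of a 1-form. -/
def Form1.neg {n : ℕ} (η : Form1 n) : Form1 n := ⟨fun z j => -η.w z j, fun z j => -η.t z j⟩

/-- Σ_j |∂ρ/∂z_j|². -/
def gradSq (n : ℕ) (ρ : Pt n → ℝ) (z : Pt n) : ℝ :=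
  ∑ j, Complex.normSq (dZ n (cR n ρ) j z)

/-- Norm of the real gradient of ρ: ‖∇ρ‖ = 2 (Σ_j |∂ρ/∂z_j|²)^{1/2}. -/
def gradNorm (n : ℕ) (ρ : Pt n → ℝ) (z : Pt n) : ℝ := 2 * Real.sqrt (gradSq n ρ z)

/-- The (1,0) field L_n = (Σ|∂ρ/∂z_j|²)⁻¹ Σ_j (∂ρ/∂z̄_j) ∂/∂z_j. -/
def LnVF (n : ℕ) (ρ : Pt n → ℝ) : VF n :=
  ⟨fun z j => dZb n (cR n ρ) j z / (gradSq n ρ z : ℂ), fun _ _ => 0⟩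

/-- The (1,0) field N = (Σ|∂ρ/∂z_j|²)^{-1/2} Σ_j (∂ρ/∂z̄_j) ∂/∂z_j. -/
def NVF (n : ℕ) (ρ : Pt n → ℝ) : VF n :=
  ⟨fun z j => dZb n (cR n ρ) j z / ((Real.sqrt (gradSq n ρ z) : ℝ) : ℂ), fun _ _ => 0⟩

/-- T = L_n − conj(L_n). -/
def TVF (n : ℕ) (ρ : Pt n → ℝ) : VF n :=
  ⟨fun z j => (LnVF n ρ).a z j, fun z j => -(starRingEnd ℂ) ((LnVF n ρ).a z j)⟩

/-- η = (1/2)(∂ρ − ∂̄ρ). -/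
def etaF (n : ℕ) (ρ : Pt n → ℝ) : Form1 n :=
  ⟨fun z j => (1 / 2 : ℂ) * dZ n (cR n ρ) j z,
   fun z j => -(1 / 2 : ℂ) * dZb n (cR n ρ) j z⟩

/-- The D'Angelo 1-form α_ρ = −Lie_T η of a defining function ρ. -/
def dAngelo (n : ℕ) (ρ : Pt n → ℝ) : Form1 n := Form1.neg (lieD (TVF n ρ) (etaF n ρ))

/-- Evaluation of the (1,0)-part ∂η of the exterior derivative of a 1-form on two
complex tangent vectors. -/
def delEval {n : ℕ} (η : Form1 n) (X Y : (Fin n → ℂ) × (Fin n → ℂ)) (z : Pt n) : ℂ :=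
  (∑ m, ∑ l, dZ n (fun w => η.w w l) m z * (X.1 m * Y.1 l - Y.1 m * X.1 l)) +
  (∑ m, ∑ l, dZ n (fun w => η.t w l) m z * (X.1 m * Y.2 l - Y.1 m * X.2 l))

/-- Evaluation of ∂̄η of a 1-form η on two complex tangent vectors. -/
def delbEval {n : ℕ} (η : Form1 n) (X Y : (Fin n → ℂ) × (Fin n → ℂ)) (z : Pt n) : ℂ :=
  (∑ m, ∑ l, dZb n (fun w => η.w w l) m z * (X.2 m * Y.1 l - Y.2 m * X.1 l)) +
  (∑ m, ∑ l, dZb n (fun w => η.t w l) m z * (X.2 m * Y.2 l - Y.2 m * X.2 l))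

/-- Evaluation of dη = ∂η + ∂̄η. -/
def dEval {n : ℕ} (η : Form1 n) (X Y : (Fin n → ℂ) × (Fin n → ℂ)) (z : Pt n) : ℂ :=
  delEval η X Y z + delbEval η X Y z

/-- Evaluation of d^c η = i(∂̄ − ∂)η. -/
def dcEval {n : ℕ} (η : Form1 n) (X Y : (Fin n → ℂ) × (Fin n → ℂ)) (z : Pt n) : ℂ :=
  Complex.I * (delbEval η X Y z - delEval η X Y z)

/-- Evaluation of ω ∧ ω̄ on two complex tangent vectors, where ω = π_{1,0} η is the
(1,0)-component of the real 1-form η. -/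
def omegaWedge {n : ℕ} (η : Form1 n) (X Y : (Fin n → ℂ) × (Fin n → ℂ)) (z : Pt n) : ℂ :=
  (∑ j, η.w z j * X.1 j) * (∑ j, (starRingEnd ℂ) (η.w z j) * Y.2 j) -
  (∑ j, η.w z j * Y.1 j) * (∑ j, (starRingEnd ℂ) (η.w z j) * X.2 j)

/-- Evaluation of ∂̄ω where ω = π_{1,0} η. -/
def delbOmega {n : ℕ} (η : Form1 n) (X Y : (Fin n → ℂ) × (Fin n → ℂ)) (z : Pt n) : ℂ :=
  delbEval ⟨η.w, fun _ _ => 0⟩ X Y z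

/-- The standard Euclidean complex Hermitian metric g on complexified tangent vectors
(so that g(∂/∂z_j, ∂/∂z_j) = 1/2). -/
def gMet {n : ℕ} (X Y : (Fin n → ℂ) × (Fin n → ℂ)) : ℂ :=
  (1 / 2 : ℂ) * (∑ j, X.1 j * (starRingEnd ℂ) (Y.1 j) + ∑ j, X.2 j * (starRingEnd ℂ) (Y.2 j))

/-- The real gradient ∇ρ as a complex vector field: 2Σ_j (∂ρ/∂z̄_j ∂/∂z_j + ∂ρ/∂z_j ∂/∂z̄_j). -/
def gradVF (n : ℕ) (ρ : Pt n → ℝ) : VF n :=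
  ⟨fun z j => 2 * dZb n (cR n ρ) j z, fun z j => 2 * dZ n (cR n ρ) j z⟩

/-- Pseudoconvexity of Ω (w.r.t. the defining function ρ): the Levi form is positive
semidefinite on the holomorphic tangent spaces of the boundary. -/
def LeviPseudoconvex (n : ℕ) (ρ : Pt n → ℝ) (Ω : Set (Pt n)) : Prop :=
  ∀ p ∈ frontier Ω, ∀ X ∈ T10 n ρ p, 0 ≤ (levi n ρ p X X).re

/-- The set Σ of weakly pseudoconvex boundary points. -/
def weakPts (n : ℕ) (ρ : Pt n → ℝ) (Ω : Set (Pt n)) : Set (Pt n) :=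
  {p | p ∈ frontier Ω ∧ ∃ X ∈ T10 n ρ p, X ≠ 0 ∧ levi n ρ p X X = 0}

/-- Action of a complex tangent vector at p on a function. -/
def vecApp (n : ℕ) (X : (Fin n → ℂ) × (Fin n → ℂ)) (f : Pt n → ℂ) (p : Pt n) : ℂ :=
  ∑ j, X.1 j * dZ n f j p + ∑ j, X.2 j * dZb n f j p

/-- Pushforward (complexified differential) of a complex tangent vector at p by a map f. -/
def push (n : ℕ) (f : Pt n → Pt n) (p : Pt n) (X : (Fin n → ℂ) × (Fin n → ℂ)) :
    (Fin n → ℂ) × (Fin n → ℂ) :=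
  (fun l => vecApp n X (fun w => f w l) p,
   fun l => vecApp n X (fun w => (starRingEnd ℂ) (f w l)) p)

/-- Conjugation of a coefficient tuple. -/
def conjVec {n : ℕ} (X : Fin n → ℂ) : Fin n → ℂ := fun j => (starRingEnd ℂ) (X j)

/-- A C^k CR-diffeomorphism between ∂Ω₁ and ∂Ω₂, presented by a C^k map f on a
neighborhood U₁ of ∂Ω₁ together with a C^k local inverse g: f maps ∂Ω₁ onto ∂Ω₂
diffeomorphically and its differential maps T^{1,0}(∂Ω₁) into T^{1,0}(∂Ω₂). -/
def IsCRDiffeo (n : ℕ) (k : ℕ∞) (Ω₁ Ω₂ : Set (Pt n)) (ρ₁ ρ₂ : Pt n → ℝ)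
    (f g : Pt n → Pt n) (U₁ U₂ : Set (Pt n)) : Prop :=
  IsOpen U₁ ∧ IsOpen U₂ ∧ frontier Ω₁ ⊆ U₁ ∧ frontier Ω₂ ⊆ U₂ ∧
  (∀ l, ContDiffOn ℝ k (fun z => f z l) U₁) ∧
  (∀ l, ContDiffOn ℝ k (fun z => g z l) U₂) ∧
  f '' frontier Ω₁ = frontier Ω₂ ∧
  (∀ p ∈ frontier Ω₁, g (f p) = p) ∧ (∀ q ∈ frontier Ω₂, f (g q) = q) ∧
  (∀ p ∈ frontier Ω₁, ∀ L ∈ T10 n ρ₁ p,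
    (push n f p (L, 0)).2 = 0 ∧ (push n f p (L, 0)).1 ∈ T10 n ρ₂ (f p))

/-- The 1-form d^c ψ = i(∂̄ψ − ∂ψ) of a real function ψ. -/
def dcForm (n : ℕ) (ψ : Pt n → ℝ) : Form1 n :=
  ⟨fun z j => -Complex.I * dZ n (cR n ψ) j z, fun z j => Complex.I * dZb n (cR n ψ) j z⟩

end

open Filter Topology

/-- Multiplication of a vector by the imaginary unit, as a real continuous linear map. -/
noncomputable def mulI (n : ℕ) : Pt n →L[ℝ] Pt n :=
  (Complex.I • ContinuousLinearMap.id ℂ (Pt n)).restrictScalars ℝ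

lemma I_smul_I_smul {n : ℕ} (X : Pt n) : Complex.I • Complex.I • X = -X := by
  rw [smul_smul, Complex.I_mul_I, neg_one_smul]

lemma complex_smul_eq {n : ℕ} (c : ℂ) (X : Pt n) : c • X = c.re • X + c.im • Complex.I • X := by
  ext j
  simp only [Pi.smul_apply, Pi.add_apply, smul_eq_mul, Complex.real_smul]
  conv_lhs => rw [← Complex.re_add_im c]
  ring

lemma pi_eq_sum_single {n : ℕ} (X : Pt n) :
    X = ∑ j, ((X j).re • (Pi.single j 1 : Pt n) + (X j).im • (Pi.single j Complex.I : Pt n)) := by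
  ext j
  rw [Finset.sum_apply, Finset.sum_eq_single j]
  · simp [Complex.re_add_im]
  · intro b _ hb
    simp [Pi.single_eq_of_ne hb.symm]
  · simp

lemma I_smul_single {n : ℕ} (j : Fin n) (c : ℂ) :
    Complex.I • (Pi.single j c : Pt n) = Pi.single j (Complex.I * c) := by
  ext i
  by_cases h : i = j
  · subst h; simp
  · simp [Pi.single_eq_of_ne h]

lemma sum_wirt {n : ℕ} (φ : Pt n →L[ℝ] ℂ) (X : Pt n) :
    ∑ j, X j * ((1 / 2 : ℂ) * (φ (Pi.single j 1) - Complex.I * φ (Pi.single j Complex.I))) =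
      (1 / 2 : ℂ) * (φ X - Complex.I * φ (Complex.I • X)) := by
  conv_rhs => rw [pi_eq_sum_single X]
  simp only [Finset.smul_sum, smul_add, map_sum, map_add, Finset.mul_sum,
    smul_comm Complex.I (_ : ℝ), I_smul_single, mul_one, Complex.I_mul_I, map_smul]
  rw [← Finset.sum_sub_distrib, Finset.mul_sum]
  refine Finset.sum_congr rfl fun j _ => ?_
  have : (Pi.single j (-1 : ℂ) : Pt n) = -Pi.single j 1 :=
    Pi.single_neg (f := fun _ : Fin n => ℂ) j (1 : ℂ)
  rw [this, map_neg]
  conv_lhs => rw [← Complex.re_add_im (X j)]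
  simp only [Complex.real_smul]
  linear_combination (1 / 2 * ((X j).im : ℂ) * φ (Pi.single j 1) - 1 / 2 * ((X j).im : ℂ) *
      φ (Pi.single j 1) - 1/2 * ((X j).im : ℂ) * φ (Pi.single j Complex.I)) * Complex.I_mul_I

lemma sum_wirtb {n : ℕ} (φ : Pt n →L[ℝ] ℂ) (X : Pt n) :
    ∑ j, (starRingEnd ℂ) (X j) *
        ((1 / 2 : ℂ) * (φ (Pi.single j 1) + Complex.I * φ (Pi.single j Complex.I))) =
      (1 / 2 : ℂ) * (φ X + Complex.I * φ (Complex.I • X)) := by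
  have h := congrArg (starRingEnd ℂ)
    (sum_wirt (n := n) ((Complex.conjCLE : ℂ →L[ℝ] ℂ).comp φ) X)
  simp only [map_sum, map_mul, map_sub, Complex.conj_I, map_div₀, map_one,
    ContinuousLinearMap.comp_apply, ContinuousLinearEquiv.coe_coe, Complex.conjCLE_apply,
    Complex.conj_conj, map_ofNat] at h
  simpa [sub_eq_add_neg] using h

/-- The derivative of type (1,0) of `f` at `z` in the direction `X`. -/
noncomputable def wd {n : ℕ} (f : Pt n → ℂ) (z X : Pt n) : ℂ :=
  (1 / 2 : ℂ) * (fderiv ℝ f z X - Complex.I * fderiv ℝ f z (Complex.I • X))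

/-- The derivative of type (0,1) of `f` at `z` in the direction `X`. -/
noncomputable def wdb {n : ℕ} (f : Pt n → ℂ) (z X : Pt n) : ℂ :=
  (1 / 2 : ℂ) * (fderiv ℝ f z X + Complex.I * fderiv ℝ f z (Complex.I • X))

lemma sum_dZ {n : ℕ} (f : Pt n → ℂ) (z X : Pt n) : ∑ j, X j * dZ n f j z = wd f z X :=
  sum_wirt (fderiv ℝ f z) X

lemma sum_dZb {n : ℕ} (f : Pt n → ℂ) (z X : Pt n) :
    ∑ j, (starRingEnd ℂ) (X j) * dZb n f j z = wdb f z X :=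
  sum_wirtb (fderiv ℝ f z) X

lemma fderiv_cR {n : ℕ} {f : Pt n → ℝ} {z : Pt n} (h : DifferentiableAt ℝ f z) (X : Pt n) :
    fderiv ℝ (cR n f) z X = (fderiv ℝ f z X : ℂ) := by
  have := (Complex.ofRealCLM.hasFDerivAt.comp z h.hasFDerivAt).fderiv
  have h2 : cR n f = Complex.ofRealCLM ∘ f := rfl
  rw [h2, this]; rfl

lemma wd_cR {n : ℕ} {f : Pt n → ℝ} {z : Pt n} (h : DifferentiableAt ℝ f z) (X : Pt n) :
    wd (cR n f) z X = (1 / 2 : ℂ) * (fderiv ℝ f z X - Complex.I *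
        fderiv ℝ f z (Complex.I • X)) := by
  rw [wd, fderiv_cR h, fderiv_cR h]

/-- The sesquilinear form attached to a real bilinear form. -/
noncomputable def leviB {n : ℕ} (B : Pt n →L[ℝ] Pt n →L[ℝ] ℝ) (X Y : Pt n) : ℂ :=
  (1 / 4 : ℂ) * (((B X Y + B (Complex.I • X) (Complex.I • Y) : ℝ) : ℂ) +
    Complex.I * ((B X (Complex.I • Y) - B (Complex.I • X) Y : ℝ) : ℂ))

/-- `f` is differentiable near `z` and its derivative is differentiable at `z`. -/
def TwiceDiffAt {n : ℕ} (f : Pt n → ℝ) (z : Pt n) : Prop :=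
  (∀ᶠ w in 𝓝 z, DifferentiableAt ℝ f w) ∧ DifferentiableAt ℝ (fderiv ℝ f) z

lemma TwiceDiffAt.diffAt {n : ℕ} {f : Pt n → ℝ} {z : Pt n} (h : TwiceDiffAt f z) :
    DifferentiableAt ℝ f z := h.1.self_of_nhds

lemma TwiceDiffAt.symm {n : ℕ} {f : Pt n → ℝ} {z : Pt n} (h : TwiceDiffAt f z) (X Y : Pt n) :
    fderiv ℝ (fderiv ℝ f) z X Y = fderiv ℝ (fderiv ℝ f) z Y X :=
  second_derivative_symmetric_of_eventually (h.1.mono fun _ hy => hy.hasFDerivAt)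
    h.2.hasFDerivAt X Y

lemma dZb_cR_eventually {n : ℕ} {f : Pt n → ℝ} {z : Pt n}
    (h : ∀ᶠ w in 𝓝 z, DifferentiableAt ℝ f w) (k : Fin n) :
    (fun w => dZb n (cR n f) k w) =ᶠ[𝓝 z] fun w => (1 / 2 : ℂ) *
      ((fderiv ℝ f w (Pi.single k 1) : ℂ) + Complex.I * fderiv ℝ f w (Pi.single k Complex.I)) := by
  filter_upwards [h] with w hw
  rw [dZb, fderiv_cR hw, fderiv_cR hw]

lemma hasFDerivAt_dZb {n : ℕ} {f : Pt n → ℝ} {z : Pt n} (h : TwiceDiffAt f z) (k : Fin n) :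
    HasFDerivAt (fun w => dZb n (cR n f) k w)
      ((1 / 2 : ℂ) • (Complex.ofRealCLM.comp ((ContinuousLinearMap.apply ℝ ℝ (Pi.single k 1)).comp
          (fderiv ℝ (fderiv ℝ f) z)) +
        Complex.I • Complex.ofRealCLM.comp
          ((ContinuousLinearMap.apply ℝ ℝ (Pi.single k Complex.I)).comp
          (fderiv ℝ (fderiv ℝ f) z)))) z := by
  refine HasFDerivAt.congr_of_eventuallyEq ?_ (dZb_cR_eventually h.1 k)
  have h1 : ∀ v : Pt n, HasFDerivAt (fun w => (fderiv ℝ f w v : ℂ))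
      (Complex.ofRealCLM.comp ((ContinuousLinearMap.apply ℝ ℝ v).comp
          (fderiv ℝ (fderiv ℝ f) z))) z := fun v =>
    Complex.ofRealCLM.hasFDerivAt.comp z
      ((ContinuousLinearMap.apply ℝ ℝ v).hasFDerivAt.comp z h.2.hasFDerivAt)
  exact ((h1 _).add ((h1 _).const_mul _)).const_mul _

lemma fderiv_dZb {n : ℕ} {f : Pt n → ℝ} {z : Pt n} (h : TwiceDiffAt f z) (k : Fin n) (X : Pt n) :
    fderiv ℝ (fun w => dZb n (cR n f) k w) z X = (1 / 2 : ℂ) *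
      ((fderiv ℝ (fderiv ℝ f) z X (Pi.single k 1) : ℂ) +
        Complex.I * fderiv ℝ (fderiv ℝ f) z X (Pi.single k Complex.I)) := by
  rw [(hasFDerivAt_dZb h k).fderiv]; rfl

lemma levi_eq {n : ℕ} {f : Pt n → ℝ} {z : Pt n} (h : TwiceDiffAt f z) (X Y : Pt n) :
    levi n f z X Y = leviB (fderiv ℝ (fderiv ℝ f) z) X Y := by
  set B := fderiv ℝ (fderiv ℝ f) z with hB
  have h1 : levi n f z X Y = ∑ k, (starRingEnd ℂ) (Y k) *
      wd (fun w => dZb n (cR n f) k w) z X := by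
    rw [levi, Finset.sum_comm]
    refine Finset.sum_congr rfl fun k _ => ?_
    rw [← sum_dZ, Finset.mul_sum]
    exact Finset.sum_congr rfl fun j _ => by ring
  have h2 := sum_wirtb (Complex.ofRealCLM.comp (B X)) Y
  have h3 := sum_wirtb (Complex.ofRealCLM.comp (B (Complex.I • X))) Y
  simp only [ContinuousLinearMap.comp_apply, Complex.ofRealCLM_apply] at h2 h3
  have h4 : levi n f z X Y = (1 / 2 : ℂ) * ((∑ j, (starRingEnd ℂ) (Y j) * (1 / 2 *
      ((B X (Pi.single j 1) : ℂ) + Complex.I * (B X (Pi.single j Complex.I) : ℂ)))) -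
      Complex.I * ∑ j, (starRingEnd ℂ) (Y j) * (1 / 2 *
      ((B (Complex.I • X) (Pi.single j 1) : ℂ) +
        Complex.I * (B (Complex.I • X) (Pi.single j Complex.I) : ℂ)))) := by
    rw [h1, Finset.mul_sum, ← Finset.sum_sub_distrib, Finset.mul_sum]
    refine Finset.sum_congr rfl fun k _ => ?_
    rw [wd, fderiv_dZb h, fderiv_dZb h]
    ring
  rw [h4, h2, h3, leviB]
  push_cast
  linear_combination (-1/4 * (B (Complex.I • X) (Complex.I • Y) : ℂ)) * Complex.I_mul_I

/-- One quarter of the Laplacian of `f` along the complex line spanned by `X`. -/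
noncomputable def lapB {n : ℕ} {F : Type*} [NormedAddCommGroup F] [NormedSpace ℝ F]
    (B : Pt n →L[ℝ] Pt n →L[ℝ] F) (X : Pt n) : F :=
  (1 / 4 : ℝ) • (B X X + B (Complex.I • X) (Complex.I • X))

noncomputable def lap {n : ℕ} {F : Type*} [NormedAddCommGroup F] [NormedSpace ℝ F]
    (f : Pt n → F) (z X : Pt n) : F :=
  lapB (fderiv ℝ (fderiv ℝ f) z) X

lemma levi_self {n : ℕ} {f : Pt n → ℝ} {z : Pt n} (h : TwiceDiffAt f z) (X : Pt n) :
    levi n f z X X = (lap f z X : ℝ) := by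
  rw [levi_eq h, leviB, lap, lapB, h.symm X (Complex.I • X), sub_self]
  simp [smul_eq_mul]

lemma twiceDiffAt_of_levi_pos {n : ℕ} {f : Pt n → ℝ} {z : Pt n}
    (h : ∀ᶠ w in 𝓝 z, DifferentiableAt ℝ f w)
    (hpos : ∀ X : Pt n, X ≠ 0 → 0 < (levi n f z X X).re) : TwiceDiffAt f z := by
  refine ⟨h, ?_⟩
  have hk : ∀ k : Fin n, DifferentiableAt ℝ (fun w => dZb n (cR n f) k w) z := by
    intro k
    by_contra hnd
    have h0 : fderiv ℝ (fun w => dZb n (cR n f) k w) z = 0 :=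
        fderiv_zero_of_not_differentiableAt hnd
    have := hpos (Pi.single k 1) (by
      intro h; have := congrFun h k; simp at this)
    have h1 : levi n f z (Pi.single k 1) (Pi.single k 1) = 0 := by
      rw [levi]
      refine Finset.sum_eq_zero fun j _ => Finset.sum_eq_zero fun l _ => ?_
      by_cases hl : l = k
      · subst hl
        rw [dZ, h0]; simp
      · simp [Pi.single_eq_of_ne hl]
    rw [h1] at this
    simp at this
  have hrep : (fderiv ℝ f) =ᶠ[𝓝 z] fun w => ∑ k,
      ((dZb n (cR n f) k w).re • ((2 : ℝ) • (Complex.reCLM.comp (ContinuousLinearMap.proj k :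
          Pt n →L[ℝ] ℂ))) +
      (dZb n (cR n f) k w).im • ((2 : ℝ) • (Complex.imCLM.comp (ContinuousLinearMap.proj k :
          Pt n →L[ℝ] ℂ)))) := by
    filter_upwards [h] with w hw
    ext v
    have hv := congrArg (fderiv ℝ f w) (pi_eq_sum_single v)
    rw [hv]
    simp only [map_sum, map_add, map_smul, sum_apply,
      add_apply, smul_apply, ContinuousLinearMap.comp_apply,
      ContinuousLinearMap.proj_apply, Complex.reCLM_apply, Complex.imCLM_apply, smul_eq_mul]
    refine Finset.sum_congr rfl fun k _ => ?_
    rw [dZb, fderiv_cR hw, fderiv_cR hw]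
    simp
    ring
  refine DifferentiableAt.congr_of_eventuallyEq ?_ hrep
  refine DifferentiableAt.fun_sum fun k _ => ?_
  exact (((Complex.reCLM.differentiableAt).comp z (hk k)).smul_const _).add
    (((Complex.imCLM.differentiableAt).comp z (hk k)).smul_const _)

section calculus
variable {n : ℕ}

lemma fderiv2_mul {A : Type*} [NormedField A] [NormedAlgebra ℝ A] {f g : Pt n → A} {z : Pt n}
    (hf : ContDiffAt ℝ 2 f z) (hg : ContDiffAt ℝ 2 g z)
    (X Y : Pt n) :
    fderiv ℝ (fderiv ℝ (fun w => f w * g w)) z X Y =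
      f z * fderiv ℝ (fderiv ℝ g) z X Y + g z * fderiv ℝ (fderiv ℝ f) z X Y +
      fderiv ℝ f z X * fderiv ℝ g z Y + fderiv ℝ f z Y * fderiv ℝ g z X := by
  have hev : ∀ {h : Pt n → A}, ContDiffAt ℝ 2 h z → ∀ᶠ w in 𝓝 z, DifferentiableAt ℝ h w := by
    intro h hh
    filter_upwards [hh.eventually (by simp)] with w hw
    exact hw.differentiableAt (by norm_num)
  have hD : ∀ {h : Pt n → A}, ContDiffAt ℝ 2 h z → DifferentiableAt ℝ (fderiv ℝ h) z := by
    intro h hh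
    exact (hh.fderiv_right (m := 1) (by norm_num)).differentiableAt (by norm_num)
  have h1 : fderiv ℝ (fun w => f w * g w) =ᶠ[𝓝 z]
      fun w => f w • fderiv ℝ g w + g w • fderiv ℝ f w := by
    filter_upwards [hev hf, hev hg] with w hw1 hw2
    exact fderiv_fun_mul hw1 hw2
  rw [h1.fderiv_eq]
  have h2 := ((hev hf).self_of_nhds.hasFDerivAt.fun_smul (hD hg).hasFDerivAt).fun_add
    ((hev hg).self_of_nhds.hasFDerivAt.fun_smul (hD hf).hasFDerivAt)
  rw [h2.fderiv]
  simp [ContinuousLinearMap.smulRight_apply]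
  ring

lemma fderiv2_add {F : Type*} [NormedAddCommGroup F] [NormedSpace ℝ F]
    {f g : Pt n → F} {z : Pt n} (hf : ContDiffAt ℝ 2 f z) (hg : ContDiffAt ℝ 2 g z) :
    fderiv ℝ (fderiv ℝ (fun w => f w + g w)) z =
      fderiv ℝ (fderiv ℝ f) z + fderiv ℝ (fderiv ℝ g) z := by
  have hev : ∀ {h : Pt n → F}, ContDiffAt ℝ 2 h z → ∀ᶠ w in 𝓝 z, DifferentiableAt ℝ h w := by
    intro h hh
    filter_upwards [hh.eventually (by simp)] with w hw
    exact hw.differentiableAt (by norm_num)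
  have hD : ∀ {h : Pt n → F}, ContDiffAt ℝ 2 h z → DifferentiableAt ℝ (fderiv ℝ h) z := by
    intro h hh
    exact (hh.fderiv_right (m := 1) (by norm_num)).differentiableAt (by norm_num)
  have h1 : fderiv ℝ (fun w => f w + g w) =ᶠ[𝓝 z] fun w => fderiv ℝ f w + fderiv ℝ g w := by
    filter_upwards [hev hf, hev hg] with w hw1 hw2
    exact fderiv_fun_add hw1 hw2
  rw [h1.fderiv_eq]
  exact ((hD hf).hasFDerivAt.add (hD hg).hasFDerivAt).fderiv

lemma lap_mul {f g : Pt n → ℂ} {z : Pt n} (hf : ContDiffAt ℝ 2 f z) (hg : ContDiffAt ℝ 2 g z)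
    (X : Pt n) :
    lap (fun w => f w * g w) z X =
      f z * lap g z X + g z * lap f z X + wd f z X * wdb g z X + wdb f z X * wd g z X := by
  simp only [lap, lapB, fderiv2_mul hf hg, wd, wdb, Complex.real_smul]
  push_cast
  linear_combination (1/2 * fderiv ℝ f z (Complex.I • X) * fderiv ℝ g z (Complex.I • X)) *
      Complex.I_mul_I

lemma lap_add {F : Type*} [NormedAddCommGroup F] [NormedSpace ℝ F]
    {f g : Pt n → F} {z : Pt n} (hf : ContDiffAt ℝ 2 f z) (hg : ContDiffAt ℝ 2 g z) (X : Pt n) :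
    lap (fun w => f w + g w) z X = lap f z X + lap g z X := by
  simp only [lap, lapB, fderiv2_add hf hg, add_apply, ← smul_add]
  congr 1
  abel

lemma wd_mul {f g : Pt n → ℂ} {z : Pt n} (hf : DifferentiableAt ℝ f z)
    (hg : DifferentiableAt ℝ g z) (X : Pt n) :
    wd (fun w => f w * g w) z X = f z * wd g z X + g z * wd f z X := by
  simp only [wd, fderiv_fun_mul hf hg, add_apply, smul_apply, smul_eq_mul]
  ring

lemma wdb_mul {f g : Pt n → ℂ} {z : Pt n} (hf : DifferentiableAt ℝ f z)
    (hg : DifferentiableAt ℝ g z) (X : Pt n) :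
    wdb (fun w => f w * g w) z X = f z * wdb g z X + g z * wdb f z X := by
  simp only [wdb, fderiv_fun_mul hf hg, add_apply, smul_apply, smul_eq_mul]
  ring

lemma wd_add {f g : Pt n → ℂ} {z : Pt n} (hf : DifferentiableAt ℝ f z)
    (hg : DifferentiableAt ℝ g z) (X : Pt n) :
    wd (fun w => f w + g w) z X = wd f z X + wd g z X := by
  simp only [wd, fderiv_fun_add hf hg, add_apply]
  ring

lemma wdb_add {f g : Pt n → ℂ} {z : Pt n} (hf : DifferentiableAt ℝ f z)
    (hg : DifferentiableAt ℝ g z) (X : Pt n) :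
    wdb (fun w => f w + g w) z X = wdb f z X + wdb g z X := by
  simp only [wdb, fderiv_fun_add hf hg, add_apply]
  ring

lemma wdb_sum {ι : Type*} {f : ι → Pt n → ℂ} {s : Finset ι} {z : Pt n}
    (hf : ∀ i ∈ s, DifferentiableAt ℝ (f i) z) (X : Pt n) :
    wdb (fun w => ∑ i ∈ s, f i w) z X = ∑ i ∈ s, wdb (f i) z X := by
  simp only [wdb, fderiv_fun_sum hf, sum_apply, Finset.mul_sum, ← Finset.sum_add_distrib]

lemma wd_sum {ι : Type*} {f : ι → Pt n → ℂ} {s : Finset ι} {z : Pt n}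
    (hf : ∀ i ∈ s, DifferentiableAt ℝ (f i) z) (X : Pt n) :
    wd (fun w => ∑ i ∈ s, f i w) z X = ∑ i ∈ s, wd (f i) z X := by
  simp only [wd, fderiv_fun_sum hf, sum_apply, Finset.mul_sum, ← Finset.sum_sub_distrib]

lemma wdb_wd_eq_lap {f : Pt n → ℂ} {z : Pt n} (hf : ContDiffAt ℝ 2 f z) (X : Pt n) :
    wdb (fun w => wd f w X) z X = lap f z X := by
  have hD : DifferentiableAt ℝ (fderiv ℝ f) z :=
    (hf.fderiv_right (m := 1) (by norm_num)).differentiableAt (by norm_num)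
  have hs := (hf.isSymmSndFDerivAt (by simp)).eq X (Complex.I • X)
  have h1 : ∀ v : Pt n, HasFDerivAt (fun w => fderiv ℝ f w v)
      ((ContinuousLinearMap.apply ℝ ℂ v).comp (fderiv ℝ (fderiv ℝ f) z)) z := fun v =>
      ((ContinuousLinearMap.apply ℝ ℂ v).hasFDerivAt.comp z hD.hasFDerivAt)
  have h2 := (((h1 X).fun_sub ((h1 (Complex.I • X)).const_mul Complex.I)).const_mul (1 / 2 :
      ℂ)).fderiv
  simp only [wdb, wd, lap, lapB]
  rw [h2]
  simp only [smul_apply, sub_apply, ContinuousLinearMap.comp_apply, ContinuousLinearMap.apply_apply,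
    smul_eq_mul, Complex.real_smul, hs]
  push_cast
  linear_combination (-1/4 * fderiv ℝ (fderiv ℝ f) z (Complex.I • X) (Complex.I • X)) *
      Complex.I_mul_I

lemma fderiv_conj_comp {f : Pt n → ℂ} {z : Pt n} (hf : DifferentiableAt ℝ f z) (X : Pt n) :
    fderiv ℝ (fun w => (starRingEnd ℂ) (f w)) z X = (starRingEnd ℂ) (fderiv ℝ f z X) := by
  have := ((Complex.conjCLE : ℂ →L[ℝ] ℂ).hasFDerivAt.comp z hf.hasFDerivAt).fderiv
  have h2 : (fun w => (starRingEnd ℂ) (f w)) = (Complex.conjCLE : ℂ →L[ℝ] ℂ) ∘ f := rfl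
  rw [h2, this]; rfl

lemma wd_conj {f : Pt n → ℂ} {z : Pt n} (hf : DifferentiableAt ℝ f z) (X : Pt n) :
    wd (fun w => (starRingEnd ℂ) (f w)) z X = (starRingEnd ℂ) (wdb f z X) := by
  simp [wd, wdb, fderiv_conj_comp hf, sub_eq_add_neg, Complex.conj_ofNat]

lemma wdb_conj {f : Pt n → ℂ} {z : Pt n} (hf : DifferentiableAt ℝ f z) (X : Pt n) :
    wdb (fun w => (starRingEnd ℂ) (f w)) z X = (starRingEnd ℂ) (wd f z X) := by
  simp [wd, wdb, fderiv_conj_comp hf, sub_eq_add_neg, Complex.conj_ofNat]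

lemma wd_smul_vec (f : Pt n → ℂ) (z X : Pt n) (c : ℂ) : wd f z (c • X) = c * wd f z X := by
  rw [← sum_dZ, ← sum_dZ, Finset.mul_sum]
  exact Finset.sum_congr rfl fun j _ => by simp; ring

lemma wd_add_vec (f : Pt n → ℂ) (z X Y : Pt n) : wd f z (X + Y) = wd f z X + wd f z Y := by
  rw [← sum_dZ, ← sum_dZ, ← sum_dZ, ← Finset.sum_add_distrib]
  exact Finset.sum_congr rfl fun j _ => by simp; ring

end calculus

section dangelo
variable {n : ℕ} {r : Pt n → ℝ} {p : Pt n}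

lemma fderiv_real_const_apply {f : Pt n → ℝ} {z : Pt n} (h : DifferentiableAt ℝ (fderiv ℝ f) z)
    (v X : Pt n) : fderiv ℝ (fun w => fderiv ℝ f w v) z X = fderiv ℝ (fderiv ℝ f) z X v := by
  have h1 : HasFDerivAt (fun w => fderiv ℝ f w v)
      ((ContinuousLinearMap.apply ℝ ℝ v).comp (fderiv ℝ (fderiv ℝ f) z)) z :=
    (ContinuousLinearMap.apply ℝ ℝ v).hasFDerivAt.comp z h.hasFDerivAt
  rw [h1.fderiv]; rfl

lemma ContDiffAt.twiceDiffAt {f : Pt n → ℝ} {z : Pt n} (h : ContDiffAt ℝ 2 f z) :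
    TwiceDiffAt f z := by
  refine ⟨?_, (h.fderiv_right (m := 1) (by norm_num)).differentiableAt (by norm_num)⟩
  filter_upwards [h.eventually (by simp)] with w hw
  exact hw.differentiableAt (by norm_num)

lemma dZ_eq_conj_dZb (hd : DifferentiableAt ℝ r p) (k : Fin n) :
    dZ n (cR n r) k p = (starRingEnd ℂ) (dZb n (cR n r) k p) := by
  simp [dZ, dZb, fderiv_cR hd, sub_eq_add_neg, Complex.conj_ofNat]

lemma ofReal_gradSq (hd : DifferentiableAt ℝ r p) :
    (gradSq n r p : ℂ) = ∑ m, (starRingEnd ℂ) (dZb n (cR n r) m p) * dZb n (cR n r) m p := by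
  rw [gradSq, Complex.ofReal_sum]
  refine Finset.sum_congr rfl fun m _ => ?_
  rw [Complex.normSq_eq_conj_mul_self, dZ_eq_conj_dZb hd, Complex.conj_conj, mul_comm]

lemma gradSq_pos (hd : DifferentiableAt ℝ r p) (h0 : fderiv ℝ r p ≠ 0) : 0 < gradSq n r p := by
  have hnn : 0 ≤ gradSq n r p := Finset.sum_nonneg fun j _ => Complex.normSq_nonneg _
  refine lt_of_le_of_ne hnn fun h => h0 ?_
  have hz : ∀ j, dZ n (cR n r) j p = 0 := by
    intro j
    have := (Finset.sum_eq_zero_iff_of_nonneg (fun j _ => Complex.normSq_nonneg _)).1 h.symm j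
      (Finset.mem_univ j)
    exact Complex.normSq_eq_zero.1 this
  ext X
  have h1 : wd (cR n r) p X = 0 := by
    rw [← sum_dZ]; exact Finset.sum_eq_zero fun j _ => by rw [hz, mul_zero]
  rw [wd_cR hd] at h1
  have := congrArg Complex.re h1
  simpa using this

/-- Continuous differentiability of the coefficients of the gradient. -/
lemma contDiffAt_dZb {m : ℕ} (h : ContDiffAt ℝ (m + 1) r p) (k : Fin n) :
    ContDiffAt ℝ m (fun w => dZb n (cR n r) k w) p := by
  have h1 : ContDiffAt ℝ (m + 1) (cR n r) p := Complex.ofRealCLM.contDiff.contDiffAt.comp p h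
  have h2 : ContDiffAt ℝ m (fderiv ℝ (cR n r)) p := h1.fderiv_right le_rfl
  unfold dZb
  exact contDiffAt_const.mul ((h2.clm_apply contDiffAt_const).add
    (contDiffAt_const.mul (h2.clm_apply contDiffAt_const)))

lemma contDiffAt_dZ {m : ℕ} (h : ContDiffAt ℝ (m + 1) r p) (k : Fin n) :
    ContDiffAt ℝ m (fun w => dZ n (cR n r) k w) p := by
  have h1 : ContDiffAt ℝ (m + 1) (cR n r) p := Complex.ofRealCLM.contDiff.contDiffAt.comp p h
  have h2 : ContDiffAt ℝ m (fderiv ℝ (cR n r)) p := h1.fderiv_right le_rfl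
  unfold dZ
  exact contDiffAt_const.mul ((h2.clm_apply contDiffAt_const).sub
    (contDiffAt_const.mul (h2.clm_apply contDiffAt_const)))

/-- Mixed Wirtinger derivatives commute. -/
lemma dZb_dZ_comm {f : Pt n → ℂ} (hf : ContDiffAt ℝ 2 f p) (j m : Fin n) :
    dZb n (fun w => dZ n f j w) m p = dZ n (fun w => dZb n f m w) j p := by
  have hD : DifferentiableAt ℝ (fderiv ℝ f) p :=
    (hf.fderiv_right (m := 1) (by norm_num)).differentiableAt (by norm_num)
  have hs := (hf.isSymmSndFDerivAt (by simp)).eq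
  have h1 : ∀ v : Pt n, HasFDerivAt (fun w => fderiv ℝ f w v)
      ((ContinuousLinearMap.apply ℝ ℂ v).comp (fderiv ℝ (fderiv ℝ f) p)) p := fun v =>
      ((ContinuousLinearMap.apply ℝ ℂ v).hasFDerivAt.comp p hD.hasFDerivAt)
  have h2 := fun v w : Pt n =>
    (((h1 v).fun_sub ((h1 w).const_mul Complex.I)).const_mul (1 / 2 : ℂ)).fderiv
  have h3 := fun v w : Pt n =>
    (((h1 v).fun_add ((h1 w).const_mul Complex.I)).const_mul (1 / 2 : ℂ)).fderiv
  unfold dZ dZb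
  rw [h2, h3]
  simp only [smul_apply, sub_apply, add_apply, ContinuousLinearMap.comp_apply,
    ContinuousLinearMap.apply_apply, smul_eq_mul]
  rw [hs (Pi.single m 1) (Pi.single j 1), hs (Pi.single m 1) (Pi.single j I),
    hs (Pi.single m I) (Pi.single j 1), hs (Pi.single m I) (Pi.single j I)]
  ring

/-- Pure Wirtinger derivatives commute. -/
lemma dZ_dZ_comm {f : Pt n → ℂ} (hf : ContDiffAt ℝ 2 f p) (j m : Fin n) :
    dZ n (fun w => dZ n f j w) m p = dZ n (fun w => dZ n f m w) j p := by
  have hD : DifferentiableAt ℝ (fderiv ℝ f) p :=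
    (hf.fderiv_right (m := 1) (by norm_num)).differentiableAt (by norm_num)
  have hs := (hf.isSymmSndFDerivAt (by simp)).eq
  have h1 : ∀ v : Pt n, HasFDerivAt (fun w => fderiv ℝ f w v)
      ((ContinuousLinearMap.apply ℝ ℂ v).comp (fderiv ℝ (fderiv ℝ f) p)) p := fun v =>
      ((ContinuousLinearMap.apply ℝ ℂ v).hasFDerivAt.comp p hD.hasFDerivAt)
  have h2 := fun v w : Pt n =>
    (((h1 v).fun_sub ((h1 w).const_mul Complex.I)).const_mul (1 / 2 : ℂ)).fderiv
  unfold dZ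
  rw [h2, h2]
  simp only [smul_apply, sub_apply, ContinuousLinearMap.comp_apply,
    ContinuousLinearMap.apply_apply, smul_eq_mul]
  rw [hs (Pi.single m 1) (Pi.single j 1), hs (Pi.single m 1) (Pi.single j I),
    hs (Pi.single m I) (Pi.single j 1), hs (Pi.single m I) (Pi.single j I)]
  ring

lemma dZ_mul {f g : Pt n → ℂ} {z : Pt n} (hf : DifferentiableAt ℝ f z)
    (hg : DifferentiableAt ℝ g z) (j : Fin n) :
    dZ n (fun w => f w * g w) j z = f z * dZ n g j z + g z * dZ n f j z := by
  simp only [dZ, fderiv_fun_mul hf hg, add_apply, smul_apply, smul_eq_mul]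
  ring

lemma dZ_const_mul (c : ℂ) {f : Pt n → ℂ} {z : Pt n} (hf : DifferentiableAt ℝ f z) (j : Fin n) :
    dZ n (fun w => c * f w) j z = c * dZ n f j z := by
  simp only [dZ, fderiv_const_mul hf, smul_apply, smul_eq_mul]
  ring

lemma dZb_const_mul (c : ℂ) {f : Pt n → ℂ} {z : Pt n} (hf : DifferentiableAt ℝ f z) (j : Fin n) :
    dZb n (fun w => c * f w) j z = c * dZb n f j z := by
  simp only [dZb, fderiv_const_mul hf, smul_apply, smul_eq_mul]
  ring

lemma dZ_sum {ι : Type*} {f : ι → Pt n → ℂ} {s : Finset ι} {z : Pt n}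
    (hf : ∀ i ∈ s, DifferentiableAt ℝ (f i) z) (j : Fin n) :
    dZ n (fun w => ∑ i ∈ s, f i w) j z = ∑ i ∈ s, dZ n (f i) j z := by
  simp only [dZ, fderiv_fun_sum hf, sum_apply, Finset.mul_sum, ← Finset.sum_sub_distrib]

lemma dZ_congr {f g : Pt n → ℂ} {z : Pt n} (h : f =ᶠ[𝓝 z] g) (j : Fin n) :
    dZ n f j z = dZ n g j z := by
  simp only [dZ, h.fderiv_eq]

/-- The coefficients of the D'Angelo form in terms of the Levi form. -/
lemma dAngelo_w_eq (h : ContDiffAt ℝ 2 r p) (h0 : fderiv ℝ r p ≠ 0) (l : Fin n) :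
    (dAngelo n r).w p l = (∑ m, (starRingEnd ℂ) (dZb n (cR n r) m p) *
      dZ n (fun w => dZb n (cR n r) m w) l p) / (gradSq n r p : ℂ) := by
  have hcR : ContDiffAt ℝ 2 (cR n r) p := Complex.ofRealCLM.contDiff.contDiffAt.comp p h
  have hd := h.differentiableAt (by norm_num)
  have hev : ∀ᶠ w in 𝓝 p, DifferentiableAt ℝ r w ∧ fderiv ℝ r w ≠ 0 := by
    refine h.twiceDiffAt.1.and ?_
    exact (h.continuousAt_fderiv (by norm_num)).eventually_ne h0
  have hgs : (gradSq n r p : ℂ) ≠ 0 := by exact_mod_cast (gradSq_pos hd h0).ne'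
  have ha : ∀ m, DifferentiableAt ℝ (fun w => dZb n (cR n r) m w) p := fun m =>
    (contDiffAt_dZb (m := 1) (by exact_mod_cast h) m).differentiableAt (by norm_num)
  have hz : ∀ m, DifferentiableAt ℝ (fun w => dZ n (cR n r) m w) p := fun m =>
    (contDiffAt_dZ (m := 1) (by exact_mod_cast h) m).differentiableAt (by norm_num)
  have hgrad : (fun w => (gradSq n r w : ℂ)) =ᶠ[𝓝 p]
      fun w => ∑ m, dZ n (cR n r) m w * dZb n (cR n r) m w := by
    filter_upwards [hev] with w hw
    rw [ofReal_gradSq hw.1]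
    exact Finset.sum_congr rfl fun m _ => by rw [dZ_eq_conj_dZb hw.1]
  have hdg : DifferentiableAt ℝ (fun w => (gradSq n r w : ℂ)) p :=
    (DifferentiableAt.fun_sum fun m _ => (hz m).mul (ha m)).congr_of_eventuallyEq hgrad
  have hconjev : ∀ m, (fun w => (starRingEnd ℂ) (dZb n (cR n r) m w / (gradSq n r w : ℂ))) =ᶠ[𝓝 p]
      fun w => dZ n (cR n r) m w / (gradSq n r w : ℂ) := by
    intro m
    filter_upwards [hev] with w hw
    rw [map_div₀, Complex.conj_ofReal, dZ_eq_conj_dZb hw.1]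
  have hTa : ∀ m, DifferentiableAt ℝ (fun w => dZb n (cR n r) m w / (gradSq n r w : ℂ)) p :=
    fun m => by
      have := (ha m).fun_mul (DifferentiableAt.fun_inv hdg hgs)
      simpa only [div_eq_mul_inv] using this
  have hTz : ∀ m, DifferentiableAt ℝ (fun w => dZ n (cR n r) m w / (gradSq n r w : ℂ)) p :=
    fun m => by
      have := (hz m).fun_mul (DifferentiableAt.fun_inv hdg hgs)
      simpa only [div_eq_mul_inv] using this
  -- differentiate the two normalisation identities
  have hid1 : ∑ m, (dZ n (cR n r) m p * dZ n (fun w =>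
      dZb n (cR n r) m w / (gradSq n r w : ℂ)) l p +
      dZb n (cR n r) m p / (gradSq n r p : ℂ) * dZ n (fun w => dZ n (cR n r) m w) l p) = 0 := by
    have e1 : (fun w => ∑ m, dZ n (cR n r) m w * (dZb n (cR n r) m w / (gradSq n r w : ℂ)))
        =ᶠ[𝓝 p] fun _ => 1 := by
      filter_upwards [hev, hgrad] with w hw hg
      have : (gradSq n r w : ℂ) ≠ 0 := by exact_mod_cast (gradSq_pos hw.1 hw.2).ne'
      simp only [← mul_div_assoc, ← Finset.sum_div]
      rw [← hg, div_self this]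
    have e2 := dZ_congr e1 l
    rw [dZ_sum fun m _ => (hz m).fun_mul (hTa m)] at e2
    simp only [dZ_mul (hz _) (hTa _)] at e2
    rw [e2]; simp [dZ]
  have hid2 : ∑ m, (dZb n (cR n r) m p * dZ n (fun w =>
      dZ n (cR n r) m w / (gradSq n r w : ℂ)) l p +
      dZ n (cR n r) m p / (gradSq n r p : ℂ) * dZ n (fun w => dZb n (cR n r) m w) l p) = 0 := by
    have e1 : (fun w => ∑ m, dZb n (cR n r) m w * (dZ n (cR n r) m w / (gradSq n r w : ℂ)))
        =ᶠ[𝓝 p] fun _ => 1 := by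
      filter_upwards [hev, hgrad] with w hw hg
      have : (gradSq n r w : ℂ) ≠ 0 := by exact_mod_cast (gradSq_pos hw.1 hw.2).ne'
      simp only [← mul_div_assoc, ← Finset.sum_div]
      rw [hg] at this ⊢
      simp only [mul_comm (dZb n (cR n r) _ w)]
      rw [div_self this]
    have e2 := dZ_congr e1 l
    rw [dZ_sum fun m _ => (ha m).fun_mul (hTz m)] at e2
    simp only [dZ_mul (ha _) (hTz _)] at e2
    rw [e2]; simp [dZ]
  simp only [Finset.sum_add_distrib] at hid1 hid2
  simp only [dAngelo, Form1.neg, lieD, VF.app, etaF, TVF, LnVF]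
  have hneg : ∀ m, dZ n (fun w => -(starRingEnd ℂ) (dZb n (cR n r) m w / (gradSq n r w : ℂ))) l p =
      -dZ n (fun w => dZ n (cR n r) m w / (gradSq n r w : ℂ)) l p := by
    intro m
    have e1 : (fun w => -(starRingEnd ℂ) (dZb n (cR n r) m w / (gradSq n r w : ℂ))) =ᶠ[𝓝 p]
        fun w => (-1) * (dZ n (cR n r) m w / (gradSq n r w : ℂ)) := by
      filter_upwards [hconjev m] with w hw
      rw [hw]; ring
    rw [dZ_congr e1, dZ_const_mul _ (hTz m)]
    ring
  simp only [hneg, dZ_const_mul _ (hz _), dZb_const_mul _ (hz _), dZb_dZ_comm hcR,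
    fun m => (hconjev m).self_of_nhds, dZ_dZ_comm hcR l]
  simp only [← dZ_eq_conj_dZb hd]
  simp only [Finset.sum_div]
  have s1 : ∑ m, (1 / 2 : ℂ) * dZ n (cR n r) m p *
      dZ n (fun w => dZb n (cR n r) m w / (gradSq n r w : ℂ)) l p =
      (1 / 2 : ℂ) * ∑ m, dZ n (cR n r) m p *
      dZ n (fun w => dZb n (cR n r) m w / (gradSq n r w : ℂ)) l p := by
    rw [Finset.mul_sum]; exact Finset.sum_congr rfl fun m _ => by ring
  have s2 : ∑ m, -(1 / 2 : ℂ) * dZb n (cR n r) m p *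
      -dZ n (fun w => dZ n (cR n r) m w / (gradSq n r w : ℂ)) l p =
      (1 / 2 : ℂ) * ∑ m, dZb n (cR n r) m p *
      dZ n (fun w => dZ n (cR n r) m w / (gradSq n r w : ℂ)) l p := by
    rw [Finset.mul_sum]; exact Finset.sum_congr rfl fun m _ => by ring
  have s3 : ∑ m, dZb n (cR n r) m p / (gradSq n r p : ℂ) *
      ((1 / 2 : ℂ) * dZ n (fun w => dZ n (cR n r) m w) l p) =
      (1 / 2 : ℂ) * ∑ m, dZb n (cR n r) m p / (gradSq n r p : ℂ) *
        dZ n (fun w => dZ n (cR n r) m w) l p := by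
    rw [Finset.mul_sum]; exact Finset.sum_congr rfl fun m _ => by ring
  have s4 : ∑ m, -(dZ n (cR n r) m p / (gradSq n r p : ℂ)) *
      ((1 / 2 : ℂ) * dZ n (fun w => dZb n (cR n r) m w) l p) =
      -((1 / 2 : ℂ) * ∑ m, dZ n (cR n r) m p / (gradSq n r p : ℂ) *
        dZ n (fun w => dZb n (cR n r) m w) l p) := by
    rw [Finset.mul_sum, ← Finset.sum_neg_distrib]
    exact Finset.sum_congr rfl fun m _ => by ring
  have s5 : ∑ m, dZ n (cR n r) m p * dZ n (fun w => dZb n (cR n r) m w) l p / (gradSq n r p : ℂ) =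
      ∑ m, dZ n (cR n r) m p / (gradSq n r p : ℂ) *
        dZ n (fun w => dZb n (cR n r) m w) l p :=
    Finset.sum_congr rfl fun m _ => by ring
  rw [s1, s2, s3, s4, s5]
  linear_combination (-1/2 : ℂ) * hid1 + (-1/2 : ℂ) * hid2

end dangelo

section omega
variable {n : ℕ} {r : Pt n → ℝ} {p : Pt n}

/-- The (1,0)-part of the D'Angelo form evaluated on a vector. -/
noncomputable def om (r : Pt n → ℝ) (p L : Pt n) : ℂ := ∑ j, (dAngelo n r).w p j * L j

/-- The form `∂̄ω` evaluated on `(L, L̄)`. -/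
noncomputable def dlb (r : Pt n → ℝ) (p L : Pt n) : ℂ :=
  delbOmega (dAngelo n r) (L, 0) (0, conjVec L) p

/-- The normalised normal vector of a defining function. -/
noncomputable def nuv (r : Pt n → ℝ) (p : Pt n) : Pt n :=
  fun k => dZb n (cR n r) k p / (2 * (gradSq n r p : ℂ))

/-- The complexified derivative of `r` along the constant direction `ν`. -/
noncomputable def HH (r : Pt n → ℝ) (ν z : Pt n) : ℂ :=
  (fderiv ℝ r z ν : ℂ) + Complex.I * (fderiv ℝ r z (Complex.I • ν) : ℂ)

lemma omegaWedge_eq (L : Pt n) :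
    omegaWedge (dAngelo n r) (L, 0) (0, conjVec L) p = (Complex.normSq (om r p L) : ℂ) := by
  simp only [omegaWedge, om, conjVec, Pi.zero_apply, mul_zero, Finset.sum_const_zero, sub_zero]
  rw [Complex.normSq_eq_conj_mul_self, map_sum, mul_comm]
  simp only [map_mul]

lemma dlb_eq_sum (L : Pt n) :
    dlb r p L = -∑ l, L l * wdb (fun w => (dAngelo n r).w w l) p L := by
  simp only [dlb, delbOmega, delbEval, conjVec, Pi.zero_apply, zero_mul, zero_sub, sub_self,
    mul_zero, Finset.sum_const_zero, add_zero, ← sum_dZb, Finset.mul_sum]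
  rw [Finset.sum_comm, ← Finset.sum_neg_distrib]
  refine Finset.sum_congr rfl fun l _ => ?_
  rw [← Finset.sum_neg_distrib]
  exact Finset.sum_congr rfl fun m _ => by ring

lemma eventually_nondeg {N : ℕ} (hN : 2 ≤ N) (h : ContDiffAt ℝ N r p) (h0 : fderiv ℝ r p ≠ 0) :
    ∀ᶠ w in 𝓝 p, ContDiffAt ℝ N r w ∧ fderiv ℝ r w ≠ 0 := by
  have hN' : (1 : WithTop ℕ∞) ≤ N := by exact_mod_cast (by omega : 1 ≤ N)
  refine (h.eventually (by simp)).and ?_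
  exact (h.continuousAt_fderiv (by positivity)).eventually_ne h0

lemma om_eq (h : ContDiffAt ℝ 2 r p) (h0 : fderiv ℝ r p ≠ 0) (L : Pt n) :
    om r p L = (∑ m, (starRingEnd ℂ) (dZb n (cR n r) m p) *
      wd (fun w => dZb n (cR n r) m w) p L) / (gradSq n r p : ℂ) := by
  simp only [om, dAngelo_w_eq h h0, ← sum_dZ, Finset.mul_sum, Finset.sum_div, Finset.sum_mul]
  rw [Finset.sum_comm]
  exact Finset.sum_congr rfl fun l _ => Finset.sum_congr rfl fun m _ => by ring

/-- The D'Angelo coefficients are continuously differentiable. -/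
lemma contDiffAt_dAngelo_w (h : ContDiffAt ℝ 3 r p) (h0 : fderiv ℝ r p ≠ 0) (l : Fin n) :
    ContDiffAt ℝ 1 (fun w => (dAngelo n r).w w l) p := by
  have ha : ∀ m, ContDiffAt ℝ 2 (fun w => dZb n (cR n r) m w) p := fun m =>
    contDiffAt_dZb (m := 2) (by exact_mod_cast h) m
  have hev := eventually_nondeg (N := 3) (by norm_num) (by exact_mod_cast h) h0
  have hconj : ∀ m, ContDiffAt ℝ 2 (fun w => (starRingEnd ℂ) (dZb n (cR n r) m w)) p := fun m =>
    Complex.conjCLE.contDiff.contDiffAt.comp p (ha m)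
  have hgs : (gradSq n r p : ℂ) ≠ 0 := by
    exact_mod_cast (gradSq_pos (h.differentiableAt (by norm_num)) h0).ne'
  have hg : ContDiffAt ℝ 2 (fun w => (gradSq n r w : ℂ)) p := by
    have : ContDiffAt ℝ 2 (fun w => ∑ m, (starRingEnd ℂ) (dZb n (cR n r) m w) *
        dZb n (cR n r) m w) p := ContDiffAt.sum fun m _ => (hconj m).mul (ha m)
    refine this.congr_of_eventuallyEq ?_
    filter_upwards [hev] with w hw
    exact ofReal_gradSq (hw.1.differentiableAt (by norm_num))
  have hdz : ∀ m, ContDiffAt ℝ 1 (fun w => dZ n (fun w => dZb n (cR n r) m w) l w) p := by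
    intro m
    have h2 : ContDiffAt ℝ 1 (fderiv ℝ (fun w => dZb n (cR n r) m w)) p :=
      (ha m).fderiv_right (m := 1) (by norm_num)
    unfold dZ
    exact contDiffAt_const.mul ((h2.clm_apply contDiffAt_const).sub
      (contDiffAt_const.mul (h2.clm_apply contDiffAt_const)))
  have key : ContDiffAt ℝ 1 (fun w => (∑ m, (starRingEnd ℂ) (dZb n (cR n r) m w) *
      dZ n (fun w => dZb n (cR n r) m w) l w) * ((gradSq n r w : ℂ))⁻¹) p :=
    (ContDiffAt.sum fun m _ => ((hconj m).of_le (by norm_num)).mul (hdz m)).mul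
      ((hg.of_le (by norm_num)).inv hgs)
  refine key.congr_of_eventuallyEq ?_
  filter_upwards [hev] with w hw
  rw [dAngelo_w_eq (hw.1.of_le (by norm_num)) hw.2, div_eq_mul_inv]

lemma dlb_eq (h : ContDiffAt ℝ 3 r p) (h0 : fderiv ℝ r p ≠ 0) (L : Pt n) :
    dlb r p L = -wdb (fun z => om r z L) p L := by
  have hw := fun l => (contDiffAt_dAngelo_w h h0 l).differentiableAt (by norm_num)
  rw [dlb_eq_sum]
  unfold om
  rw [wdb_sum (fun l _ => (hw l).mul_const _)]
  congr 1
  refine Finset.sum_congr rfl fun l _ => ?_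
  rw [wdb_mul (hw l) (differentiableAt_const _)]
  simp [wdb]

lemma HH_eq_wdb {z : Pt n} (hd : DifferentiableAt ℝ r z) (ν : Pt n) :
    HH r ν z = 2 * ∑ k, (starRingEnd ℂ) (ν k) * dZb n (cR n r) k z := by
  rw [sum_dZb, wdb, fderiv_cR hd, fderiv_cR hd, HH]; ring

lemma HH_nuv {z : Pt n} (hd : DifferentiableAt ℝ r z) :
    HH r (nuv r p) z = ∑ k, (starRingEnd ℂ) (dZb n (cR n r) k p) / (gradSq n r p : ℂ) *
      dZb n (cR n r) k z := by
  rw [HH_eq_wdb hd, Finset.mul_sum]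
  refine Finset.sum_congr rfl fun k _ => ?_
  simp only [nuv, map_div₀, map_mul, Complex.conj_ofReal, Complex.conj_ofNat]
  by_cases hg : (gradSq n r p : ℂ) = 0
  · simp [hg]
  · field_simp

lemma HH_nuv_self (hd : DifferentiableAt ℝ r p) (h0 : fderiv ℝ r p ≠ 0) :
    HH r (nuv r p) p = 1 := by
  have hgs : (gradSq n r p : ℂ) ≠ 0 := by exact_mod_cast (gradSq_pos hd h0).ne'
  rw [HH_nuv hd]
  simp only [div_mul_eq_mul_div]
  rw [← Finset.sum_div, ← ofReal_gradSq hd, div_self hgs]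

lemma fderiv_nuv (hd : DifferentiableAt ℝ r p) (h0 : fderiv ℝ r p ≠ 0) :
    fderiv ℝ r p (nuv r p) = 1 ∧ fderiv ℝ r p (Complex.I • nuv r p) = 0 := by
  have h := HH_nuv_self hd h0
  rw [HH] at h
  constructor
  · simpa using congrArg Complex.re h
  · simpa using congrArg Complex.im h

lemma mem_T10 (L : Pt n) : L ∈ T10 n r p ↔ wd (cR n r) p L = 0 := by
  rw [← sum_dZ]; rfl

lemma mem_T10_iff (hd : DifferentiableAt ℝ r p) (L : Pt n) :
    L ∈ T10 n r p ↔ fderiv ℝ r p L = 0 ∧ fderiv ℝ r p (Complex.I • L) = 0 := by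
  rw [mem_T10, wd_cR hd]
  constructor
  · intro h
    have h1 := congrArg Complex.re h
    have h2 := congrArg Complex.im h
    simp at h1 h2
    exact ⟨h1, h2⟩
  · rintro ⟨h1, h2⟩
    simp [h1, h2]

lemma null_eigen (h : ContDiffAt ℝ 2 r p) (h0 : fderiv ℝ r p ≠ 0) {L : Pt n}
    (hL : L ∈ nullSp n r p) (m : Fin n) :
    wd (fun w => dZb n (cR n r) m w) p L = om r p L * dZb n (cR n r) m p := by
  have hd := h.differentiableAt (by norm_num)
  have hgs : (gradSq n r p : ℂ) ≠ 0 := by exact_mod_cast (gradSq_pos hd h0).ne'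
  set a : Fin n → ℂ := fun m => dZb n (cR n r) m p with ha
  set u : Fin n → ℂ := fun m => wd (fun w => dZb n (cR n r) m w) p L with hu
  set lam := om r p L with hlam
  have hom : ∑ m, (starRingEnd ℂ) (a m) * u m = lam * gradSq n r p := by
    rw [hlam, om_eq h h0, div_mul_cancel₀ _ hgs]
  have hgrad : (gradSq n r p : ℂ) = ∑ m, (starRingEnd ℂ) (a m) * a m := ofReal_gradSq hd
  set v : Fin n → ℂ := fun m => u m - lam * a m with hv
  have hvperp : ∑ m, (starRingEnd ℂ) (a m) * v m = 0 := by
    simp only [hv, mul_sub, Finset.sum_sub_distrib, hom]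
    rw [hgrad, Finset.mul_sum, ← Finset.sum_sub_distrib]
    exact Finset.sum_eq_zero fun m _ => by ring
  have hvT : v ∈ T10 n r p := by
    change ∑ j, v j * dZ n (cR n r) j p = 0
    rw [← hvperp]
    exact Finset.sum_congr rfl fun m _ => by rw [dZ_eq_conj_dZb hd, mul_comm]
  have hlev : ∑ k, (starRingEnd ℂ) (v k) * u k = 0 := by
    rw [← hL.2 v hvT, levi, Finset.sum_comm]
    refine Finset.sum_congr rfl fun k _ => ?_
    rw [hu]
    simp only
    rw [← sum_dZ, Finset.mul_sum]
    exact Finset.sum_congr rfl fun j _ => by ring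
  have hvv : ∑ k, (starRingEnd ℂ) (v k) * v k = 0 := by
    have e1 : ∑ k, (starRingEnd ℂ) (v k) * v k = ∑ k, (starRingEnd ℂ) (v k) * u k -
        lam * (starRingEnd ℂ) (∑ m, (starRingEnd ℂ) (a m) * v m) := by
      rw [map_sum, Finset.mul_sum, ← Finset.sum_sub_distrib]
      refine Finset.sum_congr rfl fun m _ => ?_
      simp only [hv, map_mul, Complex.conj_conj]; ring
    rw [e1, hlev, hvperp]; simp
  have hvz : v m = 0 := by
    have : ∑ k, Complex.normSq (v k) = 0 := by
      have : ((∑ k, Complex.normSq (v k) : ℝ) : ℂ) = 0 := by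
        rw [← hvv, Complex.ofReal_sum]
        exact Finset.sum_congr rfl fun k _ => Complex.normSq_eq_conj_mul_self
      exact_mod_cast this
    exact Complex.normSq_eq_zero.1
      ((Finset.sum_eq_zero_iff_of_nonneg fun _ _ => Complex.normSq_nonneg _).1 this m
        (Finset.mem_univ m))
  exact sub_eq_zero.1 hvz

lemma contDiffAt_HH {m : ℕ} (h : ContDiffAt ℝ (m + 1) r p) (ν : Pt n) :
    ContDiffAt ℝ m (HH r ν) p := by
  have h2 : ContDiffAt ℝ m (fderiv ℝ r) p := h.fderiv_right le_rfl
  unfold HH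
  exact (Complex.ofRealCLM.contDiff.contDiffAt.comp p (h2.clm_apply contDiffAt_const)).add
    (contDiffAt_const.mul
      (Complex.ofRealCLM.contDiff.contDiffAt.comp p (h2.clm_apply contDiffAt_const)))

lemma wd_congr {f g : Pt n → ℂ} {z : Pt n} (h : f =ᶠ[𝓝 z] g) (X : Pt n) :
    wd f z X = wd g z X := by simp only [wd, h.fderiv_eq]

lemma wdb_congr {f g : Pt n → ℂ} {z : Pt n} (h : f =ᶠ[𝓝 z] g) (X : Pt n) :
    wdb f z X = wdb g z X := by simp only [wdb, h.fderiv_eq]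

lemma lap_congr {F : Type*} [NormedAddCommGroup F] [NormedSpace ℝ F]
    {f g : Pt n → F} {z : Pt n} (h : f =ᶠ[𝓝 z] g) (X : Pt n) :
    lap f z X = lap g z X := by
  simp only [lap, h.fderiv.fderiv_eq]

lemma HH_nuv_eventually (h : ContDiffAt ℝ 2 r p) :
    HH r (nuv r p) =ᶠ[𝓝 p] fun z => ∑ k, (starRingEnd ℂ) (dZb n (cR n r) k p) /
      (gradSq n r p : ℂ) * dZb n (cR n r) k z := by
  filter_upwards [h.twiceDiffAt.1] with z hz
  exact HH_nuv hz

lemma wd_const_mul (c : ℂ) {f : Pt n → ℂ} {z : Pt n} (hf : DifferentiableAt ℝ f z) (X : Pt n) :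
    wd (fun w => c * f w) z X = c * wd f z X := by
  simp only [wd, fderiv_const_mul hf, smul_apply, smul_eq_mul]; ring

lemma wdb_const_mul (c : ℂ) {f : Pt n → ℂ} {z : Pt n} (hf : DifferentiableAt ℝ f z) (X : Pt n) :
    wdb (fun w => c * f w) z X = c * wdb f z X := by
  simp only [wdb, fderiv_const_mul hf, smul_apply, smul_eq_mul]; ring

lemma lap_const_mul (c : ℂ) {f : Pt n → ℂ} {z : Pt n} (hf : ContDiffAt ℝ 2 f z) (X : Pt n) :
    lap (fun w => c * f w) z X = c * lap f z X := by
  rw [lap_mul contDiffAt_const hf]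
  simp [wd, wdb, lap, lapB]

lemma wd_HH_nuv (h : ContDiffAt ℝ 2 r p) (h0 : fderiv ℝ r p ≠ 0) (L : Pt n) :
    wd (HH r (nuv r p)) p L = om r p L := by
  have ha : ∀ m, DifferentiableAt ℝ (fun w => dZb n (cR n r) m w) p := fun m =>
    (contDiffAt_dZb (m := 1) (by exact_mod_cast h) m).differentiableAt (by norm_num)
  rw [wd_congr (HH_nuv_eventually h), wd_sum (fun m _ => (ha m).const_mul _), om_eq h h0,
    Finset.sum_div]
  refine Finset.sum_congr rfl fun m _ => ?_
  rw [wd_const_mul _ (ha m)]; ring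

lemma lap_sum {F ι : Type*} [NormedAddCommGroup F] [NormedSpace ℝ F] {f : ι → Pt n → F}
    {s : Finset ι} {z : Pt n} (hf : ∀ i ∈ s, ContDiffAt ℝ 2 (f i) z) (X : Pt n) :
    lap (fun w => ∑ i ∈ s, f i w) z X = ∑ i ∈ s, lap (f i) z X := by
  classical
  induction s using Finset.induction_on with
  | empty => simp [lap, lapB]
  | insert a s has ih =>
    simp only [Finset.sum_insert has]
    rw [lap_add (hf a (by simp)) (ContDiffAt.sum fun i hi => hf i (by simp [hi])), ih]
    exact fun i hi => hf i (by simp [hi])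

/-- `∂̄ω` on null vectors, in terms of the derivative of `r` in a fixed direction. -/
lemma dlb_null (h : ContDiffAt ℝ 3 r p) (h0 : fderiv ℝ r p ≠ 0) {L : Pt n}
    (hL : L ∈ nullSp n r p) :
    dlb r p L = -(lap (HH r (nuv r p)) p L - om r p L * wdb (HH r (nuv r p)) p L) := by
  have h2 : ContDiffAt ℝ 2 r p := h.of_le (by norm_num)
  have hd := h.differentiableAt (by norm_num)
  have hgs : (gradSq n r p : ℂ) ≠ 0 := by exact_mod_cast (gradSq_pos hd h0).ne'
  have ha2 : ∀ m, ContDiffAt ℝ 2 (fun w => dZb n (cR n r) m w) p := fun m =>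
    contDiffAt_dZb (m := 2) (by exact_mod_cast h) m
  have ha : ∀ m, DifferentiableAt ℝ (fun w => dZb n (cR n r) m w) p := fun m =>
    (ha2 m).differentiableAt (by norm_num)
  have hca : ∀ m, DifferentiableAt ℝ (fun w => (starRingEnd ℂ) (dZb n (cR n r) m w)) p := fun m =>
    (Complex.conjCLE : ℂ →L[ℝ] ℂ).differentiableAt.comp p (ha m)
  have hwd : ∀ m, DifferentiableAt ℝ (fun z => wd (fun w => dZb n (cR n r) m w) z L) p := by
    intro m
    have hf : DifferentiableAt ℝ (fderiv ℝ (fun w => dZb n (cR n r) m w)) p :=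
      ((ha2 m).fderiv_right (m := 1) (by norm_num)).differentiableAt (by norm_num)
    unfold wd
    exact ((hf.clm_apply (differentiableAt_const _)).fun_sub
      ((hf.clm_apply (differentiableAt_const _)).const_mul _)).const_mul _
  have hev := eventually_nondeg (N := 3) (by norm_num) (by exact_mod_cast h) h0
  have hdom : DifferentiableAt ℝ (fun z => om r z L) p := by
    unfold om
    exact DifferentiableAt.fun_sum fun l _ =>
      ((contDiffAt_dAngelo_w h h0 l).differentiableAt (by norm_num)).mul_const _
  set lam := om r p L with hlam
  -- differentiate `om * gradSq = Σ ā wd a`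
  have e1 : (fun z => om r z L * ∑ m, (starRingEnd ℂ) (dZb n (cR n r) m z) * dZb n (cR n r) m z)
      =ᶠ[𝓝 p] fun z => ∑ m, (starRingEnd ℂ) (dZb n (cR n r) m z) *
        wd (fun w => dZb n (cR n r) m w) z L := by
    filter_upwards [hev] with z hz
    have hdz := hz.1.differentiableAt (by norm_num)
    have : (gradSq n r z : ℂ) ≠ 0 := by exact_mod_cast (gradSq_pos hdz hz.2).ne'
    rw [om_eq (hz.1.of_le (by norm_num)) hz.2, ← ofReal_gradSq hdz, div_mul_cancel₀ _ this]
  have e2 := wdb_congr e1 L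
  rw [wdb_mul hdom (DifferentiableAt.fun_sum fun m _ => (hca m).fun_mul (ha m)),
    wdb_sum (fun m _ => (hca m).fun_mul (ha m)), wdb_sum (fun m _ => (hca m).fun_mul (hwd m))] at e2
  simp only [wdb_mul (hca _) (ha _), wdb_mul (hca _) (hwd _), wdb_wd_eq_lap (ha2 _),
    null_eigen h2 h0 hL, ← hlam] at e2
  rw [← ofReal_gradSq hd] at e2
  have e3 : lap (HH r (nuv r p)) p L = (∑ m, (starRingEnd ℂ) (dZb n (cR n r) m p) *
      lap (fun w => dZb n (cR n r) m w) p L) / (gradSq n r p : ℂ) := by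
    rw [lap_congr (HH_nuv_eventually h2), lap_sum (fun m _ => contDiffAt_const.mul (ha2 m)),
      Finset.sum_div]
    exact Finset.sum_congr rfl fun m _ => by rw [lap_const_mul _ (ha2 m)]; ring
  have e4 : wdb (HH r (nuv r p)) p L = (∑ m, (starRingEnd ℂ) (dZb n (cR n r) m p) *
      wdb (fun w => dZb n (cR n r) m w) p L) / (gradSq n r p : ℂ) := by
    rw [wdb_congr (HH_nuv_eventually h2), wdb_sum (fun m _ => (ha m).const_mul _),
      Finset.sum_div]
    exact Finset.sum_congr rfl fun m _ => by rw [wdb_const_mul _ (ha m)]; ring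
  rw [dlb_eq h h0, e3, e4]
  simp only [Finset.sum_add_distrib] at e2
  have e5 : ∑ m, lam * dZb n (cR n r) m p *
      wdb (fun w => (starRingEnd ℂ) (dZb n (cR n r) m w)) p L =
      lam * ∑ m, dZb n (cR n r) m p *
      wdb (fun w => (starRingEnd ℂ) (dZb n (cR n r) m w)) p L := by
    rw [Finset.mul_sum]; exact Finset.sum_congr rfl fun m _ => by ring
  rw [e5] at e2
  field_simp
  linear_combination -e2

end omega

section geometry
variable {n : ℕ} {s : ℕ∞} {Ω V : Set (Pt n)} {ρ : Pt n → ℝ} {p : Pt n}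

lemma IsDefining.one_le (h : IsDefining n s Ω ρ V) (hs : 1 ≤ s) : IsDefining n 1 Ω ρ V :=
  ⟨h.1, h.2.1, h.2.2.1.of_le (by exact_mod_cast hs), h.2.2.2.1, h.2.2.2.2⟩

lemma IsDefining.mem_nhds (h : IsDefining n s Ω ρ V) (hp : p ∈ frontier Ω) : V ∈ 𝓝 p :=
  h.1.mem_nhds (h.2.1 (frontier_subset_closure hp))

lemma IsDefining.contDiffAt (h : IsDefining n s Ω ρ V) (hp : p ∈ V) : ContDiffAt ℝ s ρ p :=
  h.2.2.1.contDiffAt (h.1.mem_nhds hp)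

lemma IsDefining.mem_V (h : IsDefining n s Ω ρ V) (hp : p ∈ frontier Ω) : p ∈ V :=
  h.2.1 (frontier_subset_closure hp)

lemma IsDefining.isOpen (h : IsDefining n s Ω ρ V) : IsOpen Ω := by
  rw [h.2.2.2.1]
  have := h.2.2.1.continuousOn.isOpen_inter_preimage h.1 (isOpen_Iio (a := (0 : ℝ)))
  exact this

lemma IsDefining.eq_zero (h : IsDefining n s Ω ρ V) (hp : p ∈ frontier Ω) : ρ p = 0 := by
  have hV := h.mem_V hp
  have hc : ContinuousAt ρ p := (h.contDiffAt hV).continuousAt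
  apply le_antisymm
  · by_contra! hpos
    have h1 : ∀ᶠ w in 𝓝 p, 0 < ρ w := hc.eventually (lt_mem_nhds hpos)
    have h2 := mem_closure_iff_frequently.1 (frontier_subset_closure hp)
    obtain ⟨w, hw1, hw2⟩ := (h2.and_eventually h1).exists
    rw [h.2.2.2.1] at hw1
    exact absurd hw1.2 hw2.le.not_gt
  · by_contra! hneg
    have : p ∈ Ω := by rw [h.2.2.2.1]; exact ⟨hV, hneg⟩
    have h3 : p ∈ interior Ω := by rwa [h.isOpen.interior_eq]
    exact hp.2 h3

/-- Strict differentiability in quantitative form. -/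
lemma strict_bound {f : Pt n → ℝ} (hf : ContDiffAt ℝ 1 f p) {ε : ℝ} (hε : 0 < ε) :
    ∀ᶠ z : Pt n × Pt n in 𝓝 p ×ˢ 𝓝 p,
      |f z.1 - f z.2 - fderiv ℝ f p (z.1 - z.2)| ≤ ε * ‖z.1 - z.2‖ := by
  have := (hf.hasStrictFDerivAt (by norm_num)).isLittleO.def hε
  rw [nhds_prod_eq] at this
  simpa [Real.norm_eq_abs] using this

lemma exists_ball_strict {f : Pt n → ℝ} (hf : ContDiffAt ℝ 1 f p) {ε : ℝ} (hε : 0 < ε) :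
    ∃ δ > 0, ∀ z ∈ Metric.ball p δ, ∀ w ∈ Metric.ball p δ,
      |f z - f w - fderiv ℝ f p (z - w)| ≤ ε * ‖z - w‖ := by
  have h := strict_bound hf hε
  rw [← nhds_prod_eq] at h
  obtain ⟨δ, hδ, hb⟩ := Metric.eventually_nhds_iff_ball.1 h
  refine ⟨δ, hδ, fun z hz w hw => hb (z, w) ?_⟩
  rw [← ball_prod_same]
  exact ⟨hz, hw⟩

/-- Points near the boundary where the defining function vanishes are boundary points, and
points outside the closure have positive values. -/
lemma IsDefining.eventually_sign (h : IsDefining n s Ω ρ V) (hs : 1 ≤ s) (hp : p ∈ frontier Ω) :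
    ∀ᶠ z in 𝓝 p, z ∈ V ∧ (ρ z = 0 → z ∈ frontier Ω) ∧ (z ∉ closure Ω → 0 < ρ z) := by
  have h1 := h.one_le hs
  have hc : ContDiffAt ℝ 1 ρ p := h1.contDiffAt (h.mem_V hp)
  obtain ⟨v, hv⟩ : ∃ v, fderiv ℝ ρ p v ≠ 0 := by
    by_contra! hcon
    exact h.2.2.2.2 p hp (by ext v; simpa using hcon v)
  obtain ⟨ν, hν⟩ : ∃ ν, fderiv ℝ ρ p ν = 1 :=
    ⟨(fderiv ℝ ρ p v)⁻¹ • v, by rw [map_smul, smul_eq_mul, inv_mul_cancel₀ hv]⟩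
  have hpos : ∀ᶠ z in 𝓝 p, 0 < fderiv ℝ ρ z ν := by
    have hcont : ContinuousAt (fun z => fderiv ℝ ρ z ν) p :=
      (hc.continuousAt_fderiv (by norm_num)).clm_apply continuousAt_const
    exact hcont.eventually (lt_mem_nhds (by simp only [hν]; norm_num))
  filter_upwards [hpos, h.mem_nhds hp] with z hz hzV
  have hmem : ρ z = 0 → z ∈ closure Ω := by
    intro h0
    have hd : HasDerivAt (fun t : ℝ => ρ (z + t • ν)) (fderiv ℝ ρ z ν) 0 := by
      have hdz : HasFDerivAt ρ (fderiv ℝ ρ z) (z + (0 : ℝ) • ν) := by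
        rw [zero_smul, add_zero]
        exact ((h1.contDiffAt hzV).differentiableAt (by norm_num)).hasFDerivAt
      have hl : HasDerivAt (fun t : ℝ => z + t • ν) ν 0 := by
        simpa using ((hasDerivAt_id (0 : ℝ)).smul_const ν).const_add z
      exact hdz.comp_hasDerivAt 0 hl
    have hslope := hd.tendsto_slope.mono_left (nhdsWithin_mono 0 (fun x (hx : x < 0) => hx.ne))
    have hev : ∀ᶠ t in 𝓝[<] (0 : ℝ), ρ (z + t • ν) < 0 := by
      filter_upwards [hslope.eventually (lt_mem_nhds hz), self_mem_nhdsWithin] with t ht htn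
      rw [slope_def_field] at ht
      simp only [zero_smul, add_zero, h0, sub_zero] at ht
      have htn' : t < 0 := htn
      by_contra! hcon
      exact absurd ht (div_nonpos_of_nonneg_of_nonpos hcon htn'.le).not_gt
    have hlim : Tendsto (fun t : ℝ => z + t • ν) (𝓝[<] 0) (𝓝 z) := by
      have : Continuous fun t : ℝ => z + t • ν := by fun_prop
      have := this.tendsto 0
      simp only [zero_smul, add_zero] at this
      exact this.mono_left nhdsWithin_le_nhds
    refine mem_closure_of_tendsto hlim ?_
    filter_upwards [hev, hlim.eventually (h.1.mem_nhds hzV)] with t h1 h2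
    rw [h.2.2.2.1]
    exact ⟨h2, h1⟩
  refine ⟨hzV, fun h0 => ⟨hmem h0, ?_⟩, fun hnc => ?_⟩
  · rw [h.isOpen.interior_eq, h.2.2.2.1]
    rintro ⟨_, hlt⟩
    exact absurd h0 hlt.ne
  · by_contra! hle
    rcases hle.lt_or_eq with hlt | heq
    · apply hnc
      apply subset_closure
      rw [h.2.2.2.1]
      exact ⟨hzV, hlt⟩
    · exact hnc (hmem heq)

lemma IsDefining.notMem_closure (h : IsDefining n s Ω ρ V) {z : Pt n} (hz : z ∈ V)
    (hpos : 0 < ρ z) : z ∉ closure Ω := by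
  intro hcl
  have hc : ContinuousAt ρ z := (h.contDiffAt hz).continuousAt
  have h1 : ∀ᶠ w in 𝓝 z, 0 < ρ w := hc.eventually (lt_mem_nhds hpos)
  obtain ⟨w, hw1, hw2⟩ := ((mem_closure_iff_frequently.1 hcl).and_eventually h1).exists
  rw [h.2.2.2.1] at hw1
  exact absurd hw1.2 hw2.le.not_gt

/-- Projection to the boundary along a fixed transversal direction. -/
lemma IsDefining.exists_proj (h : IsDefining n s Ω ρ V) (hs : 1 ≤ s) (hp : p ∈ frontier Ω)
    {ν : Pt n} (hν : fderiv ℝ ρ p ν = 1) {U : Set (Pt n)} (hU : U ∈ 𝓝 p) :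
    ∀ᶠ z in 𝓝 p, ∃ θ : ℝ, |θ| ≤ 2 * |ρ z| ∧ z - θ • ν ∈ frontier Ω ∧ z - θ • ν ∈ U := by
  have h1 := h.one_le hs
  have hc : ContDiffAt ℝ 1 ρ p := h1.contDiffAt (h.mem_V hp)
  have hνn : 0 < ‖ν‖ := by
    rw [norm_pos_iff]; rintro rfl; simp at hν
  obtain ⟨δ, hδ, hb⟩ := exists_ball_strict hc (ε := 1 / (2 * ‖ν‖)) (by positivity)
  obtain ⟨δ', hδ', hb'⟩ := Metric.eventually_nhds_iff_ball.1
    ((h.eventually_sign hs hp).and hU)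
  set d := min δ δ' with hd
  have hdpos : 0 < d := lt_min hδ hδ'
  have hsmall : ∀ᶠ z in 𝓝 p, 2 * |ρ z| * ‖ν‖ < d / 2 := by
    have : ContinuousAt (fun z => 2 * |ρ z| * ‖ν‖) p := by
      have := hc.continuousAt
      fun_prop
    exact this.eventually (gt_mem_nhds (by simp only [h.eq_zero hp]; simpa using half_pos hdpos))
  filter_upwards [hsmall, Metric.ball_mem_nhds p (half_pos hdpos)] with z hz hzb
  have hin : ∀ θ : ℝ, |θ| ≤ 2 * |ρ z| → z - θ • ν ∈ Metric.ball p d := by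
    intro θ hθ
    rw [Metric.mem_ball, dist_eq_norm] at hzb ⊢
    calc ‖z - θ • ν - p‖ = ‖(z - p) - θ • ν‖ := by congr 1; abel
      _ ≤ ‖z - p‖ + ‖θ • ν‖ := norm_sub_le _ _
      _ = ‖z - p‖ + |θ| * ‖ν‖ := by rw [norm_smul, Real.norm_eq_abs]
      _ ≤ ‖z - p‖ + 2 * |ρ z| * ‖ν‖ := by gcongr
      _ < d := by linarith
  have hin0 : z ∈ Metric.ball p d := by simpa using hin 0 (by simp)
  have hest : ∀ θ : ℝ, |θ| ≤ 2 * |ρ z| → |ρ z - ρ (z - θ • ν) - θ| ≤ |θ| / 2 := by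
    intro θ hθ
    have := hb z (Metric.ball_subset_ball (min_le_left _ _) hin0) _
      (Metric.ball_subset_ball (min_le_left _ _) (hin θ hθ))
    rw [sub_sub_cancel, map_smul, hν, norm_smul, Real.norm_eq_abs, smul_eq_mul, mul_one] at this
    calc _ ≤ _ := this
      _ = |θ| / 2 := by field_simp
  have hcont : ContinuousOn (fun θ : ℝ => ρ (z - θ • ν)) (Set.uIcc (-(2 * |ρ z|)) (2 * |ρ z|)) := by
    intro θ hθ
    rw [Set.uIcc_of_le (by have := abs_nonneg (ρ z); linarith)] at hθ
    have hθ' : |θ| ≤ 2 * |ρ z| := abs_le.2 hθ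
    have hV := (hb' _ (Metric.ball_subset_ball (min_le_right _ _) (hin θ hθ'))).1.1
    have e1 : ContinuousAt ρ (z - θ • ν) := (h.contDiffAt hV).continuousAt
    exact (ContinuousAt.comp (f := fun θ : ℝ => z - θ • ν) e1 (by fun_prop)).continuousWithinAt
  have hab := abs_nonneg (ρ z)
  have hA : ρ (z - (2 * |ρ z|) • ν) ≤ 0 := by
    have := hest (2 * |ρ z|) (by rw [abs_of_nonneg (by positivity)])
    rw [abs_of_nonneg (by positivity : (0:ℝ) ≤ 2 * |ρ z|)] at this
    have := abs_le.1 this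
    have := le_abs_self (ρ z)
    linarith
  have hB : 0 ≤ ρ (z - (-(2 * |ρ z|)) • ν) := by
    have := hest (-(2 * |ρ z|)) (by rw [abs_neg, abs_of_nonneg (by positivity)])
    rw [abs_neg, abs_of_nonneg (by positivity : (0:ℝ) ≤ 2 * |ρ z|)] at this
    have := abs_le.1 this
    have := neg_abs_le (ρ z)
    linarith
  obtain ⟨θ, hθ, hθ0⟩ : (0 : ℝ) ∈ (fun θ : ℝ => ρ (z - θ • ν)) ''
      (Set.uIcc (-(2 * |ρ z|)) (2 * |ρ z|)) :=
    intermediate_value_uIcc hcont (by rw [Set.mem_uIcc]; right; exact ⟨hA, hB⟩)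
  rw [Set.uIcc_of_le (by linarith)] at hθ
  have hθ' : |θ| ≤ 2 * |ρ z| := abs_le.2 hθ
  have := hb' _ (Metric.ball_subset_ball (min_le_right _ _) (hin θ hθ'))
  exact ⟨θ, hθ', this.1.2.1 hθ0, this.2⟩

/-- Two defining functions have positively proportional differentials on the boundary. -/
lemma IsDefining.fderiv_proportional {s' : ℕ∞} {r : Pt n → ℝ} {V' : Set (Pt n)}
    (h : IsDefining n s Ω ρ V) (hs : 1 ≤ s) (h' : IsDefining n s' Ω r V') (hs' : 1 ≤ s')
    (hp : p ∈ frontier Ω) : ∃ c : ℝ, 0 < c ∧ fderiv ℝ ρ p = c • fderiv ℝ r p := by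
  have hd : HasFDerivAt ρ (fderiv ℝ ρ p) p :=
    (((h.one_le hs).contDiffAt (h.mem_V hp)).differentiableAt (by norm_num)).hasFDerivAt
  have hd' : HasFDerivAt r (fderiv ℝ r p) p :=
    (((h'.one_le hs').contDiffAt (h'.mem_V hp)).differentiableAt (by norm_num)).hasFDerivAt
  have key : ∀ v, fderiv ℝ r p v < 0 → fderiv ℝ ρ p v ≤ 0 := by
    intro v hv
    have hline : ∀ {f : Pt n → ℝ} {f' : Pt n →L[ℝ] ℝ}, HasFDerivAt f f' p →
        HasDerivAt (fun t : ℝ => f (p + t • v)) (f' v) 0 := by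
      intro f f' hf
      have hf' : HasFDerivAt f f' (p + (0 : ℝ) • v) := by rwa [zero_smul, add_zero]
      have hl : HasDerivAt (fun t : ℝ => p + t • v) v 0 := by
        simpa using ((hasDerivAt_id (0 : ℝ)).smul_const v).const_add p
      exact hf'.comp_hasDerivAt 0 hl
    have hmono : 𝓝[>] (0 : ℝ) ≤ 𝓝[≠] 0 := nhdsWithin_mono 0 fun x (hx : 0 < x) => hx.ne'
    have t1 := (hline hd).tendsto_slope.mono_left hmono
    have t2 := (hline hd').tendsto_slope.mono_left hmono
    refine le_of_tendsto t1 ?_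
    have hlim : Tendsto (fun t : ℝ => p + t • v) (𝓝[>] 0) (𝓝 p) := by
      have : Continuous fun t : ℝ => p + t • v := by fun_prop
      have := this.tendsto 0
      simp only [zero_smul, add_zero] at this
      exact this.mono_left nhdsWithin_le_nhds
    filter_upwards [t2.eventually (gt_mem_nhds hv), self_mem_nhdsWithin,
      hlim.eventually (h'.mem_nhds hp)] with t ht htp htV
    rw [slope_def_field] at ht ⊢
    simp only [zero_smul, add_zero, h.eq_zero hp, h'.eq_zero hp, sub_zero] at ht ⊢
    have htp' : 0 < t := htp
    have hneg : r (p + t • v) < 0 := by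
      by_contra! hcon
      exact absurd ht (div_nonneg hcon htp'.le).not_gt
    have hΩ : p + t • v ∈ Ω := by rw [h'.2.2.2.1]; exact ⟨htV, hneg⟩
    rw [h.2.2.2.1] at hΩ
    exact div_nonpos_of_nonpos_of_nonneg hΩ.2.le htp'.le
  obtain ⟨v, hv⟩ : ∃ v, fderiv ℝ r p v ≠ 0 := by
    by_contra! hcon
    exact h'.2.2.2.2 p hp (by ext v; simpa using hcon v)
  obtain ⟨u, hu⟩ : ∃ u, fderiv ℝ r p u = 1 :=
    ⟨(fderiv ℝ r p v)⁻¹ • v, by rw [map_smul, smul_eq_mul, inv_mul_cancel₀ hv]⟩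
  have hker : ∀ w, fderiv ℝ r p w = 0 → fderiv ℝ ρ p w = 0 := by
    have hle : ∀ w, fderiv ℝ r p w = 0 → fderiv ℝ ρ p w ≤ 0 := by
      intro w hw
      by_contra! hpos
      set a := fderiv ℝ ρ p u
      have := key (-u + ((|a| + 1) / fderiv ℝ ρ p w) • w) (by simp [hu, hw])
      rw [map_add, map_neg, map_smul, smul_eq_mul, div_mul_cancel₀ _ hpos.ne'] at this
      have := le_abs_self a
      linarith
    intro w hw
    refine le_antisymm (hle w hw) ?_
    have := hle (-w) (by simp [hw])
    simpa using this
  have heq : fderiv ℝ ρ p = (fderiv ℝ ρ p u) • fderiv ℝ r p := by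
    ext w
    have := hker (w - fderiv ℝ r p w • u) (by simp [hu])
    rw [map_sub, map_smul, smul_eq_mul, sub_eq_zero] at this
    rw [this, smul_apply, smul_eq_mul, mul_comm]
  refine ⟨fderiv ℝ ρ p u, ?_, heq⟩
  have h1 := key (-u) (by simp [hu])
  rw [map_neg] at h1
  refine lt_of_le_of_ne (by linarith) fun h0 => h.2.2.2.2 p hp ?_
  rw [heq, ← h0, zero_smul]

end geometry

section scaling
variable {n : ℕ} {r Ψ : Pt n → ℝ} {p : Pt n}

lemma contDiffAt_cR {m : WithTop ℕ∞} {f : Pt n → ℝ} (hf : ContDiffAt ℝ m f p) :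
    ContDiffAt ℝ m (cR n f) p :=
  Complex.ofRealCLM.contDiff.contDiffAt.comp p hf

lemma fderiv2_cR {f : Pt n → ℝ} (hf : TwiceDiffAt f p) (X Y : Pt n) :
    fderiv ℝ (fderiv ℝ (cR n f)) p X Y = (fderiv ℝ (fderiv ℝ f) p X Y : ℂ) := by
  have h1 : fderiv ℝ (cR n f) =ᶠ[𝓝 p] fun w => Complex.ofRealCLM.comp (fderiv ℝ f w) := by
    filter_upwards [hf.1] with w hw
    exact (Complex.ofRealCLM.hasFDerivAt.comp w hw.hasFDerivAt).fderiv
  rw [h1.fderiv_eq]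
  have h2 := ((ContinuousLinearMap.compL ℝ (Pt n) ℝ ℂ) Complex.ofRealCLM).hasFDerivAt.comp p
    hf.2.hasFDerivAt
  have h3 : (fun w => Complex.ofRealCLM.comp (fderiv ℝ f w)) =
    ((ContinuousLinearMap.compL ℝ (Pt n) ℝ ℂ) Complex.ofRealCLM) ∘ fderiv ℝ f := rfl
  rw [h3, h2.fderiv]
  rfl

lemma lap_cR {f : Pt n → ℝ} (hf : TwiceDiffAt f p) (X : Pt n) :
    lap (cR n f) p X = ((lap f p X : ℝ) : ℂ) := by
  simp only [lap, lapB, fderiv2_cR hf, Complex.real_smul, smul_eq_mul]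
  push_cast; rfl

lemma wdb_cR {f : Pt n → ℝ} (hf : DifferentiableAt ℝ f p) (X : Pt n) :
    wdb (cR n f) p X = (starRingEnd ℂ) (wd (cR n f) p X) := by
  simp [wd, wdb, fderiv_cR hf, Complex.conj_ofNat, sub_eq_add_neg]

lemma fderiv_exp_comp {z : Pt n} (hΨ : DifferentiableAt ℝ Ψ z) :
    fderiv ℝ (fun w => Real.exp (Ψ w)) z = Real.exp (Ψ z) • fderiv ℝ Ψ z :=
  fderiv_exp hΨ

lemma fderiv2_exp (hΨ : ContDiffAt ℝ 2 Ψ p) (X Y : Pt n) :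
    fderiv ℝ (fderiv ℝ (fun w => Real.exp (Ψ w))) p X Y =
      Real.exp (Ψ p) * (fderiv ℝ (fderiv ℝ Ψ) p X Y + fderiv ℝ Ψ p X * fderiv ℝ Ψ p Y) := by
  have ht := hΨ.twiceDiffAt
  have h1 : fderiv ℝ (fun w => Real.exp (Ψ w)) =ᶠ[𝓝 p]
      fun w => Real.exp (Ψ w) • fderiv ℝ Ψ w := by
    filter_upwards [ht.1] with w hw
    exact fderiv_exp_comp hw
  rw [h1.fderiv_eq]
  have h2 := (ht.diffAt.exp.hasFDerivAt.fun_smul ht.2.hasFDerivAt)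
  rw [h2.fderiv, fderiv_exp_comp ht.diffAt]
  simp [ContinuousLinearMap.smulRight_apply]
  ring

lemma wd_exp (hΨ : DifferentiableAt ℝ Ψ p) (X : Pt n) :
    wd (cR n fun w => Real.exp (Ψ w)) p X = (Real.exp (Ψ p) : ℂ) * wd (cR n Ψ) p X := by
  rw [wd_cR hΨ.exp, wd_cR hΨ, fderiv_exp_comp hΨ]
  simp only [smul_apply, smul_eq_mul]
  push_cast; ring

lemma wdb_exp (hΨ : DifferentiableAt ℝ Ψ p) (X : Pt n) :
    wdb (cR n fun w => Real.exp (Ψ w)) p X = (Real.exp (Ψ p) : ℂ) * wdb (cR n Ψ) p X := by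
  rw [wdb_cR hΨ.exp, wdb_cR hΨ, wd_exp hΨ, map_mul, Complex.conj_ofReal]

lemma lap_exp (hΨ : ContDiffAt ℝ 2 Ψ p) (X : Pt n) :
    lap (cR n fun w => Real.exp (Ψ w)) p X = (Real.exp (Ψ p) : ℂ) *
      (lap (cR n Ψ) p X + wd (cR n Ψ) p X * wdb (cR n Ψ) p X) := by
  have hd := hΨ.differentiableAt (by norm_num)
  rw [lap_cR hΨ.exp.twiceDiffAt, lap_cR hΨ.twiceDiffAt, wdb_cR hd, wd_cR hd]
  simp only [lap, lapB, fderiv2_exp hΨ, smul_eq_mul, map_mul, map_sub, map_div₀, map_one,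
    Complex.conj_ofNat, Complex.conj_ofReal, Complex.conj_I]
  push_cast
  linear_combination cexp (Ψ p : ℂ) / 4 * (fderiv ℝ Ψ p (Complex.I • X) : ℂ) ^ 2 * Complex.I_mul_I

variable (r Ψ) in
/-- The defining function `r` multiplied by the positive function `exp Ψ`. -/
noncomputable def expMul : Pt n → ℝ := fun z => r z * Real.exp (Ψ z)

lemma isDefining_expMul {s : ℕ∞} {Ω V : Set (Pt n)} (h : IsDefining n s Ω r V) (hs : 1 ≤ s)
    (hΨ : ContDiff ℝ s Ψ) : IsDefining n s Ω (expMul r Ψ) V := by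
  refine ⟨h.1, h.2.1, h.2.2.1.mul hΨ.exp.contDiffOn, ?_, ?_⟩
  · have : ∀ z, expMul r Ψ z < 0 ↔ r z < 0 := fun z => by
      have := Real.exp_pos (Ψ z)
      unfold expMul
      constructor
      · intro h; by_contra! h'; exact absurd h (mul_nonneg h' this.le).not_gt
      · intro h; exact mul_neg_of_neg_of_pos h this
    simp only [this]
    exact h.2.2.2.1
  · intro z hz h0
    have hd : DifferentiableAt ℝ r z :=
      ((h.one_le hs).contDiffAt (h.mem_V hz)).differentiableAt (by norm_num)
    have hdΨ : DifferentiableAt ℝ Ψ z :=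
      (hΨ.contDiffAt.of_le (by exact_mod_cast hs : (1 : WithTop ℕ∞) ≤ s)).differentiableAt
          (by norm_num)
    unfold expMul at h0
    rw [fderiv_fun_mul hd hdΨ.exp, h.eq_zero hz, zero_smul, zero_add] at h0
    exact h.2.2.2.2 z hz ((smul_eq_zero.1 h0).resolve_left (Real.exp_pos _).ne')

lemma fderiv_expMul (hd : DifferentiableAt ℝ r p) (hΨ : DifferentiableAt ℝ Ψ p) (h0 : r p = 0) :
    fderiv ℝ (expMul r Ψ) p = Real.exp (Ψ p) • fderiv ℝ r p := by
  unfold expMul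
  rw [fderiv_fun_mul hd hΨ.exp, h0, zero_smul, zero_add]

lemma T10_expMul (hd : DifferentiableAt ℝ r p) (hΨ : DifferentiableAt ℝ Ψ p) (h0 : r p = 0) :
    T10 n (expMul r Ψ) p = T10 n r p := by
  ext L
  have hd' : DifferentiableAt ℝ (expMul r Ψ) p := hd.fun_mul hΨ.exp
  rw [mem_T10_iff hd', mem_T10_iff hd, fderiv_expMul hd hΨ h0]
  simp [(Real.exp_pos _).ne']

lemma levi_expMul (h : ContDiffAt ℝ 2 r p) (hΨ : ContDiffAt ℝ 2 Ψ p) (h0 : r p = 0)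
    {X Y : Pt n} (hX : X ∈ T10 n r p) (hY : Y ∈ T10 n r p) :
    levi n (expMul r Ψ) p X Y = (Real.exp (Ψ p) : ℂ) * levi n r p X Y := by
  have hd := h.differentiableAt (by norm_num)
  rw [mem_T10_iff hd] at hX hY
  have h' : ContDiffAt ℝ 2 (expMul r Ψ) p := h.mul hΨ.exp
  rw [levi_eq h'.twiceDiffAt, levi_eq h.twiceDiffAt]
  have key : ∀ A B : Pt n, fderiv ℝ r p A = 0 → fderiv ℝ r p B = 0 →
      fderiv ℝ (fderiv ℝ (expMul r Ψ)) p A B = Real.exp (Ψ p) * fderiv ℝ (fderiv ℝ r) p A B := by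
    intro A B hA hB
    unfold expMul
    rw [fderiv2_mul h hΨ.exp, h0, hA, hB]
    ring
  simp only [leviB, key _ _ hX.1 hY.1, key _ _ hX.1 hY.2, key _ _ hX.2 hY.1, key _ _ hX.2 hY.2]
  push_cast; ring

lemma nullSp_expMul (h : ContDiffAt ℝ 2 r p) (hΨ : ContDiffAt ℝ 2 Ψ p) (h0 : r p = 0) :
    nullSp n (expMul r Ψ) p = nullSp n r p := by
  have hT := T10_expMul (h.differentiableAt (by norm_num)) (hΨ.differentiableAt (by norm_num)) h0
  have he : (Real.exp (Ψ p) : ℂ) ≠ 0 := by exact_mod_cast (Real.exp_pos _).ne'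
  ext L
  simp only [nullSp, Set.mem_ofPred_eq, hT]
  refine and_congr_right fun hL => forall₂_congr fun Y hY => ?_
  rw [levi_expMul h hΨ h0 hL hY, mul_eq_zero, or_iff_right he]

lemma weakPts_expMul {s : ℕ∞} {Ω V : Set (Pt n)} (h : IsDefining n s Ω r V) (hs : 2 ≤ s)
    (hΨ : ContDiff ℝ s Ψ) : weakPts n (expMul r Ψ) Ω = weakPts n r Ω := by
  ext z
  simp only [weakPts, Set.mem_ofPred_eq]
  refine and_congr_right fun hz => ?_
  have hs' : ((2 : ℕ∞) : WithTop ℕ∞) ≤ s := WithTop.coe_le_coe.2 hs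
  have h2 : ContDiffAt ℝ 2 r z := (h.contDiffAt (h.mem_V hz)).of_le hs'
  have hΨ2 : ContDiffAt ℝ 2 Ψ z := hΨ.contDiffAt.of_le hs'
  have h0 := h.eq_zero hz
  have he : (Real.exp (Ψ z) : ℂ) ≠ 0 := by exact_mod_cast (Real.exp_pos _).ne'
  rw [T10_expMul (h2.differentiableAt (by norm_num)) (hΨ2.differentiableAt (by norm_num)) h0]
  refine exists_congr fun X => and_congr_right fun hX => and_congr_right fun _ => ?_
  rw [levi_expMul h2 hΨ2 h0 hX hX, mul_eq_zero, or_iff_right he]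

lemma nuv_expMul (hd : DifferentiableAt ℝ r p) (hΨ : DifferentiableAt ℝ Ψ p) (h0 : r p = 0) :
    nuv (expMul r Ψ) p = ((Real.exp (Ψ p))⁻¹ : ℝ) • nuv r p := by
  have hd' : DifferentiableAt ℝ (expMul r Ψ) p := hd.fun_mul hΨ.exp
  have he : (Real.exp (Ψ p) : ℂ) ≠ 0 := by exact_mod_cast (Real.exp_pos _).ne'
  have hb : ∀ k, dZb n (cR n (expMul r Ψ)) k p = (Real.exp (Ψ p) : ℂ) * dZb n (cR n r) k p := by
    intro k
    simp only [dZb, fderiv_cR hd', fderiv_cR hd, fderiv_expMul hd hΨ h0, smul_apply, smul_eq_mul]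
    push_cast; ring
  ext k
  simp only [nuv, Pi.smul_apply, Complex.real_smul]
  rw [ofReal_gradSq hd', ofReal_gradSq hd, hb]
  simp only [hb, map_mul, Complex.conj_ofReal]
  have : ∑ m, (Real.exp (Ψ p) : ℂ) * (starRingEnd ℂ) (dZb n (cR n r) m p) *
      ((Real.exp (Ψ p) : ℂ) * dZb n (cR n r) m p) = (Real.exp (Ψ p) : ℂ) ^ 2 *
      ∑ m, (starRingEnd ℂ) (dZb n (cR n r) m p) * dZb n (cR n r) m p := by
    rw [Finset.mul_sum]; exact Finset.sum_congr rfl fun m _ => by ring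
  rw [this]
  push_cast
  by_cases hS : ∑ m, (starRingEnd ℂ) (dZb n (cR n r) m p) * dZb n (cR n r) m p = 0
  · simp [hS]
  · field_simp

lemma HH_expMul_eventually (h : ContDiffAt ℝ 3 r p) (hΨ : ContDiffAt ℝ 3 Ψ p) (h0 : r p = 0) :
    HH (expMul r Ψ) (nuv (expMul r Ψ) p) =ᶠ[𝓝 p] fun z => (Real.exp (Ψ p) : ℂ)⁻¹ *
      (cR n (fun w => Real.exp (Ψ w)) z * HH r (nuv r p) z +
        cR n r z * HH (fun w => Real.exp (Ψ w)) (nuv r p) z) := by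
  have h1 := (h.of_le (by norm_num : (2 : WithTop ℕ∞) ≤ 3)).twiceDiffAt.1
  have h2 := (hΨ.of_le (by norm_num : (2 : WithTop ℕ∞) ≤ 3)).twiceDiffAt.1
  rw [nuv_expMul (h.differentiableAt (by norm_num)) (hΨ.differentiableAt (by norm_num)) h0]
  filter_upwards [h1, h2] with z hz1 hz2
  simp only [HH, smul_comm Complex.I (_ : ℝ), map_smul, smul_eq_mul]
  unfold expMul
  rw [fderiv_fun_mul hz1 hz2.exp]
  simp only [add_apply, smul_apply, smul_eq_mul, cR]
  push_cast; ring

/-- Transformation of `ω` and `∂̄ω` under a change of defining function. -/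
lemma om_dlb_expMul (h : ContDiffAt ℝ 3 r p) (hr : fderiv ℝ r p ≠ 0) (hΨ : ContDiffAt ℝ 3 Ψ p)
    (h0 : r p = 0) {L : Pt n} (hL : L ∈ nullSp n r p) :
    om (expMul r Ψ) p L = om r p L + wd (cR n Ψ) p L ∧
      dlb (expMul r Ψ) p L = dlb r p L - ((lap Ψ p L : ℝ) : ℂ) := by
  have hd := h.differentiableAt (by norm_num)
  have hdΨ := hΨ.differentiableAt (by norm_num)
  have h' : ContDiffAt ℝ 3 (expMul r Ψ) p := h.mul hΨ.exp
  have h2 : ContDiffAt ℝ 2 r p := h.of_le (by norm_num)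
  have hΨ2 : ContDiffAt ℝ 2 Ψ p := hΨ.of_le (by norm_num)
  have he : (Real.exp (Ψ p) : ℂ) ≠ 0 := by exact_mod_cast (Real.exp_pos _).ne'
  have hr' : fderiv ℝ (expMul r Ψ) p ≠ 0 := by
    rw [fderiv_expMul hd hdΨ h0]
    exact smul_ne_zero (Real.exp_pos _).ne' hr
  have hL' : L ∈ nullSp n (expMul r Ψ) p := by rwa [nullSp_expMul h2 hΨ2 h0]
  have hwr : wd (cR n r) p L = 0 := (mem_T10 L).1 hL.1
  have hwbr : wdb (cR n r) p L = 0 := by rw [wdb_cR hd, hwr, map_zero]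
  have hlr : lap (cR n r) p L = 0 := by
    have := hL.2 L hL.1
    rwa [levi_self h2.twiceDiffAt, ← lap_cR h2.twiceDiffAt] at this
  have cH : ContDiffAt ℝ 2 (HH r (nuv r p)) p := contDiffAt_HH (m := 2) (by exact_mod_cast h) _
  have cK : ContDiffAt ℝ 2 (HH (fun w => Real.exp (Ψ w)) (nuv r p)) p :=
    contDiffAt_HH (m := 2) (by exact_mod_cast hΨ.exp) _
  have cu : ContDiffAt ℝ 2 (cR n (fun w => Real.exp (Ψ w))) p := contDiffAt_cR hΨ2.exp
  have cr : ContDiffAt ℝ 2 (cR n r) p := contDiffAt_cR h2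
  have cuH := cu.mul cH
  have crK := cr.mul cK
  have D : ∀ {f : Pt n → ℂ}, ContDiffAt ℝ 2 f p → DifferentiableAt ℝ f p := fun hf =>
    hf.differentiableAt (by norm_num)
  have hH1 := HH_nuv_self hd hr
  have hu : cR n (fun w => Real.exp (Ψ w)) p = (Real.exp (Ψ p) : ℂ) := rfl
  have hrp : cR n r p = 0 := by simp [cR, h0]
  have e1 : wd (HH (expMul r Ψ) (nuv (expMul r Ψ) p)) p L =
      wd (HH r (nuv r p)) p L + wd (cR n Ψ) p L := by
    rw [wd_congr (HH_expMul_eventually h hΨ h0), wd_const_mul _ (D (cuH.add crK)),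
      wd_add (D cuH) (D crK), wd_mul (D cu) (D cH), wd_mul (D cr) (D cK), wd_exp hdΨ, hwr, hrp,
      hH1, hu]
    field_simp
    ring
  have e2 : wdb (HH (expMul r Ψ) (nuv (expMul r Ψ) p)) p L =
      wdb (HH r (nuv r p)) p L + wdb (cR n Ψ) p L := by
    rw [wdb_congr (HH_expMul_eventually h hΨ h0), wdb_const_mul _ (D (cuH.add crK)),
      wdb_add (D cuH) (D crK), wdb_mul (D cu) (D cH), wdb_mul (D cr) (D cK), wdb_exp hdΨ, hwbr, hrp,
      hH1, hu]
    field_simp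
    ring
  have e3 : lap (HH (expMul r Ψ) (nuv (expMul r Ψ) p)) p L =
      lap (HH r (nuv r p)) p L + lap (cR n Ψ) p L + wd (cR n Ψ) p L * wdb (cR n Ψ) p L +
      wd (cR n Ψ) p L * wdb (HH r (nuv r p)) p L + wdb (cR n Ψ) p L * wd (HH r (nuv r p)) p L := by
    rw [lap_congr (HH_expMul_eventually h hΨ h0), lap_const_mul _ (cuH.add crK),
      lap_add cuH crK, lap_mul cu cH, lap_mul cr cK, lap_exp hΨ2, wdb_exp hdΨ, wd_exp hdΨ,
      hwbr, hwr, hlr, hrp, hH1, hu]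
    field_simp
    ring
  have hom : om (expMul r Ψ) p L = om r p L + wd (cR n Ψ) p L := by
    rw [← wd_HH_nuv (h'.of_le (by norm_num)) hr', e1, wd_HH_nuv h2 hr]
  refine ⟨hom, ?_⟩
  rw [dlb_null h' hr' hL', dlb_null h hr hL, hom, e2, e3, wd_HH_nuv h2 hr,
    ← lap_cR hΨ2.twiceDiffAt]
  ring

end scaling

section localest
variable {n : ℕ} {r : Pt n → ℝ} {p : Pt n}

lemma HasStrictFDerivAt.tendsto_slope {E F α : Type*} [NormedAddCommGroup E] [NormedSpace ℝ E]
    [NormedAddCommGroup F] [NormedSpace ℝ F] {f : E → F} {f' : E →L[ℝ] F} {a e : E}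
    (hf : HasStrictFDerivAt f f' a) {l : Filter α} {u v : α → E} {s : α → ℝ}
    (hu : Tendsto u l (𝓝 a)) (hv : Tendsto v l (𝓝 a))
    (he : Tendsto (fun x => (s x)⁻¹ • (u x - v x)) l (𝓝 e)) :
    Tendsto (fun x => (s x)⁻¹ • (f (u x) - f (v x))) l (𝓝 (f' e)) := by
  have h1 : (fun x => f (u x) - f (v x) - f' (u x - v x)) =o[l] fun x => u x - v x :=
    hf.isLittleO.comp_tendsto (hu.prodMk_nhds hv)
  have h2 : (fun x => (s x)⁻¹ • (f (u x) - f (v x) - f' (u x - v x))) =o[l]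
      fun x => (s x)⁻¹ • (u x - v x) :=
    (Asymptotics.isBigO_refl (fun x => (s x)⁻¹) l).smul_isLittleO h1
  have h3 := h2.trans_isBigO (he.isBigO_one ℝ)
  rw [Asymptotics.isLittleO_one_iff] at h3
  have h4 := h3.add ((f'.continuous.tendsto e).comp he)
  rw [zero_add] at h4
  refine h4.congr fun x => ?_
  simp only [Function.comp, map_smul, ← smul_add, sub_add_cancel]

lemma contDiffAt_fderiv2_pair {m : ℕ} {X₀ : Pt n} (h : ContDiffAt ℝ (m + 2) r p)
    {g₁ g₂ : Pt n →L[ℝ] Pt n} :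
    ContDiffAt ℝ m (fun w : Pt n × Pt n => fderiv ℝ (fderiv ℝ r) w.1 (g₁ w.2) (g₂ w.2)) (p,
        X₀) := by
  have h1 : ContDiffAt ℝ (m + 1) (fderiv ℝ r) p :=
    h.fderiv_right (by rw [add_assoc]; norm_num)
  have h2 : ContDiffAt ℝ m (fderiv ℝ (fderiv ℝ r)) p := h1.fderiv_right le_rfl
  have h3 : ContDiffAt ℝ m (fun w : Pt n × Pt n => fderiv ℝ (fderiv ℝ r) w.1) (p, X₀) :=
    ContDiffAt.comp (g := fderiv ℝ (fderiv ℝ r)) (p, X₀) h2 contDiffAt_fst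
  exact (h3.clm_apply (g₁.contDiff.contDiffAt.comp _ contDiffAt_snd)).clm_apply
    (g₂.contDiff.contDiffAt.comp _ contDiffAt_snd)

lemma contDiffAt_fderiv_pair {m : ℕ} {X₀ : Pt n} (h : ContDiffAt ℝ (m + 1) r p)
    {g₁ : Pt n →L[ℝ] Pt n} :
    ContDiffAt ℝ m (fun w : Pt n × Pt n => fderiv ℝ r w.1 (g₁ w.2)) (p, X₀) := by
  have h1 : ContDiffAt ℝ m (fderiv ℝ r) p := h.fderiv_right le_rfl
  have h3 : ContDiffAt ℝ m (fun w : Pt n × Pt n => fderiv ℝ r w.1) (p, X₀) :=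
    ContDiffAt.comp (g := fderiv ℝ r) (p, X₀) h1 contDiffAt_fst
  exact h3.clm_apply (g₁.contDiff.contDiffAt.comp _ contDiffAt_snd)

lemma contDiffAt_lap_pair {m : ℕ} {X₀ : Pt n} (h : ContDiffAt ℝ (m + 2) r p) :
    ContDiffAt ℝ m (fun w : Pt n × Pt n => lap r w.1 w.2) (p, X₀) := by
  have h1 := contDiffAt_fderiv2_pair (X₀ := X₀) h (g₁ := .id ℝ _) (g₂ := .id ℝ _)
  have h2 := contDiffAt_fderiv2_pair (X₀ := X₀) h (g₁ := mulI n) (g₂ := mulI n)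
  exact (h1.add h2).const_smul (1 / 4 : ℝ)

lemma contDiffAt_wd_pair {m : ℕ} {X₀ : Pt n} (h : ContDiffAt ℝ (m + 1) r p) :
    ContDiffAt ℝ m (fun w : Pt n × Pt n => wd (cR n r) w.1 w.2) (p, X₀) := by
  have h1 := contDiffAt_fderiv_pair (X₀ := X₀) h (g₁ := .id ℝ _)
  have h2 := contDiffAt_fderiv_pair (X₀ := X₀) h (g₁ := mulI n)
  have h3 : ContDiffAt ℝ m (fun w : Pt n × Pt n => (1 / 2 : ℂ) * ((fderiv ℝ r w.1 w.2 : ℂ) -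
      Complex.I * fderiv ℝ r w.1 (Complex.I • w.2))) (p, X₀) :=
    contDiffAt_const.mul ((Complex.ofRealCLM.contDiff.contDiffAt.comp _ h1).sub
      (contDiffAt_const.mul (Complex.ofRealCLM.contDiff.contDiffAt.comp _ h2)))
  refine h3.congr_of_eventuallyEq ?_
  have h4 : ∀ᶠ z in 𝓝 p, DifferentiableAt ℝ r z := by
    have : ContDiffAt ℝ 1 r p := h.of_le (by norm_num)
    filter_upwards [this.eventually (by norm_num)] with z hz
    exact hz.differentiableAt (by norm_num)
  filter_upwards [(continuous_fst.tendsto (p, X₀)).eventually h4] with w hw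
  exact wd_cR hw _

/-- Derivative of the second derivative `D²r(Y,Y)` in a direction `v`. -/
lemma fderiv_fderiv2_apply (h : ContDiffAt ℝ 3 r p) (v Y : Pt n) :
    fderiv ℝ (fun z => fderiv ℝ (fderiv ℝ r) z Y Y) p v =
      fderiv ℝ (fderiv ℝ (fun z => fderiv ℝ r z v)) p Y Y := by
  have hev : ∀ᶠ z in 𝓝 p, ContDiffAt ℝ 3 r z := h.eventually (by norm_num)
  have hd : ∀ {z}, ContDiffAt ℝ 3 r z → ∀ X, ContDiffAt ℝ 2 (fun w => fderiv ℝ r w X) z := by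
    intro z hz X
    have : ContDiffAt ℝ 2 (fderiv ℝ r) z := hz.fderiv_right (by norm_num)
    exact this.clm_apply contDiffAt_const
  have hd1 : ∀ {z}, ContDiffAt ℝ 3 r z → DifferentiableAt ℝ (fderiv ℝ r) z := fun hz =>
    (hz.of_le (by norm_num : (2 : WithTop ℕ∞) ≤ 3)).twiceDiffAt.2
  have e1 : (fun z => fderiv ℝ (fderiv ℝ r) z Y Y) =ᶠ[𝓝 p]
      fun z => fderiv ℝ (fun w => fderiv ℝ r w Y) z Y := by
    filter_upwards [hev] with z hz
    exact (fderiv_real_const_apply (hd1 hz) Y Y).symm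
  have e2 : (fun z => fderiv ℝ (fun w => fderiv ℝ r w Y) z v) =ᶠ[𝓝 p]
      fun z => fderiv ℝ (fun w => fderiv ℝ r w v) z Y := by
    filter_upwards [hev] with z hz
    rw [fderiv_real_const_apply (hd1 hz), fderiv_real_const_apply (hd1 hz)]
    exact (hz.of_le (by norm_num : (2 : WithTop ℕ∞) ≤ 3)).twiceDiffAt.symm _ _
  have t : ∀ X, TwiceDiffAt (fun w => fderiv ℝ r w X) p := fun X => (hd h X).twiceDiffAt
  rw [e1.fderiv_eq, fderiv_real_const_apply (t Y).2, (t Y).symm,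
    ← fderiv_real_const_apply (t Y).2, e2.fderiv_eq, fderiv_real_const_apply (t v).2]

lemma fderiv_lap_pair (h : ContDiffAt ℝ 3 r p) (v X₀ : Pt n) :
    fderiv ℝ (fun w : Pt n × Pt n => lap r w.1 w.2) (p, X₀) (v, 0) =
      lap (fun z => fderiv ℝ r z v) p X₀ := by
  have h1 := ((contDiffAt_lap_pair (m := 1) (X₀ := X₀) (by norm_num; exact h)).differentiableAt
    (by norm_num)).hasFDerivAt
  have hi : HasFDerivAt (fun z : Pt n => (z, X₀)) (ContinuousLinearMap.inl ℝ (Pt n) (Pt n)) p :=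
    hasFDerivAt_prodMk_left p X₀
  have h2 := (h1.comp p hi).fderiv
  have h3 : fderiv ℝ (fun z => lap r z X₀) p v =
      fderiv ℝ (fun w : Pt n × Pt n => lap r w.1 w.2) (p, X₀) (v, 0) := by
    have : (fun z => lap r z X₀) = (fun w : Pt n × Pt n => lap r w.1 w.2) ∘ fun z => (z, X₀) := rfl
    rw [this, h2]; rfl
  rw [← h3]
  have hD : ∀ Y, DifferentiableAt ℝ (fun z => fderiv ℝ (fderiv ℝ r) z Y Y) p := by
    intro Y
    have a1 : ContDiffAt ℝ 2 (fderiv ℝ r) p := h.fderiv_right (by norm_num)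
    have a2 : ContDiffAt ℝ 1 (fderiv ℝ (fderiv ℝ r)) p := a1.fderiv_right (by norm_num)
    exact ((a2.differentiableAt (by norm_num)).clm_apply (differentiableAt_const _)).clm_apply
      (differentiableAt_const _)
  have : HasFDerivAt (fun z => lap r z X₀) ((1 / 4 : ℝ) •
      (fderiv ℝ (fun z => fderiv ℝ (fderiv ℝ r) z X₀ X₀) p +
       fderiv ℝ (fun z => fderiv ℝ (fderiv ℝ r) z (Complex.I • X₀) (Complex.I • X₀)) p)) p :=
    ((hD X₀).hasFDerivAt.fun_add (hD (Complex.I • X₀)).hasFDerivAt).fun_const_smul (1 / 4 : ℝ)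
  rw [this.fderiv]
  simp only [smul_apply, add_apply, fderiv_fderiv2_apply h]
  rfl

lemma fderiv_wd_pair (h : ContDiffAt ℝ 2 r p) (v X₀ : Pt n) :
    fderiv ℝ (fun w : Pt n × Pt n => wd (cR n r) w.1 w.2) (p, X₀) (v, 0) =
      (1 / 2 : ℂ) * ((fderiv ℝ (fderiv ℝ r) p v X₀ : ℂ) -
        Complex.I * fderiv ℝ (fderiv ℝ r) p v (Complex.I • X₀)) := by
  have h1 := ((contDiffAt_wd_pair (m := 1) (X₀ := X₀) (by norm_num; exact h)).differentiableAt
    (by norm_num)).hasFDerivAt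
  have hi : HasFDerivAt (fun z : Pt n => (z, X₀)) (ContinuousLinearMap.inl ℝ (Pt n) (Pt n)) p :=
    hasFDerivAt_prodMk_left p X₀
  have h2 := (h1.comp p hi).fderiv
  have h3 : fderiv ℝ (fun z => wd (cR n r) z X₀) p v =
      fderiv ℝ (fun w : Pt n × Pt n => wd (cR n r) w.1 w.2) (p, X₀) (v, 0) := by
    have : (fun z => wd (cR n r) z X₀) =
      (fun w : Pt n × Pt n => wd (cR n r) w.1 w.2) ∘ fun z => (z, X₀) := rfl
    rw [this, h2]; rfl
  rw [← h3]
  have ht := h.twiceDiffAt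
  have e : (fun z => wd (cR n r) z X₀) =ᶠ[𝓝 p] fun z => (1 / 2 : ℂ) * ((fderiv ℝ r z X₀ : ℂ) -
      Complex.I * fderiv ℝ r z (Complex.I • X₀)) := by
    filter_upwards [ht.1] with z hz
    exact wd_cR hz _
  have hY : ∀ Y, HasFDerivAt (fun z => ((fderiv ℝ r z Y : ℝ) : ℂ))
      (Complex.ofRealCLM.comp (fderiv ℝ (fun z => fderiv ℝ r z Y) p)) p := fun Y =>
    Complex.ofRealCLM.hasFDerivAt.comp p
      (ht.2.clm_apply (differentiableAt_const Y)).hasFDerivAt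
  rw [e.fderiv_eq, (((hY X₀).fun_sub ((hY (Complex.I • X₀)).const_mul Complex.I)).const_mul
    (1 / 2 : ℂ)).fderiv]
  simp only [smul_apply, sub_apply, smul_eq_mul, ContinuousLinearMap.comp_apply,
    Complex.ofRealCLM_apply, fderiv_real_const_apply ht.2]

lemma leviB_polar {B : Pt n →L[ℝ] Pt n →L[ℝ] ℝ} (hB : ∀ X Y, B X Y = B Y X) (Y ν : Pt n) (d : ℂ) :
    lapB B (Y + d • ν) = lapB B Y + 2 * ((starRingEnd ℂ) d *
      (leviB B Y ν + d / 2 * (lapB B ν : ℝ))).re := by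
  have e : Complex.I • (Y + d • ν) = Complex.I • Y + (d.re • Complex.I • ν - d.im • ν) := by
    rw [smul_add, complex_smul_eq d, smul_add, smul_comm Complex.I d.re, smul_comm Complex.I d.im,
      I_smul_I_smul, smul_neg, sub_eq_add_neg]
  have e2 := complex_smul_eq d ν
  unfold lapB leviB
  rw [e, e2]
  simp only [map_add, map_sub, map_smul, add_apply, sub_apply, smul_apply, smul_eq_mul]
  simp only [Complex.mul_re, Complex.add_re, Complex.add_im, Complex.mul_im, Complex.conj_re,
    Complex.conj_im, Complex.ofReal_re, Complex.ofReal_im, Complex.I_re, Complex.I_im]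
  rw [hB ν Y, hB ν (Complex.I • Y), hB (Complex.I • ν) Y, hB (Complex.I • ν) (Complex.I • Y),
    hB (Complex.I • ν) ν]
  norm_num
  ring

end localest

section nullest
variable {n : ℕ} {r : Pt n → ℝ} {p : Pt n} {s : ℕ∞} {Ω V : Set (Pt n)}

/-- The coefficient of the normal direction `ν` in a vector `X`. -/
noncomputable def nco (r : Pt n → ℝ) (ν : Pt n) (q X : Pt n) : ℂ :=
  wd (cR n r) q X / wd (cR n r) q ν

/-- The mixed Levi term of the tangential projection of `X`. -/
noncomputable def mix (r : Pt n → ℝ) (ν : Pt n) (q X : Pt n) : ℂ :=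
  leviB (fderiv ℝ (fderiv ℝ r) q) (X - nco r ν q X • ν) ν + nco r ν q X / 2 * (lap r q ν : ℝ)

lemma tangential_bound {q : Pt n} (hq : TwiceDiffAt r q) {ν : Pt n}
    (hν : wd (cR n r) q ν ≠ 0) (hpsc : ∀ Y ∈ T10 n r q, 0 ≤ (levi n r q Y Y).re) (X : Pt n) :
    2 * ((starRingEnd ℂ) (nco r ν q X) * mix r ν q X).re ≤ lap r q X := by
  set Y := X - nco r ν q X • ν with hY
  have hT : Y ∈ T10 n r q := by
    rw [mem_T10, hY, sub_eq_add_neg, ← neg_smul, wd_add_vec, wd_smul_vec, nco]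
    field_simp
    ring
  have h1 := hpsc Y hT
  rw [levi_self hq, Complex.ofReal_re] at h1
  have h2 := leviB_polar hq.symm Y ν (nco r ν q X)
  have h3 : Y + nco r ν q X • ν = X := by rw [hY, sub_add_cancel]
  rw [h3] at h2
  unfold lap at h1 ⊢
  rw [h2, mix, ← hY]
  linarith!

lemma leviB_null (h : ContDiffAt ℝ 2 r p) (h0 : fderiv ℝ r p ≠ 0) (X : Pt n) :
    leviB (fderiv ℝ (fderiv ℝ r) p) X (nuv r p) = om r p X / 2 := by
  have ht := h.twiceDiffAt
  rw [← wd_HH_nuv h h0]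
  have hY : ∀ Y, HasFDerivAt (fun z => ((fderiv ℝ r z Y : ℝ) : ℂ))
      (Complex.ofRealCLM.comp (fderiv ℝ (fun z => fderiv ℝ r z Y) p)) p := fun Y =>
    Complex.ofRealCLM.hasFDerivAt.comp p
      (ht.2.clm_apply (differentiableAt_const Y)).hasFDerivAt
  have hH : HasFDerivAt (HH r (nuv r p)) _ p :=
    (hY (nuv r p)).fun_add ((hY (Complex.I • nuv r p)).const_mul Complex.I)
  unfold wd leviB
  rw [hH.fderiv]
  simp only [smul_apply, add_apply, smul_eq_mul, ContinuousLinearMap.comp_apply,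
    Complex.ofRealCLM_apply, fderiv_real_const_apply ht.2]
  push_cast
  linear_combination ((1 / 4 : ℂ) * (fderiv ℝ (fderiv ℝ r) p (I • X) (I • nuv r p) : ℂ)) *
      Complex.I_mul_I

lemma wdb_HH_eq (h : ContDiffAt ℝ 2 r p) (ν X : Pt n) :
    wdb (HH r ν) p X = (1 / 2 : ℂ) * ((fderiv ℝ (fderiv ℝ r) p X ν : ℂ)
      + Complex.I * fderiv ℝ (fderiv ℝ r) p X (Complex.I • ν)
      + Complex.I * (fderiv ℝ (fderiv ℝ r) p (Complex.I • X) ν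
      + Complex.I * fderiv ℝ (fderiv ℝ r) p (Complex.I • X) (Complex.I • ν))) := by
  have ht := h.twiceDiffAt
  have hY : ∀ Y, HasFDerivAt (fun z => ((fderiv ℝ r z Y : ℝ) : ℂ))
      (Complex.ofRealCLM.comp (fderiv ℝ (fun z => fderiv ℝ r z Y) p)) p := fun Y =>
    Complex.ofRealCLM.hasFDerivAt.comp p
      (ht.2.clm_apply (differentiableAt_const Y)).hasFDerivAt
  have hH : HasFDerivAt (HH r ν) _ p :=
    (hY ν).fun_add ((hY (Complex.I • ν)).const_mul Complex.I)
  unfold wdb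
  rw [hH.fderiv]
  simp only [smul_apply, add_apply, smul_eq_mul, ContinuousLinearMap.comp_apply,
    Complex.ofRealCLM_apply, fderiv_real_const_apply ht.2]

lemma lap_HH_eq (h : ContDiffAt ℝ 3 r p) (ν X : Pt n) :
    lap (HH r ν) p X = ((lap (fun z => fderiv ℝ r z ν) p X : ℝ) : ℂ) +
      Complex.I * ((lap (fun z => fderiv ℝ r z (Complex.I • ν)) p X : ℝ) : ℂ) := by
  have hd : ∀ Y, ContDiffAt ℝ 2 (fun w => fderiv ℝ r w Y) p := by
    intro Y
    have : ContDiffAt ℝ 2 (fderiv ℝ r) p := h.fderiv_right (by norm_num)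
    exact this.clm_apply contDiffAt_const
  have e : HH r ν = fun z => cR n (fun w => fderiv ℝ r w ν) z +
    Complex.I * cR n (fun w => fderiv ℝ r w (Complex.I • ν)) z := rfl
  rw [e, lap_add (contDiffAt_cR (hd _)) (contDiffAt_const.mul (contDiffAt_cR (hd _))),
    lap_const_mul _ (contDiffAt_cR (hd _)), lap_cR (hd _).twiceDiffAt, lap_cR (hd _).twiceDiffAt]

/-- The limits governing the expansion of the Levi form in a direction `v`. -/
lemma expansion_re (h : ContDiffAt ℝ 3 r p) (h0 : fderiv ℝ r p ≠ 0) {X : Pt n}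
    (hX : X ∈ nullSp n r p) :
    lap (fun z => fderiv ℝ r z (nuv r p)) p X -
      4 * ((starRingEnd ℂ) (fderiv ℝ (fun w : Pt n × Pt n => wd (cR n r) w.1 w.2) (p, X)
        (nuv r p, 0)) * (om r p X / 2)).re = -(dlb r p X).re - normSq (om r p X) := by
  have h2 : ContDiffAt ℝ 2 r p := h.of_le (by norm_num)
  rw [dlb_null h h0 hX, fderiv_wd_pair h2, lap_HH_eq h]
  have e1 := leviB_null h2 h0 X
  have e2 := wdb_HH_eq h2 (nuv r p) X
  have hs := h2.twiceDiffAt.symm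
  have e3 : (starRingEnd ℂ) ((1 / 2 : ℂ) * ((fderiv ℝ (fderiv ℝ r) p (nuv r p) X : ℂ) -
        Complex.I * fderiv ℝ (fderiv ℝ r) p (nuv r p) (Complex.I • X))) =
      (wdb (HH r (nuv r p)) p X + (starRingEnd ℂ) (om r p X)) / 2 := by
    have : om r p X = 2 * leviB (fderiv ℝ (fderiv ℝ r) p) X (nuv r p) := by rw [e1]; ring
    rw [this, e2, leviB, hs (nuv r p), hs (nuv r p)]
    simp only [map_mul, map_sub, map_add, map_div₀, map_one, Complex.conj_ofNat,
      Complex.conj_ofReal, Complex.conj_I]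
    push_cast
    linear_combination (-(1 / 4 : ℂ) * (fderiv ℝ (fderiv ℝ r) p (I • X) (I • nuv r p) : ℂ)) *
        Complex.I_mul_I
  rw [e3]
  simp [Complex.normSq_apply]
  ring

lemma expansion_im (h : ContDiffAt ℝ 3 r p) (h0 : fderiv ℝ r p ≠ 0) {X : Pt n}
    (hX : X ∈ nullSp n r p) :
    lap (fun z => fderiv ℝ r z (Complex.I • nuv r p)) p X -
      4 * ((starRingEnd ℂ) (fderiv ℝ (fun w : Pt n × Pt n => wd (cR n r) w.1 w.2) (p, X)
        (Complex.I • nuv r p, 0)) * (om r p X / 2)).re = -(dlb r p X).im := by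
  have h2 : ContDiffAt ℝ 2 r p := h.of_le (by norm_num)
  rw [dlb_null h h0 hX, fderiv_wd_pair h2, lap_HH_eq h]
  have e1 := leviB_null h2 h0 X
  have e2 := wdb_HH_eq h2 (nuv r p) X
  have hs := h2.twiceDiffAt.symm
  have e3 : (starRingEnd ℂ) ((1 / 2 : ℂ) * ((fderiv ℝ (fderiv ℝ r) p (Complex.I • nuv r p) X : ℂ) -
        Complex.I * fderiv ℝ (fderiv ℝ r) p (Complex.I • nuv r p) (Complex.I • X))) =
      -Complex.I * (wdb (HH r (nuv r p)) p X - (starRingEnd ℂ) (om r p X)) / 2 := by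
    have : om r p X = 2 * leviB (fderiv ℝ (fderiv ℝ r) p) X (nuv r p) := by rw [e1]; ring
    rw [this, e2, leviB, hs (Complex.I • nuv r p), hs (Complex.I • nuv r p)]
    simp only [map_mul, map_sub, map_add, map_div₀, map_one, Complex.conj_ofNat,
      Complex.conj_ofReal, Complex.conj_I]
    push_cast
    linear_combination ((1 / 2 : ℂ) * (fderiv ℝ (fderiv ℝ r) p X (I • nuv r p) : ℂ) + 1 / 4 *
        Complex.I * (fderiv ℝ (fderiv ℝ r) p (I • X) (I • nuv r p) : ℂ)) * Complex.I_mul_I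
  rw [e3]
  simp
  ring

end nullest

section nulllocal
variable {n : ℕ} {r : Pt n → ℝ} {p : Pt n} {s : ℕ∞} {Ω V : Set (Pt n)}

lemma square_completion {t σ κ τ ℓq ℓz η : ℝ} {d c β lam bz : ℂ} (hσ : 0 < σ) (hκ : 0 < κ)
    (ht : t = κ * σ) (hℓ : ℓz = ℓq + σ * τ) (hq : 2 * ((starRingEnd ℂ) d * lam).re ≤ ℓq)
    (hb : bz = d * c + (σ : ℂ) * β) (hc : c ≠ 0) (hη : 1 < η)
    (hB : 0 < κ * (τ - 2 * ((starRingEnd ℂ) β * (lam / (starRingEnd ℂ) c)).re) -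
      κ ^ 2 * normSq (lam / (starRingEnd ℂ) c) / (η - 1)) :
    0 < t * ℓz + (η - 1) * normSq bz := by
  have hc' : (starRingEnd ℂ) c ≠ 0 := by simpa using hc
  set μ := lam / (starRingEnd ℂ) c with hμ
  have hlam : lam = (starRingEnd ℂ) c * μ := by rw [hμ]; field_simp
  have e1 : ((starRingEnd ℂ) d * lam) = (starRingEnd ℂ) bz * μ - (σ : ℂ) *
      ((starRingEnd ℂ) β * μ) := by
    rw [hlam, hb]; simp; ring
  rw [e1] at hq
  have hη' : 0 < η - 1 := by linarith
  have h1 : t * ℓz ≥ κ * σ * (2 * ((starRingEnd ℂ) bz * μ - (σ : ℂ) * ((starRingEnd ℂ) β * μ)).re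
      + σ * τ) := by
    rw [ht, hℓ]
    exact mul_le_mul_of_nonneg_left (by linarith) (by positivity)
  have h2 : 0 ≤ (η - 1) * ((bz.re + σ * κ * μ.re / (η - 1)) ^ 2 +
      (bz.im + σ * κ * μ.im / (η - 1)) ^ 2) := by
    positivity
  have h3 : (η - 1) * normSq bz + κ * σ * (2 *
      ((starRingEnd ℂ) bz * μ - (σ : ℂ) * ((starRingEnd ℂ) β * μ)).re + σ * τ)
      = (η - 1) * ((bz.re + σ * κ * μ.re / (η - 1)) ^ 2 + (bz.im + σ * κ * μ.im / (η - 1)) ^ 2)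
        + σ ^ 2 * (κ * (τ - 2 * ((starRingEnd ℂ) β * μ).re) - κ ^ 2 * normSq μ / (η - 1)) := by
    simp only [normSq_apply, mul_re, sub_re, mul_im, conj_re, conj_im, ofReal_re, ofReal_im]
    field_simp
    ring
  have h4 : 0 < σ ^ 2 * (κ * (τ - 2 * ((starRingEnd ℂ) β * μ).re) - κ ^ 2 *
      normSq μ / (η - 1)) := by
    positivity
  linarith

lemma wd_nuv (hd : DifferentiableAt ℝ r p) (h0 : fderiv ℝ r p ≠ 0) :
    wd (cR n r) p (nuv r p) = 1 / 2 := by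
  rw [wd_cR hd, (fderiv_nuv hd h0).1, (fderiv_nuv hd h0).2]; simp

lemma continuousAt_nco (h : ContDiffAt ℝ 2 r p) {X : Pt n} {ν : Pt n} (hν : wd (cR n r) p ν ≠ 0) :
    ContinuousAt (fun w : Pt n × Pt n => nco r ν w.1 w.2) (p, X) := by
  have h1 : ∀ Y, ContinuousAt (fun w : Pt n × Pt n => wd (cR n r) w.1 w.2) (p, Y) := fun Y =>
    (contDiffAt_wd_pair (m := 1) (by norm_num; exact h)).continuousAt
  have h2 : ContinuousAt (fun w : Pt n × Pt n => wd (cR n r) w.1 ν) (p, X) :=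
    ContinuousAt.comp (f := fun w : Pt n × Pt n => (w.1, ν)) (g := fun w : Pt n × Pt n =>
        wd (cR n r) w.1 w.2)
      (h1 ν) (by fun_prop)
  exact (h1 X).div h2 hν

lemma continuousAt_mix (h : ContDiffAt ℝ 2 r p) {X : Pt n} {ν : Pt n} (hν : wd (cR n r) p ν ≠ 0) :
    ContinuousAt (fun w : Pt n × Pt n => mix r ν w.1 w.2) (p, X) := by
  have h1 := continuousAt_nco h (X := X) hν
  have h2 : ContinuousAt (fun w : Pt n × Pt n => fderiv ℝ (fderiv ℝ r) w.1) (p, X) := by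
    have a1 : ContDiffAt ℝ 1 (fderiv ℝ r) p := h.fderiv_right (by norm_num)
    have a2 : ContDiffAt ℝ 0 (fderiv ℝ (fderiv ℝ r)) p := a1.fderiv_right (by norm_num)
    exact ContinuousAt.comp (g := fderiv ℝ (fderiv ℝ r)) (f := Prod.fst) a2.continuousAt
      continuousAt_fst
  have h3 : ContinuousAt (fun w : Pt n × Pt n => w.2 - nco r ν w.1 w.2 • ν) (p, X) :=
    continuousAt_snd.sub (h1.smul continuousAt_const)
  have h4 : ∀ g₁ g₂ : Pt n × Pt n → Pt n, ContinuousAt g₁ (p, X) → ContinuousAt g₂ (p, X) →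
      ContinuousAt (fun w : Pt n × Pt n => ((fderiv ℝ (fderiv ℝ r) w.1 (g₁ w) (g₂ w) : ℝ) : ℂ))
          (p, X) :=
    fun g₁ g₂ c₁ c₂ => Complex.continuous_ofReal.continuousAt.comp ((h2.clm_apply c₁).clm_apply c₂)
  unfold mix leviB lap lapB
  have cI : ∀ g : Pt n × Pt n → Pt n, ContinuousAt g (p, X) →
    ContinuousAt (fun w => Complex.I • g w) (p, X) := fun g hg =>
    (continuous_const_smul Complex.I).continuousAt.comp hg
  have cν : ContinuousAt (fun _ : Pt n × Pt n => ν) (p, X) := continuousAt_const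
  simp only [Complex.ofReal_add, Complex.ofReal_sub, smul_eq_mul, Complex.ofReal_mul]
  refine ContinuousAt.add (continuousAt_const.mul (ContinuousAt.add (ContinuousAt.add ?_ ?_)
    (continuousAt_const.mul (ContinuousAt.sub ?_ ?_))))
    ((h1.div_const 2).mul (continuousAt_const.mul (ContinuousAt.add ?_ ?_)))
  · exact h4 _ _ h3 cν
  · exact h4 _ _ (cI _ h3) (cI _ cν)
  · exact h4 _ _ h3 (cI _ cν)
  · exact h4 _ _ (cI _ h3) cν
  · exact h4 _ _ cν cν
  · exact h4 _ _ (cI _ cν) (cI _ cν)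

lemma mix_null (h : ContDiffAt ℝ 2 r p) (h0 : fderiv ℝ r p ≠ 0) {X : Pt n} (hX : X ∈ T10 n r p) :
    mix r (nuv r p) p X = om r p X / 2 := by
  have : nco r (nuv r p) p X = 0 := by rw [nco, (mem_T10 X).1 hX, zero_div]
  rw [mix, this, zero_smul, sub_zero, leviB_null h h0]; simp

/-- Near a null direction with strict D'Angelo inequality the power of the defining function is
strictly plurisubharmonic outside the domain. -/
lemma eventually_pos_of_null (h : IsDefining n s Ω r V) (hs : 3 ≤ s)
    (hpsc : LeviPseudoconvex n r Ω) (hp : p ∈ frontier Ω) {X : Pt n} (hX : X ∈ nullSp n r p)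
    {η : ℝ} (hη : 1 < η) (hneg : η / (η - 1) * normSq (om r p X) + (dlb r p X).re < 0) :
    ∀ᶠ w : Pt n × Pt n in 𝓝 (p, X), w.1 ∉ closure Ω →
      0 < r w.1 * lap r w.1 w.2 + (η - 1) * normSq (wd (cR n r) w.1 w.2) := by
  have hs1 : 1 ≤ s := le_trans (by norm_num) hs
  have h3 : ContDiffAt ℝ 3 r p := (h.contDiffAt (h.mem_V hp)).of_le
    (show ((3 : ℕ∞) : WithTop ℕ∞) ≤ s from WithTop.coe_le_coe.2 hs)
  have h2 : ContDiffAt ℝ 2 r p := h3.of_le (by norm_num)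
  have hd := h2.differentiableAt (by norm_num)
  have h0 := h.2.2.2.2 p hp
  set ν := nuv r p with hνdef
  have hν := fderiv_nuv hd h0
  have hev2 : ∀ᶠ q in 𝓝 p, ContDiffAt ℝ 2 r q := h2.eventually (by norm_num)
  have hex := h.exists_proj hs1 hp hν.1 hev2
  classical
  choose! θ hθ1 hθ2 hθ3 using fun z (hz : ∃ θ : ℝ, |θ| ≤ 2 * |r z| ∧ z - θ • ν ∈ frontier Ω ∧
    z - θ • ν ∈ {q | ContDiffAt ℝ 2 r q}) => hz
  set l : Filter (Pt n × Pt n) := 𝓝 (p, X) ⊓ 𝓟 {w | w.1 ∉ closure Ω} with hl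
  have hfst : Tendsto (fun w : Pt n × Pt n => w.1) l (𝓝 p) :=
    (continuous_fst.tendsto (p, X)).mono_left inf_le_left
  have hsnd : Tendsto (fun w : Pt n × Pt n => w.2) l (𝓝 X) :=
    (continuous_snd.tendsto (p, X)).mono_left inf_le_left
  have hout : ∀ᶠ w in l, w.1 ∉ closure Ω := mem_inf_of_right (mem_principal_self _)
  have hθe := hfst.eventually hex
  have hrpos : ∀ᶠ w in l, 0 < r w.1 := by
    filter_upwards [hfst.eventually (h.eventually_sign hs1 hp), hout] with w hw ho
    exact hw.2.2 ho
  have hrt : Tendsto (fun w : Pt n × Pt n => r w.1) l (𝓝 0) := by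
    have := hd.continuousAt.tendsto.comp hfst
    rwa [h.eq_zero hp] at this
  have hθt : Tendsto (fun w : Pt n × Pt n => θ w.1) l (𝓝 0) := by
    have hr2 : Tendsto (fun w : Pt n × Pt n => 2 * |r w.1|) l (𝓝 0) := by
      simpa using (hrt.abs.const_mul 2)
    refine squeeze_zero_norm' ?_ hr2
    filter_upwards [hθe] with w hw
    exact hθ1 _ hw
  have hqt : Tendsto (fun w : Pt n × Pt n => w.1 - θ w.1 • ν) l (𝓝 p) := by
    simpa using hfst.sub (hθt.smul_const ν)
  have hθ0 : ∀ᶠ w in l, θ w.1 ≠ 0 := by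
    filter_upwards [hθe, hrpos] with w hw hr h0'
    have := hθ2 _ hw
    rw [h0', zero_smul, sub_zero] at this
    exact hr.ne' (h.eq_zero this)
  have hslope : Tendsto (fun w : Pt n × Pt n => (θ w.1)⁻¹ • (w.1 - (w.1 - θ w.1 • ν))) l (𝓝 ν) := by
    refine tendsto_const_nhds.congr' ?_
    filter_upwards [hθ0] with w hw
    rw [sub_sub_cancel, smul_smul, inv_mul_cancel₀ hw, one_smul]
  have hu : Tendsto (fun w : Pt n × Pt n => (w.1, w.2)) l (𝓝 (p, X)) := hfst.prodMk_nhds hsnd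
  have hv : Tendsto (fun w : Pt n × Pt n => (w.1 - θ w.1 • ν, w.2)) l (𝓝 (p, X)) :=
    hqt.prodMk_nhds hsnd
  have hslope2 : Tendsto (fun w : Pt n × Pt n => (θ w.1)⁻¹ • ((w.1, w.2) - (w.1 - θ w.1 • ν, w.2)))
      l (𝓝 (ν, (0 : Pt n))) := by
    have := hslope.prodMk_nhds (tendsto_const_nhds (x := (0 : Pt n)) (f := l))
    refine this.congr fun w => ?_
    rw [Prod.mk_sub_mk, sub_self, Prod.smul_mk, smul_zero]
  have tκ := (h2.hasStrictFDerivAt (by norm_num)).tendsto_slope hfst hqt hslope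
  rw [hν.1] at tκ
  have cb : ContDiffAt ℝ 1 (fun w : Pt n × Pt n => wd (cR n r) w.1 w.2) (p, X) :=
    contDiffAt_wd_pair (m := 1) (by norm_num; exact h2)
  have cl : ContDiffAt ℝ 1 (fun w : Pt n × Pt n => lap r w.1 w.2) (p, X) :=
    contDiffAt_lap_pair (m := 1) (by norm_num; exact h3)
  have tβ := (cb.hasStrictFDerivAt (by norm_num)).tendsto_slope hu hv hslope2
  have tτ := (cl.hasStrictFDerivAt (by norm_num)).tendsto_slope hu hv hslope2
  have hwν := wd_nuv hd h0
  have hwν0 : wd (cR n r) p ν ≠ 0 := by rw [hνdef, hwν]; norm_num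
  have tmix := (continuousAt_mix h2 (X := X) hwν0).tendsto.comp hv
  have tc : Tendsto (fun w : Pt n × Pt n => wd (cR n r) (w.1 - θ w.1 • ν) ν) l (𝓝 (1 / 2)) := by
    have cb' : ContDiffAt ℝ 1 (fun w : Pt n × Pt n => wd (cR n r) w.1 w.2) (p, ν) :=
      contDiffAt_wd_pair (m := 1) (by norm_num; exact h2)
    have := cb'.continuousAt.tendsto.comp (hqt.prodMk_nhds (tendsto_const_nhds (x := ν) (f := l)))
    simp only at this
    rwa [hνdef, hwν] at this
  simp only at tmix
  rw [hνdef, mix_null h2 h0 hX.1, ← hνdef] at tmix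
  have hid := expansion_re h3 h0 hX
  have hfl := fderiv_lap_pair h3 ν X
  rw [hfl] at tτ
  set τ₀ := lap (fun z => fderiv ℝ r z ν) p X with hτ₀
  set β₀ := fderiv ℝ (fun w : Pt n × Pt n => wd (cR n r) w.1 w.2) (p, X) (ν, 0) with hβ₀
  have tcc : Tendsto (fun w : Pt n × Pt n => (starRingEnd ℂ) (wd (cR n r) (w.1 - θ w.1 • ν) ν)) l
      (𝓝 (1 / 2)) := by
    have := (Complex.continuous_conj.tendsto (1 / 2 : ℂ)).comp tc
    have e : (starRingEnd ℂ) (1 / 2 : ℂ) = 1 / 2 := by simp [Complex.conj_ofNat]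
    rw [e] at this
    exact this
  have tμ := tmix.div tcc (by norm_num)
  have tB := (tκ.mul (tτ.sub ((Complex.continuous_re.tendsto _).comp
    (((Complex.continuous_conj.tendsto _).comp tβ).mul tμ) |>.const_mul 2))).sub
    (((tκ.pow 2).mul ((Complex.continuous_normSq.tendsto _).comp tμ)).div_const (η - 1))
  have hlim : 0 < 1 * (τ₀ - 2 * ((starRingEnd ℂ) β₀ * (om r p X / 2 / (1 / 2))).re) -
      1 ^ 2 * normSq (om r p X / 2 / (1 / 2)) / (η - 1) := by
    have e1 : om r p X / 2 / (1 / 2) = om r p X := by ring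
    have e2 : ((starRingEnd ℂ) β₀ * (om r p X / 2)).re =
        ((starRingEnd ℂ) β₀ * om r p X).re / 2 := by
      rw [← mul_div_assoc]; simp
    rw [e1]
    rw [e2] at hid
    have e3 : η / (η - 1) = 1 + 1 / (η - 1) := by
      have : η - 1 ≠ 0 := by linarith
      field_simp; ring
    rw [e3] at hneg
    have e4 : 1 ^ 2 * normSq (om r p X) / (η - 1) = 1 / (η - 1) * normSq (om r p X) := by ring
    rw [e4]
    linarith
  have hBpos := tB.eventually (lt_mem_nhds hlim)
  have hfin : ∀ᶠ w in l, 0 < r w.1 * lap r w.1 w.2 + (η - 1) * normSq (wd (cR n r) w.1 w.2) := by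
    filter_upwards [hBpos, hθe, hθ0, hrpos, tκ.eventually
        (lt_mem_nhds (by norm_num : (1 / 2 : ℝ) < 1)),
      tc.eventually_ne (by norm_num : (1 / 2 : ℂ) ≠ 0)] with w hB hw hθn hr hκ hc
    have hq := hθ2 _ hw
    have hq0 := h.eq_zero hq
    have hq2 : ContDiffAt ℝ 2 r (w.1 - θ w.1 • ν) := hθ3 _ hw
    rw [smul_eq_mul, hq0, sub_zero] at hκ
    have hθpos : 0 < θ w.1 := by
      by_contra hcon
      have : (θ w.1)⁻¹ ≤ 0 := inv_nonpos.2 (not_lt.1 hcon)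
      have := mul_nonpos_of_nonpos_of_nonneg this hr.le
      linarith
    have htb := tangential_bound hq2.twiceDiffAt hc (hpsc _ hq) w.2
    refine square_completion (σ := θ w.1) (κ := (θ w.1)⁻¹ • (r w.1 - r (w.1 - θ w.1 • ν))) hθpos
        ?_ ?_ ?_ htb ?_ hc hη hB
    · rw [smul_eq_mul, hq0, sub_zero]; linarith
    · rw [smul_eq_mul, hq0, sub_zero]; field_simp
    · simp only [smul_eq_mul]; field_simp; ring
    · beta_reduce
      rw [nco, div_mul_cancel₀ _ hc, Complex.real_smul, ← mul_assoc, ← Complex.ofReal_mul,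
        mul_inv_cancel₀ hθn, Complex.ofReal_one, one_mul]; ring
  have := Filter.eventually_inf_principal.1 hfin
  exact this

/-- On the null space of the Levi form `∂̄ω(L, L̄)` is real. -/
lemma dlb_im_eq_zero (h : IsDefining n s Ω r V) (hs : 3 ≤ s)
    (hpsc : LeviPseudoconvex n r Ω) (hp : p ∈ frontier Ω) {X : Pt n} (hX : X ∈ nullSp n r p) :
    (dlb r p X).im = 0 := by
  have hs1 : 1 ≤ s := le_trans (by norm_num) hs
  have h3 : ContDiffAt ℝ 3 r p := (h.contDiffAt (h.mem_V hp)).of_le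
    (show ((3 : ℕ∞) : WithTop ℕ∞) ≤ s from WithTop.coe_le_coe.2 hs)
  have h2 : ContDiffAt ℝ 2 r p := h3.of_le (by norm_num)
  have hd := h2.differentiableAt (by norm_num)
  have h0 := h.2.2.2.2 p hp
  set ν := nuv r p with hνdef
  have hν := fderiv_nuv hd h0
  have hev2 : ∀ᶠ q in 𝓝 p, ContDiffAt ℝ 2 r q := h2.eventually (by norm_num)
  have hex := h.exists_proj hs1 hp hν.1 hev2
  classical
  choose! θ hθ1 hθ2 hθ3 using fun z (hz : ∃ θ : ℝ, |θ| ≤ 2 * |r z| ∧ z - θ • ν ∈ frontier Ω ∧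
    z - θ • ν ∈ {q | ContDiffAt ℝ 2 r q}) => hz
  set l : Filter ℝ := 𝓝[≠] 0 with hl
  have hl0 : Tendsto (fun t : ℝ => t) l (𝓝 0) := tendsto_nhdsWithin_of_tendsto_nhds tendsto_id
  have hne : ∀ᶠ t in l, t ≠ 0 := self_mem_nhdsWithin
  set y : ℝ → Pt n := fun t => p + t • Complex.I • ν with hy
  have hyt : Tendsto y l (𝓝 p) := by
    simpa using (tendsto_const_nhds (x := p)).add (hl0.smul_const (Complex.I • ν))
  have hysl : Tendsto (fun t => t⁻¹ • (y t - p)) l (𝓝 (Complex.I • ν)) := by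
    refine tendsto_const_nhds.congr' ?_
    filter_upwards [hne] with t ht
    rw [hy, add_sub_cancel_left, smul_smul, inv_mul_cancel₀ ht, one_smul]
  have hrsl := (h2.hasStrictFDerivAt (by norm_num)).tendsto_slope hyt
    (tendsto_const_nhds (x := p)) hysl
  rw [hν.2] at hrsl
  have hθe := hyt.eventually hex
  have hθsl : Tendsto (fun t => t⁻¹ * θ (y t)) l (𝓝 0) := by
    have hr2 : Tendsto (fun t => 2 * |t⁻¹ • (r (y t) - r p)|) l (𝓝 0) := by
      simpa using (hrsl.abs.const_mul 2)
    refine squeeze_zero_norm' ?_ hr2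
    filter_upwards [hθe] with t ht
    have := hθ1 _ ht
    rw [h.eq_zero hp, sub_zero, smul_eq_mul, abs_mul, Real.norm_eq_abs, abs_mul]
    nlinarith [abs_nonneg t⁻¹]
  have hθt : Tendsto (fun t => θ (y t)) l (𝓝 0) := by
    have := hl0.mul hθsl
    rw [zero_mul] at this
    refine this.congr' ?_
    filter_upwards [hne] with t ht
    field_simp
  have hqt : Tendsto (fun t => y t - θ (y t) • ν) l (𝓝 p) := by
    simpa using hyt.sub (hθt.smul_const ν)
  have hslope : Tendsto (fun t => t⁻¹ • ((y t - θ (y t) • ν) - p)) l (𝓝 (Complex.I • ν)) := by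
    have := hysl.sub (hθsl.smul_const ν)
    rw [zero_smul, sub_zero] at this
    refine this.congr fun t => ?_
    rw [mul_smul, ← smul_sub]; congr 1; abel
  have hu : Tendsto (fun t => (y t - θ (y t) • ν, X)) l (𝓝 (p, X)) :=
    hqt.prodMk_nhds tendsto_const_nhds
  have hslope2 : Tendsto (fun t => t⁻¹ • ((y t - θ (y t) • ν, X) - (p, X)))
      l (𝓝 (Complex.I • ν, (0 : Pt n))) := by
    have := hslope.prodMk_nhds (tendsto_const_nhds (x := (0 : Pt n)) (f := l))
    refine this.congr fun w => ?_
    rw [Prod.mk_sub_mk, sub_self, Prod.smul_mk, smul_zero]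
  have cb : ContDiffAt ℝ 1 (fun w : Pt n × Pt n => wd (cR n r) w.1 w.2) (p, X) :=
    contDiffAt_wd_pair (m := 1) (by norm_num; exact h2)
  have cl : ContDiffAt ℝ 1 (fun w : Pt n × Pt n => lap r w.1 w.2) (p, X) :=
    contDiffAt_lap_pair (m := 1) (by norm_num; exact h3)
  have tβ := (cb.hasStrictFDerivAt (by norm_num)).tendsto_slope hu tendsto_const_nhds hslope2
  have tτ := (cl.hasStrictFDerivAt (by norm_num)).tendsto_slope hu tendsto_const_nhds hslope2
  have hwν := wd_nuv hd h0
  have hwν0 : wd (cR n r) p ν ≠ 0 := by rw [hνdef, hwν]; norm_num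
  have tmix := (continuousAt_mix h2 (X := X) hwν0).tendsto.comp hu
  have tc : Tendsto (fun t => wd (cR n r) (y t - θ (y t) • ν) ν) l (𝓝 (1 / 2)) := by
    have cb' : ContDiffAt ℝ 1 (fun w : Pt n × Pt n => wd (cR n r) w.1 w.2) (p, ν) :=
      contDiffAt_wd_pair (m := 1) (by norm_num; exact h2)
    have := cb'.continuousAt.tendsto.comp (hqt.prodMk_nhds (tendsto_const_nhds (x := ν) (f := l)))
    simp only at this
    rwa [hνdef, hwν] at this
  simp only at tmix
  rw [hνdef, mix_null h2 h0 hX.1, ← hνdef] at tmix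
  have hid := expansion_im h3 h0 hX
  rw [fderiv_lap_pair h3 (Complex.I • ν) X] at tτ
  have hΛp : lap r p X = 0 := by
    have := hX.2 X hX.1
    rw [levi_self h2.twiceDiffAt] at this
    exact_mod_cast this
  have hbp : wd (cR n r) p X = 0 := (mem_T10 X).1 hX.1
  simp only [hΛp, sub_zero] at tτ
  simp only [hbp, sub_zero] at tβ
  set τ₀ := lap (fun z => fderiv ℝ r z (Complex.I • ν)) p X with hτ₀
  set β₀ := fderiv ℝ (fun w : Pt n × Pt n => wd (cR n r) w.1 w.2) (p, X) (Complex.I • ν, 0) with hβ₀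
  have tB := (tτ.sub (((Complex.continuous_re.tendsto _).comp
    (((Complex.continuous_conj.tendsto _).comp (tβ.div tc (by norm_num))).mul tmix)).const_mul 2))
  have hmono1 : 𝓝[>] (0 : ℝ) ≤ l := nhdsWithin_mono _ fun x hx => ne_of_gt hx
  have hmono2 : 𝓝[<] (0 : ℝ) ≤ l := nhdsWithin_mono _ fun x hx => ne_of_lt hx
  have hkey : ∀ᶠ t in l, 0 ≤ t * (t⁻¹ • lap r (y t - θ (y t) • ν) X -
      2 * ((starRingEnd ℂ) (t⁻¹ • wd (cR n r) (y t - θ (y t) • ν) X /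
        wd (cR n r) (y t - θ (y t) • ν) ν) * mix r ν (y t - θ (y t) • ν) X).re) := by
    filter_upwards [hθe, hne, tc.eventually_ne (by norm_num : (1 / 2 : ℂ) ≠ 0)] with t ht htn hc
    have hq := hθ2 _ ht
    have hq2 : ContDiffAt ℝ 2 r (y t - θ (y t) • ν) := hθ3 _ ht
    have htb := tangential_bound hq2.twiceDiffAt hc (hpsc _ hq) X
    have e : (starRingEnd ℂ) (t⁻¹ • wd (cR n r) (y t - θ (y t) • ν) X /
        wd (cR n r) (y t - θ (y t) • ν) ν) * mix r ν (y t - θ (y t) • ν) X =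
        (t⁻¹ : ℝ) * ((starRingEnd ℂ) (nco r ν (y t - θ (y t) • ν) X) *
          mix r ν (y t - θ (y t) • ν) X) := by
      generalize mix r ν (y t - θ (y t) • ν) X = mm
      simp only [nco, Complex.real_smul, map_mul, map_div₀, Complex.conj_ofReal]
      ring
    rw [e, Complex.re_ofReal_mul, smul_eq_mul]
    field_simp
    linarith
  have hge : 0 ≤ τ₀ - 2 * ((starRingEnd ℂ) (β₀ / (1 / 2)) * (om r p X / 2)).re := by
    refine ge_of_tendsto (tB.mono_left hmono1) ?_
    filter_upwards [hkey.filter_mono hmono1, self_mem_nhdsWithin] with t ht htp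
    exact nonneg_of_mul_nonneg_right ht htp
  have hle : τ₀ - 2 * ((starRingEnd ℂ) (β₀ / (1 / 2)) * (om r p X / 2)).re ≤ 0 := by
    refine le_of_tendsto (tB.mono_left hmono2) ?_
    filter_upwards [hkey.filter_mono hmono2, self_mem_nhdsWithin] with t ht htp
    exact nonpos_of_mul_nonneg_right ht htp
  have e : ((starRingEnd ℂ) (β₀ / (1 / 2)) * (om r p X / 2)).re =
      2 * ((starRingEnd ℂ) β₀ * (om r p X / 2)).re := by
    have : (starRingEnd ℂ) (β₀ / (1 / 2)) * (om r p X / 2) =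
        ((2 : ℝ) : ℂ) * ((starRingEnd ℂ) β₀ * (om r p X / 2)) := by
      simp [Complex.conj_ofNat]; ring
    rw [this, Complex.re_ofReal_mul]
  rw [e] at hge hle
  linarith

end nulllocal

section upper
variable {n : ℕ} {r : Pt n → ℝ} {p : Pt n} {s : ℕ∞} {Ω V : Set (Pt n)}

lemma normSq_wd_cR {f : Pt n → ℝ} {z : Pt n} (hf : DifferentiableAt ℝ f z) (X : Pt n) :
    normSq (wd (cR n f) z X) = 1 / 4 * ((fderiv ℝ f z X) ^ 2 +
        (fderiv ℝ f z (Complex.I • X)) ^ 2) := by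
  rw [wd_cR hf, normSq_apply]
  simp
  ring

lemma fderiv2_comp {f : Pt n → ℝ} {φ : ℝ → ℝ} {z : Pt n} (hf : ContDiffAt ℝ 2 f z)
    (hφ : ContDiffAt ℝ 2 φ (f z)) (X Y : Pt n) :
    fderiv ℝ (fderiv ℝ (fun w => φ (f w))) z X Y =
      deriv φ (f z) * fderiv ℝ (fderiv ℝ f) z X Y +
        deriv (deriv φ) (f z) * (fderiv ℝ f z X * fderiv ℝ f z Y) := by
  have e : fderiv ℝ (fun w => φ (f w)) =ᶠ[𝓝 z] fun w => deriv φ (f w) • fderiv ℝ f w := by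
    have h1 : ∀ᶠ w in 𝓝 z, ContDiffAt ℝ 2 φ (f w) :=
      hf.continuousAt.eventually (hφ.eventually (by norm_num))
    filter_upwards [hf.eventually (by norm_num), h1] with w hw hw1
    exact ((hw1.differentiableAt (by norm_num)).hasDerivAt.comp_hasFDerivAt w
      (hw.differentiableAt (by norm_num)).hasFDerivAt).fderiv
  have d1 : DifferentiableAt ℝ (fderiv ℝ f) z :=
    (hf.fderiv_right (m := 1) (by norm_num)).differentiableAt (by norm_num)
  have d2 : DifferentiableAt ℝ (deriv φ) (f z) := by
    have h1 : ContDiffAt ℝ 1 (fderiv ℝ φ) (f z) := hφ.fderiv_right (by norm_num)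
    have h2 : DifferentiableAt ℝ (fun x => fderiv ℝ φ x 1) (f z) :=
      (h1.differentiableAt (by norm_num)).clm_apply (differentiableAt_const _)
    exact h2
  have h2 : HasFDerivAt (fun w => deriv φ (f w)) (deriv (deriv φ) (f z) • fderiv ℝ f z) z :=
    d2.hasDerivAt.comp_hasFDerivAt z (hf.differentiableAt (by norm_num)).hasFDerivAt
  have h3 : HasFDerivAt (fun w => deriv φ (f w) • fderiv ℝ f w) _ z :=
    h2.fun_smul d1.hasFDerivAt
  rw [e.fderiv_eq, h3.fderiv]
  simp only [add_apply, smul_apply, ContinuousLinearMap.smulRight_apply, smul_eq_mul]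
  ring

lemma lap_comp {f : Pt n → ℝ} {φ : ℝ → ℝ} {z : Pt n} (hf : ContDiffAt ℝ 2 f z)
    (hφ : ContDiffAt ℝ 2 φ (f z)) (X : Pt n) :
    lap (fun w => φ (f w)) z X =
      deriv φ (f z) * lap f z X + deriv (deriv φ) (f z) * normSq (wd (cR n f) z X) := by
  rw [normSq_wd_cR (hf.differentiableAt (by norm_num))]
  unfold lap lapB
  rw [fderiv2_comp hf hφ, fderiv2_comp hf hφ]
  simp only [smul_eq_mul]
  ring

lemma lap_rpow {f : Pt n → ℝ} {z : Pt n} (hf : ContDiffAt ℝ 2 f z) (hz : 0 < f z) (η : ℝ)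
    (X : Pt n) :
    lap (fun w => f w ^ η) z X = η * f z ^ (η - 2) *
      (f z * lap f z X + (η - 1) * normSq (wd (cR n f) z X)) := by
  have hφ : ContDiffAt ℝ 2 (fun x : ℝ => x ^ η) (f z) := Real.contDiffAt_rpow_const_of_ne hz.ne'
  rw [lap_comp hf hφ]
  have e1 : ∀ x : ℝ, 0 < x → ∀ a : ℝ, deriv (fun x : ℝ => x ^ a) x = a * x ^ (a - 1) :=
      fun x hx a =>
    (Real.hasDerivAt_rpow_const (Or.inl hx.ne')).deriv
  have e2 : deriv (fun x : ℝ => x ^ η) =ᶠ[𝓝 (f z)] fun x => η * x ^ (η - 1) := by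
    filter_upwards [lt_mem_nhds hz] with x hx
    exact e1 x hx η
  rw [e1 _ hz, e2.deriv_eq, deriv_const_mul _ (Real.hasDerivAt_rpow_const
      (Or.inl hz.ne')).differentiableAt,
    e1 _ hz]
  have e3 : f z ^ (η - 1) = f z ^ (η - 2) * f z := by
    rw [← Real.rpow_add_one hz.ne']; congr 1; ring
  have e4 : η - 1 - 1 = η - 2 := by ring
  rw [e4, e3]; ring

lemma lap_real_smul (f : Pt n → ℝ) (z X : Pt n) (c : ℝ) : lap f z (c • X) = c ^ 2 * lap f z X := by
  unfold lap lapB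
  rw [smul_comm Complex.I c X]
  simp only [map_smul, smul_apply, smul_eq_mul]
  ring

lemma wd_real_smul (f : Pt n → ℂ) (z X : Pt n) (c : ℝ) : wd f z (c • X) = c * wd f z X := by
  have : (c • X : Pt n) = (c : ℂ) • X := by ext; simp
  rw [this, wd_smul_vec]

lemma mem_nullSp_of_lap_eq_zero (h : ContDiffAt ℝ 2 r p)
    (hpsc : ∀ X ∈ T10 n r p, 0 ≤ (levi n r p X X).re) {X : Pt n} (hX : X ∈ T10 n r p)
    (h0 : lap r p X = 0) : X ∈ nullSp n r p := by
  refine ⟨hX, fun Y hY => ?_⟩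
  rw [levi_eq h.twiceDiffAt]
  have hY0 : 0 ≤ lap r p Y := by
    have := hpsc Y hY
    rwa [levi_self h.twiceDiffAt, ofReal_re] at this
  set lam := leviB (fderiv ℝ (fderiv ℝ r) p) X Y with hlam
  set t : ℝ := 1 / (1 + lap r p Y) with ht
  have htp : 0 < t := by positivity
  have htl : t * lap r p Y < 1 := by
    rw [ht, one_div, inv_mul_lt_iff₀ (by positivity)]; linarith
  have hmem : X + (-(t : ℂ) * lam) • Y ∈ T10 n r p := by
    rw [mem_T10] at *
    rw [wd_add_vec, wd_smul_vec, hX, hY]; simp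
  have h1 := hpsc _ hmem
  rw [levi_self h.twiceDiffAt, ofReal_re] at h1
  unfold lap at h1 h0
  rw [leviB_polar (fun X Y => h.twiceDiffAt.symm X Y), h0, ← hlam] at h1
  have e : ((starRingEnd ℂ) (-(t : ℂ) * lam) * (lam + -(t : ℂ) * lam / 2 *
      ((lapB (fderiv ℝ (fderiv ℝ r) p) Y : ℝ) : ℂ))).re =
      -(t * normSq lam * (1 - t * lap r p Y / 2)) := by
    rw [show lap r p Y = lapB (fderiv ℝ (fderiv ℝ r) p) Y from rfl]
    generalize lapB (fderiv ℝ (fderiv ℝ r) p) Y = b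
    have : (starRingEnd ℂ) (-(t : ℂ) * lam) * (lam + -(t : ℂ) * lam / 2 * (b : ℂ)) =
        (((-t * (1 - t * b / 2) : ℝ)) : ℂ) * ((normSq lam : ℝ) : ℂ) := by
      rw [normSq_eq_conj_mul_self]
      simp
      ring
    rw [this, ← ofReal_mul, ofReal_re]; ring
  rw [e] at h1
  have h2 : normSq lam ≤ 0 := by
    by_contra hcon
    have h3 : 0 < t * normSq lam * (1 - t * lap r p Y / 2) :=
      mul_pos (mul_pos htp (not_le.1 hcon)) (by linarith)
    linarith
  exact normSq_eq_zero.1 (le_antisymm h2 (normSq_nonneg _))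

/-- Strict negativity of the D'Angelo expression on null vectors makes the power `r ^ η` strictly
plurisubharmonic outside the domain near its boundary. -/
lemma exists_strictPSHOn (h : IsDefining n s Ω r V) (hs : 3 ≤ s) (hpsc : LeviPseudoconvex n r Ω)
    {η : ℝ} (hη : 1 < η) (hneg : ∀ p ∈ weakPts n r Ω, ∀ L ∈ nullSp n r p, L ≠ 0 →
      η / (η - 1) * normSq (om r p L) + (dlb r p L).re < 0) :
    ∃ U : Set (Pt n), IsOpen U ∧ frontier Ω ⊆ U ∧
      StrictPSHOn n (fun z => r z ^ η) ((closure Ω)ᶜ ∩ U) := by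
  have hs1 : 1 ≤ s := le_trans (by norm_num) hs
  have key : ∀ p ∈ frontier Ω, ∀ᶠ z in 𝓝 p, z ∉ closure Ω → ∀ X : Pt n, X ≠ 0 →
      0 < (levi n (fun z => r z ^ η) z X X).re := by
    intro p hp
    have h3 : ContDiffAt ℝ 3 r p := (h.contDiffAt (h.mem_V hp)).of_le
      (show ((3 : ℕ∞) : WithTop ℕ∞) ≤ s from WithTop.coe_le_coe.2 hs)
    have h2 : ContDiffAt ℝ 2 r p := h3.of_le (by norm_num)
    have hr0 := h.eq_zero hp
    have hsign := h.eventually_sign hs1 hp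
    have cr : ∀ X : Pt n, Tendsto (fun w : Pt n × Pt n => r w.1) (𝓝 (p, X)) (𝓝 (r p)) := fun X =>
      h2.continuousAt.tendsto.comp (continuous_fst.tendsto (p, X))
    have cw : ∀ X : Pt n, ContinuousAt (fun w : Pt n × Pt n => wd (cR n r) w.1 w.2) (p, X) :=
      fun X => (contDiffAt_wd_pair (m := 1) (by norm_num; exact h2)).continuousAt
    have cl : ∀ X : Pt n, ContinuousAt (fun w : Pt n × Pt n => lap r w.1 w.2) (p, X) :=
      fun X => (contDiffAt_lap_pair (m := 0) (by norm_num; exact h2)).continuousAt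
    have hsph : ∀ᶠ z in 𝓝 p, ∀ X ∈ Metric.sphere (0 : Pt n) 1, z ∉ closure Ω →
        0 < r z * lap r z X + (η - 1) * normSq (wd (cR n r) z X) := by
      refine (isCompact_sphere (0 : Pt n) 1).eventually_forall_of_forall_eventually ?_
      intro X hX
      have hX0 : X ≠ 0 := by
        rintro rfl; simp at hX
      by_cases hT : wd (cR n r) p X = 0
      · have hXT : X ∈ T10 n r p := (mem_T10 X).2 hT
        have hnn := hpsc p hp X hXT
        rw [levi_self h2.twiceDiffAt, ofReal_re] at hnn
        rcases hnn.lt_or_eq with hlt | heq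
        · have hsign' : ∀ᶠ w : Pt n × Pt n in 𝓝 (p, X), w.1 ∉ closure Ω → 0 < r w.1 := by
            filter_upwards [(continuous_fst.tendsto (p, X)).eventually hsign] with w hw
            exact hw.2.2
          filter_upwards [hsign', (cl X).tendsto.eventually (lt_mem_nhds hlt)] with w h1 h2 ho
          have := mul_pos (h1 ho) h2
          have := normSq_nonneg (wd (cR n r) w.1 w.2)
          have hη' : 0 < η - 1 := by linarith
          positivity
        · have hnull := mem_nullSp_of_lap_eq_zero h2 (hpsc p hp) hXT heq.symm
          have hweak : p ∈ weakPts n r Ω := ⟨hp, X, hXT, hX0, hnull.2 X hXT⟩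
          exact eventually_pos_of_null h hs hpsc hp hnull hη (hneg p hweak X hnull hX0)
      · have ht := ((cr X).mul (cl X).tendsto).add
          (((continuous_normSq.tendsto _).comp (cw X).tendsto).const_mul (η - 1))
        have hpos : 0 < r p * lap r p X + (η - 1) * normSq (wd (cR n r) p X) := by
          rw [hr0, zero_mul, zero_add]
          exact mul_pos (by linarith) (normSq_pos.2 hT)
        filter_upwards [ht.eventually (lt_mem_nhds hpos)] with w hw _
        exact hw
    filter_upwards [hsph, hsign, h2.eventually (by norm_num)] with z hz hzs hz2 ho X hX
    have hrz := hzs.2.2 ho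
    have hC2 : ContDiffAt ℝ 2 (fun w => r w ^ η) z := hz2.rpow_const_of_ne hrz.ne'
    rw [levi_self hC2.twiceDiffAt, ofReal_re, lap_rpow hz2 hrz]
    have hXn : 0 < ‖X‖ := norm_pos_iff.2 hX
    have hu := hz (‖X‖⁻¹ • X) (by simp [norm_smul, hXn.ne']) ho
    rw [lap_real_smul, wd_real_smul, normSq_mul, normSq_ofReal] at hu
    have e : r z * (‖X‖⁻¹ ^ 2 * lap r z X) + (η - 1) * (‖X‖⁻¹ * ‖X‖⁻¹ * normSq (wd (cR n r) z X)) =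
        ‖X‖⁻¹ ^ 2 * (r z * lap r z X + (η - 1) * normSq (wd (cR n r) z X)) := by ring
    rw [e] at hu
    have h4 := (pos_iff_pos_of_mul_pos hu).1 (by positivity)
    have h5 : 0 < r z ^ (η - 2) := Real.rpow_pos_of_pos hrz _
    have h6 : 0 < η := by linarith
    positivity
  refine ⟨interior {z | z ∉ closure Ω → ∀ X : Pt n, X ≠ 0 →
      0 < (levi n (fun z => r z ^ η) z X X).re}, isOpen_interior, fun p hp => ?_, fun z hz => ?_⟩
  · exact mem_interior_iff_mem_nhds.2 (key p hp)
  · exact (interior_subset hz.2) hz.1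

end upper

section euclid
variable {n : ℕ}

/-- The square of the Euclidean norm. -/
noncomputable def sqn (z : Pt n) : ℝ := ∑ j, normSq (z j)

lemma sqn_nonneg (z : Pt n) : 0 ≤ sqn z := Finset.sum_nonneg fun _ _ => normSq_nonneg _

lemma sqn_pos {z : Pt n} (hz : z ≠ 0) : 0 < sqn z := by
  obtain ⟨j, hj⟩ := Function.ne_iff.1 hz
  exact Finset.sum_pos' (fun _ _ => normSq_nonneg _) ⟨j, Finset.mem_univ _, normSq_pos.2 hj⟩

lemma contDiff_sqn_sub (a : Pt n) {m : WithTop ℕ∞} : ContDiff ℝ m fun z => sqn (z - a) := by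
  unfold sqn
  simp only [normSq_apply, Pi.sub_apply]
  refine ContDiff.sum fun j _ => ?_
  have h1 : ContDiff ℝ m fun z : Pt n => (z j - a j).re :=
    reCLM.contDiff.comp ((contDiff_apply ℝ ℂ j).sub contDiff_const)
  have h2 : ContDiff ℝ m fun z : Pt n => (z j - a j).im :=
    imCLM.contDiff.comp ((contDiff_apply ℝ ℂ j).sub contDiff_const)
  exact (h1.mul h1).add (h2.mul h2)

lemma fderiv_sqn_sub (a z X : Pt n) :
    fderiv ℝ (fun w => sqn (w - a)) z X = 2 * ∑ j,
        ((z j - a j).re * (X j).re + (z j - a j).im * (X j).im) := by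
  have h1 : ∀ j, HasFDerivAt (fun w : Pt n => (w j - a j).re)
      (reCLM.comp (ContinuousLinearMap.proj (R := ℝ) (φ := fun _ : Fin n => ℂ) j)) z :=
    fun j => reCLM.hasFDerivAt.comp z (((ContinuousLinearMap.proj (R := ℝ) (φ := fun _ : Fin n =>
        ℂ) j).hasFDerivAt).sub_const (a j))
  have h2 : ∀ j, HasFDerivAt (fun w : Pt n => (w j - a j).im)
      (imCLM.comp (ContinuousLinearMap.proj (R := ℝ) (φ := fun _ : Fin n => ℂ) j)) z :=
    fun j => imCLM.hasFDerivAt.comp z (((ContinuousLinearMap.proj (R := ℝ) (φ := fun _ : Fin n =>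
        ℂ) j).hasFDerivAt).sub_const (a j))
  have h3 := HasFDerivAt.fun_sum (u := Finset.univ) (fun j _ =>
      ((h1 j).fun_mul (h1 j)).fun_add ((h2 j).fun_mul (h2 j)))
  unfold sqn
  simp only [normSq_apply, Pi.sub_apply]
  rw [h3.fderiv]
  simp only [sum_apply, add_apply, smul_apply, smul_eq_mul, Finset.mul_sum,
    ContinuousLinearMap.comp_apply, ContinuousLinearMap.proj_apply, reCLM_apply, imCLM_apply]
  refine Finset.sum_congr rfl fun j _ => ?_
  ring

lemma fderiv2_sqn_sub (a z X Y : Pt n) :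
    fderiv ℝ (fderiv ℝ (fun w => sqn (w - a))) z X Y =
      2 * ∑ j, ((X j).re * (Y j).re + (X j).im * (Y j).im) := by
  have hd : DifferentiableAt ℝ (fderiv ℝ (fun w => sqn (w - a))) z :=
    ((contDiff_sqn_sub a (m := 2)).contDiffAt.twiceDiffAt).2
  rw [← fderiv_real_const_apply hd]
  have e : (fun w => fderiv ℝ (fun w => sqn (w - a)) w Y) = fun w =>
      (∑ j, 2 • ((Y j).re • (reCLM.comp (ContinuousLinearMap.proj (R := ℝ) (φ := fun _ :
          Fin n => ℂ) j)) +
        (Y j).im • (imCLM.comp (ContinuousLinearMap.proj (R := ℝ) (φ := fun _ : Fin n => ℂ) j))))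
            (w - a) := by
    funext w
    rw [fderiv_sqn_sub, Finset.mul_sum]
    simp only [sum_apply, add_apply, smul_apply, smul_eq_mul, 
      ContinuousLinearMap.comp_apply, ContinuousLinearMap.proj_apply, reCLM_apply, imCLM_apply,
          Pi.sub_apply, nsmul_eq_mul]
    refine Finset.sum_congr rfl fun j _ => ?_
    push_cast
    ring
  rw [e]
  have hT : ∀ T : Pt n →L[ℝ] ℝ, fderiv ℝ (fun w => T (w - a)) z = T := fun T =>
    (T.hasFDerivAt.comp z ((hasFDerivAt_id z).sub_const a)).fderiv
  rw [hT]
  simp only [sum_apply, add_apply, smul_apply, smul_eq_mul, 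
      ContinuousLinearMap.comp_apply, ContinuousLinearMap.proj_apply, reCLM_apply, imCLM_apply,
          nsmul_eq_mul, Finset.mul_sum]
  refine Finset.sum_congr rfl fun j _ => ?_
  push_cast
  ring

lemma lap_sqn_sub (a z X : Pt n) : lap (fun w => sqn (w - a)) z X = sqn X := by
  unfold lap lapB
  rw [fderiv2_sqn_sub, fderiv2_sqn_sub, smul_eq_mul, ← mul_add, ← Finset.sum_add_distrib,
      ← mul_assoc,
    Finset.mul_sum, sqn]
  refine Finset.sum_congr rfl fun j _ => ?_
  simp [normSq_apply]
  ring

lemma normSq_wd_sqn_sub_le (a z X : Pt n) :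
    normSq (wd (cR n fun w => sqn (w - a)) z X) ≤ sqn (z - a) * sqn X := by
  have e : wd (cR n fun w => sqn (w - a)) z X = ∑ j, (starRingEnd ℂ) (z j - a j) * X j := by
    rw [wd_cR ((contDiff_sqn_sub a (m := 1)).differentiable (by norm_num) z), fderiv_sqn_sub,
        fderiv_sqn_sub]
    push_cast
    simp only [Finset.mul_sum, ← Finset.sum_sub_distrib]
    refine Finset.sum_congr rfl fun j _ => ?_
    apply Complex.ext <;> simp <;> ring
  rw [e, normSq_eq_norm_sq]
  have h1 : ‖∑ j, (starRingEnd ℂ) (z j - a j) * X j‖ ≤ ∑ j, ‖z j - a j‖ * ‖X j‖ := by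
    refine (norm_sum_le _ _).trans (le_of_eq ?_)
    simp only [norm_mul, norm_conj]
  have h2 := Finset.sum_mul_sq_le_sq_mul_sq Finset.univ (fun j => ‖z j - a j‖) (fun j => ‖X j‖)
  have h3 : sqn (z - a) * sqn X = (∑ j, ‖z j - a j‖ ^ 2) * ∑ j, ‖X j‖ ^ 2 := by
    simp only [sqn, normSq_eq_norm_sq, Pi.sub_apply]
  rw [h3]
  exact (pow_le_pow_left₀ (norm_nonneg _) h1 2).trans h2

end euclid

section upper
variable {n : ℕ} {r : Pt n → ℝ} {s : ℕ∞} {Ω V : Set (Pt n)}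

lemma normSq_add_le {c c₂ : ℝ} (hcc : c < c₂) (a b : ℂ) :
    c * normSq (a + b) ≤ c₂ * normSq a + c * c₂ / (c₂ - c) * normSq b := by
  have hd : 0 < c₂ - c := by linarith
  have h1 : c₂ * normSq a + c * c₂ / (c₂ - c) * normSq b - c * normSq (a + b) =
      ((((c₂ - c) * a.re - c * b.re)) ^ 2 + ((c₂ - c) * a.im - c * b.im) ^ 2) / (c₂ - c) := by
    simp only [normSq_apply, add_re, add_im]
    field_simp
    ring
  have h2 : 0 ≤ ((((c₂ - c) * a.re - c * b.re)) ^ 2 + ((c₂ - c) * a.im - c * b.im) ^ 2) /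
      (c₂ - c) := by
    positivity
  linarith

lemma continuous_sqn : Continuous (sqn : Pt n → ℝ) := by
  have := (contDiff_sqn_sub (0 : Pt n) (m := 0)).continuous
  simpa using this

lemma conj_exponent_lt {η₂ η : ℝ} (h₂ : 1 < η₂) (h : η₂ < η) : η / (η - 1) < η₂ / (η₂ - 1) := by
  rw [div_lt_div_iff₀ (by linarith) (by linarith)]; nlinarith

lemma conj_exponent_pos {η : ℝ} (h : 1 < η) : 0 < η / (η - 1) :=
  div_pos (by linarith) (by linarith)

lemma isCompact_frontier (hb : Bornology.IsBounded Ω) : IsCompact (frontier Ω) :=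
  hb.isCompact_closure.of_isClosed_subset isClosed_frontier frontier_subset_closure

/-- A weak D'Angelo inequality with exponent `η₂` becomes strict for every larger exponent after
multiplying the defining function by a smooth positive factor. -/
lemma exists_expMul_strict (h : IsDefining n s Ω r V) (hs : 3 ≤ s) (hb : Bornology.IsBounded Ω)
    {c c₂ : ℝ} (hc : 0 < c) (hcc : c < c₂)
    (hle : ∀ p ∈ weakPts n r Ω, ∀ L ∈ nullSp n r p, c₂ * normSq (om r p L) + (dlb r p L).re ≤ 0) :
    ∃ Ψ : Pt n → ℝ, ContDiff ℝ s Ψ ∧ ∀ p ∈ weakPts n (expMul r Ψ) Ω,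
      ∀ L ∈ nullSp n (expMul r Ψ) p, L ≠ 0 →
      c * normSq (om (expMul r Ψ) p L) + (dlb (expMul r Ψ) p L).re < 0 := by
  obtain ⟨M, hM⟩ := (isCompact_frontier hb).bddAbove_image (continuous_sqn (n := n)).continuousOn
  set M' := max M 0
  set C := c * c₂ / (c₂ - c)
  have hd : 0 < c₂ - c := by linarith
  have hC : 0 < C := div_pos (mul_pos hc (by linarith)) hd
  set ε := 1 / (C * M' + 1)
  have hM0 : 0 ≤ M' := le_max_right _ _
  have hε : 0 < ε := by positivity
  have hεC : C * M' * ε < 1 := by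
    rw [mul_one_div, div_lt_one (by positivity)]; linarith
  have hsm : ContDiff ℝ s fun z : Pt n => ε * sqn (z - 0) := contDiff_const.mul (contDiff_sqn_sub 0)
  have hsm3 : ContDiff ℝ 3 fun z : Pt n => ε * sqn (z - 0) :=
      contDiff_const.mul (contDiff_sqn_sub 0)
  refine ⟨fun z => ε * sqn (z - 0), hsm, fun p hp L hL hL0 => ?_⟩
  rw [weakPts_expMul h (le_trans (by norm_num) hs) hsm] at hp
  have hpf := hp.1
  have h3 : ContDiffAt ℝ 3 r p := (h.contDiffAt (h.mem_V hpf)).of_le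
    (show ((3 : ℕ∞) : WithTop ℕ∞) ≤ s from WithTop.coe_le_coe.2 hs)
  rw [nullSp_expMul (h3.of_le (by norm_num)) (hsm3.contDiffAt.of_le (by norm_num))
      (h.eq_zero hpf)] at hL
  obtain ⟨e1, e2⟩ := om_dlb_expMul h3 (h.2.2.2.2 p hpf) hsm3.contDiffAt (h.eq_zero hpf) hL
  have hs0 : ContDiffAt ℝ 2 (fun z : Pt n => sqn (z - 0)) p := (contDiff_sqn_sub 0).contDiffAt
  have e3 : lap (fun z : Pt n => ε * sqn (z - 0)) p L = ε * sqn L := by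
    have hφ : ContDiffAt ℝ 2 (fun x : ℝ => ε * x) (sqn (p - 0)) :=
        contDiffAt_const.mul contDiffAt_id
    rw [lap_comp hs0 hφ, lap_sqn_sub]
    have : deriv (fun x : ℝ => ε * x) = fun _ => ε := by
      funext x; simp
    rw [this]; simp
  have e4 : wd (cR n fun z : Pt n => ε * sqn (z - 0)) p L = ε *
      wd (cR n fun z : Pt n => sqn (z - 0)) p L := by
    have : (cR n fun z : Pt n => ε * sqn (z - 0)) = fun z => (ε : ℂ) *
        (cR n fun z : Pt n => sqn (z - 0)) z := by
      funext z; simp [cR]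
    rw [this, wd_const_mul _ ((contDiffAt_cR hs0).differentiableAt (by norm_num))]
  rw [e1, e2, sub_re, ofReal_re, e3, e4]
  have h5 := normSq_add_le hcc (om r p L) (ε * wd (cR n fun z : Pt n => sqn (z - 0)) p L)
  have h6 := hle p hp L hL
  have h7 := normSq_wd_sqn_sub_le 0 p L
  rw [sub_zero] at h7
  have h8 : sqn p ≤ M' := (hM ⟨p, hpf, rfl⟩).trans (le_max_left _ _)
  have hLp := sqn_pos hL0
  rw [normSq_mul, normSq_ofReal] at h5
  have h9 : C * (ε * ε * normSq (wd (cR n fun z : Pt n => sqn (z - 0)) p L)) < ε * sqn L := by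
    calc C * (ε * ε * normSq (wd (cR n fun z : Pt n => sqn (z - 0)) p L))
        ≤ C * (ε * ε * (M' * sqn L)) := by
          have := h7.trans (mul_le_mul_of_nonneg_right h8 hLp.le)
          gcongr
      _ = (C * M' * ε) * (ε * sqn L) := by ring
      _ < 1 * (ε * sqn L) := by gcongr
      _ = ε * sqn L := one_mul _
  linarith

lemma Sindex_le (hs : 3 ≤ s) (hb : Bornology.IsBounded Ω) (h : IsDefining n s Ω r V)
    (hpsc : ∀ ρ V, IsDefining n s Ω ρ V → LeviPseudoconvex n ρ Ω) {η₂ : ℝ} (h₂ : 1 < η₂)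
    (hle : ∀ p ∈ weakPts n r Ω, ∀ L ∈ nullSp n r p,
      η₂ / (η₂ - 1) * normSq (om r p L) + (dlb r p L).re ≤ 0) :
    Sindex n Ω ≤ (η₂ : EReal) := by
  refine EReal.le_of_forall_lt_iff_le.1 fun η hη => ?_
  have hη' : η₂ < η := EReal.coe_lt_coe_iff.1 hη
  have hη1 : 1 < η := h₂.trans hη'
  obtain ⟨Ψ, hΨ, hneg⟩ := exists_expMul_strict h hs hb (conj_exponent_pos hη1)
    (conj_exponent_lt h₂ hη') hle
  have hs1 : 1 ≤ s := le_trans (by norm_num) hs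
  have hd := isDefining_expMul h hs1 hΨ
  have hU := exists_strictPSHOn hd hs (hpsc _ _ hd) hη1 hneg
  calc Sindex n Ω ≤ Sexp n (expMul r Ψ) Ω := sInf_le ⟨_, V, hd.one_le hs1, rfl⟩
    _ ≤ η := sInf_le ⟨η, hη1, hU, rfl⟩

end upper

section notouch
variable {n : ℕ}

lemma IsLocalMax.second_deriv_nonpos {g g' : ℝ → ℝ} {a : ℝ} (hm : IsLocalMax g 0)
    (h1 : ∀ᶠ t in 𝓝 0, HasDerivAt g (g' t) t) (h2 : HasDerivAt g' a 0) : a ≤ 0 := by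
  by_contra hcon
  have e1 : deriv g =ᶠ[𝓝 0] g' := by
    filter_upwards [h1] with t ht using ht.deriv
  have e2 : deriv (deriv g) 0 = a := by rw [e1.deriv_eq, h2.deriv]
  have hmin := isLocalMin_of_deriv_deriv_pos (f := g) (x₀ := 0) (by rw [e2]; exact not_le.1 hcon)
    hm.deriv_eq_zero h1.self_of_nhds.continuousAt
  have e3 : g =ᶠ[𝓝 0] fun _ => g 0 := by
    filter_upwards [hm, hmin] with t h h' using le_antisymm h h'
  have e4 : deriv g =ᶠ[𝓝 0] fun _ => 0 := by
    have := e3.deriv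
    simpa using this
  rw [e4.deriv_eq] at e2
  simp at e2
  exact hcon e2.symm.le

lemma second_deriv_disc {f : Pt n → ℝ} {E : ℂ → Pt n} {H : ℂ → ℂ} (hE : AnalyticAt ℂ E 0)
    (hH : AnalyticAt ℂ H 0) (hf : TwiceDiffAt f (E 0))
    (hm : IsLocalMax (fun ζ => f (E ζ) - (H ζ).re) 0) (u : ℂ) :
    fderiv ℝ (fderiv ℝ f) (E 0) (u • deriv E 0) (u • deriv E 0) +
      fderiv ℝ f (E 0) (u • u • deriv (deriv E) 0) - (u * (u * deriv (deriv H) 0)).re ≤ 0 := by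
  have hl : ∀ t : ℝ, HasDerivAt (fun t : ℝ => (t : ℂ) * u) u t := fun t => by
    simpa using (Complex.ofRealCLM.hasDerivAt (x := t)).mul_const u
  have hl0 : Tendsto (fun t : ℝ => (t : ℂ) * u) (𝓝 0) (𝓝 0) := by
    have := (hl 0).continuousAt.tendsto
    simpa using this
  have hz : ((0 : ℝ) : ℂ) * u = 0 := by simp
  have dE : ∀ t : ℝ, AnalyticAt ℂ E ((t : ℂ) * u) →
      HasDerivAt (fun t : ℝ => E ((t : ℂ) * u)) (u • deriv E ((t : ℂ) * u)) t := fun t ht =>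
    ht.differentiableAt.hasDerivAt.scomp t (hl t)
  have dE' : HasDerivAt (fun t : ℝ => u • deriv E ((t : ℂ) * u)) (u • u • deriv (deriv E) 0) 0 := by
    have h := hE.deriv.differentiableAt.hasDerivAt
    rw [← hz] at h
    have := (h.scomp (0 : ℝ) (hl 0)).const_smul u
    rw [hz] at this
    exact this
  have dH : ∀ t : ℝ, AnalyticAt ℂ H ((t : ℂ) * u) →
      HasDerivAt (fun t : ℝ => (H ((t : ℂ) * u)).re) (u * deriv H ((t : ℂ) * u)).re t := fun t ht =>
    reCLM.hasFDerivAt.comp_hasDerivAt t (ht.differentiableAt.hasDerivAt.scomp t (hl t))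
  have dH' : HasDerivAt (fun t : ℝ => (u * deriv H ((t : ℂ) * u)).re) (u *
      (u * deriv (deriv H) 0)).re 0 := by
    have h := hH.deriv.differentiableAt.hasDerivAt
    rw [← hz] at h
    have := (h.scomp (0 : ℝ) (hl 0)).const_mul u
    rw [hz] at this
    exact reCLM.hasFDerivAt.comp_hasDerivAt (0 : ℝ) this
  have hE0 : Tendsto (fun t : ℝ => E ((t : ℂ) * u)) (𝓝 0) (𝓝 (E 0)) :=
    hE.continuousAt.tendsto.comp hl0
  have hm' : IsLocalMax (fun t : ℝ => f (E ((t : ℂ) * u)) - (H ((t : ℂ) * u)).re) 0 := by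
    have := hl0.eventually hm
    filter_upwards [this] with t ht
    rw [hz]; exact ht
  refine IsLocalMax.second_deriv_nonpos (g' := fun t : ℝ => fderiv ℝ f (E ((t : ℂ) * u))
    (u • deriv E ((t : ℂ) * u)) - (u * deriv H ((t : ℂ) * u)).re) hm' ?_ ?_
  · filter_upwards [hE0.eventually hf.1, hl0.eventually hE.eventually_analyticAt,
      hl0.eventually hH.eventually_analyticAt] with t h1 h2 h3
    have h5 := dE t h2
    have h6 := dH t h3
    have h7 := h1.hasFDerivAt
    generalize fderiv ℝ f (E ((t : ℂ) * u)) = A at h7 ⊢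
    generalize u • deriv E ((t : ℂ) * u) = v at h5 ⊢
    have h4 : HasDerivAt (fun t : ℝ => f (E ((t : ℂ) * u))) (A v) t :=
      HasFDerivAt.comp_hasDerivAt (f := fun t : ℝ => E ((t : ℂ) * u)) t h7 h5
    exact h4.sub h6
  · have hE00 : AnalyticAt ℂ E (((0 : ℝ) : ℂ) * u) := by rw [hz]; exact hE
    have h5 := dE 0 hE00
    have h1 : HasFDerivAt (fderiv ℝ f) (fderiv ℝ (fderiv ℝ f) (E 0)) (E (((0 : ℝ) : ℂ) * u)) := by
      rw [hz]; exact hf.2.hasFDerivAt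
    have h4 : HasDerivAt (fun t : ℝ => fderiv ℝ f (E ((t : ℂ) * u)))
        (fderiv ℝ (fderiv ℝ f) (E 0) (u • deriv E (((0 : ℝ) : ℂ) * u))) 0 :=
      HasFDerivAt.comp_hasDerivAt (f := fun t : ℝ => E ((t : ℂ) * u)) (0 : ℝ) h1 h5
    have h2 := (HasDerivAt.clm_apply h4 dE').sub dH'
    simp only [hz] at h2
    exact h2

/-- A function with positive Levi form along an immersed holomorphic disc, minus a harmonic
function, has no local maximum. -/
lemma not_isLocalMax_disc {f : Pt n → ℝ} {E : ℂ → Pt n} {H : ℂ → ℂ} (hE : AnalyticAt ℂ E 0)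
    (hH : AnalyticAt ℂ H 0) (hf : TwiceDiffAt f (E 0)) (hpos : 0 < lap f (E 0) (deriv E 0)) :
    ¬ IsLocalMax (fun ζ => f (E ζ) - (H ζ).re) 0 := by
  intro hm
  have h1 := second_deriv_disc hE hH hf hm 1
  have h2 := second_deriv_disc hE hH hf hm Complex.I
  simp only [one_smul, one_mul, I_smul_I_smul, map_neg] at h1 h2
  rw [← mul_assoc, I_mul_I] at h2
  simp only [neg_mul, one_mul, neg_re] at h2
  unfold lap lapB at hpos
  rw [smul_eq_mul] at hpos
  linarith

end notouch

section meanvalue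

lemma exists_entire_re_approx {u : ℂ → ℝ} {ε δ : ℝ} (hε : 0 < ε) (hδ : 0 < δ)
    (hu : ContinuousOn u (Metric.sphere 0 ε)) :
    ∃ H : ℂ → ℂ, Differentiable ℂ H ∧ ∀ z ∈ Metric.sphere (0 : ℂ) ε, |u z - (H z).re| < δ := by
  have : Fact (0 < 2 * Real.pi) := ⟨Real.two_pi_pos⟩
  let ψ : AddCircle (2 * Real.pi) → ℂ := fun x => (ε : ℂ) * (AddCircle.toCircle x : ℂ)
  have hψ : Continuous ψ := continuous_const.mul
      (continuous_subtype_val.comp AddCircle.continuous_toCircle)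
  have hψs : ∀ x, ψ x ∈ Metric.sphere (0 : ℂ) ε := fun x => by
    simp [ψ, abs_of_pos hε, Circle.norm_coe]
  let U : C(AddCircle (2 * Real.pi), ℂ) :=
    ⟨fun x => (u (ψ x) : ℂ), continuous_ofReal.comp (hu.comp_continuous hψ hψs)⟩
  have hU : U ∈ (Submodule.span ℂ (Set.range (@fourier (2 * Real.pi)))).topologicalClosure := by
    rw [span_fourier_closure_eq_top]; trivial
  obtain ⟨f, hf, hfU⟩ := Metric.mem_closure_iff.1 hU δ hδ
  have hspan : ∀ f ∈ Submodule.span ℂ (Set.range (@fourier (2 * Real.pi))),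
      ∃ H₁ H₂ : ℂ → ℂ, Differentiable ℂ H₁ ∧ Differentiable ℂ H₂ ∧
        ∀ x, f x = H₁ (AddCircle.toCircle x) + (starRingEnd ℂ) (H₂ (AddCircle.toCircle x)) := by
    intro f hf
    induction hf using Submodule.span_induction with
    | mem f hf =>
      obtain ⟨m, rfl⟩ := hf
      obtain ⟨k, rfl | rfl⟩ := m.eq_nat_or_neg
      · refine ⟨fun z => z ^ k, fun _ => 0, by fun_prop, by fun_prop, fun x => ?_⟩
        simp [AddCircle.toCircle_nsmul]
      · refine ⟨fun _ => 0, fun z => z ^ k, by fun_prop, by fun_prop, fun x => ?_⟩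
        simp [AddCircle.toCircle_nsmul, AddCircle.toCircle_neg, ← Circle.coe_inv_eq_conj]
    | zero => exact ⟨fun _ => 0, fun _ => 0, by fun_prop, by fun_prop, fun x => by simp⟩
    | add f g _ _ h1 h2 =>
      obtain ⟨A, B, hA, hB, h⟩ := h1
      obtain ⟨A', B', hA', hB', h'⟩ := h2
      refine ⟨fun z => A z + A' z, fun z => B z + B' z, by fun_prop, by fun_prop, fun x => ?_⟩
      rw [ContinuousMap.add_apply, h, h', map_add]; ring
    | smul c f _ h1 =>
      obtain ⟨A, B, hA, hB, h⟩ := h1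
      refine ⟨fun z => c * A z, fun z => (starRingEnd ℂ) c * B z, by fun_prop, by fun_prop,
        fun x => ?_⟩
      rw [ContinuousMap.smul_apply, h, map_mul, conj_conj, smul_eq_mul]; ring
  obtain ⟨A, B, hA, hB, h⟩ := hspan f hf
  refine ⟨fun z => A ((ε : ℂ)⁻¹ * z) + B ((ε : ℂ)⁻¹ * z), by fun_prop, fun z hz => ?_⟩
  have hεc : (ε : ℂ) ≠ 0 := by exact_mod_cast hε.ne'
  have hzn : ‖z‖ = ε := by simpa using hz
  obtain ⟨x, hx⟩ : ∃ x : AddCircle (2 * Real.pi), ψ x = z := by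
    refine ⟨((arg z : ℝ) : AddCircle (2 * Real.pi)), ?_⟩
    simp only [ψ, AddCircle.toCircle_apply_mk, Circle.coe_exp]
    rw [div_self Real.two_pi_pos.ne', one_mul, ← hzn, norm_mul_exp_arg_mul_I]
  have h1 : dist (U x) (f x) < δ := (ContinuousMap.dist_apply_le_dist x).trans_lt hfU
  have h2 : (ε : ℂ)⁻¹ * z = AddCircle.toCircle x := by
    rw [← hx]; simp only [ψ]; field_simp
  beta_reduce
  rw [h2]
  rw [dist_eq_norm, h] at h1
  have h3 := (abs_re_le_norm _).trans_lt h1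
  simpa [U, hx] using h3

/-- A continuous function on a disc that is not touched from above by harmonic functions is
dominated by its circle averages. -/
lemma le_circleAverage_of_not_isLocalMax {u : ℂ → ℝ} {ε : ℝ} (hε : 0 < ε)
    (hu : ContinuousOn u (Metric.closedBall 0 ε))
    (hn : ∀ H : ℂ → ℂ, Differentiable ℂ H → ∀ ζ ∈ Metric.ball (0 : ℂ) ε,
      ¬ IsLocalMax (fun z => u z - (H z).re) ζ) :
    u 0 ≤ Real.circleAverage u 0 ε := by
  by_contra! hlt
  obtain ⟨δ, hδ, hδ'⟩ : ∃ δ > 0, 2 * δ < u 0 - Real.circleAverage u 0 ε :=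
    ⟨(u 0 - Real.circleAverage u 0 ε) / 3, by linarith, by linarith⟩
  obtain ⟨H, hH, hHu⟩ := exists_entire_re_approx hε hδ (hu.mono Metric.sphere_subset_closedBall)
  have hi : CircleIntegrable u 0 ε := by
    refine ContinuousOn.circleIntegrable hε.le (hu.mono Metric.sphere_subset_closedBall)
  have hHr : Continuous fun z => (H z).re := continuous_re.comp hH.continuous
  have hiH : CircleIntegrable (fun z => (H z).re) 0 ε := hHr.continuousOn.circleIntegrable hε.le
  have hav : Real.circleAverage (fun z => (H z).re) 0 ε = (H 0).re := by
    have h1 := reCLM.circleAverage_comp_comm (c := 0) (R := ε) (f := H)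
      (hH.continuous.continuousOn.circleIntegrable hε.le)
    have h2 : Real.circleAverage H 0 ε = H 0 := hH.diffContOnCl.circleAverage
    rw [h2] at h1
    exact h1
  have hle : (H 0).re ≤ Real.circleAverage u 0 ε + δ := by
    rw [← hav, ← Real.circleAverage_const δ 0 ε,
        ← Real.circleAverage_fun_add hi (circleIntegrable_const _ _ _)]
    refine Real.circleAverage_mono hiH (hi.add (circleIntegrable_const _ _ _)) fun z hz => ?_
    rw [abs_of_pos hε] at hz
    have := abs_lt.1 (hHu z hz)
    linarith
  obtain ⟨z₀, hz₀, hmax⟩ := (isCompact_closedBall (0 : ℂ) ε).exists_isMaxOn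
    ⟨0, Metric.mem_closedBall_self hε.le⟩ (hu.sub hHr.continuousOn)
  have h0 : u 0 - (H 0).re ≤ u z₀ - (H z₀).re := hmax (Metric.mem_closedBall_self hε.le)
  have hz₁ : z₀ ∈ Metric.ball (0 : ℂ) ε := by
    rw [Metric.mem_ball]
    refine lt_of_le_of_ne hz₀ fun h => ?_
    have := abs_lt.1 (hHu z₀ h)
    linarith
  refine hn H hH z₀ hz₁ ?_
  filter_upwards [Metric.isOpen_ball.mem_nhds hz₁] with z hz
  exact hmax (Metric.ball_subset_closedBall hz)

end meanvalue

noncomputable section jets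
variable {n : ℕ}

/-- The second order Taylor polynomial of `f` at `p`. -/
def jet2 (f : Pt n → ℝ) (p z : Pt n) : ℝ :=
  f p + fderiv ℝ f p (z - p) + (1 / 2) * fderiv ℝ (fderiv ℝ f) p (z - p) (z - p)

lemma contDiff_jet2 (f : Pt n → ℝ) (p : Pt n) {m : WithTop ℕ∞} : ContDiff ℝ m (jet2 f p) := by
  unfold jet2
  have h1 : ContDiff ℝ m fun z : Pt n => z - p := by fun_prop
  exact ((contDiff_const.add ((fderiv ℝ f p).contDiff.comp h1))).add
    (contDiff_const.mul (((fderiv ℝ (fderiv ℝ f) p).contDiff.comp h1).clm_apply h1))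

lemma hasFDerivAt_jet2 {f : Pt n → ℝ} {p : Pt n} (h : TwiceDiffAt f p) (z : Pt n) :
    HasFDerivAt (jet2 f p) (fderiv ℝ f p + fderiv ℝ (fderiv ℝ f) p (z - p)) z := by
  have h1 : HasFDerivAt (fun z : Pt n => z - p) (ContinuousLinearMap.id ℝ (Pt n)) z :=
    (hasFDerivAt_id z).sub_const p
  have h2 := (fderiv ℝ f p).hasFDerivAt.comp z h1
  have h3 := (fderiv ℝ (fderiv ℝ f) p).hasFDerivAt.comp z h1
  have h4 := (h3.clm_apply h1).const_mul (1 / 2 : ℝ)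
  have h5 := (h2.const_add (f p)).add h4
  refine h5.congr_fderiv ?_
  ext X
  have := h.symm (z - p) X
  simp only [map_sub, sub_apply] at this
  simp
  linarith

lemma fderiv_jet2 {f : Pt n → ℝ} {p : Pt n} (h : TwiceDiffAt f p) :
    fderiv ℝ (jet2 f p) = fun z => fderiv ℝ f p + fderiv ℝ (fderiv ℝ f) p (z - p) :=
  funext fun z => (hasFDerivAt_jet2 h z).fderiv

lemma fderiv2_jet2 {f : Pt n → ℝ} {p : Pt n} (h : TwiceDiffAt f p) (z : Pt n) :
    fderiv ℝ (fderiv ℝ (jet2 f p)) z = fderiv ℝ (fderiv ℝ f) p := by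
  rw [fderiv_jet2 h]
  have h1 : HasFDerivAt (fun z : Pt n => z - p) (ContinuousLinearMap.id ℝ (Pt n)) z :=
    (hasFDerivAt_id z).sub_const p
  exact (((fderiv ℝ (fderiv ℝ f) p).hasFDerivAt.comp z h1).const_add _).fderiv

lemma lap_jet2 {f : Pt n → ℝ} {p : Pt n} (h : TwiceDiffAt f p) (z X : Pt n) :
    lap (jet2 f p) z X = lap f p X := by
  unfold lap lapB
  rw [fderiv2_jet2 h]

/-- Second order Taylor expansion. -/
lemma TwiceDiffAt.taylor {f : Pt n → ℝ} {p : Pt n} (h : TwiceDiffAt f p) {ε : ℝ} (hε : 0 < ε) :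
    ∀ᶠ z in 𝓝 p, |f z - jet2 f p z| ≤ ε * ‖z - p‖ ^ 2 := by
  have h1 := (hasFDerivAt_iff_isLittleO.1 h.2.hasFDerivAt).def hε
  obtain ⟨r, hr, hb⟩ := Metric.eventually_nhds_iff_ball.1 (h1.and h.1)
  filter_upwards [Metric.ball_mem_nhds p hr] with z hz
  have hsub : Metric.closedBall p ‖z - p‖ ⊆ Metric.ball p r :=
    Metric.closedBall_subset_ball (by simpa [dist_eq_norm] using hz)
  have hd : ∀ x ∈ Metric.closedBall p ‖z - p‖, HasFDerivWithinAt (fun x => f x - jet2 f p x)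
      (fderiv ℝ f x - (fderiv ℝ f p + fderiv ℝ (fderiv ℝ f) p (x - p)))
      (Metric.closedBall p ‖z - p‖) x := fun x hx =>
    ((hb x (hsub hx)).2.hasFDerivAt.sub (hasFDerivAt_jet2 h x)).hasFDerivWithinAt
  have hbd : ∀ x ∈ Metric.closedBall p ‖z - p‖,
      ‖fderiv ℝ f x - (fderiv ℝ f p + fderiv ℝ (fderiv ℝ f) p (x - p))‖ ≤ ε * ‖z - p‖ := by
    intro x hx
    have h2 := (hb x (hsub hx)).1
    rw [sub_sub] at h2
    refine h2.trans (mul_le_mul_of_nonneg_left ?_ hε.le)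
    simpa [dist_eq_norm] using hx
  have := (convex_closedBall p ‖z - p‖).norm_image_sub_le_of_norm_hasFDerivWithin_le hd hbd
    (Metric.mem_closedBall_self (norm_nonneg _)) (y := z) (by simp [dist_eq_norm])
  have h0 : jet2 f p p = f p := by simp [jet2]
  rw [h0, sub_self, sub_zero, Real.norm_eq_abs] at this
  rw [pow_two, ← mul_assoc]; exact this

end jets

section laplace
variable {n : ℕ}

lemma lap_nonneg_of_le_circleAverage {G : Pt n → ℝ} {z X : Pt n} (hc : Continuous G)
    (h : TwiceDiffAt G z)
    (hmv : ∀ᶠ ε in 𝓝[>] (0 : ℝ), G z ≤ Real.circleAverage (fun ζ : ℂ => G (z + ζ • X)) 0 ε) :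
    0 ≤ lap G z X := by
  by_contra! hneg
  obtain ⟨δ, hδ, hδX⟩ : ∃ δ > 0, lap G z X + δ * ‖X‖ ^ 2 < 0 := by
    refine ⟨-lap G z X / (2 * (‖X‖ ^ 2 + 1)), by apply div_pos <;> nlinarith [sq_nonneg ‖X‖], ?_⟩
    have h1 : 0 ≤ ‖X‖ ^ 2 := sq_nonneg _
    have h2 : -lap G z X / (2 * (‖X‖ ^ 2 + 1)) * ‖X‖ ^ 2 ≤ -lap G z X / 2 := by
      rw [div_mul_eq_mul_div, div_le_div_iff₀ (by linarith) (by norm_num)]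
      nlinarith
    linarith
  have hl : Tendsto (fun ζ : ℂ => z + ζ • X) (𝓝 0) (𝓝 z) := by
    have : Continuous fun ζ : ℂ => z + ζ • X := by fun_prop
    simpa using this.tendsto 0
  obtain ⟨r, hr, hb⟩ := Metric.eventually_nhds_iff_ball.1 (hl.eventually (h.taylor hδ))
  obtain ⟨ε, ⟨hε0, hεr⟩, hε⟩ := (Filter.Eventually.and (Ioo_mem_nhdsGT hr) hmv).exists
  let a : ℂ := ⟨fderiv ℝ G z X, -fderiv ℝ G z (I • X)⟩
  let A := fderiv ℝ (fderiv ℝ G) z X X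
  let B := fderiv ℝ (fderiv ℝ G) z X (I • X)
  let C := fderiv ℝ (fderiv ℝ G) z (I • X) (I • X)
  let b : ℂ := ⟨(A - C) / 4, -B / 2⟩
  let H : ℂ → ℂ := fun ζ => G z + a * ζ + b * ζ ^ 2
  have hH : Differentiable ℂ H := by fun_prop
  have hj : ∀ ζ : ℂ, jet2 G z (z + ζ • X) = (H ζ).re + lap G z X * ‖ζ‖ ^ 2 := by
    intro ζ
    have e1 : ζ • X = ζ.re • X + ζ.im • (I • X) := by
      ext j
      simp only [Pi.smul_apply, Pi.add_apply, smul_eq_mul, real_smul]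
      conv_lhs => rw [← re_add_im ζ]
      ring
    have e2 : fderiv ℝ (fderiv ℝ G) z (I • X) X = B := h.symm _ _
    unfold jet2 lap lapB
    rw [add_sub_cancel_left, e1, ← normSq_eq_norm_sq, normSq_apply]
    simp only [map_add, map_smul, add_apply, smul_apply, smul_eq_mul, e2]
    simp only [H, a, b, add_re, mul_re, ofReal_re, pow_two, mul_im]
    simp only [A, B, C]
    ring
  have hHr : Continuous fun z => (H z).re := continuous_re.comp hH.continuous
  have hcG : Continuous fun ζ : ℂ => G (z + ζ • X) := by fun_prop
  have hav : Real.circleAverage (fun z => (H z).re) 0 ε = G z := by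
    have h1 := reCLM.circleAverage_comp_comm (c := 0) (R := ε) (f := H)
      (hH.continuous.continuousOn.circleIntegrable hε0.le)
    have h2 : Real.circleAverage H 0 ε = H 0 := hH.diffContOnCl.circleAverage
    rw [h2] at h1
    have h3 : H 0 = G z := by simp [H]
    rw [h3] at h1
    exact h1
  have hle : Real.circleAverage (fun ζ : ℂ => G (z + ζ • X)) 0 ε ≤
      G z + (lap G z X + δ * ‖X‖ ^ 2) * ε ^ 2 := by
    have hi := hHr.continuousOn.circleIntegrable (c := 0) hε0.le
    have hi2 := circleIntegrable_const ((lap G z X + δ * ‖X‖ ^ 2) * ε ^ 2) 0 ε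
    rw [← hav, ← Real.circleAverage_const ((lap G z X + δ * ‖X‖ ^ 2) * ε ^ 2) 0 ε,
      ← Real.circleAverage_fun_add hi hi2]
    refine Real.circleAverage_mono (hcG.continuousOn.circleIntegrable hε0.le) (hi.add hi2)
      fun ζ hζ => ?_
    have hζ' : ‖ζ‖ = ε := by simpa [abs_of_pos hε0] using hζ
    have h3 := (abs_le.1 (hb ζ (by simpa [hζ'] using hεr))).2
    rw [hj, add_sub_cancel_left, norm_smul, hζ', mul_pow] at h3
    linarith
  nlinarith [mul_pos hε0 hε0]

/-- `g` is not touched from above, along complex lines transversal to `ν`, by harmonic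
functions. -/
def NoTouch (g : Pt n → ℝ) (W : Set (Pt n)) (ν : Pt n) : Prop :=
  ∀ z ∈ W, ∀ X : Pt n, (∀ c : ℂ, X ≠ c • ν) → ∀ H : ℂ → ℂ, Differentiable ℂ H →
    ¬ IsLocalMax (fun ζ : ℂ => g (z + ζ • X) - (H ζ).re) 0

lemma NoTouch.le_circleAverage {g : Pt n → ℝ} {W : Set (Pt n)} {ν z X : Pt n} {ε : ℝ}
    (hn : NoTouch g W ν) (hg : ContinuousOn g W) (hX : ∀ c : ℂ, X ≠ c • ν) (hε : 0 < ε)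
    (hW : ∀ ζ ∈ Metric.closedBall (0 : ℂ) ε, z + ζ • X ∈ W) :
    g z ≤ Real.circleAverage (fun ζ : ℂ => g (z + ζ • X)) 0 ε := by
  have := le_circleAverage_of_not_isLocalMax (u := fun ζ : ℂ => g (z + ζ • X)) hε
    (hg.comp (by fun_prop) hW) fun H hH ζ₀ hζ₀ hm => by
      refine hn (z + ζ₀ • X) (hW _ (Metric.ball_subset_closedBall hζ₀)) X hX
        (fun ζ => H (ζ₀ + ζ)) (by fun_prop) ?_
      have ht : Tendsto (fun ζ : ℂ => ζ₀ + ζ) (𝓝 0) (𝓝 ζ₀) := by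
        have : Continuous fun ζ : ℂ => ζ₀ + ζ := by fun_prop
        simpa using this.tendsto 0
      filter_upwards [ht.eventually hm] with ζ hζ
      simpa [add_smul, add_assoc] using hζ
  simpa using this

end laplace

section mollify
open MeasureTheory
open scoped Convolution
variable {n : ℕ}

lemma convolution_le_circleAverage {g : Pt n → ℝ} (hg : Continuous g)
    (φ : ContDiffBump (0 : Pt n)) {z X : Pt n} {ε : ℝ}
    (h : ∀ y ∈ Metric.ball (0 : Pt n) φ.rOut,
      g (z - y) ≤ Real.circleAverage (fun ζ : ℂ => g (z - y + ζ • X)) 0 ε) :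
    (φ.normed volume ⋆[ContinuousLinearMap.lsmul ℝ ℝ, volume] g : Pt n → ℝ) z ≤
      Real.circleAverage (fun ζ : ℂ =>
        (φ.normed volume ⋆[ContinuousLinearMap.lsmul ℝ ℝ, volume] g : Pt n → ℝ) (z + ζ • X))
            0 ε := by
  have hφ : Continuous (φ.normed (volume : Measure (Pt n))) := φ.continuous_normed
  have hcs : HasCompactSupport (φ.normed (volume : Measure (Pt n))) := φ.hasCompactSupport_normed
  let F : ℝ → Pt n → ℝ := fun θ y => φ.normed volume y * g (z + circleMap 0 ε θ • X - y)
  have hF : Continuous (Function.uncurry F) := by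
    refine (hφ.comp continuous_snd).mul (hg.comp ?_)
    have : Continuous fun q : ℝ × Pt n => circleMap 0 ε q.1 :=
      (continuous_circleMap 0 ε).comp continuous_fst
    fun_prop
  have hFi : Integrable (Function.uncurry F)
      ((volume.restrict (Set.uIoc 0 (2 * Real.pi))).prod (volume : Measure (Pt n))) := by
    have h1 : IntegrableOn (Function.uncurry F)
        (Set.uIcc 0 (2 * Real.pi) ×ˢ tsupport (φ.normed (volume : Measure (Pt n))))
        (volume.prod volume) :=
      hF.continuousOn.integrableOn_compact (isCompact_uIcc.prod hcs)
    have h2 : IntegrableOn (Function.uncurry F)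
        (Set.uIcc 0 (2 * Real.pi) ×ˢ Set.univ) (volume.prod volume) := by
      refine h1.of_forall_sdiff_eq_zero (measurableSet_uIcc.prod MeasurableSet.univ) ?_
      rintro ⟨θ, y⟩ ⟨hq, hq'⟩
      have : y ∉ tsupport (φ.normed (volume : Measure (Pt n))) := fun hy => hq' ⟨hq.1, hy⟩
      simp [F, Function.uncurry, image_eq_zero_of_notMem_tsupport this]
    have h3 := h2.mono_set (Set.prod_mono (Set.uIoc_subset_uIcc (a := (0 : ℝ)) (b := 2 * Real.pi))
      (subset_refl (Set.univ : Set (Pt n))))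
    rw [IntegrableOn, ← Measure.prod_restrict, Measure.restrict_univ] at h3
    exact h3
  have hswap := intervalIntegral_integral_swap hFi
  have hR : Real.circleAverage (fun ζ : ℂ =>
        (φ.normed volume ⋆[ContinuousLinearMap.lsmul ℝ ℝ, volume] g : Pt n → ℝ) (z + ζ • X)) 0 ε =
      ∫ y, φ.normed volume y * Real.circleAverage (fun ζ : ℂ => g (z - y + ζ • X)) 0 ε := by
    have e1 : ∀ y, φ.normed volume y * Real.circleAverage (fun ζ : ℂ => g (z - y + ζ • X)) 0 ε
        = (2 * Real.pi)⁻¹ * ∫ θ in (0)..(2 * Real.pi), F θ y := by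
      intro y
      rw [Real.circleAverage_def, smul_eq_mul, intervalIntegral.integral_const_mul]
      simp only [sub_add_eq_add_sub]
      ring
    simp only [e1]
    rw [integral_const_mul, ← hswap, Real.circleAverage_def, smul_eq_mul]
    rfl
  rw [hR]
  have hcav : Continuous fun y => Real.circleAverage (fun ζ : ℂ => g (z - y + ζ • X)) 0 ε := by
    simp only [Real.circleAverage_def]
    have h0 : Continuous (Function.uncurry fun (y : Pt n) (θ : ℝ) =>
        g (z - y + circleMap 0 ε θ • X)) := by
      refine hg.comp ?_
      have : Continuous fun q : Pt n × ℝ => circleMap 0 ε q.2 :=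
        (continuous_circleMap 0 ε).comp continuous_snd
      fun_prop
    have h1 := intervalIntegral.continuous_parametric_intervalIntegral_of_continuous'
      (μ := (volume : Measure ℝ)) h0 0 (2 * Real.pi)
    exact h1.const_smul (2 * Real.pi)⁻¹
  have hcont_int : ∀ k : Pt n → ℝ, Continuous k →
      Integrable (fun y => φ.normed volume y * k y) (volume : Measure (Pt n)) := fun k hk =>
    (hφ.mul hk).integrable_of_hasCompactSupport hcs.mul_right
  refine integral_mono (hcont_int _ (by fun_prop)) (hcont_int _ hcav) fun y => ?_
  by_cases hy : y ∈ Metric.ball (0 : Pt n) φ.rOut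
  · exact mul_le_mul_of_nonneg_left (h y hy) (φ.nonneg_normed y)
  · have : φ.normed volume y = 0 := by
      rw [← Function.notMem_support, φ.support_normed_eq]; exact hy
    simp [this]

/-- Smooth approximation of functions that are not touched from above by harmonic functions. -/
lemma NoTouch.exists_smooth {g : Pt n → ℝ} {W K : Set (Pt n)} {ν : Pt n} (hn : NoTouch g W ν)
    (hW : IsOpen W) (hg : ContinuousOn g W) (hK : IsCompact K) (hKW : K ⊆ W) {δ : ℝ} (hδ : 0 < δ) :
    ∃ G : Pt n → ℝ, ContDiff ℝ ((⊤ : ℕ∞) : WithTop ℕ∞) G ∧ (∀ z ∈ K, |G z - g z| ≤ δ) ∧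
      ∀ z ∈ K, ∀ X : Pt n, (∀ c : ℂ, X ≠ c • ν) → 0 ≤ lap G z X := by
  obtain ⟨r, hr, hrW⟩ := hK.exists_cthickening_subset_open hW hKW
  have hK2 : IsCompact (Metric.cthickening r K) := hK.cthickening
  obtain ⟨gt, hgt⟩ := ContinuousMap.exists_restrict_eq hK2.isClosed
    ⟨(Metric.cthickening r K).domRestrict g, (hg.mono hrW).domRestrict⟩
  have hgt' : ∀ z ∈ Metric.cthickening r K, gt z = g z := fun z hz =>
    congrArg (fun f : C(_, ℝ) => f ⟨z, hz⟩) hgt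
  have huc := hK2.uniformContinuousOn_of_continuous gt.continuous.continuousOn
  obtain ⟨r₁, hr₁, hu⟩ := Metric.uniformContinuousOn_iff.1 huc δ hδ
  have hr2 : 0 < min (r / 2) r₁ := lt_min (by linarith) hr₁
  let φ : ContDiffBump (0 : Pt n) := ⟨min (r / 2) r₁ / 2, min (r / 2) r₁, by linarith, by linarith⟩
  have hφr : φ.rOut = min (r / 2) r₁ := rfl
  have hmem : ∀ z ∈ K, ∀ w, dist w z ≤ r → w ∈ Metric.cthickening r K := fun z hz w hw =>
    Metric.mem_cthickening_of_dist_le w z r K hz hw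
  refine ⟨(φ.normed volume ⋆[ContinuousLinearMap.lsmul ℝ ℝ, volume] gt : Pt n → ℝ), ?_, ?_, ?_⟩
  · exact φ.hasCompactSupport_normed.contDiff_convolution_left _ φ.contDiff_normed
      gt.continuous.locallyIntegrable
  · intro z hz
    have h1 : dist ((φ.normed volume ⋆[ContinuousLinearMap.lsmul ℝ ℝ, volume] gt : Pt n → ℝ) z)
        (gt z) ≤ δ := by
      refine φ.dist_normed_convolution_le gt.continuous.aestronglyMeasurable fun x hx => ?_
      rw [Metric.mem_ball, hφr] at hx
      have hx1 := hx.trans_le (min_le_left _ _)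
      have hx2 := hx.trans_le (min_le_right _ _)
      exact (hu x (hmem z hz x (by linarith)) z (hmem z hz z (by simp [hr.le])) hx2).le
    rwa [hgt' z (hmem z hz z (by simp [hr.le]))] at h1
  · intro z hz X hX
    have hsm : ContDiff ℝ ((⊤ : ℕ∞) : WithTop ℕ∞)
        (φ.normed volume ⋆[ContinuousLinearMap.lsmul ℝ ℝ, volume] gt : Pt n → ℝ) :=
      φ.hasCompactSupport_normed.contDiff_convolution_left _ φ.contDiff_normed
        gt.continuous.locallyIntegrable
    refine lap_nonneg_of_le_circleAverage hsm.continuous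
      ((hsm.contDiffAt.of_le (show ((2 : ℕ∞) : WithTop ℕ∞) ≤
          _ from WithTop.coe_le_coe.2 le_top)).twiceDiffAt) ?_
    have hpos : 0 < r / (2 * (‖X‖ + 1)) := by positivity
    filter_upwards [Ioo_mem_nhdsGT hpos] with ε hε
    refine convolution_le_circleAverage gt.continuous φ fun y hy => ?_
    rw [hφr, mem_ball_zero_iff] at hy
    have hy1 := hy.trans_le (min_le_left _ _)
    have hin : ∀ ζ ∈ Metric.closedBall (0 : ℂ) ε, z - y + ζ • X ∈ Metric.cthickening r K := by
      intro ζ hζ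
      refine hmem z hz _ ?_
      rw [dist_eq_norm]
      have e : z - y + ζ • X - z = ζ • X - y := by abel
      rw [e]
      refine (norm_sub_le _ _).trans ?_
      rw [norm_smul]
      rw [mem_closedBall_zero_iff] at hζ
      have h3 : ‖ζ‖ * ‖X‖ ≤ r / 2 := by
        have h4 := (lt_div_iff₀ (by positivity)).1 hε.2
        nlinarith [norm_nonneg ζ, norm_nonneg X, hε.1]
      linarith
    have h5 := hn.le_circleAverage hg hX hε.1 (z := z - y) fun ζ hζ => hrW (hin ζ hζ)
    rw [hgt' _ (by simpa using hin 0 (by simp [hε.1.le]))]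
    refine h5.trans_eq (Real.circleAverage_congr_sphere fun ζ hζ => ?_)
    rw [abs_of_pos hε.1] at hζ
    exact (hgt' _ (hin ζ (Metric.sphere_subset_closedBall hζ))).symm

end mollify

section root

lemma exists_continuousOn_root {Z : Type*} [TopologicalSpace Z] {W : Set Z} {x₁ x₂ : ℝ}
    (h12 : x₁ < x₂) {F : Z → ℝ → ℝ → ℝ} (hW : IsOpen W)
    (hF : ContinuousOn (fun q : Z × ℝ × ℝ => F q.1 q.2.1 q.2.2)
      (W ×ˢ (Set.Icc x₁ x₂ ×ˢ Set.Icc (-1) 1)))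
    (h1 : ∀ z ∈ W, ∀ y ∈ Set.Icc (-1 : ℝ) 1, F z x₁ y < 0)
    (h2 : ∀ z ∈ W, ∃ y ∈ Set.Icc (-1 : ℝ) 1, 0 < F z x₂ y)
    (hmono : ∀ z ∈ W, ∀ y ∈ Set.Icc (-1 : ℝ) 1, StrictMonoOn (fun x => F z x y) (Set.Icc x₁ x₂)) :
    ∃ x : Z → ℝ, ContinuousOn x W ∧ ∀ z ∈ W, x z ∈ Set.Ioo x₁ x₂ ∧
      (∃ y ∈ Set.Icc (-1 : ℝ) 1, F z (x z) y = 0) ∧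
      ∀ x' ∈ Set.Icc x₁ x₂, x' ≤ x z → ∀ y ∈ Set.Icc (-1 : ℝ) 1, F z x' y ≤ 0 := by
  have hx₁ : x₁ ∈ Set.Icc x₁ x₂ := ⟨le_rfl, h12.le⟩
  have hx₂ : x₂ ∈ Set.Icc x₁ x₂ := ⟨h12.le, le_rfl⟩
  have key : ∀ z ∈ W, ∃ x, x ∈ Set.Ioo x₁ x₂ ∧ (∃ y ∈ Set.Icc (-1 : ℝ) 1, F z x y = 0) ∧
      (∀ x' ∈ Set.Icc x₁ x₂, x' ≤ x → ∀ y ∈ Set.Icc (-1 : ℝ) 1, F z x' y ≤ 0) ∧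
      (∀ x' ∈ Set.Icc x₁ x₂, x' < x → ∀ y ∈ Set.Icc (-1 : ℝ) 1, F z x' y < 0) := by
    intro z hz
    have hFz : ContinuousOn (fun q : ℝ × ℝ => F z q.1 q.2) (Set.Icc x₁ x₂ ×ˢ Set.Icc (-1) 1) :=
      hF.comp (f := fun q : ℝ × ℝ => (z, q)) (by fun_prop) fun q hq => ⟨hz, hq⟩
    let S' : Set (ℝ × ℝ) := {q ∈ Set.Icc x₁ x₂ ×ˢ Set.Icc (-1 : ℝ) 1 | 0 ≤ F z q.1 q.2}
    have hS' : IsCompact S' := by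
      refine (isCompact_Icc.prod isCompact_Icc).of_isClosed_subset ?_ (Set.sep_subset _ _)
      exact (isClosed_Icc.prod isClosed_Icc).isClosed_le continuousOn_const hFz
    obtain ⟨y₂, hy₂, hpos⟩ := h2 z hz
    have hne : S'.Nonempty := ⟨(x₂, y₂), ⟨hx₂, hy₂⟩, hpos.le⟩
    obtain ⟨⟨x, y⟩, ⟨⟨hx, hy⟩, hF0⟩, hmin⟩ := hS'.exists_isMinOn hne (f := fun q => q.1)
      continuousOn_fst
    simp only at hx hy hF0 hmin
    have hlt : ∀ x' ∈ Set.Icc x₁ x₂, x' < x → ∀ y ∈ Set.Icc (-1 : ℝ) 1, F z x' y < 0 := by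
      intro x' hx' hxx y' hy'
      by_contra! hc
      have := hmin (show (x', y') ∈ S' from ⟨⟨hx', hy'⟩, hc⟩)
      simp only [Set.mem_ofPred_eq] at this
      exact absurd this (not_le.2 hxx)
    have hx1 : x₁ < x := lt_of_le_of_ne hx.1 fun h => by
      rw [← h] at hF0; exact absurd (h1 z hz y hy) (not_lt.2 hF0)
    have hle0 : ∀ y ∈ Set.Icc (-1 : ℝ) 1, F z x y ≤ 0 := by
      intro y' hy'
      have hc : ContinuousWithinAt (fun x => F z x y') (Set.Icc x₁ x₂) x :=
        (hFz.comp (f := fun x : ℝ => (x, y')) (by fun_prop) fun x hx => ⟨hx, hy'⟩) x hx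
      have hc2 := hc.mono (show Set.Ioo x₁ x ⊆ Set.Icc x₁ x₂ from
        fun t ht => ⟨ht.1.le, ht.2.le.trans hx.2⟩)
      have : (𝓝[Set.Ioo x₁ x] x).NeBot := by
        rw [nhdsWithin_Ioo_eq_nhdsLT hx1]; infer_instance
      refine le_of_tendsto hc2 ?_
      filter_upwards [self_mem_nhdsWithin] with t ht
      exact (hlt t ⟨ht.1.le, ht.2.le.trans hx.2⟩ ht.2 y' hy').le
    have hx2 : x < x₂ := lt_of_le_of_ne hx.2 fun h => by
      have := hle0 y₂ hy₂
      rw [h] at this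
      linarith
    refine ⟨x, ⟨hx1, hx2⟩, ⟨y, hy, le_antisymm (hle0 y hy) hF0⟩, ?_, hlt⟩
    intro x' hx' hxx y' hy'
    rcases hxx.lt_or_eq with h | h
    · exact (hlt x' hx' h y' hy').le
    · rw [h]; exact hle0 y' hy'
  choose! x hx using key
  refine ⟨x, fun z hz => ?_, fun z hz => ⟨(hx z hz).1, (hx z hz).2.1, (hx z hz).2.2.1⟩⟩
  obtain ⟨hxI, ⟨y₀, hy₀, hF0⟩, -, hlt⟩ := hx z hz
  refine ContinuousAt.continuousWithinAt (tendsto_order.2 ⟨fun a ha => ?_, fun a ha => ?_⟩)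
  · have hm : max a x₁ < x z := max_lt ha hxI.1
    obtain ⟨x', hx'1, hx'2⟩ := exists_between hm
    have hx' : x' ∈ Set.Icc x₁ x₂ := ⟨(le_max_right a x₁).trans hx'1.le, hx'2.le.trans hxI.2.le⟩
    have hev : ∀ᶠ w in 𝓝 z, ∀ y ∈ Set.Icc (-1 : ℝ) 1, y ∈ Set.Icc (-1 : ℝ) 1 → w ∈ W →
        F w x' y < 0 := by
      refine isCompact_Icc.eventually_forall_of_forall_eventually fun y hy => ?_
      have hc : ContinuousWithinAt (fun q : Z × ℝ => F q.1 x' q.2) (W ×ˢ Set.Icc (-1) 1) (z, y) :=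
        (hF.comp (f := fun q : Z × ℝ => (q.1, x', q.2)) (by fun_prop)
          fun q hq => ⟨hq.1, hx', hq.2⟩) (z, y) ⟨hz, hy⟩
      have := eventually_nhdsWithin_iff.1 (hc.eventually (gt_mem_nhds (hlt x' hx' hx'2 y hy)))
      filter_upwards [this] with q hq h1 h2 using hq ⟨h2, h1⟩
    filter_upwards [hev, hW.mem_nhds hz] with w hw hwW
    obtain ⟨hwI, ⟨y, hy, hFw⟩, -, -⟩ := hx w hwW
    by_contra! hc
    have h3 := hw y hy hy hwW
    have h4 : F w (x w) y ≤ F w x' y := (hmono w hwW y hy).monotoneOn ⟨hwI.1.le, hwI.2.le⟩ hx'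
      (hc.trans ((le_max_left a x₁).trans hx'1.le))
    linarith
  · have hm : x z < min a x₂ := lt_min ha hxI.2
    obtain ⟨x', hx'1, hx'2⟩ := exists_between hm
    have hx' : x' ∈ Set.Icc x₁ x₂ := ⟨hxI.1.le.trans hx'1.le, hx'2.le.trans (min_le_right a x₂)⟩
    have hpos : 0 < F z x' y₀ := by
      rw [← hF0]; exact hmono z hz y₀ hy₀ ⟨hxI.1.le, hxI.2.le⟩ hx' hx'1
    have hc : ContinuousWithinAt (fun w : Z => F w x' y₀) W z :=
      (hF.comp (f := fun w : Z => (w, x', y₀)) (by fun_prop) fun w hw => ⟨hw, hx', hy₀⟩) z hz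
    have h3 := hc.eventually (lt_mem_nhds hpos)
    rw [hW.nhdsWithin_eq hz] at h3
    filter_upwards [h3, hW.mem_nhds hz] with w hw hwW
    by_contra! hcon
    obtain ⟨hwI, -, -, hltw⟩ := hx w hwW
    have := hltw x' hx' ((hx'2.trans_le (min_le_left a x₂)).trans_le hcon) y₀ hy₀
    linarith

end root

section jetlog

variable {n : ℕ} {r : Pt n → ℝ} {p : Pt n}

lemma lap_clm {F F' : Type*} [NormedAddCommGroup F] [NormedSpace ℝ F] [NormedAddCommGroup F']
    [NormedSpace ℝ F'] (A : F →L[ℝ] F') {f : Pt n → F} (hf : ContDiffAt ℝ 2 f p) (X : Pt n) :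
    lap (fun z => A (f z)) p X = A (lap f p X) := by
  have hev : ∀ᶠ w in 𝓝 p, DifferentiableAt ℝ f w :=
    (hf.eventually (by norm_num)).mono fun w hw => hw.differentiableAt (by norm_num)
  have h1 : fderiv ℝ (fun z => A (f z)) =ᶠ[𝓝 p] fun w => A.comp (fderiv ℝ f w) := by
    filter_upwards [hev] with w hw
    exact (A.hasFDerivAt.comp w hw.hasFDerivAt).fderiv
  have hd : DifferentiableAt ℝ (fderiv ℝ f) p :=
    (hf.fderiv_right (m := 1) (by norm_num)).differentiableAt (by norm_num)
  have h2 : fderiv ℝ (fderiv ℝ (fun z => A (f z))) p =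
      (ContinuousLinearMap.compL ℝ (Pt n) F F' A).comp (fderiv ℝ (fderiv ℝ f) p) := by
    rw [h1.fderiv_eq]
    exact (((ContinuousLinearMap.compL ℝ (Pt n) F F' A).hasFDerivAt).comp p
      hd.hasFDerivAt).fderiv
  simp only [lap, lapB, h2]
  simp

lemma wd_cR_re {f : Pt n → ℂ} (hf : DifferentiableAt ℝ f p) (X : Pt n) :
    wd (cR n fun z => (f z).re) p X = 1 / 2 * (wd f p X + (starRingEnd ℂ) (wdb f p X)) := by
  have hc : DifferentiableAt ℝ (fun w => (starRingEnd ℂ) (f w)) p :=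
    (conjCLE.toContinuousLinearMap.differentiableAt).comp p hf
  have h1 : (cR n fun z => (f z).re) = fun w => (1 / 2 : ℂ) * (f w + (starRingEnd ℂ) (f w)) := by
    funext w
    simp only [cR, add_conj]
    push_cast
    ring
  rw [h1, wd_const_mul (f := fun w => f w + (starRingEnd ℂ) (f w)) _ (hf.add hc), wd_add hf hc,
    wd_conj hf]

lemma hasFDerivAt_cexp_linear (ℓ : Pt n →L[ℂ] ℂ) (z : Pt n) :
    HasFDerivAt (fun w => cexp (ℓ (w - p))) (cexp (ℓ (z - p)) • ℓ.restrictScalars ℝ) z := by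
  have h1 : HasFDerivAt (fun w : Pt n => ℓ (w - p)) ℓ z := by
    exact ((ℓ.hasFDerivAt (x := z - p)).comp z ((hasFDerivAt_id z).sub_const p) :)
  exact (h1.cexp).restrictScalars ℝ

lemma wd_cexp_linear (ℓ : Pt n →L[ℂ] ℂ) (z X : Pt n) :
    wd (fun w => cexp (ℓ (w - p))) z X = ℓ X * cexp (ℓ (z - p)) := by
  simp only [wd, (hasFDerivAt_cexp_linear ℓ z).fderiv, smul_apply,
    ContinuousLinearMap.coe_restrictScalars', map_smul, smul_eq_mul]
  linear_combination (-(1 / 2 : ℂ) * cexp (ℓ (z - p)) * ℓ X) * I_sq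

lemma wdb_cexp_linear (ℓ : Pt n →L[ℂ] ℂ) (z X : Pt n) :
    wdb (fun w => cexp (ℓ (w - p))) z X = 0 := by
  simp only [wdb, (hasFDerivAt_cexp_linear ℓ z).fderiv, smul_apply,
    ContinuousLinearMap.coe_restrictScalars', map_smul, smul_eq_mul]
  linear_combination ((1 / 2 : ℂ) * cexp (ℓ (z - p)) * ℓ X) * I_sq

lemma contDiff_cexp_linear (ℓ : Pt n →L[ℂ] ℂ) {m : WithTop ℕ∞} :
    ContDiff ℝ m (fun w : Pt n => cexp (ℓ (w - p))) :=
  (((ℓ.contDiff.comp (contDiff_id.sub contDiff_const)).cexp).restrict_scalars ℝ)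

lemma lap_cexp_linear (ℓ : Pt n →L[ℂ] ℂ) (z X : Pt n) :
    lap (fun w => cexp (ℓ (w - p))) z X = 0 := by
  rw [← wdb_wd_eq_lap (contDiff_cexp_linear ℓ).contDiffAt]
  simp only [wd_cexp_linear]
  rw [wdb_const_mul _ ((contDiff_cexp_linear (m := 1) ℓ).contDiffAt.differentiableAt (by norm_num)),
    wdb_cexp_linear, mul_zero]

lemma fderiv_eq_wd_add_wdb (f : Pt n → ℂ) (z X : Pt n) : fderiv ℝ f z X = wd f z X + wdb f z X := by
  simp only [wd, wdb]
  ring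

/-- A second order model of `log |∂r/∂ν|` at a boundary point, corrected by a linear phase. -/
lemma exists_jet (h : ContDiffAt ℝ 3 r p) (h0 : fderiv ℝ r p ≠ 0) :
    ∃ (ℓ : Pt n →L[ℂ] ℂ) (T : Pt n → ℝ) (q : Pt n → ℂ),
      (∀ z, q z = (starRingEnd ℂ) (HH r (nuv r p) z) * cexp (ℓ (z - p))) ∧
      ContDiff ℝ ((⊤ : ℕ∞) : WithTop ℕ∞) T ∧ (∀ X, wd (cR n T) p X = om r p X) ∧
      (∀ L ∈ nullSp n r p, lap T p L = -(dlb r p L).re) ∧ q p = 1 ∧ ContinuousAt q p ∧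
      (∀ ε > 0, ∀ᶠ z in 𝓝 p, |Real.log (q z).re - T z| ≤ ε * ‖z - p‖ ^ 2) ∧
      ∀ ε > 0, ∀ᶠ z in 𝓝 p, |(q z).im| ≤ ε * ‖z - p‖ := by
  set G : Pt n → ℂ := fun z => (starRingEnd ℂ) (HH r (nuv r p) z) with hG
  have hd : DifferentiableAt ℝ r p := h.differentiableAt (by norm_num)
  have hHH : ContDiffAt ℝ 2 (HH r (nuv r p)) p := contDiffAt_HH (m := 2) (by exact_mod_cast h) _
  have hHd : DifferentiableAt ℝ (HH r (nuv r p)) p := hHH.differentiableAt (by norm_num)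
  have hGc : ContDiffAt ℝ 2 G p := conjCLE.contDiff.contDiffAt.comp p hHH
  have hGd : DifferentiableAt ℝ G p := hGc.differentiableAt (by norm_num)
  have hGp : G p = 1 := by simp [hG, HH_nuv_self hd h0]
  set ℓ : Pt n →L[ℂ] ℂ := ∑ j, ((dAngelo n r).w p j - dZ n G j p) •
    (ContinuousLinearMap.proj j : Pt n →L[ℂ] ℂ) with hℓ
  have hℓX : ∀ X, ℓ X = om r p X - wd G p X := by
    intro X
    rw [← sum_dZ, om, ← Finset.sum_sub_distrib, hℓ]
    simp only [sum_apply, smul_apply, ContinuousLinearMap.proj_apply, smul_eq_mul]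
    exact Finset.sum_congr rfl fun j _ => by ring
  set E : Pt n → ℂ := fun w => cexp (ℓ (w - p)) with hE
  have hEc : ContDiffAt ℝ 2 E p := (contDiff_cexp_linear ℓ).contDiffAt
  have hEd : DifferentiableAt ℝ E p := hEc.differentiableAt (by norm_num)
  have hEp : E p = 1 := by simp [hE]
  set q : Pt n → ℂ := fun z => G z * E z with hq
  have hqc : ContDiffAt ℝ 2 q p := hGc.mul hEc
  have hqd : DifferentiableAt ℝ q p := hqc.differentiableAt (by norm_num)
  have hqp : q p = 1 := by simp [hq, hGp, hEp]
  have hwdbG : ∀ X, wdb G p X = (starRingEnd ℂ) (om r p X) := by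
    intro X
    rw [wdb_conj hHd, wd_HH_nuv (h.of_le (by norm_num)) h0]
  have hwdq : ∀ X, wd q p X = om r p X := by
    intro X
    rw [wd_mul hGd hEd, wd_cexp_linear, hGp, hEp, hℓX, sub_self, map_zero, Complex.exp_zero]
    ring
  have hwdbq : ∀ X, wdb q p X = (starRingEnd ℂ) (om r p X) := by
    intro X
    rw [wdb_mul hGd hEd, wdb_cexp_linear, hGp, hEp, hwdbG]
    ring
  set v : Pt n → ℝ := fun z => Real.log (q z).re with hv
  have hrec : ContDiffAt ℝ 2 (fun z => (q z).re) p := reCLM.contDiff.contDiffAt.comp p hqc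
  have hre1 : (q p).re = 1 := by simp [hqp]
  have hvc : ContDiffAt ℝ 2 v p := hrec.log (by simp [hqp])
  have hvt : TwiceDiffAt v p := hvc.twiceDiffAt
  have hlog : ContDiffAt ℝ 2 Real.log ((fun z => (q z).re) p) :=
    Real.contDiffAt_log.2 (by simp [hqp])
  have hwdre : ∀ X, wd (cR n fun z => (q z).re) p X = om r p X := by
    intro X
    rw [wd_cR_re hqd, hwdq, hwdbq, conj_conj]
    ring
  have hfv : fderiv ℝ v p = fderiv ℝ (fun z => (q z).re) p := by
    rw [hv, fderiv.log (hrec.differentiableAt (by norm_num)) (by simp [hqp]), hre1, inv_one,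
      one_smul]
  refine ⟨ℓ, jet2 v p, q, fun z => rfl, contDiff_jet2 _ _, fun X => ?_, fun L hL => ?_, hqp,
    hqc.continuousAt, fun ε hε => hvt.taylor hε, fun ε hε => ?_⟩
  · rw [← hwdre X, wd_cR (hasFDerivAt_jet2 hvt p).differentiableAt,
      wd_cR (hrec.differentiableAt (by norm_num)), fderiv_jet2 hvt, hfv.symm]
    simp
  · rw [lap_jet2 hvt, hv, lap_comp hrec hlog, hwdre, show lap (fun z => (q z).re) p L =
      (lap q p L).re from lap_clm reCLM hqc L, hq, lap_mul hGc hEc,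
      lap_cexp_linear, wdb_cexp_linear, wd_cexp_linear, hwdbG, hEp, hGp, hℓX,
      dlb_null h h0 hL]
    have e1 : deriv Real.log 1 = 1 := by simp
    have e2 : deriv (deriv Real.log) 1 = -1 := by
      rw [Real.deriv_log']
      simp [deriv_inv]
    have e3 : lap G p L = (starRingEnd ℂ) (lap (HH r (nuv r p)) p L) := by
      exact lap_clm conjCLE.toContinuousLinearMap hHH L
    have e4 : wd G p L = (starRingEnd ℂ) (wdb (HH r (nuv r p)) p L) := wd_conj hHd L
    rw [e3, e4, hre1, e1, e2]
    simp only [normSq_apply, sub_self, map_zero, Complex.exp_zero]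
    simp
    ring
  · have him : HasFDerivAt (fun z => (q z).im) (0 : Pt n →L[ℝ] ℝ) p := by
      have h1 := imCLM.hasFDerivAt.comp p hqd.hasFDerivAt
      have h2 : imCLM.comp (fderiv ℝ q p) = 0 := by
        ext X
        simp [fderiv_eq_wd_add_wdb, hwdq, hwdbq]
      rw [h2] at h1
      exact h1
    have := (hasFDerivAt_iff_isLittleO.1 him).bound hε
    filter_upwards [this] with z hz
    simpa [hqp] using hz

end jetlog

section coarse

variable {n : ℕ} {ρ : Pt n → ℝ} {p ν : Pt n}

lemma fderiv_complex_smul {h0 : ℝ} (hν : fderiv ℝ ρ p ν = h0)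
    (hν' : fderiv ℝ ρ p (Complex.I • ν) = 0) (c : ℂ) : fderiv ℝ ρ p (c • ν) = c.re * h0 := by
  rw [complex_smul_eq, map_add, map_smul, map_smul, hν, hν']
  simp

/-- First order behaviour of `ρ` along short discs in the direction `ν`. -/
lemma exists_disc_estimate (hρ : ContDiffAt ℝ 1 ρ p) {h0 : ℝ} (hh0 : 0 < h0)
    (hν : fderiv ℝ ρ p ν = h0) (hν' : fderiv ℝ ρ p (Complex.I • ν) = 0) {a : Pt n → ℂ}
    (ha : ContinuousAt a p) (ha0 : a p = 0) {M d : ℝ} (hM : 0 ≤ M) (hd : 0 < d)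
    {N : Set (Pt n)} (hN : N ∈ 𝓝 p) :
    ∃ R > 0, ∃ δ > 0, ∃ t₀ > 0, ∀ z ∈ Metric.ball p R, z ∈ N ∧ ∀ t : ℝ, 0 < t → t < t₀ →
      |ρ z| ≤ δ * t → ∀ w : ℂ, ‖w‖ ≤ M →
        z + ((t : ℂ) * w * cexp (a z)) • ν ∈ N ∧
        |ρ (z + ((t : ℂ) * w * cexp (a z)) • ν) / (h0 * t) - w.re| ≤ d ∧
        ∀ w' : ℂ, ‖w'‖ ≤ M → w'.im = w.im → w.re ≤ w'.re →
          (1 - d) * (w'.re - w.re) ≤ ρ (z + ((t : ℂ) * w' * cexp (a z)) • ν) / (h0 * t) -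
            ρ (z + ((t : ℂ) * w * cexp (a z)) • ν) / (h0 * t) := by
  set e1 : ℝ := min 1 (d / (3 * (M + 1))) with he1
  have he1p : 0 < e1 := by positivity
  have he11 : e1 ≤ 1 := min_le_left _ _
  have he1d : e1 * (M + 1) ≤ d / 3 := by
    calc e1 * (M + 1) ≤ d / (3 * (M + 1)) * (M + 1) := by
          gcongr
          exact min_le_right _ _
      _ = d / 3 := by field_simp
  set ε : ℝ := d * h0 / (6 * (M + 1) * (‖ν‖ + 1)) with hε
  have hεp : 0 < ε := by positivity
  have hεd : ε * (2 * (‖ν‖ + 1)) * (M + 1) = d / 3 * h0 := by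
    rw [hε]
    field_simp
    ring
  obtain ⟨δ1, hδ1, hstr⟩ := exists_ball_strict hρ hεp
  obtain ⟨δ2, hδ2, hNb⟩ := Metric.mem_nhds_iff.1 hN
  have hexp : ContinuousAt (fun z => cexp (a z)) p := ha.cexp
  have hev : ∀ᶠ z in 𝓝 p, ‖cexp (a z) - 1‖ < e1 := by
    have h1 : Tendsto (fun z => ‖cexp (a z) - 1‖) (𝓝 p) (𝓝 0) := by
      have := (hexp.sub (continuousAt_const (y := (1 : ℂ)))).norm
      simpa [ContinuousAt, ha0] using this
    exact h1.eventually (gt_mem_nhds he1p)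
  obtain ⟨δ3, hδ3, hexpb⟩ := Metric.eventually_nhds_iff_ball.1 hev
  set D : ℝ := min δ1 δ2 with hD
  have hDp : 0 < D := lt_min hδ1 hδ2
  refine ⟨min (D / 2) δ3, by positivity, d * h0 / 3, by positivity,
    D / (4 * (M + 1) * (‖ν‖ + 1)), by positivity, fun z hz => ⟨hNb ?_, ?_⟩⟩
  · exact Metric.ball_subset_ball
      ((min_le_left _ _).trans ((half_le_self hDp.le).trans (min_le_right _ _))) hz
  intro t ht ht0 hρz w hw
  have hzD : ‖z - p‖ < D / 2 := by
    rw [← dist_eq_norm]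
    exact lt_of_lt_of_le hz (min_le_left _ _)
  have hze : ‖cexp (a z) - 1‖ < e1 :=
    hexpb z (Metric.ball_subset_ball (min_le_right _ _) hz)
  have hzn : ‖cexp (a z)‖ ≤ 2 := by
    calc ‖cexp (a z)‖ = ‖(cexp (a z) - 1) + 1‖ := by ring_nf
      _ ≤ ‖cexp (a z) - 1‖ + 1 := by simpa using norm_add_le (cexp (a z) - 1) 1
      _ ≤ 2 := by linarith
  have hnorm : ∀ u : ℂ, ‖((t : ℂ) * u * cexp (a z)) • ν‖ ≤ t * ‖u‖ * (2 * (‖ν‖ + 1)) := by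
    intro u
    rw [norm_smul, norm_mul, norm_mul, Complex.norm_real, Real.norm_of_nonneg ht.le]
    calc t * ‖u‖ * ‖cexp (a z)‖ * ‖ν‖ ≤ t * ‖u‖ * 2 * (‖ν‖ + 1) := by
          gcongr
          linarith
      _ = _ := by ring
  have hball : ∀ u : ℂ, ‖u‖ ≤ M → z + ((t : ℂ) * u * cexp (a z)) • ν ∈ Metric.ball p D := by
    intro u hu
    have h1 : t * ‖u‖ * (2 * (‖ν‖ + 1)) ≤ t * (M + 1) * (2 * (‖ν‖ + 1)) := by
      gcongr
      linarith
    have h2 : t * (M + 1) * (2 * (‖ν‖ + 1)) < D / 2 := by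
      rw [lt_div_iff₀ (by positivity)] at ht0
      linarith
    rw [Metric.mem_ball, dist_eq_norm]
    calc ‖z + ((t : ℂ) * u * cexp (a z)) • ν - p‖
        = ‖(z - p) + ((t : ℂ) * u * cexp (a z)) • ν‖ := by congr 1; abel
      _ ≤ ‖z - p‖ + t * ‖u‖ * (2 * (‖ν‖ + 1)) := (norm_add_le _ _).trans (by gcongr; exact hnorm u)
      _ < D := by linarith
  have hht : 0 < h0 * t := by positivity
  have hre : ∀ u : ℂ, |((t : ℂ) * u * cexp (a z)).re - t * u.re| ≤ t * ‖u‖ * e1 := by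
    intro u
    have h1 : ((t : ℂ) * u * cexp (a z)).re - t * u.re =
        ((t : ℂ) * (u * (cexp (a z) - 1))).re := by
      rw [mul_sub, mul_sub, sub_re, mul_assoc, mul_one, re_ofReal_mul _ u]
    rw [h1]
    refine (abs_re_le_norm _).trans ?_
    rw [norm_mul, norm_mul, Complex.norm_real, Real.norm_of_nonneg ht.le, mul_assoc]
    gcongr
  have hdiff : ∀ u v : ℂ, ‖u‖ ≤ M → ‖v‖ ≤ M →
      |(ρ (z + ((t : ℂ) * u * cexp (a z)) • ν) - ρ (z + ((t : ℂ) * v * cexp (a z)) • ν)) / (h0 * t)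
        - (u - v).re| ≤ ‖u - v‖ * (e1 + ε * (2 * (‖ν‖ + 1)) / h0) := by
    intro u v hu hv
    have h1 := hstr _ (Metric.ball_subset_ball (min_le_left _ _) (hball u hu)) _
      (Metric.ball_subset_ball (min_le_left _ _) (hball v hv))
    have h2 : z + ((t : ℂ) * u * cexp (a z)) • ν - (z + ((t : ℂ) * v * cexp (a z)) • ν) =
        ((t : ℂ) * (u - v) * cexp (a z)) • ν := by
      rw [add_sub_add_left_eq_sub, ← sub_smul]
      congr 1
      ring
    rw [h2, fderiv_complex_smul hν hν'] at h1
    have h3 := h1.trans (mul_le_mul_of_nonneg_left (hnorm (u - v)) hεp.le)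
    have h4 := hre (u - v)
    generalize ρ (z + ((t : ℂ) * u * cexp (a z)) • ν) = A at *
    generalize ρ (z + ((t : ℂ) * v * cexp (a z)) • ν) = B at *
    generalize ((t : ℂ) * (u - v) * cexp (a z)).re = C at *
    have h5 : (A - B) / (h0 * t) - (u - v).re =
        (A - B - C * h0) / (h0 * t) + (C - t * (u - v).re) / t := by
      field_simp
      ring
    rw [h5]
    refine (abs_add_le _ _).trans ?_
    rw [abs_div, abs_div, abs_of_pos hht, abs_of_pos ht]
    have h6 : |A - B - C * h0| / (h0 * t) ≤ ε * (t * ‖u - v‖ * (2 * (‖ν‖ + 1))) / (h0 * t) := by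
      gcongr
    have h7 : |C - t * (u - v).re| / t ≤ t * ‖u - v‖ * e1 / t := by gcongr
    have h8 : ε * (t * ‖u - v‖ * (2 * (‖ν‖ + 1))) / (h0 * t) =
      ‖u - v‖ * (ε * (2 * (‖ν‖ + 1)) / h0) := by field_simp
    have h9 : t * ‖u - v‖ * e1 / t = ‖u - v‖ * e1 := by field_simp
    linarith
  have hsum : (e1 + ε * (2 * (‖ν‖ + 1)) / h0) * (M + 1) ≤ 2 * d / 3 := by
    have : ε * (2 * (‖ν‖ + 1)) / h0 * (M + 1) = d / 3 := by
      rw [div_mul_eq_mul_div, hεd]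
      field_simp
    linarith
  have hsp : 0 ≤ e1 + ε * (2 * (‖ν‖ + 1)) / h0 := by positivity
  refine ⟨hNb (Metric.ball_subset_ball (min_le_right _ _) (hball w hw)), ?_, ?_⟩
  · have h1 := hdiff w 0 hw (by simpa using hM)
    simp only [mul_zero, zero_mul, zero_smul, add_zero, sub_zero] at h1
    have h2 : |ρ z / (h0 * t)| ≤ d / 3 := by
      rw [abs_div, abs_of_pos hht, div_le_iff₀ hht]
      linarith
    have h3 : ‖w‖ * (e1 + ε * (2 * (‖ν‖ + 1)) / h0) ≤ 2 * d / 3 := by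
      refine le_trans ?_ hsum
      rw [mul_comm]
      gcongr
      linarith
    have h4 := abs_le.1 (h1.trans h3)
    have h5 := abs_le.1 h2
    rw [sub_div] at h4
    rw [abs_le]
    constructor <;> linarith [h4.1, h4.2, h5.1, h5.2]
  · intro w' hw' him hle
    have h1 := hdiff w' w hw' hw
    have h2 : ‖w' - w‖ = w'.re - w.re := by
      have : w' - w = ((w'.re - w.re : ℝ) : ℂ) := by
        apply Complex.ext <;> simp [him]
      rw [this, Complex.norm_real, Real.norm_of_nonneg (by linarith)]
    rw [h2, sub_div, sub_re] at h1
    have h3 : e1 + ε * (2 * (‖ν‖ + 1)) / h0 ≤ d := by nlinarith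
    have h4 := (abs_le.1 h1).1
    nlinarith [mul_le_mul_of_nonneg_left h3 (sub_nonneg.2 hle)]

end coarse

section scalar

/-- The derivative of `βf`. -/
noncomputable def βd (η κ x : ℝ) : ℝ := -(κ / η) / (1 + κ - κ * x) - (η - 1) / η / x

/-- The second derivative of `βf`. -/
noncomputable def βdd (η κ x : ℝ) : ℝ :=
  -(κ ^ 2 / η) / (1 + κ - κ * x) ^ 2 + (η - 1) / η / x ^ 2

/-- The logarithm of the boundary slope in terms of the touching parameter. -/
noncomputable def βf (η κ x : ℝ) : ℝ :=
  1 / η * Real.log (1 + κ - κ * x) - (η - 1) / η * Real.log x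

lemma hasDerivAt_βf {η κ x : ℝ} (hx : x ≠ 0) (hκ : 1 + κ - κ * x ≠ 0) :
    HasDerivAt (βf η κ) (βd η κ x) x := by
  have h1 : HasDerivAt (fun x => 1 + κ - κ * x) (-κ) x := by
    simpa using ((hasDerivAt_id x).const_mul κ).const_sub (1 + κ)
  have h2 := ((h1.log hκ).const_mul (1 / η)).sub
    ((Real.hasDerivAt_log hx).const_mul ((η - 1) / η))
  refine h2.congr_deriv ?_
  simp only [βd]
  ring

lemma hasDerivAt_βd {η κ x : ℝ} (hx : x ≠ 0) (hκ : 1 + κ - κ * x ≠ 0) :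
    HasDerivAt (βd η κ) (βdd η κ x) x := by
  have h1 : HasDerivAt (fun x => 1 + κ - κ * x) (-κ) x := by
    simpa using ((hasDerivAt_id x).const_mul κ).const_sub (1 + κ)
  have h2 := ((h1.inv hκ).const_mul (-(κ / η))).sub
    ((hasDerivAt_inv hx).const_mul ((η - 1) / η))
  refine (h2.congr_deriv ?_)
  simp only [βdd]
  field_simp
  ring

lemma one_sub_rpow_lt {η κ ι : ℝ} (hη : 1 < η) (hκ : 0 < κ) (hι : 0 < ι) (hι1 : ι < 1) :
    (1 - ι) ^ η < (1 + κ) * (1 - ι) - κ * (1 - ι) ^ 2 := by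
  have h1 : 0 < 1 - ι := by linarith
  have h2 : 1 + η * (ι / (1 - ι)) ≤ (1 + ι / (1 - ι)) ^ η :=
    one_add_mul_self_le_rpow_one_add (by have : 0 < ι / (1 - ι) := by positivity
                                         linarith) hη.le
  have h3 : 1 + ι / (1 - ι) = (1 - ι)⁻¹ := by field_simp; ring
  rw [h3, Real.inv_rpow h1.le] at h2
  have h4 : 0 < (1 - ι) ^ η := by positivity
  generalize (1 - ι) ^ η = Y at *
  have h5 : Y * (1 + η * (ι / (1 - ι))) ≤ 1 := by
    calc Y * (1 + η * (ι / (1 - ι))) ≤ Y * Y⁻¹ := by gcongr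
      _ = 1 := mul_inv_cancel₀ h4.ne'
  have h6 : Y * (1 - ι + η * ι) ≤ 1 - ι := by
    have : Y * (1 - ι + η * ι) = Y * (1 + η * (ι / (1 - ι))) * (1 - ι) := by field_simp
    rw [this]
    nlinarith
  have h7 : Y ≤ 1 - ι := by nlinarith [mul_pos h4 hι]
  nlinarith [mul_pos (mul_pos hκ hι) h1]

lemma lt_one_add_rpow {η κ ι : ℝ} (hη : 1 < η) (hκ : 0 < κ) (hι : 0 < ι) :
    (1 + κ) * (1 + ι) - κ * (1 + ι) ^ 2 < (1 + ι) ^ η := by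
  have h2 : 1 + η * ι ≤ (1 + ι) ^ η := one_add_mul_self_le_rpow_one_add (by linarith) hη.le
  nlinarith [mul_pos (sub_pos.2 hη) hι, mul_pos hκ hι, mul_pos (mul_pos hκ hι) hι]

lemma exists_touch_parameters {η c : ℝ} (hη : 1 < η) (hc : c < η / (η - 1)) :
    ∃ κ ι d : ℝ, 0 < κ ∧ κ ≤ 1 ∧ 0 < ι ∧ ι ≤ 1 / 4 ∧ 0 < d ∧ d ≤ 1 / 4 ∧
      (∀ x ∈ Set.Icc (1 - 2 * ι) (1 + 2 * ι), c * βd η κ x ^ 2 ≤ βdd η κ x) ∧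
      (1 - ι + d) ^ η < (1 + κ) * (1 - ι) - κ * (1 - ι) ^ 2 ∧
      (1 + κ) * (1 + ι) - κ * (1 + ι) ^ 2 < (1 + ι - d) ^ η ∧
      (1 + ι + d) ^ η - (1 + κ) * (1 - ι) + κ * (1 + ι) ^ 2 < κ ∧
      1 + κ - 2 * κ * (1 - ι) < η * (1 - ι - d) ^ (η - 1) * (1 - d) := by
  have hη0 : 0 < η - 1 := by linarith
  have hκe : ∀ᶠ κ in 𝓝 (0 : ℝ), c * βd η κ 1 ^ 2 < βdd η κ 1 := by
    have h1 : ContinuousAt (fun κ => c * βd η κ 1 ^ 2) 0 := by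
      unfold βd
      fun_prop (disch := norm_num)
    have h2 : ContinuousAt (fun κ => βdd η κ 1) 0 := by
      unfold βdd
      fun_prop (disch := norm_num)
    refine h1.eventually_lt h2 ?_
    rw [lt_div_iff₀ hη0] at hc
    simp only [βd, βdd]
    have h3 : 0 < (η - 1) / η := by positivity
    have h4 : c * ((η - 1) / η) < 1 := by
      rw [mul_div_assoc', div_lt_one (by linarith)]
      exact hc
    norm_num
    nlinarith
  obtain ⟨κ, hκ, hκ1⟩ := ((hκe.filter_mono nhdsWithin_le_nhds).and
    (Ioo_mem_nhdsGT (zero_lt_one' ℝ))).exists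
  have hκ0 : 0 < κ := hκ1.1
  have hxe : ∀ᶠ x in 𝓝 (1 : ℝ), c * βd η κ x ^ 2 < βdd η κ x := by
    have h1 : ContinuousAt (fun x => c * βd η κ x ^ 2) 1 := by
      have : 1 + κ - κ * 1 ≠ 0 := by norm_num
      exact ((hasDerivAt_βd one_ne_zero this).continuousAt.pow 2).const_mul c
    have h2 : ContinuousAt (fun x => βdd η κ x) 1 := by
      unfold βdd
      fun_prop (disch := norm_num)
    exact h1.eventually_lt h2 hκ
  obtain ⟨τ, hτ, hτb⟩ := Metric.eventually_nhds_iff_ball.1 hxe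
  have hι3 : ∀ᶠ ι in 𝓝 (0 : ℝ), (1 + ι + 0) ^ η - (1 + κ) * (1 - ι) + κ * (1 + ι) ^ 2 < κ := by
    have h1 : ContinuousAt
        (fun ι : ℝ => (1 + ι + 0) ^ η - (1 + κ) * (1 - ι) + κ * (1 + ι) ^ 2) 0 := by
      fun_prop (disch := norm_num)
    refine h1.eventually_lt continuousAt_const ?_
    norm_num
    linarith
  have hι4 : ∀ᶠ ι in 𝓝 (0 : ℝ),
      1 + κ - 2 * κ * (1 - ι) < η * (1 - ι - 0) ^ (η - 1) * (1 - 0) := by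
    have h1 : ContinuousAt (fun ι : ℝ => 1 + κ - 2 * κ * (1 - ι)) 0 := by fun_prop
    have h2 : ContinuousAt (fun ι : ℝ => η * (1 - ι - 0) ^ (η - 1) * (1 - 0)) 0 := by
      fun_prop (disch := norm_num)
    refine h1.eventually_lt h2 ?_
    norm_num
    linarith
  obtain ⟨ι, ⟨h3, h4⟩, hι⟩ := (((hι3.and hι4).filter_mono nhdsWithin_le_nhds).and
    (Ioo_mem_nhdsGT (show (0 : ℝ) < min (1 / 4) (τ / 2) by positivity))).exists
  have hι14 : ι < 1 / 4 := hι.2.trans_le (min_le_left _ _)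
  have hιτ : ι < τ / 2 := hι.2.trans_le (min_le_right _ _)
  have hι0 : 0 < ι := hι.1
  have hr : ∀ b e : ℝ, 0 < b → ContinuousAt (fun d : ℝ => (b + d) ^ e) 0 := fun b e hb =>
    ContinuousAt.rpow_const (by fun_prop) (Or.inl (by simpa using hb.ne'))
  have hr' : ∀ b e : ℝ, 0 < b → ContinuousAt (fun d : ℝ => (b - d) ^ e) 0 := fun b e hb =>
    ContinuousAt.rpow_const (by fun_prop) (Or.inl (by simpa using hb.ne'))
  have d1 : ∀ᶠ d in 𝓝 (0 : ℝ), (1 - ι + d) ^ η < (1 + κ) * (1 - ι) - κ * (1 - ι) ^ 2 := by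
    have h1 : ContinuousAt (fun d : ℝ => (1 - ι + d) ^ η) 0 := by
      exact hr (1 - ι) η (by linarith)
    refine h1.eventually_lt continuousAt_const ?_
    simpa using one_sub_rpow_lt hη hκ0 hι0 (by linarith)
  have d2 : ∀ᶠ d in 𝓝 (0 : ℝ), (1 + κ) * (1 + ι) - κ * (1 + ι) ^ 2 < (1 + ι - d) ^ η := by
    have h1 : ContinuousAt (fun d : ℝ => (1 + ι - d) ^ η) 0 := by
      exact hr' (1 + ι) η (by linarith)
    refine continuousAt_const.eventually_lt h1 ?_
    simpa using lt_one_add_rpow hη hκ0 hι0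
  have d3 : ∀ᶠ d in 𝓝 (0 : ℝ), (1 + ι + d) ^ η - (1 + κ) * (1 - ι) + κ * (1 + ι) ^ 2 < κ := by
    have h1 : ContinuousAt
        (fun d : ℝ => (1 + ι + d) ^ η - (1 + κ) * (1 - ι) + κ * (1 + ι) ^ 2) 0 := by
      exact ((hr (1 + ι) η (by linarith)).sub continuousAt_const).add continuousAt_const
    exact h1.eventually_lt continuousAt_const h3
  have d4 : ∀ᶠ d in 𝓝 (0 : ℝ),
      1 + κ - 2 * κ * (1 - ι) < η * (1 - ι - d) ^ (η - 1) * (1 - d) := by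
    have h2 : ContinuousAt (fun d : ℝ => η * (1 - ι - d) ^ (η - 1) * (1 - d)) 0 := by
      exact ((hr' (1 - ι) (η - 1) (by linarith)).const_mul η).mul (by fun_prop)
    exact continuousAt_const.eventually_lt h2 h4
  obtain ⟨d, ⟨⟨d1, d2⟩, d3, d4⟩, hd⟩ := ((((d1.and d2).and (d3.and d4)).filter_mono
    nhdsWithin_le_nhds).and (Ioo_mem_nhdsGT (show (0 : ℝ) < 1 / 4 by norm_num))).exists
  refine ⟨κ, ι, d, hκ0, hκ1.2.le, hι0, hι14.le, hd.1, hd.2.le, fun x hx => ?_, d1, d2, d3, d4⟩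
  refine (hτb x ?_).le
  rw [Metric.mem_ball, Real.dist_eq, abs_lt]
  constructor <;> linarith [hx.1, hx.2]

end scalar

section touch

variable {n : ℕ} {ρ : Pt n → ℝ} {p ν : Pt n}

lemma rpow_tangent_le {η a b : ℝ} (hη : 1 ≤ η) (ha : 0 < a) (hb : 0 ≤ b) :
    a ^ η + η * a ^ (η - 1) * (b - a) ≤ b ^ η := by
  have h1 : 1 + η * (b / a - 1) ≤ (1 + (b / a - 1)) ^ η :=
    one_add_mul_self_le_rpow_one_add (by have : 0 ≤ b / a := by positivity
                                         linarith) hη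
  rw [add_sub_cancel, Real.div_rpow hb ha.le, le_div_iff₀ (by positivity)] at h1
  rw [Real.rpow_sub_one ha.ne']
  refine le_trans (le_of_eq ?_) h1
  field_simp

/-- The end point of the disc of size `t` with complex parameter `w` attached at `z`. -/
noncomputable def tip (ℓ : Pt n →L[ℂ] ℂ) (p ν : Pt n) (t : ℝ) (z : Pt n) (w : ℂ) : Pt n :=
  z + ((t : ℂ) * w * cexp (ℓ (z - p))) • ν

lemma continuous_tip (ℓ : Pt n →L[ℂ] ℂ) (t : ℝ) :
    Continuous fun q : Pt n × ℂ => tip ℓ p ν t q.1 q.2 := by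
  unfold tip
  fun_prop

lemma rpow_twiceDiffAt_lap_pos {Ω V U : Set (Pt n)} {η : ℝ} (h : IsDefining n 1 Ω ρ V)
    (hpsh : StrictPSHOn n (fun z => ρ z ^ η) ((closure Ω)ᶜ ∩ U)) {z : Pt n} (hz : z ∈ V)
    (hzU : z ∈ U) (hpos : 0 < ρ z) :
    TwiceDiffAt (fun z => ρ z ^ η) z ∧ ∀ X, X ≠ 0 → 0 < lap (fun z => ρ z ^ η) z X := by
  have hmem : z ∈ (closure Ω)ᶜ ∩ U := ⟨h.notMem_closure hz hpos, hzU⟩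
  have hc : ContDiffAt ℝ 1 ρ z := h.contDiffAt hz
  have hev : ∀ᶠ w in 𝓝 z, DifferentiableAt ℝ (fun z => ρ z ^ η) w := by
    filter_upwards [hc.eventually (by norm_num),
      hc.continuousAt.eventually (lt_mem_nhds hpos)] with w hw hwp
    exact (hw.differentiableAt (by norm_num)).rpow_const (Or.inl hwp.ne')
  have ht := twiceDiffAt_of_levi_pos hev (hpsh z hmem)
  refine ⟨ht, fun X hX => ?_⟩
  have := hpsh z hmem X hX
  rwa [levi_self ht, ofReal_re] at this

lemma not_isLocalMax_tip {Ω V U : Set (Pt n)} {η κ : ℝ} (h : IsDefining n 1 Ω ρ V)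
    (hpsh : StrictPSHOn n (fun z => ρ z ^ η) ((closure Ω)ᶜ ∩ U)) (ℓ : Pt n →L[ℂ] ℂ) {t : ℝ}
    {z X : Pt n} (hX : ∀ c : ℂ, X ≠ c • ν) {w : ℂ → ℂ} (hw : Differentiable ℂ w)
    (hV : tip ℓ p ν t z (w 0) ∈ V) (hU : tip ℓ p ν t z (w 0) ∈ U)
    (hpos : 0 < ρ (tip ℓ p ν t z (w 0))) {σ : ℝ} (hσ : 0 < σ) :
    ¬ IsLocalMax (fun ζ : ℂ => (ρ (tip ℓ p ν t (z + ζ • X) (w ζ)) / σ) ^ η -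
      ((1 + κ) * w ζ - κ * w ζ ^ 2).re) 0 := by
  intro hm
  set E : ℂ → Pt n := fun ζ => tip ℓ p ν t (z + ζ • X) (w ζ) with hE
  have hE0 : E 0 = tip ℓ p ν t z (w 0) := by simp [hE]
  set b : ℂ → ℂ := fun ζ => (t : ℂ) * w ζ * cexp (ℓ (z + ζ • X - p)) with hb
  have hbd : Differentiable ℂ b := by
    refine (hw.const_mul _).mul (Differentiable.cexp ?_)
    exact ℓ.differentiable.comp (((differentiable_id.smul_const X).const_add z).sub_const p)
  have hEd : Differentiable ℂ E :=
    ((differentiable_id.smul_const X).const_add z).add (hbd.smul_const ν)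
  have hderiv : deriv E 0 = X + deriv b 0 • ν := by
    have h1 : HasDerivAt E ((1 : ℂ) • X + deriv b 0 • ν) 0 :=
      (((hasDerivAt_id (0 : ℂ)).smul_const X).const_add z).add
        ((hbd 0).hasDerivAt.smul_const ν)
    rw [h1.deriv, one_smul]
  have hne : deriv E 0 ≠ 0 := by
    rw [hderiv]
    intro h0
    exact hX (-deriv b 0) (by rw [neg_smul]; exact eq_neg_of_add_eq_zero_left h0)
  rw [← hE0] at hV hU hpos
  obtain ⟨ht, hl⟩ := rpow_twiceDiffAt_lap_pos h hpsh hV hU hpos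
  set H : ℂ → ℂ := fun ζ => ((σ ^ η : ℝ) : ℂ) * ((1 + κ) * w ζ - κ * w ζ ^ 2) with hH
  have hHd : Differentiable ℂ H :=
    ((hw.const_mul _).sub ((hw.pow 2).const_mul _)).const_mul _
  refine not_isLocalMax_disc (hEd.analyticAt 0) (hHd.analyticAt 0) ht (hl _ hne) ?_
  have hσ' : 0 < σ ^ η := by positivity
  have hposev : ∀ᶠ ζ in 𝓝 (0 : ℂ), 0 < ρ (E ζ) :=
    ((h.contDiffAt hV).continuousAt.comp hEd.continuous.continuousAt).eventually
      (lt_mem_nhds hpos)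
  have key : ∀ ζ, 0 < ρ (E ζ) → ρ (E ζ) ^ η - (H ζ).re =
      σ ^ η * ((ρ (E ζ) / σ) ^ η - ((1 + κ) * w ζ - κ * w ζ ^ 2).re) := by
    intro ζ hζ
    rw [Real.div_rpow hζ.le hσ.le, hH, re_ofReal_mul]
    field_simp
  filter_upwards [hm, hposev] with ζ hζ hζp
  rw [key ζ hζp, key 0 hpos]
  exact mul_le_mul_of_nonneg_left hζ hσ'.le

/-- Touching the graph of `ρ ^ η` by a family of discs gives a function without upper contact. -/
lemma exists_touch {Ω V U : Set (Pt n)} {η κ ι d : ℝ} (h : IsDefining n 1 Ω ρ V) (hη : 1 < η)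
    (hU : IsOpen U) (hfU : frontier Ω ⊆ U)
    (hpsh : StrictPSHOn n (fun z => ρ z ^ η) ((closure Ω)ᶜ ∩ U)) (hp : p ∈ frontier Ω)
    {h0 : ℝ} (hh0 : 0 < h0) (hν : fderiv ℝ ρ p ν = h0)
    (hν' : fderiv ℝ ρ p (Complex.I • ν) = 0) (ℓ : Pt n →L[ℂ] ℂ)
    (hκ : 0 < κ) (hι : 0 < ι) (hι4 : ι ≤ 1 / 4) (hd : 0 < d) (hd4 : d ≤ 1 / 4)
    (p1 : (1 - ι + d) ^ η < (1 + κ) * (1 - ι) - κ * (1 - ι) ^ 2)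
    (p2 : (1 + κ) * (1 + ι) - κ * (1 + ι) ^ 2 < (1 + ι - d) ^ η)
    (p3 : (1 + ι + d) ^ η - (1 + κ) * (1 - ι) + κ * (1 + ι) ^ 2 < κ)
    (p4 : 1 + κ - 2 * κ * (1 - ι) < η * (1 - ι - d) ^ (η - 1) * (1 - d)) :
    ∃ R > 0, ∃ t₀ > 0, ∀ t : ℝ, 0 < t → t < t₀ → ∃ W : Set (Pt n), IsOpen W ∧
      frontier Ω ∩ Metric.ball p R ⊆ W ∧ ∃ x : Pt n → ℝ, ContinuousOn x W ∧
      NoTouch (fun z => -x z) W ν ∧ ∀ z ∈ W, x z ∈ Set.Ioo (1 - ι) (1 + ι) ∧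
        0 < ρ (tip ℓ p ν t z (x z : ℂ)) / (h0 * t) ∧
        (ρ (tip ℓ p ν t z (x z : ℂ)) / (h0 * t)) ^ η ≤ (1 + κ) * x z - κ * x z ^ 2 ∧
        ∃ y ∈ Set.Icc (-1 : ℝ) 1, 0 < ρ (tip ℓ p ν t z (x z + y * I)) / (h0 * t) ∧
          (ρ (tip ℓ p ν t z (x z + y * I)) / (h0 * t)) ^ η =
            (1 + κ) * x z - κ * (x z ^ 2 - y ^ 2) := by
  have hη0 : 0 < η := by linarith
  have hN : V ∩ U ∈ 𝓝 p := inter_mem (h.mem_nhds hp) (hU.mem_nhds (hfU hp))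
  obtain ⟨R, hR, δ, hδ, t₀, ht₀, key⟩ := exists_disc_estimate (h.contDiffAt (h.mem_V hp)) hh0 hν hν'
    (a := fun z => ℓ (z - p)) (by fun_prop) (by simp) (M := 3) (by norm_num) hd hN
  refine ⟨R, hR, t₀, ht₀, fun t ht htt => ?_⟩
  have hσ : 0 < h0 * t := by positivity
  set m : Pt n → ℂ → ℝ := fun z w => ρ (tip ℓ p ν t z w) / (h0 * t) with hm
  have hρc : ContinuousOn ρ V := h.2.2.1.continuousOn
  set W : Set (Pt n) := Metric.ball p R ∩ ρ ⁻¹' Metric.ball 0 (δ * t) with hW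
  have hWo : IsOpen W := (hρc.mono fun z hz => (key z hz).1.1).isOpen_inter_preimage
    Metric.isOpen_ball Metric.isOpen_ball
  have hWk : ∀ z ∈ W, ∀ w : ℂ, ‖w‖ ≤ 3 → tip ℓ p ν t z w ∈ V ∩ U ∧ |m z w - w.re| ≤ d ∧
      ∀ w' : ℂ, ‖w'‖ ≤ 3 → w'.im = w.im → w.re ≤ w'.re →
        (1 - d) * (w'.re - w.re) ≤ m z w' - m z w := by
    intro z hz w hw
    refine (key z hz.1).2 t ht htt ?_ w hw
    have := hz.2
    simp only [Set.mem_preimage, Metric.mem_ball, dist_zero_right, Real.norm_eq_abs] at this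
    exact this.le
  have hnorm : ∀ x ∈ Set.Icc (1 - ι) (1 + ι), ∀ y ∈ Set.Icc (-1 : ℝ) 1,
      ‖(x : ℂ) + y * I‖ ≤ 3 := by
    intro x hx y hy
    refine (norm_add_le _ _).trans ?_
    rw [norm_mul, norm_I, mul_one, Complex.norm_real, Complex.norm_real, Real.norm_eq_abs,
      Real.norm_eq_abs, abs_of_pos (by linarith [hx.1] : 0 < x)]
    have := abs_le.2 hy
    linarith [hx.2]
  set F : Pt n → ℝ → ℝ → ℝ := fun z x y =>
    m z (x + y * I) ^ η - (1 + κ) * x + κ * (x ^ 2 - y ^ 2) with hF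
  have hre : ∀ x y : ℝ, ((x : ℂ) + y * I).re = x := fun x y => by simp
  have him : ∀ x y : ℝ, ((x : ℂ) + y * I).im = y := fun x y => by simp
  have hmb : ∀ z ∈ W, ∀ x ∈ Set.Icc (1 - ι) (1 + ι), ∀ y ∈ Set.Icc (-1 : ℝ) 1,
      x - d ≤ m z (x + y * I) ∧ m z (x + y * I) ≤ x + d := by
    intro z hz x hx y hy
    have := (hWk z hz _ (hnorm x hx y hy)).2.1
    rw [hre, abs_le] at this
    constructor <;> linarith [this.1, this.2]
  have hmpos : ∀ z ∈ W, ∀ x ∈ Set.Icc (1 - ι) (1 + ι), ∀ y ∈ Set.Icc (-1 : ℝ) 1,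
      0 < m z (x + y * I) := by
    intro z hz x hx y hy
    linarith [(hmb z hz x hx y hy).1, hx.1]
  have h1mem : (1 - ι) ∈ Set.Icc (1 - ι) (1 + ι) := ⟨le_rfl, by linarith⟩
  have h2mem : (1 + ι) ∈ Set.Icc (1 - ι) (1 + ι) := ⟨by linarith, le_rfl⟩
  have h0mem : (0 : ℝ) ∈ Set.Icc (-1 : ℝ) 1 := ⟨by norm_num, by norm_num⟩
  refine Exists.elim (exists_continuousOn_root (x₁ := 1 - ι) (x₂ := 1 + ι) (by linarith)
    (F := F) hWo ?_ ?_ ?_ ?_) ?_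
  · have h1 : ContinuousOn (fun q : Pt n × ℝ × ℝ => m q.1 (q.2.1 + q.2.2 * I))
        (W ×ˢ (Set.Icc (1 - ι) (1 + ι) ×ˢ Set.Icc (-1) 1)) := by
      refine ContinuousOn.div_const (hρc.comp ?_ ?_) _
      · refine Continuous.continuousOn ?_
        exact (continuous_tip ℓ t).comp (f := fun q : Pt n × ℝ × ℝ =>
          (q.1, (q.2.1 : ℂ) + q.2.2 * I)) (by fun_prop)
      · rintro ⟨z, x, y⟩ ⟨hz, hx, hy⟩
        exact (hWk z hz _ (hnorm x hx y hy)).1.1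
    refine ((h1.rpow_const fun q hq => Or.inr hη0.le).sub ?_).add ?_ <;>
      exact Continuous.continuousOn (by fun_prop)
  · intro z hz y hy
    have h1 := (hmb z hz _ h1mem y hy).2
    have h2 := Real.rpow_le_rpow (hmpos z hz _ h1mem y hy).le h1 hη0.le
    simp only [hF]
    nlinarith [mul_nonneg hκ.le (sq_nonneg y)]
  · intro z hz
    refine ⟨0, h0mem, ?_⟩
    have h1 := (hmb z hz _ h2mem 0 h0mem).1
    have h2 := Real.rpow_le_rpow (by linarith : 0 ≤ 1 + ι - d) h1 hη0.le
    simp only [hF]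
    nlinarith
  · intro z hz y hy x hx x' hx' hlt
    have h1 := (hWk z hz _ (hnorm x hx y hy)).2.2 _ (hnorm x' hx' y hy) (by simp)
      (by simpa using hlt.le)
    rw [hre, hre] at h1
    have ha := hmpos z hz x hx y hy
    have hb := hmpos z hz x' hx' y hy
    have h2 := rpow_tangent_le hη.le ha hb.le
    have h3 : (1 - ι - d) ^ (η - 1) ≤ m z (x + y * I) ^ (η - 1) := by
      refine Real.rpow_le_rpow (by linarith) ?_ (by linarith)
      linarith [(hmb z hz x hx y hy).1, hx.1]
    simp only [hF]
    have h4 : η * (1 - ι - d) ^ (η - 1) * ((1 - d) * (x' - x)) ≤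
        η * m z (x + y * I) ^ (η - 1) * (m z (x' + y * I) - m z (x + y * I)) := by
      have : 0 ≤ 1 - d := by linarith
      have : 0 ≤ x' - x := by linarith
      have h5 : 0 ≤ η * m z (x + y * I) ^ (η - 1) := by positivity
      gcongr
    have h6 : (1 + κ - 2 * κ * (1 - ι)) * (x' - x) <
        η * (1 - ι - d) ^ (η - 1) * (1 - d) * (x' - x) :=
      mul_lt_mul_of_pos_right p4 (by linarith)
    have h7 : 0 ≤ κ * ((x' - x) * (x' + x - 2 * (1 - ι))) :=
      mul_nonneg hκ.le (mul_nonneg (by linarith) (by linarith [hx.1, hx'.1]))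
    nlinarith
  rintro x ⟨hxc, hx⟩
  refine ⟨W, hWo, ?_, x, hxc, ?_, fun z hz => ?_⟩
  · intro z hz
    refine ⟨hz.2, ?_⟩
    simp only [Set.mem_preimage, h.eq_zero hz.1]
    exact Metric.mem_ball_self (by positivity)
  · intro z hz X hX H hH hmax
    obtain ⟨hxI, ⟨y, hy, hFy⟩, hle⟩ := hx z hz
    have hxI' : x z ∈ Set.Icc (1 - ι) (1 + ι) := ⟨hxI.1.le, hxI.2.le⟩
    have hyI : y ∈ Set.Ioo (-1 : ℝ) 1 := by
      have hy2 : y ^ 2 < 1 := by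
        by_contra hcon
        push Not at hcon
        have h1 := (hmb z hz _ hxI' y hy).2
        have h2 := Real.rpow_le_rpow (hmpos z hz _ hxI' y hy).le
          (h1.trans (by linarith [hxI.2] : x z + d ≤ 1 + ι + d)) hη0.le
        have h3 : x z ^ 2 ≤ (1 + ι) ^ 2 := by
          have := hxI.2
          have : 0 ≤ x z := by linarith [hxI.1]
          gcongr
        simp only [hF] at hFy
        nlinarith [mul_le_mul_of_nonneg_left h3 hκ.le, mul_le_mul_of_nonneg_left hcon hκ.le,
          mul_lt_mul_of_pos_left hxI.1 (by linarith : 0 < 1 + κ)]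
      exact abs_lt.1 ((sq_lt_one_iff_abs_lt_one y).1 hy2)
    set w : ℂ → ℂ := fun ζ => ((x z : ℂ) + y * I) + (H 0 - H ζ) with hw
    have hwd : Differentiable ℂ w := (hH.const_sub (H 0)).const_add _
    have hw0 : w 0 = (x z : ℂ) + y * I := by simp [hw]
    have hmem := (hWk z hz _ (hnorm _ hxI' y hy)).1
    have hpos := hmpos z hz _ hxI' y hy
    rw [← hw0] at hmem hpos
    refine not_isLocalMax_tip (κ := κ) h hpsh ℓ hX hwd hmem.1 hmem.2
      ((div_pos_iff_of_pos_right hσ).1 hpos) hσ ?_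
    have e0 : ∀ ζ, (ρ (tip ℓ p ν t (z + ζ • X) (w ζ)) / (h0 * t)) ^ η -
        ((1 + κ) * w ζ - κ * w ζ ^ 2).re = F (z + ζ • X) (w ζ).re (w ζ).im := by
      intro ζ
      simp only [hF, re_add_im, hm]
      have : ((1 + κ) * w ζ - κ * w ζ ^ 2).re =
          (1 + κ) * (w ζ).re - κ * ((w ζ).re ^ 2 - (w ζ).im ^ 2) := by
        simp [pow_two]
      rw [this]
      ring
    have hWev : ∀ᶠ ζ in 𝓝 (0 : ℂ), z + ζ • X ∈ W := by
      have : ContinuousAt (fun ζ : ℂ => z + ζ • X) 0 := by fun_prop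
      exact this.eventually_mem (hWo.mem_nhds (by simpa using hz))
    have hrec : ContinuousAt (fun ζ => (w ζ).re) 0 :=
      continuous_re.continuousAt.comp hwd.continuous.continuousAt
    have himc : ContinuousAt (fun ζ => (w ζ).im) 0 :=
      continuous_im.continuousAt.comp hwd.continuous.continuousAt
    have hxev : ∀ᶠ ζ in 𝓝 (0 : ℂ), (w ζ).re ∈ Set.Icc (1 - ι) (1 + ι) :=
      hrec.eventually_mem (Icc_mem_nhds (by simpa [hw0] using hxI.1) (by simpa [hw0] using hxI.2))
    have hyev : ∀ᶠ ζ in 𝓝 (0 : ℂ), (w ζ).im ∈ Set.Icc (-1 : ℝ) 1 :=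
      himc.eventually_mem (Icc_mem_nhds (by simpa [hw0] using hyI.1) (by simpa [hw0] using hyI.2))
    filter_upwards [hmax, hWev, hxev, hyev] with ζ hζ hζW hζx hζy
    rw [e0, e0]
    have hz0 : F (z + (0 : ℂ) • X) (w 0).re (w 0).im = 0 := by
      rw [zero_smul, add_zero, hw0, hre, him]
      exact hFy
    rw [hz0]
    refine (hx _ hζW).2.2 _ hζx ?_ _ hζy
    simp only [zero_smul, add_zero] at hζ
    simp only [hw, add_re, sub_re]
    rw [← add_re, hre]
    linarith
  · obtain ⟨hxI, ⟨y, hy, hFy⟩, hle⟩ := hx z hz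
    have hxI' : x z ∈ Set.Icc (1 - ι) (1 + ι) := ⟨hxI.1.le, hxI.2.le⟩
    have h1 := hle (x z) hxI' le_rfl 0 h0mem
    have h2 := hmpos z hz _ hxI' 0 h0mem
    simp only [hF, ofReal_zero, zero_mul, add_zero] at h1 h2
    refine ⟨hxI, h2, by linarith, y, hy, hmpos z hz _ hxI' y hy, ?_⟩
    simp only [hF] at hFy
    linarith

end touch

section limits
variable {n : ℕ} {p ν : Pt n} {ρ : Pt n → ℝ}

lemma βf_eq {η κ x : ℝ} (hη : η ≠ 0) (hx : 0 < x) (hκ : 0 < 1 + κ - κ * x) :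
    βf η κ x = 1 / η * Real.log ((1 + κ) * x - κ * x ^ 2) - Real.log x := by
  rw [βf, show (1 + κ) * x - κ * x ^ 2 = x * (1 + κ - κ * x) by ring,
    Real.log_mul hx.ne' hκ.ne']
  field_simp
  ring

lemma touch_log_estimate {η κ x A B M₀ M₁ y ε : ℝ} (hη : 1 < η) (hκ : 0 < κ) (hκ1 : κ ≤ 1)
    (hx : 3 / 4 ≤ x) (hx' : x ≤ 5 / 4) (hA : 1 / 2 ≤ A) (hε : 0 ≤ ε) (hε1 : ε ≤ 1 / 8)
    (hM₀ : 0 < M₀) (hM₁ : 0 < M₁) (h₀ : |M₀ - x * A| ≤ ε) (h₁ : |M₁ - (x * A - y * B)| ≤ ε)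
    (hP₀ : M₀ ^ η ≤ (1 + κ) * x - κ * x ^ 2)
    (hP₁ : M₁ ^ η = (1 + κ) * x - κ * (x ^ 2 - y ^ 2)) (hy : |y| ≤ 1) :
    |βf η κ x - Real.log A| ≤ 8 * ε + 16 * η * B ^ 2 / κ := by
  have hx0 : 0 < x := by linarith
  have hA0 : 0 < A := by linarith
  have hη0 : 0 < η := by linarith
  have hk : 0 < 1 + κ - κ * x := by nlinarith
  set P := (1 + κ) * x - κ * x ^ 2 with hPdef
  have hP : 0 < P := by rw [hPdef]; nlinarith [mul_pos hx0 hk]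
  have hP2 : P ≤ 2 := by rw [hPdef]; nlinarith [mul_nonneg hκ.le (sq_nonneg (x - 1))]
  have hβ : βf η κ x = 1 / η * Real.log P - Real.log x := βf_eq hη0.ne' hx0 hk
  have hxA : 3 / 8 ≤ x * A := by nlinarith
  have hlog : Real.log (x * A) = Real.log x + Real.log A := Real.log_mul hx0.ne' hA0.ne'
  obtain ⟨h₀a, h₀b⟩ := abs_le.1 h₀
  obtain ⟨h₁a, h₁b⟩ := abs_le.1 h₁
  have hlow : -(8 * ε) ≤ βf η κ x - Real.log A := by
    have e1 : Real.log M₀ ≤ 1 / η * Real.log P := by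
      have := Real.log_le_log (by positivity) hP₀
      rw [Real.log_rpow hM₀] at this
      rw [one_div, ← div_eq_inv_mul, le_div_iff₀ hη0]
      linarith
    have e2 := Real.one_sub_inv_le_log_of_pos (div_pos hM₀ (by linarith : 0 < x * A))
    rw [Real.log_div hM₀.ne' (by linarith)] at e2
    have e3 : -(8 * ε) ≤ 1 - (M₀ / (x * A))⁻¹ := by
      rw [inv_div, neg_le_sub_iff_le_add, div_le_iff₀ hM₀]
      nlinarith
    linarith
  have hup : βf η κ x - Real.log A ≤ 8 * ε + 16 * η * B ^ 2 / κ := by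
    have hy2 : y ^ 2 ≤ 1 := (sq_le_one_iff_abs_le_one y).2 hy
    have hPy : (1 + κ) * x - κ * (x ^ 2 - y ^ 2) = P + κ * y ^ 2 := by rw [hPdef]; ring
    have hPy0 : 0 < P + κ * y ^ 2 := by positivity
    have e1 : Real.log (P + κ * y ^ 2) = η * Real.log M₁ := by
      rw [← Real.log_rpow hM₁, hP₁, hPy]
    have e2 := Real.one_sub_inv_le_log_of_pos (div_pos hPy0 hP)
    rw [Real.log_div hPy0.ne' hP.ne', inv_div] at e2
    have e3 : κ * y ^ 2 / 4 ≤ 1 - P / (P + κ * y ^ 2) := by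
      have ha : 0 ≤ κ * y ^ 2 := by positivity
      have ha1 : κ * y ^ 2 ≤ 1 := mul_le_one₀ hκ1 (sq_nonneg y) hy2
      have : 1 - P / (P + κ * y ^ 2) = κ * y ^ 2 / (P + κ * y ^ 2) := by
        rw [eq_div_iff hPy0.ne', sub_mul, div_mul_cancel₀ _ hPy0.ne']
        ring
      rw [this]
      exact div_le_div_of_nonneg_left ha hPy0 (by linarith)
    have e4 : 1 / η * Real.log P ≤ Real.log M₁ - κ * y ^ 2 / (4 * η) := by
      rw [one_div, ← div_eq_inv_mul, div_le_iff₀ hη0, sub_mul,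
        show κ * y ^ 2 / (4 * η) * η = κ * y ^ 2 / 4 by field_simp]
      linarith
    have e5 := Real.log_le_sub_one_of_pos (div_pos hM₁ (by linarith : 0 < x * A))
    rw [Real.log_div hM₁.ne' (by linarith)] at e5
    have e6 : M₁ / (x * A) - 1 ≤ 3 * (|y * B| + ε) := by
      rw [sub_le_iff_le_add, div_le_iff₀ (by linarith)]
      have hb := neg_abs_le (y * B)
      have hb' : 0 ≤ |y * B| := abs_nonneg _
      have : 3 / 8 * (|y * B| + ε) ≤ x * A * (|y * B| + ε) :=
        mul_le_mul_of_nonneg_right hxA (by linarith)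
      linarith
    have e7 : 3 * |y * B| - κ * y ^ 2 / (4 * η) ≤ 16 * η * B ^ 2 / κ := by
      rw [abs_mul, ← sq_abs y, ← sq_abs B]
      generalize |y| = a
      generalize |B| = b
      have : 16 * η * b ^ 2 / κ - (3 * (a * b) - κ * a ^ 2 / (4 * η)) =
          ((κ * a - 6 * η * b) ^ 2 + 28 * η ^ 2 * b ^ 2) / (4 * η * κ) := by
        field_simp
        ring
      have : 0 ≤ ((κ * a - 6 * η * b) ^ 2 + 28 * η ^ 2 * b ^ 2) / (4 * η * κ) := by positivity
      linarith
    linarith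
  rw [abs_le]
  have : 0 ≤ 16 * η * B ^ 2 / κ := by positivity
  exact ⟨by linarith, hup⟩

lemma eventually_tip_slope {K : Set (Pt n)} (hK : IsCompact K)
    (hρ : ∀ z ∈ K, ContDiffAt ℝ 1 ρ z) (h0 : ∀ z ∈ K, ρ z = 0) (ℓ : Pt n →L[ℂ] ℂ) (p ν : Pt n)
    (M : ℝ) {ε : ℝ} (hε : 0 < ε) :
    ∀ᶠ t in 𝓝[>] (0 : ℝ), ∀ z ∈ K, ∀ w : ℂ, ‖w‖ ≤ M →
      |ρ (tip ℓ p ν t z w) / t - fderiv ℝ ρ z ((w * cexp (ℓ (z - p))) • ν)| ≤ ε := by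
  have hKM : IsCompact (K ×ˢ Metric.closedBall (0 : ℂ) M) :=
    hK.prod (isCompact_closedBall 0 M)
  have key : ∀ q ∈ K ×ˢ Metric.closedBall (0 : ℂ) M,
      ∀ᶠ x : ℝ × (Pt n × ℂ) in 𝓝[>] (0 : ℝ) ×ˢ 𝓝 q,
      |(ρ (tip ℓ p ν x.1 x.2.1 x.2.2) - ρ x.2.1) / x.1 -
        fderiv ℝ ρ x.2.1 ((x.2.2 * cexp (ℓ (x.2.1 - p))) • ν)| ≤ ε := by
    rintro ⟨z₀, w₀⟩ ⟨hz₀, -⟩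
    have hst := (hρ z₀ hz₀).hasStrictFDerivAt one_ne_zero
    have ht : Tendsto (fun x : ℝ × (Pt n × ℂ) => x.1) (𝓝[>] (0 : ℝ) ×ˢ 𝓝 (z₀, w₀)) (𝓝 0) :=
      tendsto_fst.mono_right nhdsWithin_le_nhds
    have hzw : Tendsto (fun x : ℝ × (Pt n × ℂ) => x.2) (𝓝[>] (0 : ℝ) ×ˢ 𝓝 (z₀, w₀))
      (𝓝 (z₀, w₀)) := tendsto_snd
    have hz := (continuous_fst.tendsto (z₀, w₀)).comp hzw
    have hvec : Tendsto (fun x : ℝ × (Pt n × ℂ) => (x.2.2 * cexp (ℓ (x.2.1 - p))) • ν)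
        (𝓝[>] (0 : ℝ) ×ˢ 𝓝 (z₀, w₀)) (𝓝 ((w₀ * cexp (ℓ (z₀ - p))) • ν)) := by
      have : Continuous fun y : Pt n × ℂ => (y.2 * cexp (ℓ (y.1 - p))) • ν := by fun_prop
      exact (this.tendsto (z₀, w₀)).comp hzw
    have hne : ∀ᶠ x : ℝ × (Pt n × ℂ) in 𝓝[>] (0 : ℝ) ×ˢ 𝓝 (z₀, w₀), 0 < x.1 :=
      tendsto_fst.eventually self_mem_nhdsWithin
    have htip : Tendsto (fun x : ℝ × (Pt n × ℂ) => tip ℓ p ν x.1 x.2.1 x.2.2)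
        (𝓝[>] (0 : ℝ) ×ˢ 𝓝 (z₀, w₀)) (𝓝 z₀) := by
      have hc : Continuous fun x : ℝ × (Pt n × ℂ) => tip ℓ p ν x.1 x.2.1 x.2.2 := by
        unfold tip
        fun_prop
      have := (hc.tendsto (0, (z₀, w₀))).comp (ht.prodMk_nhds hzw)
      simp only [tip, ofReal_zero, zero_mul, zero_smul, add_zero] at this
      exact this
    have hsl := hst.tendsto_slope (s := fun x : ℝ × (Pt n × ℂ) => x.1) htip hz
      (e := (w₀ * cexp (ℓ (z₀ - p))) • ν) (by
        refine hvec.congr' ?_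
        filter_upwards [hne] with x hx
        simp only [tip, Function.comp, add_sub_cancel_left]
        rw [mul_assoc, mul_smul (x.1 : ℂ), Complex.coe_smul, inv_smul_smul₀ hx.ne'])
    have hfd : Tendsto (fun x : ℝ × (Pt n × ℂ) =>
        fderiv ℝ ρ x.2.1 ((x.2.2 * cexp (ℓ (x.2.1 - p))) • ν))
        (𝓝[>] (0 : ℝ) ×ˢ 𝓝 (z₀, w₀)) (𝓝 (fderiv ℝ ρ z₀ ((w₀ * cexp (ℓ (z₀ - p))) • ν))) := by
      have h1 := ((hρ z₀ hz₀).continuousAt_fderiv one_ne_zero).tendsto.comp hz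
      exact ((isBoundedBilinearMap_apply (𝕜 := ℝ) (E := Pt n) (F := ℝ)).continuous.tendsto
        (fderiv ℝ ρ z₀, _)).comp (h1.prodMk_nhds hvec)
    have hdiff := (hsl.sub hfd).abs
    rw [sub_self, abs_zero] at hdiff
    filter_upwards [hdiff.eventually_le_const hε] with x hx
    rw [div_eq_inv_mul]
    exact hx
  have := hKM.eventually_forall_of_forall_eventually (x₀ := (0 : ℝ)) (P := fun t q => 0 < t →
    |(ρ (tip ℓ p ν t q.1 q.2) - ρ q.1) / t -
        fderiv ℝ ρ q.1 ((q.2 * cexp (ℓ (q.1 - p))) • ν)| ≤ ε) (fun q hq => by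
      have h1 := key q hq
      rw [← nhdsWithin_univ q, ← nhdsWithin_prod_eq, eventually_nhdsWithin_iff] at h1
      filter_upwards [h1] with x hx hx0
      exact hx ⟨hx0, Set.mem_univ _⟩)
  filter_upwards [this.filter_mono nhdsWithin_le_nhds, self_mem_nhdsWithin] with t ht ht0 z hz w hw
  have h1 := ht (z, w) ⟨hz, by simpa using hw⟩ ht0
  simpa [h0 z hz] using h1

open scoped Manifold ContDiff in
lemma exists_contDiff_eventuallyEq {K O : Set (Pt n)} {f : Pt n → ℝ} (hK : IsCompact K)
    (hO : IsOpen O) (hKO : K ⊆ O) (hf : ContDiffOn ℝ ((⊤ : ℕ∞) : WithTop ℕ∞) f O) :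
    ∃ g : Pt n → ℝ, ContDiff ℝ ((⊤ : ℕ∞) : WithTop ℕ∞) g ∧ ∀ z ∈ K, g =ᶠ[𝓝 z] f := by
  obtain ⟨K', hK', hKK', hK'O⟩ := exists_compact_between hK hO hKO
  obtain ⟨χ, h1, h0, -⟩ := exists_contMDiffMap_one_nhds_of_subset_interior (n := ⊤)
    𝓘(ℝ, Pt n) hK.isClosed hKK'
  have hχ : ContDiff ℝ ((⊤ : ℕ∞) : WithTop ℕ∞) χ := χ.contMDiff.contDiff
  refine ⟨fun z => χ z * f z, contDiff_iff_contDiffAt.2 fun z => ?_, fun z hz => ?_⟩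
  · by_cases hz : z ∈ O
    · exact hχ.contDiffAt.mul (hf.contDiffAt (hO.mem_nhds hz))
    · refine (contDiffAt_const (c := (0 : ℝ))).congr_of_eventuallyEq ?_
      filter_upwards [hK'.isClosed.isOpen_compl.mem_nhds fun h => hz (hK'O h)] with w hw
      simp [h0 w hw]
  · filter_upwards [h1.filter_mono (nhds_le_nhdsSet hz)] with w hw
    simp [hw]

end limits

section bundle
variable {n : ℕ} {p : Pt n} {r : Pt n → ℝ} {Ω V : Set (Pt n)} {s : ℕ∞}

/-- The unit vectors in the Levi null spaces over the boundary. -/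
def nullBundle (r : Pt n → ℝ) (Ω : Set (Pt n)) : Set (Pt n × Pt n) :=
  {q | q.1 ∈ frontier Ω ∧ q.2 ∈ nullSp n r q.1 ∧ sqn q.2 = 1}

lemma norm_sq_le_sqn (z : Pt n) : ‖z‖ ^ 2 ≤ sqn z := by
  have h : ‖z‖ ≤ Real.sqrt (sqn z) := by
    refine (pi_norm_le_iff_of_nonneg (Real.sqrt_nonneg _)).2 fun j => ?_
    refine Real.le_sqrt_of_sq_le ?_
    rw [← Complex.normSq_eq_norm_sq]
    exact Finset.single_le_sum (f := fun j => normSq (z j)) (fun i _ => normSq_nonneg _)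
      (Finset.mem_univ j)
  have := pow_le_pow_left₀ (norm_nonneg z) h 2
  rwa [Real.sq_sqrt (sqn_nonneg z)] at this

lemma isCompact_sqn_sphere : IsCompact {X : Pt n | sqn X = 1} := by
  refine Metric.isCompact_of_isClosed_isBounded (isClosed_eq continuous_sqn continuous_const)
    ((Metric.isBounded_iff_subset_closedBall 0).2 ⟨1, fun X hX => ?_⟩)
  have h1 := norm_sq_le_sqn X
  rw [show sqn X = 1 from hX] at h1
  rw [mem_closedBall_zero_iff]
  nlinarith [norm_nonneg X]

lemma IsDefining.contDiffAt_nat (h : IsDefining n s Ω r V) {m : ℕ} (hs : (m : ℕ∞) ≤ s)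
    (hp : p ∈ frontier Ω) : ContDiffAt ℝ m r p :=
  (h.contDiffAt (h.mem_V hp)).of_le (by exact_mod_cast hs)

lemma lap_eq_zero_of_mem_nullSp (h : ContDiffAt ℝ 2 r p) {L : Pt n} (hL : L ∈ nullSp n r p) :
    lap r p L = 0 := by
  have := hL.2 L hL.1
  rw [levi_self h.twiceDiffAt] at this
  exact_mod_cast this

lemma isCompact_nullBundle (h : IsDefining n s Ω r V) (hs : 2 ≤ s) (hb : Bornology.IsBounded Ω)
    (hpsc : LeviPseudoconvex n r Ω) : IsCompact (nullBundle r Ω) := by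
  have hK : IsCompact (frontier Ω ×ˢ {X : Pt n | sqn X = 1}) :=
    (isCompact_frontier hb).prod isCompact_sqn_sphere
  have h2 : ∀ z ∈ frontier Ω, ContDiffAt ℝ 2 r z := fun z hz => h.contDiffAt_nat (m := 2) hs hz
  have hc : ContinuousOn (fun w : Pt n × Pt n => (wd (cR n r) w.1 w.2, lap r w.1 w.2))
      (frontier Ω ×ˢ {X : Pt n | sqn X = 1}) := by
    rintro ⟨z, X⟩ ⟨hz, -⟩
    have a1 := (contDiffAt_wd_pair (m := 1) (X₀ := X) (h2 z hz)).continuousAt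
    have a2 := (contDiffAt_lap_pair (m := 0) (X₀ := X) (h2 z hz)).continuousAt
    exact (a1.prodMk a2).continuousWithinAt
  have hcl := hc.preimage_isClosed_of_isClosed hK.isClosed (isClosed_singleton (x := (0, 0)))
  suffices heq : frontier Ω ×ˢ {X : Pt n | sqn X = 1} ∩
      (fun w : Pt n × Pt n => (wd (cR n r) w.1 w.2, lap r w.1 w.2)) ⁻¹' {(0, 0)} =
      nullBundle r Ω by
    rw [heq] at hcl
    exact hK.of_isClosed_subset hcl fun q hq => ⟨hq.1, hq.2.2⟩
  ext ⟨z, X⟩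
  constructor
  · rintro ⟨⟨hz, hX⟩, hq⟩
    obtain ⟨h3, h4⟩ := Prod.mk.inj (show (wd (cR n r) z X, lap r z X) = (0, 0) from hq)
    exact ⟨hz, mem_nullSp_of_lap_eq_zero (h2 z hz) (hpsc z hz) ((mem_T10 X).2 h3) h4, hX⟩
  · rintro ⟨hz, hL, hX⟩
    refine ⟨⟨hz, hX⟩, ?_⟩
    show (wd (cR n r) z X, lap r z X) = (0, 0)
    rw [(mem_T10 X).1 hL.1, lap_eq_zero_of_mem_nullSp (h2 z hz) hL]

lemma continuousAt_om (h : ContDiffAt ℝ 3 r p) (h0 : fderiv ℝ r p ≠ 0) (X : Pt n) :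
    ContinuousAt (fun q : Pt n × Pt n => om r q.1 q.2) (p, X) := by
  unfold om
  refine tendsto_finsetSum _ fun j _ => ?_
  have h1 : ContinuousAt (fun q : Pt n × Pt n => (dAngelo n r).w q.1 j) (p, X) :=
    ContinuousAt.comp (f := Prod.fst) (x := (p, X))
      (contDiffAt_dAngelo_w h h0 j).continuousAt continuousAt_fst
  exact h1.mul (by fun_prop)

lemma continuousAt_dlb (h : ContDiffAt ℝ 3 r p) (h0 : fderiv ℝ r p ≠ 0) (X : Pt n) :
    ContinuousAt (fun q : Pt n × Pt n => dlb r q.1 q.2) (p, X) := by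
  simp only [dlb_eq_sum, wdb]
  refine ContinuousAt.neg (tendsto_finsetSum _ fun j _ => ?_)
  have h1 : ContinuousAt (fun q : Pt n × Pt n => fderiv ℝ (fun w => (dAngelo n r).w w j) q.1)
      (p, X) :=
    ContinuousAt.comp (f := Prod.fst) (x := (p, X))
      ((contDiffAt_dAngelo_w h h0 j).continuousAt_fderiv one_ne_zero) continuousAt_fst
  have h2 : ContinuousAt (fun q : Pt n × Pt n => q.2 j) (p, X) := by fun_prop
  have h3 : ContinuousAt (fun q : Pt n × Pt n => q.2) (p, X) := continuousAt_snd
  have h4 : ContinuousAt (fun q : Pt n × Pt n => Complex.I • q.2) (p, X) := by fun_prop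
  exact h2.mul (continuousAt_const.mul ((h1.clm_apply h3).add
    (continuousAt_const.mul (h1.clm_apply h4))))

lemma tube_estimate (h : IsDefining n s Ω r V) (hs : 3 ≤ s) (hb : Bornology.IsBounded Ω)
    (hpsc : LeviPseudoconvex n r Ω) (hp : p ∈ frontier Ω) {T : Pt n → ℝ}
    (hT : ContDiff ℝ 2 T) (hT1 : ∀ X, wd (cR n T) p X = om r p X)
    (hT2 : ∀ L ∈ nullSp n r p, lap T p L = -(dlb r p L).re) {ε : ℝ} (hε : 0 < ε) :
    ∀ᶠ z in 𝓝 p, ∀ L, (z, L) ∈ nullBundle r Ω →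
      normSq (om r z L - wd (cR n T) z L) ≤ ε ∧ (dlb r z L).re + lap T z L ≤ ε := by
  have hs2 : (2 : ℕ∞) ≤ s := le_trans (by norm_num) hs
  have hN := (isCompact_nullBundle h hs2 hb hpsc).isClosed
  have hr := h.contDiffAt_nat (m := 3) hs hp
  have hr0 := h.2.2.2.2 p hp
  have key := isCompact_sqn_sphere.eventually_forall_of_forall_eventually (x₀ := p)
    (P := fun z L => (z, L) ∈ nullBundle r Ω →
      normSq (om r z L - wd (cR n T) z L) ≤ ε ∧ (dlb r z L).re + lap T z L ≤ ε) (fun L hL => by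
    by_cases hmem : (p, L) ∈ nullBundle r Ω
    · have c1 := continuousAt_om hr hr0 L
      have c2 := continuousAt_dlb hr hr0 L
      have c3 := (contDiffAt_wd_pair (m := 1) (X₀ := L) (hT.contDiffAt (x := p))).continuousAt
      have c4 := (contDiffAt_lap_pair (m := 0) (X₀ := L) (hT.contDiffAt (x := p))).continuousAt
      have d1 : ContinuousAt (fun w : Pt n × Pt n =>
          normSq (om r w.1 w.2 - wd (cR n T) w.1 w.2)) (p, L) :=
        continuous_normSq.continuousAt.comp (c1.sub c3)
      have d2 : ContinuousAt (fun w : Pt n × Pt n => (dlb r w.1 w.2).re + lap T w.1 w.2) (p, L) :=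
        (continuous_re.continuousAt.comp c2).add c4
      have e1 := d1.tendsto.eventually_le_const (u := ε) (by
        show normSq (om r p L - wd (cR n T) p L) < ε
        rwa [hT1, sub_self, map_zero])
      have e2 := d2.tendsto.eventually_le_const (u := ε) (by
        show (dlb r p L).re + lap T p L < ε
        rwa [hT2 L hmem.2.1, add_neg_cancel])
      filter_upwards [e1, e2] with w h1 h2 _
      exact ⟨h1, h2⟩
    · filter_upwards [hN.isOpen_compl.mem_nhds hmem] with w hw hw'
      exact absurd hw' hw)
  filter_upwards [key] with z hz L hL
  exact hz L hL.2.2 hL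

end bundle

section slope
variable {n : ℕ} {p : Pt n} {ρ r hh : Pt n → ℝ} {Ω V V' U : Set (Pt n)} {s : ℕ∞}

lemma fderiv_smul_eq_re (r : Pt n → ℝ) (z ν : Pt n) (c : ℂ) :
    fderiv ℝ r z (c • ν) = (c * (starRingEnd ℂ) (HH r ν z)).re := by
  rw [complex_smul_eq, map_add, map_smul, map_smul, HH]
  simp

lemma continuousOn_βf {η κ : ℝ} (hκ : 0 < κ) (hκ1 : κ ≤ 1) {ι : ℝ} (hι4 : ι ≤ 1 / 4) :
    ContinuousOn (βf η κ) (Set.Icc (1 - 2 * ι) (1 + 2 * ι)) := by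
  intro x hx
  have hx0 : 0 < x := by linarith [hx.1]
  have : 0 < 1 + κ - κ * x := by nlinarith [hx.2]
  exact (hasDerivAt_βf hx0.ne' this.ne').continuousAt.continuousWithinAt

set_option maxHeartbeats 1000000 in
/-- Near a boundary point the logarithm of the slope of `ρ` relative to `r` is approximated by
a concave function of a smooth function that is superharmonic in the tangential directions. -/
lemma exists_log_slope_approx {η κ ι d : ℝ} (hρ : IsDefining n 1 Ω ρ V') (hη : 1 < η)
    (hU : IsOpen U) (hfU : frontier Ω ⊆ U)
    (hpsh : StrictPSHOn n (fun z => ρ z ^ η) ((closure Ω)ᶜ ∩ U))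
    (h : IsDefining n s Ω r V) (hs : 3 ≤ s) (hb : Bornology.IsBounded Ω)
    (hhh : ∀ z ∈ frontier Ω, 0 < hh z ∧ fderiv ℝ ρ z = hh z • fderiv ℝ r z)
    (hp : p ∈ frontier Ω) (hκ : 0 < κ) (hκ1 : κ ≤ 1) (hι : 0 < ι) (hι4 : ι ≤ 1 / 4) (hd : 0 < d)
    (hd4 : d ≤ 1 / 4)
    (p1 : (1 - ι + d) ^ η < (1 + κ) * (1 - ι) - κ * (1 - ι) ^ 2)
    (p2 : (1 + κ) * (1 + ι) - κ * (1 + ι) ^ 2 < (1 + ι - d) ^ η)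
    (p3 : (1 + ι + d) ^ η - (1 + κ) * (1 - ι) + κ * (1 + ι) ^ 2 < κ)
    (p4 : 1 + κ - 2 * κ * (1 - ι) < η * (1 - ι - d) ^ (η - 1) * (1 - d)) :
    ∃ T : Pt n → ℝ, ContDiff ℝ ((⊤ : ℕ∞) : WithTop ℕ∞) T ∧
      (∀ X, wd (cR n T) p X = om r p X) ∧
      (∀ L ∈ nullSp n r p, lap T p L = -(dlb r p L).re) ∧
      ∀ μ > 0, ∃ R₀ > 0, ∀ R, 0 < R → R < R₀ → ∃ G : Pt n → ℝ,
        ContDiff ℝ ((⊤ : ℕ∞) : WithTop ℕ∞) G ∧ ∀ z ∈ frontier Ω, sqn (z - p) ≤ R ^ 2 →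
          -G z ∈ Set.Icc (1 - 2 * ι) (1 + 2 * ι) ∧
          |βf η κ (-G z) - T z + Real.log (hh p) - Real.log (hh z)| ≤ μ * R ^ 2 ∧
          ∀ X ∈ T10 n r z, 0 ≤ lap G z X := by
  have hs1 : 1 ≤ s := le_trans (by norm_num) hs
  have hr3 := h.contDiffAt_nat (m := 3) hs hp
  have hr0 := h.2.2.2.2 p hp
  have hrd := hr3.differentiableAt (by norm_num)
  obtain ⟨ℓ, T, q, hq, hT, hT1, hT2, hq1, hqc, hqlog, hqim⟩ := exists_jet hr3 hr0
  refine ⟨T, hT, hT1, hT2, fun μ hμ => ?_⟩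
  obtain ⟨hν1, hν2⟩ := fderiv_nuv hrd hr0
  set ν := nuv r p with hν
  obtain ⟨hh0, hhp⟩ := hhh p hp
  set h0 := hh p with hh0def
  have hη0 : 0 < η := by linarith
  obtain ⟨R₁, hR₁, t₀, ht₀, touch⟩ := exists_touch hρ hη hU hfU hpsh hp hh0
    (by rw [hhp, smul_apply, hν1, smul_eq_mul, mul_one])
    (by rw [hhp, smul_apply, hν2, smul_zero]) ℓ hκ hι hι4 hd hd4 p1 p2 p3 p4
  set ε₁ := min 1 (μ / (4 * (1 + 256 * η / κ))) with hε₁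
  have hε₁0 : 0 < ε₁ := lt_min one_pos (by positivity)
  have hε₁1 : ε₁ ≤ 1 := min_le_left _ _
  have hε₁2 : ε₁ * (1 + 256 * η / κ) ≤ μ / 4 := by
    have h1 : ε₁ ≤ μ / (4 * (1 + 256 * η / κ)) := min_le_right _ _
    have h2 : 0 < 1 + 256 * η / κ := by positivity
    rw [le_div_iff₀ (by positivity)] at h1
    linarith
  have hρp := (hρ.contDiffAt (hρ.mem_V hp))
  have hDρ : ∀ z ∈ frontier Ω, ∀ w : ℂ, fderiv ℝ ρ z ((w * cexp (ℓ (z - p))) • ν) / h0 =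
      w.re * (hh z / h0 * (q z).re) - w.im * (hh z / h0 * (q z).im) := by
    intro z hz w
    rw [(hhh z hz).2, smul_apply, fderiv_smul_eq_re, mul_assoc,
      mul_comm (cexp _), ← hq, mul_re, smul_eq_mul]
    ring
  have ev1 : ∀ᶠ z in 𝓝 p, fderiv ℝ ρ z ((1 * cexp (ℓ (z - p))) • ν) / h0 ∈
      Set.Icc (1 / 2 : ℝ) 2 := by
    have hc : ContinuousAt (fun z => fderiv ℝ ρ z ((1 * cexp (ℓ (z - p))) • ν) / h0) p := by
      refine ((hρp.continuousAt_fderiv one_ne_zero).clm_apply ?_).div_const _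
      exact Continuous.continuousAt (by fun_prop)
    refine hc.eventually_mem (Icc_mem_nhds ?_ ?_) <;>
    · rw [hDρ p hp, hq1, div_self hh0.ne']
      norm_num
  have ev2 : ∀ᶠ z in 𝓝 p, 1 / 2 ≤ (q z).re := by
    refine (continuous_re.continuousAt.comp hqc).tendsto.eventually_const_le ?_
    simp only [Function.comp, hq1]
    norm_num
  have ev3 : ∀ᶠ z in 𝓝 p, wd (cR n r) z ν ≠ 0 := by
    have hc : ContinuousAt (fun z => wd (cR n r) z ν) p :=
      ContinuousAt.comp (f := fun z => (z, ν)) (x := p)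
        (contDiffAt_wd_pair (m := 2) (X₀ := ν) hr3).continuousAt (by fun_prop)
    refine hc.eventually_ne ?_
    rw [hν, wd_nuv hrd hr0]
    norm_num
  obtain ⟨R₂, hR₂, hball⟩ := Metric.eventually_nhds_iff_ball.1
    ((hqlog ε₁ hε₁0).and ((hqim ε₁ hε₁0).and (ev1.and (ev2.and ev3))))
  refine ⟨min R₁ R₂, lt_min hR₁ hR₂, fun R hR hRlt => ?_⟩
  set K : Set (Pt n) := frontier Ω ∩ {z | sqn (z - p) ≤ R ^ 2} with hKdef
  have hK : IsCompact K := (isCompact_frontier hb).inter_right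
    (isClosed_le (contDiff_sqn_sub p (m := 0)).continuous continuous_const)
  have hKnorm : ∀ z ∈ K, ‖z - p‖ ^ 2 ≤ R ^ 2 := fun z hz => (norm_sq_le_sqn _).trans hz.2
  have hKball : ∀ z ∈ K, z ∈ Metric.ball p (min R₁ R₂) := by
    intro z hz
    rw [mem_ball_iff_norm]
    exact lt_of_le_of_lt (abs_le_of_sq_le_sq' (hKnorm z hz) hR.le).2 hRlt
  set ε' := min (1 / 8) (μ * R ^ 2 / 32) with hε'
  have hε'0 : 0 < ε' := lt_min (by norm_num) (by positivity)
  have hε'1 : ε' ≤ 1 / 8 := min_le_left _ _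
  have hε'2 : ε' ≤ μ * R ^ 2 / 32 := min_le_right _ _
  obtain ⟨t, htip, ht, htt⟩ := ((eventually_tip_slope hK
    (fun z hz => hρ.contDiffAt (hρ.mem_V hz.1)) (fun z hz => hρ.eq_zero hz.1) ℓ p ν 3
    (mul_pos hε'0 hh0)).and (Ioo_mem_nhdsGT ht₀)).exists
  obtain ⟨W, hWo, hWK, x, hxc, hxn, hx⟩ := touch t ht htt
  have hKW : K ⊆ W := fun z hz => hWK ⟨hz.1,
    Metric.ball_subset_ball (min_le_left _ _) (hKball z hz)⟩
  have hslope : ∀ z ∈ K, ∀ w : ℂ, ‖w‖ ≤ 3 → |ρ (tip ℓ p ν t z w) / (h0 * t) -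
      (w.re * (hh z / h0 * (q z).re) - w.im * (hh z / h0 * (q z).im))| ≤ ε' := by
    intro z hz w hw
    rw [← hDρ z hz.1, mul_comm h0 t, ← div_div, ← sub_div, abs_div, abs_of_pos hh0,
      div_le_iff₀ hh0]
    exact htip z hz w hw
  have hlogx : ∀ z ∈ K, |βf η κ (x z) - T z + Real.log h0 - Real.log (hh z)| ≤
      μ * R ^ 2 / 2 := by
    intro z hz
    obtain ⟨b1, b2, b3, b4, -⟩ := hball z
      (Metric.ball_subset_ball (min_le_right _ _) (hKball z hz))
    obtain ⟨hxI, hM0, hP0, y, hy, hM1, hP1⟩ := hx z (hKW hz)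
    rw [hDρ z hz.1, one_re, one_im, zero_mul, sub_zero, one_mul] at b3
    have hhz := (hhh z hz.1).1
    have hqz : 0 < (q z).re := by linarith
    set A := hh z / h0 * (q z).re with hA
    set B := hh z / h0 * (q z).im with hB
    have hy1 : |y| ≤ 1 := abs_le.2 hy
    have hn0 : ‖(x z : ℂ)‖ ≤ 3 / 2 := by
      rw [Complex.norm_real, Real.norm_eq_abs, abs_le]
      constructor <;> linarith [hxI.1, hxI.2]
    have s0 := hslope z hz (x z) (by linarith)
    have s1 := hslope z hz (x z + y * I) (by
      refine (norm_add_le _ _).trans ?_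
      rw [norm_mul, norm_I, mul_one, Complex.norm_real y, Real.norm_eq_abs]
      linarith)
    simp only [ofReal_re, ofReal_im, zero_mul, sub_zero] at s0
    have e1 : ((x z : ℂ) + y * I).re = x z := by simp
    have e2 : ((x z : ℂ) + y * I).im = y := by simp
    rw [e1, e2] at s1
    have key := touch_log_estimate (η := η) (κ := κ) hη hκ hκ1 (by linarith [hxI.1])
      (by linarith [hxI.2]) b3.1 hε'0.le hε'1 hM0 hM1 s0 s1 hP0 hP1 hy1
    have hlogA : Real.log A = Real.log (hh z) - Real.log h0 + Real.log (q z).re := by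
      rw [hA, Real.log_mul (by positivity) hqz.ne', Real.log_div hhz.ne' hh0.ne']
    have hB1 : B ^ 2 ≤ 16 * (ε₁ ^ 2 * ‖z - p‖ ^ 2) := by
      have hBA : B * (q z).re = A * (q z).im := by rw [hA, hB]; ring
      have h1 : |B| * (1 / 2) ≤ 2 * (ε₁ * ‖z - p‖) := by
        calc |B| * (1 / 2) ≤ |B| * (q z).re := by gcongr
          _ = |B * (q z).re| := by rw [abs_mul B, abs_of_pos hqz]
          _ = |A * (q z).im| := by rw [hBA]
          _ = A * |(q z).im| := by rw [abs_mul A, abs_of_nonneg (a := A) (by linarith [b3.1])]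
          _ ≤ 2 * (ε₁ * ‖z - p‖) := mul_le_mul b3.2 b2 (abs_nonneg _) (by norm_num)
      have h2 : |B| ≤ 4 * (ε₁ * ‖z - p‖) := by linarith
      calc B ^ 2 = |B| ^ 2 := (sq_abs B).symm
        _ ≤ (4 * (ε₁ * ‖z - p‖)) ^ 2 := by gcongr
        _ = 16 * (ε₁ ^ 2 * ‖z - p‖ ^ 2) := by ring
    have hB2 : 16 * η * B ^ 2 / κ + ε₁ * ‖z - p‖ ^ 2 ≤ μ * R ^ 2 / 4 := by
      calc 16 * η * B ^ 2 / κ + ε₁ * ‖z - p‖ ^ 2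
          ≤ 16 * η * (16 * (ε₁ * ‖z - p‖ ^ 2)) / κ + ε₁ * ‖z - p‖ ^ 2 := by
            have h1 : ε₁ ^ 2 ≤ ε₁ := pow_le_of_le_one hε₁0.le hε₁1 two_ne_zero
            have h2 : B ^ 2 ≤ 16 * (ε₁ * ‖z - p‖ ^ 2) := hB1.trans (by gcongr)
            gcongr
        _ = ε₁ * (1 + 256 * η / κ) * ‖z - p‖ ^ 2 := by ring
        _ ≤ μ / 4 * R ^ 2 := by
          have := hKnorm z hz
          gcongr
        _ = μ * R ^ 2 / 4 := by ring
    rw [hlogA] at key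
    have k1 := abs_le.1 key
    have k2 := abs_le.1 b1
    rw [abs_le]
    constructor <;> linarith [k1.1, k1.2, k2.1, k2.2]
  have huc := isCompact_Icc.uniformContinuousOn_of_continuous
    (continuousOn_βf (η := η) hκ hκ1 hι4)
  obtain ⟨δ, hδ, huc⟩ := Metric.uniformContinuousOn_iff.1 huc (μ * R ^ 2 / 2) (by positivity)
  obtain ⟨G, hG, hGx, hGl⟩ := hxn.exists_smooth hWo hxc.neg hK hKW
    (δ := min ι (δ / 2)) (lt_min hι (by positivity))
  refine ⟨G, hG, fun z hz hzR => ?_⟩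
  have hzK : z ∈ K := ⟨hz, hzR⟩
  have hxI := (hx z (hKW hzK)).1
  have hGz := hGx z hzK
  have g1 := abs_le.1 (hGz.trans (min_le_left _ _))
  have hGI : -G z ∈ Set.Icc (1 - 2 * ι) (1 + 2 * ι) :=
    ⟨by linarith [g1.1, g1.2, hxI.1, hxI.2], by linarith [g1.1, g1.2, hxI.1, hxI.2]⟩
  refine ⟨hGI, ?_, fun X hX => ?_⟩
  · have h1 := huc (-G z) hGI (x z) ⟨by linarith [hxI.1], by linarith [hxI.2]⟩ (by
      rw [Real.dist_eq, ← abs_neg]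
      have := hGz.trans (min_le_right _ _)
      rw [show -(-G z - x z) = G z - -x z by ring]
      linarith)
    rw [Real.dist_eq] at h1
    have h2 := abs_lt.1 h1
    have h3 := abs_le.1 (hlogx z hzK)
    rw [abs_le]
    constructor <;> linarith [h2.1, h2.2, h3.1, h3.2]
  · by_cases hXν : ∃ c : ℂ, X = c • ν
    · obtain ⟨c, rfl⟩ := hXν
      rw [mem_T10, wd_smul_vec] at hX
      have hne := (hball z (Metric.ball_subset_ball (min_le_right _ _) (hKball z hzK))).2.2.2.2
      have hc : c = 0 := (mul_eq_zero.1 hX).resolve_right hne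
      have := lap_real_smul G z 0 0
      rw [zero_smul] at this
      rw [hc, zero_smul, this]
      simp
    · push Not at hXν
      exact hGl z hzK X hXν

end slope

section localweight
variable {n : ℕ} {p : Pt n} {ρ r hh : Pt n → ℝ} {Ω V V' U : Set (Pt n)} {s : ℕ∞}

lemma lap_affine {f : Pt n → ℝ} {z : Pt n} (hf : ContDiffAt ℝ 2 f z) (k a : ℝ) (X : Pt n) :
    lap (fun w => k + a * f w) z X = a * lap f z X := by
  have h1 : deriv (fun x : ℝ => k + a * x) = fun _ => a := by
    funext x
    simp
  rw [lap_comp (φ := fun x => k + a * x) hf (by fun_prop), h1]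
  simp

lemma wd_affine {f : Pt n → ℝ} {z : Pt n} (hf : DifferentiableAt ℝ f z) (k a : ℝ) (X : Pt n) :
    wd (cR n fun w => k + a * f w) z X = a * wd (cR n f) z X := by
  have h1 : HasFDerivAt (fun w => k + a * f w) (a • fderiv ℝ f z) z :=
    (hf.hasFDerivAt.const_smul a).const_add k
  rw [wd_cR h1.differentiableAt, wd_cR hf, h1.fderiv]
  simp only [smul_apply, smul_eq_mul]
  push_cast
  ring

lemma wd_comp {f : Pt n → ℝ} {φ : ℝ → ℝ} {d : ℝ} {z : Pt n} (hf : DifferentiableAt ℝ f z)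
    (hφ : HasDerivAt φ d (f z)) (X : Pt n) :
    wd (cR n fun w => φ (f w)) z X = d * wd (cR n f) z X := by
  have h1 : HasFDerivAt (fun w => φ (f w)) (d • fderiv ℝ f z) z :=
    hφ.comp_hasFDerivAt z hf.hasFDerivAt
  rw [wd_cR h1.differentiableAt, wd_cR hf, h1.fderiv]
  simp only [smul_apply, smul_eq_mul]
  push_cast
  ring

lemma wd_cR_add {f g : Pt n → ℝ} {z : Pt n} (hf : DifferentiableAt ℝ f z)
    (hg : DifferentiableAt ℝ g z) (X : Pt n) :
    wd (cR n fun w => f w + g w) z X = wd (cR n f) z X + wd (cR n g) z X := by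
  rw [wd_cR (hf.fun_add hg), wd_cR hf, wd_cR hg, fderiv_fun_add hf hg]
  simp only [add_apply]
  push_cast
  ring

lemma wd_cR_congr {f g : Pt n → ℝ} {z : Pt n} (h : f =ᶠ[𝓝 z] g) (X : Pt n) :
    wd (cR n f) z X = wd (cR n g) z X :=
  wd_congr (h.mono fun _ hw => by simp only [cR, hw]) X

lemma contDiffAt_βf {η κ x : ℝ} {m : WithTop ℕ∞} (hx : 0 < x) (hκ : 0 < 1 + κ - κ * x) :
    ContDiffAt ℝ m (βf η κ) x := by
  unfold βf
  have h1 : ContDiffAt ℝ m (fun x : ℝ => 1 + κ - κ * x) x := by fun_prop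
  exact (contDiffAt_const.mul (h1.log hκ.ne')).sub
    (contDiffAt_const.mul (contDiffAt_id.log hx.ne'))

lemma normSq_add_le_two (a b : ℂ) : normSq (a + b) ≤ 2 * normSq a + 2 * normSq b := by
  simp only [normSq_apply, add_re, add_im]
  nlinarith [sq_nonneg (a.re - b.re), sq_nonneg (a.im - b.im)]

lemma weight_algebra {c c₂ C b b' lG dl lT σ ε N : ℝ} {x y w : ℂ} (hc : 0 < c) (hcc : c < c₂)
    (hC : C = c * c₂ / (c₂ - c)) (hb : b ≤ 0) (hG : 0 ≤ lG) (hbb : c₂ * b ^ 2 ≤ b')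
    (hy : normSq y ≤ ε) (hT : dl + lT ≤ ε) (hw : normSq w ≤ σ ^ 2 * N) :
    c * normSq (-(b * x) + y + w) + dl - (-(b * lG) + b' * normSq x - lT + σ) ≤
      (2 * C + 1) * ε + 2 * C * (σ ^ 2 * N) - σ := by
  have hC0 : 0 ≤ C := by
    rw [hC]
    have := sub_pos.2 hcc
    have := hc.trans hcc
    positivity
  have h1 := normSq_add_le hcc (-(b * x)) (y + w)
  rw [← hC, normSq_neg, normSq_mul, normSq_ofReal, ← add_assoc] at h1
  have h2 := mul_le_mul_of_nonneg_left (normSq_add_le_two y w) hC0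
  have h3 := mul_le_mul_of_nonneg_right hbb (normSq_nonneg x)
  have h4 := mul_le_mul_of_nonneg_left hy hC0
  have h5 := mul_le_mul_of_nonneg_left hw hC0
  have h6 := mul_nonneg (neg_nonneg.2 hb) hG
  nlinarith

lemma βd_neg {η κ x : ℝ} (hη : 1 < η) (hκ : 0 < κ) (hx : 0 < x) (hκx : 0 < 1 + κ - κ * x) :
    βd η κ x ≤ 0 := by
  have h1 : 0 ≤ κ / η / (1 + κ - κ * x) := by positivity
  have h2 : 0 ≤ (η - 1) / η / x := by
    have := sub_pos.2 hη
    positivity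
  rw [βd, neg_div]
  linarith

set_option maxHeartbeats 1000000 in
/-- Near every boundary point there is a smooth weight, close to the logarithm of the slope
of `ρ` relative to `r` up to a controlled bump, which makes the curvature term negative. -/
lemma exists_local_weight {η c : ℝ} (hρ : IsDefining n 1 Ω ρ V') (hη : 1 < η)
    (hU : IsOpen U) (hfU : frontier Ω ⊆ U)
    (hpsh : StrictPSHOn n (fun z => ρ z ^ η) ((closure Ω)ᶜ ∩ U))
    (h : IsDefining n s Ω r V) (hs : 3 ≤ s) (hb : Bornology.IsBounded Ω)
    (hpsc : LeviPseudoconvex n r Ω)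
    (hhh : ∀ z ∈ frontier Ω, 0 < hh z ∧ fderiv ℝ ρ z = hh z • fderiv ℝ r z)
    (hc0 : 0 < c) (hc : c < η / (η - 1)) :
    ∃ σ > 0, ∀ p ∈ frontier Ω, ∃ R > 0, ∃ g : Pt n → ℝ,
      ContDiff ℝ ((⊤ : ℕ∞) : WithTop ℕ∞) g ∧ ∀ z ∈ frontier Ω, sqn (z - p) ≤ R ^ 2 →
        |g z - (Real.log (hh z) + 2 * σ * sqn z) - σ * (R ^ 2 / 4 - sqn (z - p))| ≤
          σ * R ^ 2 / 16 ∧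
        ∀ L, (z, L) ∈ nullBundle r Ω →
          c * normSq (om r z L + wd (cR n g) z L) + (dlb r z L).re - lap g z L ≤ -(σ / 2) := by
  obtain ⟨c₂, hcc, hc2⟩ := exists_between hc
  obtain ⟨κ, ι, d, hκ, hκ1, hι, hι4, hd, hd4, hβ, p1, p2, p3, p4⟩ :=
    exists_touch_parameters hη hc2
  set C := c * c₂ / (c₂ - c) with hC
  have hC0 : 0 < C := by
    have := sub_pos.2 hcc
    have := hc0.trans hcc
    positivity
  obtain ⟨M, hM⟩ := ((isCompact_frontier hb).image continuous_sqn).bddAbove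
  set N := 2 + 8 * max M 0 with hN
  have hN0 : 0 < N := by positivity
  set σ := 1 / (8 * C * N) with hσdef
  have hσ : 0 < σ := by positivity
  have hσN : 2 * C * (σ ^ 2 * N) = σ / 4 := by
    rw [hσdef]
    field_simp
    norm_num
  refine ⟨σ, hσ, fun p hp => ?_⟩
  obtain ⟨T, hT, hT1, hT2, hTG⟩ := exists_log_slope_approx hρ hη hU hfU hpsh h hs hb hhh hp hκ hκ1
    hι hι4 hd hd4 p1 p2 p3 p4
  obtain ⟨R₀, hR₀, hTG⟩ := hTG (σ / 16) (by positivity)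
  set ε := σ / (4 * (2 * C + 1)) with hε
  have hε0 : 0 < ε := by positivity
  have hεC : (2 * C + 1) * ε = σ / 4 := by
    rw [hε]
    field_simp
  have hT2' : ContDiff ℝ 2 T := hT.of_le (by
    show ((2 : ℕ∞) : WithTop ℕ∞) ≤ _
    exact WithTop.coe_le_coe.2 le_top)
  obtain ⟨δ, hδ, hball⟩ := Metric.eventually_nhds_iff_ball.1
    (tube_estimate h hs hb hpsc hp hT2' hT1 hT2 hε0)
  set R := min 1 (min R₀ δ) / 2 with hR
  have hmin : 0 < min 1 (min R₀ δ) := lt_min one_pos (lt_min hR₀ hδ)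
  have hR0 : 0 < R := half_pos hmin
  have hRm : R < min 1 (min R₀ δ) := half_lt_self hmin
  have hR1 : R < 1 := hRm.trans_le (min_le_left _ _)
  have hRR : R < R₀ := hRm.trans_le ((min_le_right _ _).trans (min_le_left _ _))
  have hRδ : R < δ := hRm.trans_le ((min_le_right _ _).trans (min_le_right _ _))
  obtain ⟨G, hG, hGz⟩ := hTG R hR0 hRR
  have hGc : Continuous G := hG.continuous
  set K : Set (Pt n) := frontier Ω ∩ {z | sqn (z - p) ≤ R ^ 2} with hKdef
  have hK : IsCompact K := (isCompact_frontier hb).inter_right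
    (isClosed_le (contDiff_sqn_sub p (m := 0)).continuous continuous_const)
  have hpos : ∀ x ∈ Set.Ioo (1 / 4 : ℝ) (7 / 4), 0 < x ∧ 0 < 1 + κ - κ * x := fun x hx =>
    ⟨by linarith [hx.1], by nlinarith [hx.2]⟩
  obtain ⟨f, hf, hfeq⟩ := exists_contDiff_eventuallyEq (f := fun z => βf η κ (-G z)) hK
    (O := (fun z => -G z) ⁻¹' Set.Ioo (1 / 4 : ℝ) (7 / 4)) (isOpen_Ioo.preimage hGc.neg)
    (fun z hz => by
      have := (hGz z hz.1 hz.2).1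
      show -G z ∈ Set.Ioo (1 / 4 : ℝ) (7 / 4)
      exact ⟨by linarith [this.1], by linarith [this.2]⟩)
    (fun z hz => by
      obtain ⟨h1, h2⟩ := hpos _ hz
      exact ((contDiffAt_βf h1 h2).comp z hG.neg.contDiffAt).contDiffWithinAt)
  set g : Pt n → ℝ := fun w => f w + ((Real.log (hh p) + (-1) * T w) +
    ((σ * (R ^ 2 / 4) + (-σ) * sqn (w - p)) + (0 + 2 * σ * sqn (w - 0)))) with hg
  have hsm : ∀ a : Pt n, ContDiff ℝ ((⊤ : ℕ∞) : WithTop ℕ∞) fun w => sqn (w - a) :=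
    fun a => contDiff_sqn_sub a
  refine ⟨R, hR0, g, hf.add ((contDiff_const.add (contDiff_const.mul hT)).add
    ((contDiff_const.add (contDiff_const.mul (hsm p))).add
      (contDiff_const.add (contDiff_const.mul (hsm 0))))), fun z hz hzR => ?_⟩
  have hzK : z ∈ K := ⟨hz, hzR⟩
  obtain ⟨hGI, hGv, hGl⟩ := hGz z hz hzR
  have hGI' : -G z ∈ Set.Ioo (1 / 4 : ℝ) (7 / 4) :=
    ⟨by linarith [hGI.1], by linarith [hGI.2]⟩
  obtain ⟨hx0, hx1⟩ := hpos _ hGI'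
  refine ⟨?_, fun L hL => ?_⟩
  · rw [hg]
    simp only [sub_zero, (hfeq z hzK).eq_of_nhds]
    convert hGv using 2 <;> ring
  · have two_le : ((2 : ℕ∞) : WithTop ℕ∞) ≤ ((⊤ : ℕ∞) : WithTop ℕ∞) := WithTop.coe_le_coe.2 le_top
    have cG : ContDiffAt ℝ 2 G z := hG.contDiffAt.of_le two_le
    have cT : ContDiffAt ℝ 2 T z := hT2'.contDiffAt
    have cf : ContDiffAt ℝ 2 f z := hf.contDiffAt.of_le two_le
    have cs : ∀ a : Pt n, ContDiffAt ℝ 2 (fun w => sqn (w - a)) z :=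
      fun a => (contDiff_sqn_sub a).contDiffAt
    have caf : ∀ (u : Pt n → ℝ) (k a : ℝ), ContDiffAt ℝ 2 u z →
        ContDiffAt ℝ 2 (fun w => k + a * u w) z :=
      fun u k a hu => contDiffAt_const.add (contDiffAt_const.mul hu)
    have dd : ∀ u : Pt n → ℝ, ContDiffAt ℝ 2 u z → DifferentiableAt ℝ u z :=
      fun u hu => hu.differentiableAt (by norm_num)
    have hφ1 : ∀ x : ℝ, -x ∈ Set.Ioo (1 / 4 : ℝ) (7 / 4) →
        HasDerivAt (fun x => βf η κ (-x)) (-βd η κ (-x)) x := fun x hx => by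
      obtain ⟨h1, h2⟩ := hpos _ hx
      have := (hasDerivAt_βf (η := η) h1.ne' h2.ne').comp x (hasDerivAt_neg x)
      rwa [mul_neg_one] at this
    have hφ2 : deriv (deriv fun x => βf η κ (-x)) (G z) = βdd η κ (-G z) := by
      have e1 : (deriv fun x => βf η κ (-x)) =ᶠ[𝓝 (G z)] fun x => -βd η κ (-x) := by
        filter_upwards [(isOpen_Ioo.preimage continuous_neg).mem_nhds
          (show G z ∈ (fun x : ℝ => -x) ⁻¹' Set.Ioo (1 / 4 : ℝ) (7 / 4) from hGI')] with x hx
        exact (hφ1 x hx).deriv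
      rw [e1.deriv_eq]
      have := ((hasDerivAt_βd (η := η) hx0.ne' hx1.ne').comp (G z) (hasDerivAt_neg (G z))).neg
      rw [mul_neg_one, neg_neg] at this
      exact this.deriv
    have lf : lap f z L = -(βd η κ (-G z) * lap G z L) +
        βdd η κ (-G z) * normSq (wd (cR n G) z L) := by
      rw [lap_congr (hfeq z hzK), lap_comp (φ := fun x => βf η κ (-x)) cG, hφ2, (hφ1 _ hGI').deriv,
        neg_mul]
      exact (contDiffAt_βf hx0 hx1).comp (G z) contDiff_neg.contDiffAt
    have wf : wd (cR n f) z L = -(βd η κ (-G z) * wd (cR n G) z L) := by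
      rw [wd_cR_congr (hfeq z hzK), wd_comp (φ := fun x => βf η κ (-x)) (dd _ cG) (hφ1 _ hGI')]
      push_cast
      ring
    have hL1 : sqn L = 1 := hL.2.2
    set w : ℂ := ((-σ : ℝ) : ℂ) * wd (cR n fun w => sqn (w - p)) z L +
      ((2 * σ : ℝ) : ℂ) * wd (cR n fun w => sqn (w - 0)) z L with hw
    have lg : lap g z L = -(βd η κ (-G z) * lap G z L) +
        βdd η κ (-G z) * normSq (wd (cR n G) z L) - lap T z L + σ := by
      rw [hg, lap_add cf ((caf _ _ _ cT).add ((caf _ _ _ (cs p)).add (caf _ _ _ (cs 0)))),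
        lap_add (caf _ _ _ cT) ((caf _ _ _ (cs p)).add (caf _ _ _ (cs 0))),
        lap_add (caf _ _ _ (cs p)) (caf _ _ _ (cs 0)), lap_affine cT, lap_affine (cs p),
        lap_affine (cs 0), lap_sqn_sub, lap_sqn_sub, hL1, lf]
      ring
    have wg : om r z L + wd (cR n g) z L = -(βd η κ (-G z) * wd (cR n G) z L) +
        (om r z L - wd (cR n T) z L) + w := by
      rw [hg, wd_cR_add (dd _ cf) (dd _ ((caf _ _ _ cT).add
          ((caf _ _ _ (cs p)).add (caf _ _ _ (cs 0))))),
        wd_cR_add (dd _ (caf _ _ _ cT)) (dd _ ((caf _ _ _ (cs p)).add (caf _ _ _ (cs 0)))),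
        wd_cR_add (dd _ (caf _ _ _ (cs p))) (dd _ (caf _ _ _ (cs 0))), wd_affine (dd _ cT),
        wd_affine (dd _ (cs p)), wd_affine (dd _ (cs 0)), wf, hw]
      push_cast
      ring
    have hwN : normSq w ≤ σ ^ 2 * N := by
      refine (normSq_add_le_two _ _).trans ?_
      rw [normSq_mul, normSq_mul, normSq_ofReal, normSq_ofReal]
      have h1 := normSq_wd_sqn_sub_le p z L
      have h2 := normSq_wd_sqn_sub_le 0 z L
      rw [hL1, mul_one] at h1 h2
      rw [sub_zero] at h2
      have h3 : sqn z ≤ max M 0 := (hM ⟨z, hz, rfl⟩).trans (le_max_left _ _)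
      have h4 : sqn (z - p) ≤ 1 := hzR.trans (by nlinarith)
      have h5 := mul_le_mul_of_nonneg_left (h1.trans h4) (sq_nonneg σ)
      have h6 := mul_le_mul_of_nonneg_left (h2.trans h3) (sq_nonneg σ)
      rw [hN]
      linarith
    have hzb : z ∈ Metric.ball p δ := by
      rw [mem_ball_iff_norm]
      exact lt_of_le_of_lt (abs_le_of_sq_le_sq' ((norm_sq_le_sqn _).trans hzR) hR0.le).2 hRδ
    obtain ⟨t1, t2⟩ := hball z hzb L hL
    have := weight_algebra hc0 hcc hC (βd_neg hη hκ hx0 hx1) (hGl L hL.2.1.1) (hβ _ hGI) t1 t2 hwN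
      (x := wd (cR n G) z L)
    rw [wg, lg]
    linarith

end localweight

section gluing
variable {n : ℕ}

lemma lap_mul_real {a b : Pt n → ℝ} {z : Pt n} (ha : ContDiffAt ℝ 2 a z) (hb : ContDiffAt ℝ 2 b z)
    (X : Pt n) : lap (fun w => a w * b w) z X = a z * lap b z X + b z * lap a z X +
      2 * (wd (cR n a) z X * (starRingEnd ℂ) (wd (cR n b) z X)).re := by
  rw [wd_cR (ha.differentiableAt (by norm_num)), wd_cR (hb.differentiableAt (by norm_num))]
  unfold lap lapB
  rw [fderiv2_mul ha hb, fderiv2_mul ha hb]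
  simp
  ring

lemma wd_mul_real {a b : Pt n → ℝ} {z : Pt n} (ha : DifferentiableAt ℝ a z)
    (hb : DifferentiableAt ℝ b z) (X : Pt n) :
    wd (cR n fun w => a w * b w) z X = a z * wd (cR n b) z X + b z * wd (cR n a) z X := by
  rw [wd_cR (ha.fun_mul hb), wd_cR ha, wd_cR hb, fderiv_fun_mul ha hb]
  simp only [add_apply, smul_apply, smul_eq_mul]
  push_cast
  ring

/-- The Wirtinger derivative and the Laplacian of `φ² exp (K g)`. -/
lemma wd_lap_bump {φ g : Pt n → ℝ} {z : Pt n} (hφ : ContDiffAt ℝ 2 φ z) (hg : ContDiffAt ℝ 2 g z)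
    (K : ℝ) (X : Pt n) :
    wd (cR n fun w => φ w * φ w * Real.exp (K * g w)) z X = ((Real.exp (K * g z) * φ z : ℝ) : ℂ) *
        (2 * wd (cR n φ) z X + (K * φ z : ℝ) * wd (cR n g) z X) ∧
      lap (fun w => φ w * φ w * Real.exp (K * g w)) z X = Real.exp (K * g z) *
        (φ z ^ 2 * (K * lap g z X + K ^ 2 * normSq (wd (cR n g) z X)) + 2 * φ z * lap φ z X +
          2 * normSq (wd (cR n φ) z X) +
          4 * K * φ z * (wd (cR n φ) z X * (starRingEnd ℂ) (wd (cR n g) z X)).re) := by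
  have dφ := hφ.differentiableAt (by norm_num)
  have dg := hg.differentiableAt (by norm_num)
  have hK : ∀ x : ℝ, HasDerivAt (fun x => Real.exp (K * x)) (K * Real.exp (K * x)) x := fun x => by
    have := ((hasDerivAt_id x).const_mul K).exp
    rw [mul_one, mul_comm] at this
    exact this
  have hK1 : deriv (fun x => Real.exp (K * x)) = fun x => K * Real.exp (K * x) :=
    funext fun x => (hK x).deriv
  have hK2 : ∀ x, deriv (deriv fun x => Real.exp (K * x)) x = K * (K * Real.exp (K * x)) :=
    fun x => by rw [hK1]; exact ((hK x).const_mul K).deriv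
  have cu : ContDiffAt ℝ 2 (fun w => Real.exp (K * g w)) z := (contDiffAt_const.mul hg).exp
  have wu := wd_comp (φ := fun x => Real.exp (K * x)) dg (hK (g z)) X
  have lu := lap_comp (φ := fun x => Real.exp (K * x)) hg
    (contDiffAt_const.mul contDiffAt_id).exp X
  rw [hK2, hK1] at lu
  have wφ := wd_mul_real dφ dφ X
  have lφ := lap_mul_real hφ hφ X
  rw [mul_conj, ofReal_re] at lφ
  refine ⟨?_, ?_⟩
  · rw [wd_mul_real (a := fun w => φ w * φ w) (dφ.fun_mul dφ) (cu.differentiableAt (by norm_num)),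
      wu, wφ]
    push_cast
    ring
  · rw [lap_mul_real (a := fun w => φ w * φ w) (hφ.mul hφ) cu, wu, lu, wφ, lφ]
    simp only [mul_re, mul_im, add_re, add_im, conj_re, conj_im, ofReal_re, ofReal_im]
    ring

/-- The curvature term of `(log V) / K` in terms of `V`. -/
lemma curvature_log {V : Pt n → ℝ} {z : Pt n} (hV : ContDiffAt ℝ 2 V z) (hV0 : 0 < V z) {K : ℝ}
    (hK : 0 < K) (c dl : ℝ) (o : ℂ) (X : Pt n) :
    c * normSq (o + wd (cR n fun w => 1 / K * Real.log (V w)) z X) + dl -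
        lap (fun w => 1 / K * Real.log (V w)) z X =
      (K * (c * normSq o + dl) * V z + 2 * c * (o * (starRingEnd ℂ) (wd (cR n V) z X)).re +
        (1 + c / K) * (normSq (wd (cR n V) z X) / V z) - lap V z X) / (K * V z) := by
  have h1 : ∀ x : ℝ, x ≠ 0 → HasDerivAt (fun x => 1 / K * Real.log x) (1 / K * x⁻¹) x :=
    fun x hx => (Real.hasDerivAt_log hx).const_mul _
  have h2 : deriv (deriv fun x => 1 / K * Real.log x) (V z) = 1 / K * -(V z ^ 2)⁻¹ := by
    have e1 : (deriv fun x => 1 / K * Real.log x) =ᶠ[𝓝 (V z)] fun x => 1 / K * x⁻¹ := by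
      filter_upwards [isOpen_ne.mem_nhds hV0.ne'] with x hx
      exact (h1 x hx).deriv
    rw [e1.deriv_eq]
    exact ((hasDerivAt_inv hV0.ne').const_mul _).deriv
  rw [wd_comp (φ := fun x => 1 / K * Real.log x) (hV.differentiableAt (by norm_num)) (h1 _ hV0.ne'),
    lap_comp (φ := fun x => 1 / K * Real.log x) hV
      (contDiffAt_const.mul (contDiffAt_id.log hV0.ne')), h2, (h1 _ hV0.ne').deriv]
  simp only [normSq_apply, mul_re, mul_im, add_re, add_im, conj_re, conj_im, ofReal_re, ofReal_im]
  field_simp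
  ring

/-- The density of the curvature term of a bump `φ² exp (K g)`. -/
noncomputable def bumpTerm (c K A φ lφ lg : ℝ) (o wφ wg : ℂ) : ℝ :=
  K * A * φ ^ 2 + 2 * c * φ * (o * (starRingEnd ℂ) (2 * wφ + (K * φ : ℝ) * wg)).re +
    (1 + c / K) * normSq (2 * wφ + (K * φ : ℝ) * wg) -
    (φ ^ 2 * (K * lg + K ^ 2 * normSq wg) + 2 * φ * lφ + 2 * normSq wφ +
      4 * K * φ * (wφ * (starRingEnd ℂ) wg).re)

lemma bumpTerm_one {c K dl lg : ℝ} (hK : K ≠ 0) (o wg : ℂ) :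
    bumpTerm c K (c * normSq o + dl) 1 0 lg o 0 wg = K * (c * normSq (o + wg) + dl - lg) := by
  rw [bumpTerm]
  simp only [normSq_apply, mul_re, mul_im, add_re, add_im, conj_re, conj_im, ofReal_re, ofReal_im,
    zero_re, zero_im]
  field_simp
  simp
  ring

lemma bumpTerm_zero (c K A lφ lg : ℝ) (o wg : ℂ) : bumpTerm c K A 0 lφ lg o 0 wg = 0 := by
  simp [bumpTerm]

lemma bumpTerm_le {c K A φ lφ lg : ℝ} (hc : 0 ≤ c) (hK : 1 ≤ K) (hφ : 0 ≤ φ) (o wφ wg : ℂ) :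
    bumpTerm c K A φ lφ lg o wφ wg ≤ K ^ 2 * (|A| * φ ^ 2 + 2 * c * φ *
        (‖o‖ * (2 * ‖wφ‖ + φ * ‖wg‖))
      + (1 + c) * (2 * ‖wφ‖ + φ * ‖wg‖) ^ 2 + φ ^ 2 * |lg| + 2 * φ * |lφ| +
        4 * φ * (‖wφ‖ * ‖wg‖)) := by
  have hK0 : 0 < K := by linarith
  have hKK : K ≤ K ^ 2 := by nlinarith
  have hK2 : 1 ≤ K ^ 2 := by nlinarith
  set N := 2 * ‖wφ‖ + φ * ‖wg‖ with hN
  have hN0 : 0 ≤ N := by positivity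
  have ha : ‖2 * wφ + (K * φ : ℝ) * wg‖ ≤ K * N := by
    refine (norm_add_le _ _).trans ?_
    rw [norm_mul, norm_mul, Complex.norm_real, Real.norm_eq_abs, abs_of_nonneg (by positivity), hN]
    have : ‖(2 : ℂ)‖ = 2 := by norm_num
    rw [this]
    nlinarith [norm_nonneg wφ]
  have t1 : K * A * φ ^ 2 ≤ K ^ 2 * (|A| * φ ^ 2) := by
    calc K * A * φ ^ 2 ≤ K * |A| * φ ^ 2 := by gcongr; exact le_abs_self A
      _ ≤ K ^ 2 * |A| * φ ^ 2 := by gcongr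
      _ = _ := by ring
  have t2 : 2 * c * φ * (o * (starRingEnd ℂ) (2 * wφ + (K * φ : ℝ) * wg)).re ≤
      K ^ 2 * (2 * c * φ * (‖o‖ * N)) := by
    have h1 : (o * (starRingEnd ℂ) (2 * wφ + (K * φ : ℝ) * wg)).re ≤ ‖o‖ * (K ^ 2 * N) := by
      refine (re_le_norm _).trans ?_
      rw [norm_mul, norm_conj]
      have : K * N ≤ K ^ 2 * N := by gcongr
      have := ha.trans this
      gcongr
    calc _ ≤ 2 * c * φ * (‖o‖ * (K ^ 2 * N)) := by gcongr
      _ = _ := by ring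
  have t3 : (1 + c / K) * normSq (2 * wφ + (K * φ : ℝ) * wg) ≤ K ^ 2 * ((1 + c) * N ^ 2) := by
    have h1 : c / K ≤ c := div_le_self hc hK
    rw [normSq_eq_norm_sq]
    calc _ ≤ (1 + c) * (K * N) ^ 2 := by gcongr
      _ = _ := by ring
  have t4 : -(φ ^ 2 * (K * lg)) ≤ K ^ 2 * (φ ^ 2 * |lg|) := by
    calc -(φ ^ 2 * (K * lg)) = K * (φ ^ 2 * -lg) := by ring
      _ ≤ K * (φ ^ 2 * |lg|) := by gcongr; exact neg_le_abs lg
      _ ≤ _ := by gcongr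
  have t5 : -(2 * φ * lφ) ≤ K ^ 2 * (2 * φ * |lφ|) := by
    calc -(2 * φ * lφ) = 2 * φ * -lφ := by ring
      _ ≤ 1 * (2 * φ * |lφ|) := by rw [one_mul]; gcongr; exact neg_le_abs lφ
      _ ≤ _ := by gcongr
  have t6 : -(4 * K * φ * (wφ * (starRingEnd ℂ) wg).re) ≤ K ^ 2 * (4 * φ * (‖wφ‖ * ‖wg‖)) := by
    have h1 : -(wφ * (starRingEnd ℂ) wg).re ≤ ‖wφ‖ * ‖wg‖ := by
      rw [← norm_conj wg, ← norm_mul]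
      exact (neg_le_abs _).trans (abs_re_le_norm _)
    calc _ = K * (4 * φ * -(wφ * (starRingEnd ℂ) wg).re) := by ring
      _ ≤ K * (4 * φ * (‖wφ‖ * ‖wg‖)) := by gcongr
      _ ≤ _ := by gcongr
  have t7 : 0 ≤ φ ^ 2 * (K ^ 2 * normSq wg) := by
    have := normSq_nonneg wg
    positivity
  have t8 := normSq_nonneg wφ
  rw [bumpTerm]
  linarith

lemma normSq_sum_le {ι : Type*} (t : Finset ι) (v φ : ι → ℝ) (a : ι → ℂ) (hv : ∀ i ∈ t, 0 ≤ v i)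
    (hφ : ∀ i ∈ t, 0 ≤ φ i) :
    normSq (∑ i ∈ t, ((v i * φ i : ℝ) : ℂ) * a i) ≤
      (∑ i ∈ t, v i * φ i ^ 2) * ∑ i ∈ t, v i * normSq (a i) := by
  rw [normSq_eq_norm_sq]
  have h1 : ‖∑ i ∈ t, ((v i * φ i : ℝ) : ℂ) * a i‖ ≤ ∑ i ∈ t, v i * φ i * ‖a i‖ := by
    refine (norm_sum_le _ _).trans (Finset.sum_le_sum fun i hi => ?_)
    rw [norm_mul, Complex.norm_real, Real.norm_eq_abs,
      abs_of_nonneg (mul_nonneg (hv i hi) (hφ i hi))]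
  refine (pow_le_pow_left₀ (norm_nonneg _) h1 2).trans ?_
  refine Finset.sum_sq_le_sum_mul_sum_of_sq_le_mul t (fun i hi => ?_) (fun i hi => ?_)
    (fun i _ => ?_)
  · exact mul_nonneg (hv i hi) (sq_nonneg _)
  · exact mul_nonneg (hv i hi) (normSq_nonneg _)
  · rw [normSq_eq_norm_sq]
    exact le_of_eq (by ring)

end gluing

section glueAssembly
variable {n : ℕ} {r ρ hh : Pt n → ℝ} {Ω V V' U : Set (Pt n)} {s : ℕ∞} {p : Pt n}

lemma wd_cR_sum {ι : Type*} {f : ι → Pt n → ℝ} {t : Finset ι} {z : Pt n}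
    (hf : ∀ i ∈ t, DifferentiableAt ℝ (f i) z) (X : Pt n) :
    wd (cR n fun w => ∑ i ∈ t, f i w) z X = ∑ i ∈ t, wd (cR n (f i)) z X := by
  have h1 : (cR n fun w => ∑ i ∈ t, f i w) = fun w => ∑ i ∈ t, cR n (f i) w := by
    ext w
    simp [cR]
  rw [h1]
  exact wd_sum (fun i hi => Complex.ofRealCLM.differentiableAt.comp z (hf i hi)) X

/-- A smooth cutoff function around `p` at scale `R`. -/
noncomputable def bump (R : ℝ) (p z : Pt n) : ℝ :=
  Real.smoothTransition (2 - 2 / R ^ 2 * sqn (z - p))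

lemma contDiff_bump (R : ℝ) (p : Pt n) : ContDiff ℝ ((⊤ : ℕ∞) : WithTop ℕ∞) (bump R p) :=
  Real.smoothTransition.contDiff.comp
    (contDiff_const.sub (contDiff_const.mul (contDiff_sqn_sub p)))

lemma bump_nonneg (R : ℝ) (p z : Pt n) : 0 ≤ bump R p z := Real.smoothTransition.nonneg _

lemma bump_eventually_one {R : ℝ} (hR : 0 < R) {z : Pt n} (hz : sqn (z - p) < R ^ 2 / 2) :
    bump R p =ᶠ[𝓝 z] fun _ => 1 := by
  have h1 : Continuous fun w : Pt n => sqn (w - p) := (contDiff_sqn_sub p (m := 0)).continuous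
  filter_upwards [h1.continuousAt.eventually_lt_const hz] with w hw
  refine Real.smoothTransition.one_of_one_le ?_
  have h2 : 2 / R ^ 2 * sqn (w - p) ≤ 1 := by
    rw [div_mul_eq_mul_div, div_le_one (by positivity)]
    linarith
  linarith

lemma bump_eventually_zero {R : ℝ} (hR : 0 < R) {z : Pt n} (hz : R ^ 2 < sqn (z - p)) :
    bump R p =ᶠ[𝓝 z] fun _ => 0 := by
  have h1 : Continuous fun w : Pt n => sqn (w - p) := (contDiff_sqn_sub p (m := 0)).continuous
  filter_upwards [h1.continuousAt.eventually_const_lt hz] with w hw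
  refine Real.smoothTransition.zero_of_nonpos ?_
  have h2 : 2 ≤ 2 / R ^ 2 * sqn (w - p) := by
    rw [div_mul_eq_mul_div, le_div_iff₀ (by positivity)]
    linarith
  linarith

lemma wd_lap_of_eventuallyEq_const {φ : Pt n → ℝ} {z : Pt n} {k : ℝ} (h : φ =ᶠ[𝓝 z] fun _ => k)
    (X : Pt n) : wd (cR n φ) z X = 0 ∧ lap φ z X = 0 := by
  rw [wd_cR_congr h, lap_congr h]
  have h1 := wd_affine (n := n) (f := fun _ => (0 : ℝ)) (z := z) (by fun_prop) k 0 X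
  have h2 := lap_affine (n := n) (f := fun _ => (0 : ℝ)) (z := z) contDiffAt_const k 0 X
  simp only [mul_zero, add_zero, zero_mul, ofReal_zero] at h1 h2
  exact ⟨h1, h2⟩

lemma exists_bumpTerm_bound (h : IsDefining n s Ω r V) (hs : 3 ≤ s) (hb : Bornology.IsBounded Ω)
    (hpsc : LeviPseudoconvex n r Ω) {φ g : Pt n → ℝ}
    (hφ : ContDiff ℝ ((⊤ : ℕ∞) : WithTop ℕ∞) φ) (hg : ContDiff ℝ ((⊤ : ℕ∞) : WithTop ℕ∞) g)
    (h0 : ∀ z, 0 ≤ φ z) {c : ℝ} (hc : 0 ≤ c) :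
    ∃ C, 0 ≤ C ∧ ∀ z L, (z, L) ∈ nullBundle r Ω → ∀ K, 1 ≤ K →
      bumpTerm c K (c * normSq (om r z L) + (dlb r z L).re) (φ z) (lap φ z L) (lap g z L)
        (om r z L) (wd (cR n φ) z L) (wd (cR n g) z L) ≤ K ^ 2 * C := by
  have hK := isCompact_nullBundle h (le_trans (by norm_num) hs) hb hpsc
  let F : Pt n × Pt n → ℝ := fun q =>
    |c * normSq (om r q.1 q.2) + (dlb r q.1 q.2).re| * φ q.1 ^ 2 +
      2 * c * φ q.1 * (‖om r q.1 q.2‖ * (2 * ‖wd (cR n φ) q.1 q.2‖ + φ q.1 * ‖wd (cR n g) q.1 q.2‖))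
      + (1 + c) * (2 * ‖wd (cR n φ) q.1 q.2‖ + φ q.1 * ‖wd (cR n g) q.1 q.2‖) ^ 2
      + φ q.1 ^ 2 * |lap g q.1 q.2| + 2 * φ q.1 * |lap φ q.1 q.2| +
        4 * φ q.1 * (‖wd (cR n φ) q.1 q.2‖ * ‖wd (cR n g) q.1 q.2‖)
  have wdc : ∀ f : Pt n → ℝ, ContDiff ℝ ((⊤ : ℕ∞) : WithTop ℕ∞) f → ∀ q : Pt n × Pt n,
      ContinuousAt (fun q : Pt n × Pt n => wd (cR n f) q.1 q.2) q := fun f hf q =>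
    (contDiffAt_wd_pair (m := 0) (p := q.1) (X₀ := q.2)
      (hf.contDiffAt.of_le (WithTop.coe_le_coe.2 le_top))).continuousAt
  have lapc : ∀ f : Pt n → ℝ, ContDiff ℝ ((⊤ : ℕ∞) : WithTop ℕ∞) f → ∀ q : Pt n × Pt n,
      ContinuousAt (fun q : Pt n × Pt n => lap f q.1 q.2) q := fun f hf q =>
    (contDiffAt_lap_pair (m := 0) (p := q.1) (X₀ := q.2)
      (hf.contDiffAt.of_le (WithTop.coe_le_coe.2 le_top))).continuousAt
  have hF : ContinuousOn F (nullBundle r Ω) := by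
    intro q hq
    have c1 : ContinuousAt (fun q : Pt n × Pt n => om r q.1 q.2) q :=
      continuousAt_om (h.contDiffAt_nat hs hq.1) (h.2.2.2.2 _ hq.1) q.2
    have c2 : ContinuousAt (fun q : Pt n × Pt n => dlb r q.1 q.2) q :=
      continuousAt_dlb (h.contDiffAt_nat hs hq.1) (h.2.2.2.2 _ hq.1) q.2
    have c3 := wdc φ hφ q
    have c4 := wdc g hg q
    have c5 := lapc φ hφ q
    have c6 := lapc g hg q
    have c7 : ContinuousAt (fun q : Pt n × Pt n => φ q.1) q :=
      hφ.continuous.continuousAt.comp continuousAt_fst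
    have c8 : ContinuousAt (fun q : Pt n × Pt n => normSq (om r q.1 q.2)) q :=
      continuous_normSq.continuousAt.comp c1
    have c9 : ContinuousAt (fun q : Pt n × Pt n => (dlb r q.1 q.2).re) q :=
      continuous_re.continuousAt.comp c2
    refine ContinuousAt.continuousWithinAt ?_
    have d1 := ((continuousAt_const (y := c)).mul c8 |>.add c9).abs.mul (c7.pow 2)
    have d2 := ((continuousAt_const (y := (2 : ℝ))).mul c3.norm).add (c7.mul c4.norm)
    have d3 := (c7.const_mul (2 * c)).mul (c1.norm.mul d2)
    exact ((((d1.add d3).add ((d2.pow 2).const_mul (1 + c))).add ((c7.pow 2).mul c6.abs)).add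
      ((c7.const_mul 2).mul c5.abs)).add ((c7.const_mul 4).mul (c3.norm.mul c4.norm))
  obtain ⟨C, hC⟩ := hK.exists_bound_of_continuousOn hF
  refine ⟨max C 0, le_max_right _ _, fun z L hzL K hK1 => ?_⟩
  refine (bumpTerm_le hc hK1 (h0 z) _ _ _).trans ?_
  gcongr
  exact ((le_abs_self _).trans (hC (z, L) hzL)).trans (le_max_left _ _)

end glueAssembly

section glueFinal
variable {n : ℕ} {r ρ hh : Pt n → ℝ} {Ω V V' U : Set (Pt n)} {s : ℕ∞} {p : Pt n}

/-- The curvature of a logarithmic sum of bumps is bounded by the weighted sum of the terms. -/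
lemma curvature_sum_le {ι : Type*} {t : Finset ι} {φ g : ι → Pt n → ℝ} {z : Pt n}
    (hφ : ∀ i ∈ t, ContDiffAt ℝ 2 (φ i) z) (hg : ∀ i ∈ t, ContDiffAt ℝ 2 (g i) z)
    (h0 : ∀ i ∈ t, 0 ≤ φ i z) {c K : ℝ} (hc : 0 ≤ c) (hK : 0 < K) {W : Pt n → ℝ}
    (hW : W = fun w => ∑ i ∈ t, φ i w * φ i w * Real.exp (K * g i w)) (hW0 : 0 < W z) (dl : ℝ)
    (o : ℂ) (X : Pt n) :
    c * normSq (o + wd (cR n fun w => 1 / K * Real.log (W w)) z X) + dl -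
        lap (fun w => 1 / K * Real.log (W w)) z X ≤
      (∑ i ∈ t, Real.exp (K * g i z) * bumpTerm c K (c * normSq o + dl) (φ i z) (lap (φ i) z X)
        (lap (g i) z X) o (wd (cR n (φ i)) z X) (wd (cR n (g i)) z X)) / (K * W z) := by
  have hterm : ∀ i ∈ t, ContDiffAt ℝ 2 (fun w => φ i w * φ i w * Real.exp (K * g i w)) z :=
    fun i hi => ((hφ i hi).mul (hφ i hi)).mul (contDiffAt_const.mul (hg i hi)).exp
  have hW2 : ContDiffAt ℝ 2 W z := by
    rw [hW]
    exact ContDiffAt.sum hterm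
  have hwd : wd (cR n W) z X = ∑ i ∈ t, ((Real.exp (K * g i z) * φ i z : ℝ) : ℂ) *
      (2 * wd (cR n (φ i)) z X + (K * φ i z : ℝ) * wd (cR n (g i)) z X) := by
    rw [hW, wd_cR_sum fun i hi => (hterm i hi).differentiableAt (by norm_num)]
    exact Finset.sum_congr rfl fun i hi => (wd_lap_bump (hφ i hi) (hg i hi) K X).1
  have hlap : lap W z X = ∑ i ∈ t, Real.exp (K * g i z) *
        (φ i z ^ 2 * (K * lap (g i) z X + K ^ 2 * normSq (wd (cR n (g i)) z X)) +
          2 * φ i z * lap (φ i) z X + 2 * normSq (wd (cR n (φ i)) z X) +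
          4 * K * φ i z * (wd (cR n (φ i)) z X * (starRingEnd ℂ) (wd (cR n (g i)) z X)).re) := by
    rw [hW, lap_sum hterm]
    exact Finset.sum_congr rfl fun i hi => (wd_lap_bump (hφ i hi) (hg i hi) K X).2
  have hWz : W z = ∑ i ∈ t, Real.exp (K * g i z) * φ i z ^ 2 := by
    rw [hW]
    exact Finset.sum_congr rfl fun i _ => by ring
  have hsq := normSq_sum_le t (fun i => Real.exp (K * g i z)) (fun i => φ i z)
    (fun i => 2 * wd (cR n (φ i)) z X + (K * φ i z : ℝ) * wd (cR n (g i)) z X)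
    (fun i _ => (Real.exp_pos _).le) h0
  rw [← hwd, ← hWz, mul_comm, ← div_le_iff₀ hW0] at hsq
  rw [curvature_log hW2 hW0 hK]
  gcongr
  have hre : 2 * c * (o * (starRingEnd ℂ) (wd (cR n W) z X)).re =
      ∑ i ∈ t, Real.exp (K * g i z) * (2 * c * φ i z * (o * (starRingEnd ℂ)
        (2 * wd (cR n (φ i)) z X + (K * φ i z : ℝ) * wd (cR n (g i)) z X)).re) := by
    rw [hwd, map_sum, Finset.mul_sum, re_sum, Finset.mul_sum]
    refine Finset.sum_congr rfl fun i _ => ?_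
    rw [map_mul, conj_ofReal, mul_left_comm, re_ofReal_mul]
    ring
  have hcK : 0 ≤ 1 + c / K := by positivity
  have h3 := mul_le_mul_of_nonneg_left hsq hcK
  rw [hre, hlap]
  refine le_trans (sub_le_sub_right (add_le_add_right h3 _) _) (le_of_eq ?_)
  rw [hWz, Finset.mul_sum, Finset.mul_sum, ← Finset.sum_add_distrib, ← Finset.sum_add_distrib,
    ← Finset.sum_sub_distrib]
  refine Finset.sum_congr rfl fun i _ => ?_
  rw [bumpTerm]
  ring

/-- Far terms are dominated by the gain of a covering term once `K` is large. -/
lemma sum_neg_of_dominated {ι : Type*} {t : Finset ι} {B C : ι → ℝ} {K γ m Λ : ℝ} {j : ι}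
    (hj : j ∈ t) (hC : ∀ i ∈ t, 0 ≤ C i) (hγ : 0 < γ) (hm : 0 < m) (hK : 0 < K)
    (hKC : ∑ i ∈ t, C i < 2 * γ ^ 2 * m * K)
    (hB : ∀ i ∈ t, B i ≤ C i * K ^ 2 * Real.exp (K * (Λ - γ)))
    (hBj : B j ≤ -(K * m * Real.exp (K * (Λ + γ)))) : ∑ i ∈ t, B i < 0 := by
  classical
  have hE : 0 < Real.exp (K * (Λ - γ)) := Real.exp_pos _
  have h1 : ∀ i ∈ t, B i ≤ C i * K ^ 2 * Real.exp (K * (Λ - γ)) -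
      if i = j then K * m * Real.exp (K * (Λ + γ)) else 0 := by
    intro i hi
    split_ifs with hij
    · subst hij
      have := mul_nonneg (mul_nonneg (hC i hi) (sq_nonneg K)) hE.le
      linarith
    · simpa using hB i hi
  have h2 : Real.exp (K * (Λ + γ)) = Real.exp (K * (Λ - γ)) * Real.exp (2 * γ * K) := by
    rw [← Real.exp_add]
    ring_nf
  have h3 := Real.quadratic_le_exp_of_nonneg (x := 2 * γ * K) (by positivity)
  have h4 : 2 * γ ^ 2 * K ^ 2 ≤ Real.exp (2 * γ * K) := by
    have : 0 < γ * K := by positivity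
    nlinarith
  refine (Finset.sum_le_sum h1).trans_lt ?_
  rw [Finset.sum_sub_distrib, Finset.sum_ite_eq' t j, if_pos hj, ← Finset.sum_mul, ← Finset.sum_mul,
    h2]
  have h5 : K * m * (2 * γ ^ 2 * K ^ 2) ≤ K * m * Real.exp (2 * γ * K) := by gcongr
  have h6 : (∑ i ∈ t, C i) * K ^ 2 < 2 * γ ^ 2 * m * K * K ^ 2 := by gcongr
  have h7 : (∑ i ∈ t, C i) * K ^ 2 < K * m * Real.exp (2 * γ * K) := by linarith
  have h8 := mul_lt_mul_of_pos_right h7 hE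
  linarith

end glueFinal

section globalWeight
variable {n : ℕ} {r ρ hh : Pt n → ℝ} {Ω V V' U : Set (Pt n)} {s : ℕ∞} {p : Pt n}

/-- Gluing of the local weights to a single smooth weight near the boundary. -/
lemma exists_global_weight {η c : ℝ} (hρ : IsDefining n 1 Ω ρ V') (hη : 1 < η)
    (hU : IsOpen U) (hfU : frontier Ω ⊆ U)
    (hpsh : StrictPSHOn n (fun z => ρ z ^ η) ((closure Ω)ᶜ ∩ U))
    (h : IsDefining n s Ω r V) (hs : 3 ≤ s) (hb : Bornology.IsBounded Ω)
    (hpsc : LeviPseudoconvex n r Ω)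
    (hhh : ∀ z ∈ frontier Ω, 0 < hh z ∧ fderiv ℝ ρ z = hh z • fderiv ℝ r z)
    (hc0 : 0 < c) (hc : c < η / (η - 1)) :
    ∃ Ψ : Pt n → ℝ, ContDiff ℝ ((⊤ : ℕ∞) : WithTop ℕ∞) Ψ ∧ ∀ z L, (z, L) ∈ nullBundle r Ω →
      c * normSq (om r z L + wd (cR n Ψ) z L) + (dlb r z L).re - lap Ψ z L < 0 := by
  obtain ⟨σ, hσ, hloc⟩ := exists_local_weight hρ hη hU hfU hpsh h hs hb hpsc hhh hc0 hc
  choose! R hR g hg hgz using hloc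
  have hCex : ∀ p ∈ frontier Ω, ∃ C, 0 ≤ C ∧ ∀ z L, (z, L) ∈ nullBundle r Ω → ∀ K, 1 ≤ K →
      bumpTerm c K (c * normSq (om r z L) + (dlb r z L).re) (bump (R p) p z)
        (lap (bump (R p) p) z L) (lap (g p) z L) (om r z L) (wd (cR n (bump (R p) p)) z L)
        (wd (cR n (g p)) z L) ≤ K ^ 2 * C := fun p hp =>
    exists_bumpTerm_bound h hs hb hpsc (contDiff_bump _ _) (hg p hp) (bump_nonneg _ _) hc0.le
  choose! C hC0 hC using hCex
  obtain ⟨t, ht, hcov⟩ := (isCompact_frontier hb).elim_nhds_subcover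
    (fun p => {z | sqn (z - p) < R p ^ 2 / 8}) fun p hp => by
      have h1 : Continuous fun w : Pt n => sqn (w - p) := (contDiff_sqn_sub p (m := 0)).continuous
      refine (isOpen_lt h1 continuous_const).mem_nhds ?_
      have := hR p hp
      have h2 : sqn (p - p) = 0 := by simp [sqn]
      rw [Set.mem_ofPred_eq, h2]
      positivity
  have hcov' : ∀ z ∈ frontier Ω, ∃ j ∈ t, sqn (z - j) < R j ^ 2 / 8 := fun z hz => by
    simpa using hcov hz
  obtain ⟨γ, hγt, hγ⟩ : ∃ γ : ℝ, (∀ i ∈ t, γ ≤ σ * R i ^ 2 / 16) ∧ 0 < γ := by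
    have h1 : ∀ᶠ γ in 𝓝[>] (0 : ℝ), ∀ i ∈ t, γ ≤ σ * R i ^ 2 / 16 := by
      refine (Filter.eventually_all_finset t).2 fun i hi => ?_
      have := hR i (ht i hi)
      exact (eventually_le_nhds (by positivity : (0 : ℝ) < σ * R i ^ 2 / 16)).filter_mono
        nhdsWithin_le_nhds
    exact (h1.and self_mem_nhdsWithin).exists
  obtain ⟨K, hK1, hKC⟩ : ∃ K : ℝ, 1 ≤ K ∧ ∑ i ∈ t, C i < 2 * γ ^ 2 * (σ / 2) * K := by
    refine ⟨max 1 ((∑ i ∈ t, C i) / (2 * γ ^ 2 * (σ / 2)) + 1), le_max_left _ _, ?_⟩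
    rw [← div_lt_iff₀' (by positivity)]
    exact (lt_add_one _).trans_le (le_max_right _ _)
  have hK0 : 0 < K := by linarith
  set W : Pt n → ℝ := fun w => ∑ i ∈ t, bump (R i) i w * bump (R i) i w * Real.exp (K * g i w)
    with hW
  have hWd : ContDiff ℝ ((⊤ : ℕ∞) : WithTop ℕ∞) W := ContDiff.sum fun i hi =>
    ((contDiff_bump _ _).mul (contDiff_bump _ _)).mul
      (contDiff_const.mul (hg i (ht i hi))).exp
  have hWpos : ∀ z ∈ frontier Ω, 0 < W z := fun z hz => by
    obtain ⟨j, hj, hjz⟩ := hcov' z hz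
    have hRj := hR j (ht j hj)
    refine Finset.sum_pos' (fun i _ => ?_) ⟨j, hj, ?_⟩
    · have := bump_nonneg (R i) i z
      positivity
    · rw [(bump_eventually_one hRj (z := z) (by nlinarith)).eq_of_nhds]
      positivity
  obtain ⟨Ψ, hΨ, hΨe⟩ := exists_contDiff_eventuallyEq (f := fun w => 1 / K * Real.log (W w))
    (isCompact_frontier hb) (isOpen_lt continuous_const hWd.continuous) hWpos
    (contDiffOn_const.mul (hWd.contDiffOn.log fun z hz => ne_of_gt hz))
  refine ⟨Ψ, hΨ, fun z L hzL => ?_⟩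
  have hz : z ∈ frontier Ω := hzL.1
  have two_le : ((2 : ℕ∞) : WithTop ℕ∞) ≤ ((⊤ : ℕ∞) : WithTop ℕ∞) := WithTop.coe_le_coe.2 le_top
  rw [wd_cR_congr (hΨe z hz), lap_congr (hΨe z hz)]
  refine (curvature_sum_le (t := t) (φ := fun i => bump (R i) i) (g := g)
    (fun i _ => (contDiff_bump _ _).contDiffAt.of_le two_le)
    (fun i hi => (hg i (ht i hi)).contDiffAt.of_le two_le) (fun i _ => bump_nonneg _ _ _)
    hc0.le hK0 hW (hWpos z hz) (dlb r z L).re (om r z L) L).trans_lt ?_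
  refine div_neg_of_neg_of_pos ?_ (mul_pos hK0 (hWpos z hz))
  have hnear : ∀ i ∈ t, sqn (z - i) < R i ^ 2 / 2 →
      Real.exp (K * g i z) * bumpTerm c K (c * normSq (om r z L) + (dlb r z L).re) (bump (R i) i z)
        (lap (bump (R i) i) z L) (lap (g i) z L) (om r z L) (wd (cR n (bump (R i) i)) z L)
        (wd (cR n (g i)) z L) ≤ -(K * (σ / 2) * Real.exp (K * g i z)) := by
    intro i hi he
    have hone := bump_eventually_one (hR i (ht i hi)) he
    rw [hone.eq_of_nhds, (wd_lap_of_eventuallyEq_const hone L).1,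
      (wd_lap_of_eventuallyEq_const hone L).2, bumpTerm_one hK0.ne']
    have h1 := (hgz i (ht i hi) z hz (by have := sq_nonneg (R i); linarith)).2 L hzL
    have h2 := mul_le_mul_of_nonneg_left h1
      (mul_nonneg hK0.le (Real.exp_pos (K * g i z)).le)
    linarith
  obtain ⟨j, hj, hjz⟩ := hcov' z hz
  have hsq : ∀ i ∈ t, 0 < R i ^ 2 := fun i hi => pow_pos (hR i (ht i hi)) 2
  refine sum_neg_of_dominated (C := C) (K := K) (γ := γ) (m := σ / 2)
    (Λ := Real.log (hh z) + 2 * σ * sqn z) hj (fun i hi => hC0 i (ht i hi)) hγ (by positivity) hK0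
    hKC (fun i hi => ?_) ?_
  · have hpos : 0 ≤ C i * K ^ 2 * Real.exp (K * (Real.log (hh z) + 2 * σ * sqn z - γ)) := by
      have := hC0 i (ht i hi)
      positivity
    rcases lt_or_ge (sqn (z - i)) (R i ^ 2 / 2) with he | he
    · refine (hnear i hi he).trans (le_trans ?_ hpos)
      have : 0 < K * (σ / 2) * Real.exp (K * g i z) := by positivity
      linarith
    rcases lt_or_ge (R i ^ 2) (sqn (z - i)) with he' | he'
    · have hzero := bump_eventually_zero (hR i (ht i hi)) he'
      rw [hzero.eq_of_nhds, (wd_lap_of_eventuallyEq_const hzero L).1, bumpTerm_zero, mul_zero]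
      exact hpos
    · have h1 := hC i (ht i hi) z L hzL K hK1
      have h2 := (abs_le.1 (hgz i (ht i hi) z hz he').1).2
      have h3 := mul_le_mul_of_nonneg_left he hσ.le
      have h4 : g i z ≤ Real.log (hh z) + 2 * σ * sqn z - γ := by
        have := hγt i hi
        linarith [mul_pos hσ (hsq i hi)]
      calc _ ≤ Real.exp (K * g i z) * (K ^ 2 * C i) := by gcongr
        _ ≤ Real.exp (K * (Real.log (hh z) + 2 * σ * sqn z - γ)) * (K ^ 2 * C i) := by
          have := hC0 i (ht i hi)
          gcongr
        _ = _ := by ring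
  · refine (hnear j hj (by linarith [hsq j hj])).trans ?_
    have h2 := (abs_le.1 (hgz j (ht j hj) z hz (by linarith [hsq j hj])).1).1
    have h3 := mul_le_mul_of_nonneg_left hjz.le hσ.le
    have h4 : Real.log (hh z) + 2 * σ * sqn z + γ ≤ g j z := by
      have := hγt j hj
      linarith [mul_pos hσ (hsq j hj)]
    rw [neg_le_neg_iff]
    gcongr

end globalWeight

section final
variable {n : ℕ} {r ρ hh : Pt n → ℝ} {Ω V V' U : Set (Pt n)} {s : ℕ∞} {p : Pt n}

lemma dlb_real_smul (r : Pt n → ℝ) (p L : Pt n) (c : ℝ) :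
    dlb r p (c • L) = (c : ℂ) ^ 2 * dlb r p L := by
  have h1 : ∀ f : Pt n → ℂ, wdb f p (c • L) = c * wdb f p L := fun f => by
    rw [wdb, wdb, smul_comm, map_smul, map_smul, Complex.real_smul, Complex.real_smul]
    ring
  rw [dlb_eq_sum, dlb_eq_sum, mul_neg, Finset.mul_sum]
  congr 1
  refine Finset.sum_congr rfl fun l _ => ?_
  rw [h1, Pi.smul_apply, Complex.real_smul]
  ring

lemma om_real_smul (r : Pt n → ℝ) (p L : Pt n) (c : ℝ) : om r p (c • L) = c * om r p L := by
  rw [om, om, Finset.mul_sum]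
  refine Finset.sum_congr rfl fun l _ => ?_
  rw [Pi.smul_apply, Complex.real_smul]
  ring

lemma real_smul_mem_nullSp {L : Pt n} (hL : L ∈ nullSp n r p) (c : ℝ) : c • L ∈ nullSp n r p := by
  refine ⟨?_, fun Y hY => ?_⟩
  · have h1 : ∑ j, L j * dZ n (cR n r) j p = 0 := hL.1
    change ∑ j, (c • L) j * dZ n (cR n r) j p = 0
    simp only [Pi.smul_apply, Complex.real_smul, mul_assoc, ← Finset.mul_sum, h1, mul_zero]
  · have h1 := hL.2 Y hY
    have h2 : levi n r p (c • L) Y = c * levi n r p L Y := by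
      simp only [levi, Finset.mul_sum]
      refine Finset.sum_congr rfl fun j _ => Finset.sum_congr rfl fun k _ => ?_
      rw [Pi.smul_apply, Complex.real_smul]
      ring
    rw [h2, h1, mul_zero]

/-- Strict plurisubharmonicity of `ρ ^ η` yields the D'Angelo inequality, for every smaller
coefficient, for some defining function of the smoothness class of the boundary. -/
lemma exists_expMul_le {η c : ℝ} (hρ : IsDefining n 1 Ω ρ V') (hη : 1 < η)
    (hU : IsOpen U) (hfU : frontier Ω ⊆ U)
    (hpsh : StrictPSHOn n (fun z => ρ z ^ η) ((closure Ω)ᶜ ∩ U))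
    (h : IsDefining n s Ω r V) (hs : 3 ≤ s) (hb : Bornology.IsBounded Ω)
    (hpsc : LeviPseudoconvex n r Ω) (hc0 : 0 < c) (hc : c < η / (η - 1)) :
    ∃ Ψ : Pt n → ℝ, ContDiff ℝ s Ψ ∧ ∀ p ∈ frontier Ω, ∀ L ∈ nullSp n (expMul r Ψ) p,
      c * normSq (om (expMul r Ψ) p L) + (dlb (expMul r Ψ) p L).re ≤ 0 := by
  have hs1 : 1 ≤ s := le_trans (by norm_num) hs
  have hprop : ∀ z ∈ frontier Ω, ∃ a : ℝ, 0 < a ∧ fderiv ℝ ρ z = a • fderiv ℝ r z := fun z hz =>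
    hρ.fderiv_proportional le_rfl h hs1 hz
  choose! hh hhh using hprop
  obtain ⟨Ψ, hΨ, hneg⟩ := exists_global_weight hρ hη hU hfU hpsh h hs hb hpsc hhh hc0 hc
  refine ⟨Ψ, hΨ.of_le (WithTop.coe_le_coe.2 le_top), fun p hp L hL => ?_⟩
  have h3 : ContDiffAt ℝ 3 r p := h.contDiffAt_nat hs hp
  have hΨ3 : ContDiffAt ℝ 3 Ψ p :=
    hΨ.contDiffAt.of_le (show ((3 : ℕ∞) : WithTop ℕ∞) ≤ _ from WithTop.coe_le_coe.2 le_top)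
  rcases eq_or_ne L 0 with rfl | hL0
  · have h1 := om_real_smul (expMul r Ψ) p 0 0
    have h2 := dlb_real_smul (expMul r Ψ) p 0 0
    rw [smul_zero] at h1 h2
    rw [h1, h2]
    simp
  have hpos := sqn_pos hL0
  have hN : nullSp n (expMul r Ψ) p = nullSp n r p :=
    nullSp_expMul (h3.of_le (by norm_num)) (hΨ3.of_le (by norm_num)) (h.eq_zero hp)
  set a : ℝ := Real.sqrt (sqn L) with ha
  have ha0 : 0 < a := Real.sqrt_pos.2 hpos
  have ha2 : a ^ 2 = sqn L := Real.sq_sqrt hpos.le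
  have hM : a⁻¹ • L ∈ nullSp n r p := real_smul_mem_nullSp (hN ▸ hL) _
  have hMb : (p, a⁻¹ • L) ∈ nullBundle r Ω := by
    refine ⟨hp, hM, ?_⟩
    have h1 : sqn (a⁻¹ • L) = a⁻¹ ^ 2 * sqn L := by
      simp only [sqn, Finset.mul_sum, Pi.smul_apply, Complex.real_smul, normSq_mul, normSq_ofReal]
      exact Finset.sum_congr rfl fun i _ => by ring
    change sqn (a⁻¹ • L) = 1
    rw [h1, ← ha2]
    field_simp
  have hJ := hneg p _ hMb
  obtain ⟨e1, e2⟩ := om_dlb_expMul h3 (h.2.2.2.2 p hp) hΨ3 (h.eq_zero hp) hM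
  have hre : (dlb (expMul r Ψ) p (a⁻¹ • L)).re = (dlb r p (a⁻¹ • L)).re - lap Ψ p (a⁻¹ • L) := by
    rw [e2, sub_re, ofReal_re]
  have hLa : L = a • (a⁻¹ • L) := by rw [smul_inv_smul₀ ha0.ne']
  rw [hLa, om_real_smul, dlb_real_smul, e1, normSq_mul, normSq_ofReal, ← ofReal_pow, re_ofReal_mul,
    hre]
  have := mul_neg_of_pos_of_neg (pow_pos ha0 2) hJ
  linarith

lemma omegaWedge_add_delbOmega_nonpos_iff (h : IsDefining n s Ω r V) (hs : 3 ≤ s)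
    (hpsc : LeviPseudoconvex n r Ω) (hp : p ∈ frontier Ω) {L : Pt n} (hL : L ∈ nullSp n r p)
    (c : ℝ) : (c : ℂ) * omegaWedge (dAngelo n r) (L, 0) (0, conjVec L) p +
      delbOmega (dAngelo n r) (L, 0) (0, conjVec L) p ≤ 0 ↔
      c * normSq (om r p L) + (dlb r p L).re ≤ 0 := by
  have h1 := dlb_im_eq_zero h hs hpsc hp hL
  rw [omegaWedge_eq, ← ofReal_mul, Complex.le_def]
  change (_ + dlb r p L).re ≤ _ ∧ (_ + dlb r p L).im = _ ↔ _
  simp [h1]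

end final

/-- Theorem 1.1, Steinness part: characterization of the Steinness index
in terms of the D'Angelo 1-form. -/
theorem Sindex_eq_inf_dAngelo
    (n k : ℕ) (hn : 2 ≤ n) (hk : 3 ≤ k)
    (Ω : Set (Pt n)) (hopen : IsOpen Ω) (hconn : IsConnected Ω)
    (hbdd : Bornology.IsBounded Ω)
    (hbdry : ∃ ρ V, IsDefining n (k : ℕ∞) Ω ρ V)
    (hpsc : ∀ ρ V, IsDefining n (k : ℕ∞) Ω ρ V → LeviPseudoconvex n ρ Ω) :
    Sindex n Ω = sInf {e : EReal | ∃ η₂ : ℝ, 1 < η₂ ∧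
      (∃ ρ V, IsDefining n (k : ℕ∞) Ω ρ V ∧
        ∀ p ∈ weakPts n ρ Ω, ∀ L ∈ nullSp n ρ p,
          ((η₂ / (η₂ - 1) : ℝ) : ℂ) * omegaWedge (dAngelo n ρ) (L, 0) (0, conjVec L) p +
            delbOmega (dAngelo n ρ) (L, 0) (0, conjVec L) p ≤ 0) ∧ e = (η₂ : EReal)} := by
  have hs : (3 : ℕ∞) ≤ (k : ℕ∞) := by exact_mod_cast hk
  obtain ⟨r, V, h⟩ := hbdry
  apply le_antisymm
  · refine le_sInf ?_
    rintro _ ⟨η₂, h₂, ⟨ρ, V', hρ, hle⟩, rfl⟩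
    exact Sindex_le hs hbdd hρ hpsc h₂ fun p hp L hL =>
      (omegaWedge_add_delbOmega_nonpos_iff hρ hs (hpsc _ _ hρ) hp.1 hL _).1 (hle p hp L hL)
  · refine le_sInf ?_
    rintro _ ⟨ρ, V', hρ, rfl⟩
    refine le_sInf ?_
    rintro _ ⟨η, hη, ⟨U, hU, hfU, hpsh⟩, rfl⟩
    refine EReal.le_of_forall_lt_iff_le.1 fun η' hη' => ?_
    have hlt : η < η' := EReal.coe_lt_coe_iff.1 hη'
    have hη'1 : 1 < η' := hη.trans hlt
    obtain ⟨Ψ, hΨ, hle⟩ := exists_expMul_le hρ hη hU hfU hpsh h hs hbdd (hpsc _ _ h)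
      (conj_exponent_pos hη'1) (conj_exponent_lt hη hlt)
    have h' := isDefining_expMul h (le_trans (by norm_num) hs) hΨ
    exact sInf_le ⟨η', hη'1, ⟨expMul r Ψ, V, h', fun p hp L hL =>
      (omegaWedge_add_delbOmega_nonpos_iff h' hs (hpsc _ _ h') hp.1 hL _).2 (hle p hp.1 L hL)⟩, rfl⟩
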